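/- Application to (p,q)-growth: Let 2 ≤ p ≤ q < ∞, 𝔞₀ > 0 constant, and let u ∈ C⁰(Q₁) be a bounded viscosity solution in Q₁ of ∂ₜu − div((|∇u|^{p−2} + 𝔞₀|∇u|^{q−2})∇u) = f(x,t), understood through its non-divergence form ∂ₜu = ℋ_{p,q}(∇u)Δ_p^N u + 𝔞₀(q−p)|∇u|^{q−2}Δ_∞^N u + f with ℋ_{p,q}(ξ) = |ξ|^{p−2} + 𝔞₀|ξ|^{q−2}. Assume either (i) the function 𝒢(D²u,∇u) := |∇u|^{q−2}Δ_∞^N u belongs to L^∞(Q₁) and f ∈ L^∞(Q₁), or (ii) Δ_∞^N u, f ∈ L^∞(Q₁), u is Lipschitz continuous in the spatial variable on Q₁, and q ≥ 2. Then u ∈ C^{1+α,(1+α)/2}_loc(Q₁) for some α ∈ (0, 1/(p−1)), and with 𝔭 := p−2 there is a constant C > 0 such that sup over (x,t) ≠ (y,s) in Q_{1/2} of |∇u(x,t) − ∇u(y,s)|/(|x−y|^α + |t−s|^{α/2}) ≤ C[‖u‖_{L^∞(Q₁)} + (‖f‖_{L^∞(Q₁)} + ‖𝒢‖_{L^∞(Q₁)})^{1/(1+𝔭)}],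 and sup over (x,t),(x,s) in Q_{1/2}, t ≠ s, of |u(x,t) − u(x,s)|/|t−s|^{(1+α)/2} ≤ C[‖u‖_{L^∞(Q₁)} + (‖f‖_{L^∞(Q₁)} + ‖𝒢‖_{L^∞(Q₁)})^{1/(1+𝔭)}]. -/

import Mathlib

open Set Metric Filter MeasureTheory

noncomputable section

/-- `n`-dimensional Euclidean space. -/
abbrev Euc (n : ℕ) := EuclideanSpace ℝ (Fin n)

/-- Standard parabolic cylinder `B_r × (-r², 0]` centered at the origin. -/
def Qcyl (n : ℕ) (r : ℝ) : Set (Euc n × ℝ) :=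
  {z | ‖z.1‖ < r ∧ -(r ^ 2) < z.2 ∧ z.2 ≤ 0}

/-- Intrinsic parabolic cylinder `B_r × (-r² λ^{-𝔭}, 0]`. -/
def QcylIntr (n : ℕ) (r lam pp : ℝ) : Set (Euc n × ℝ) :=
  {z | ‖z.1‖ < r ∧ -(r ^ 2 * lam ^ (-pp)) < z.2 ∧ z.2 ≤ 0}

/-- The θ-parabolic cylinder `B_r(x₀) × (t₀ - r^θ, t₀]`. -/
def QcylTheta (n : ℕ) (r θ : ℝ) (x₀ : Euc n) (t₀ : ℝ) : Set (Euc n × ℝ) :=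
  {z | ‖z.1 - x₀‖ < r ∧ t₀ - r ^ θ < z.2 ∧ z.2 ≤ t₀}

/-- Parabolic boundary of the θ-parabolic cylinder. -/
def parBdryTheta (n : ℕ) (r θ : ℝ) (x₀ : Euc n) (t₀ : ℝ) : Set (Euc n × ℝ) :=
  {z | ‖z.1 - x₀‖ = r ∧ t₀ - r ^ θ ≤ z.2 ∧ z.2 < t₀} ∪
    {z | ‖z.1 - x₀‖ < r ∧ z.2 = t₀ - r ^ θ}

/-- The spatial gradient of a space-time function. -/
def sgrad {n : ℕ} (u : Euc n × ℝ → ℝ) (x : Euc n) (t : ℝ) : Euc n :=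
  gradient (fun y => u (y, t)) x

/-- The spatial Hessian, as a continuous linear operator. -/
def hessOp {n : ℕ} (φ : Euc n → ℝ) (x : Euc n) : Euc n →L[ℝ] Euc n :=
  fderiv ℝ (fun y => gradient φ y) x

/-- The normalized `∞`-Laplacian `⟨D²φ (∇φ/|∇φ|), ∇φ/|∇φ|⟩`. -/
def infLapN {n : ℕ} (φ : Euc n → ℝ) (x : Euc n) : ℝ :=
  @inner ℝ (Euc n) _ ((hessOp φ x) ((‖gradient φ x‖)⁻¹ • gradient φ x))
    ((‖gradient φ x‖)⁻¹ • gradient φ x)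

/-- The normalized `p`-Laplacian `Δφ + (p-2)⟨D²φ (∇φ/|∇φ|), ∇φ/|∇φ|⟩`. -/
def pLapN {n : ℕ} (p : ℝ) (φ : Euc n → ℝ) (x : Euc n) : ℝ :=
  LinearMap.trace ℝ (Euc n) (hessOp φ x : Euc n →ₗ[ℝ] Euc n) + (p - 2) * infLapN φ x

/-- `ℋ(x,t,ξ) = |ξ|^𝔭 + 𝔞(x,t)|ξ|^𝔮`. -/
def Hop {n : ℕ} (pp qq : ℝ) (a : Euc n × ℝ → ℝ) (z : Euc n × ℝ) (ξ : Euc n) : ℝ :=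
  ‖ξ‖ ^ pp + a z * ‖ξ‖ ^ qq

/-- Test functions of class `C^{2,1}`: `C²` in space and `C¹` in time. -/
def IsTestC21 {n : ℕ} (φ : Euc n × ℝ → ℝ) : Prop :=
  (∀ t, ContDiff ℝ 2 fun x => φ (x, t)) ∧ ∀ x, ContDiff ℝ 1 fun s => φ (x, s)

/-- Viscosity subsolution of `∂ₜ u - G(x,t)[u(·,t)] = f` on `Q`, where the
spatial operator `G` is evaluated on time slices of test functions. -/
def ViscSubsolOp {n : ℕ} (G : Euc n × ℝ → (Euc n → ℝ) → ℝ) (f : Euc n × ℝ → ℝ)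
    (Q : Set (Euc n × ℝ)) (u : Euc n × ℝ → ℝ) : Prop :=
  ∀ x₀ : Euc n, ∀ t₀ : ℝ, (x₀, t₀) ∈ Q →
    (∀ φ : Euc n × ℝ → ℝ, IsTestC21 φ →
      IsLocalMaxOn (fun z => u z - φ z) Q (x₀, t₀) →
      gradient (fun x => φ (x, t₀)) x₀ ≠ 0 →
      deriv (fun s => φ (x₀, s)) t₀ - G (x₀, t₀) (fun x => φ (x, t₀)) ≤ f (x₀, t₀)) ∧
    (∀ δ₁ : ℝ, 0 < δ₁ → ∀ φ : ℝ → ℝ, ContDiff ℝ 1 φ → φ t₀ = 0 →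
      (∀ t ∈ Ioo (t₀ - δ₁) (t₀ + δ₁), u (x₀, t) - φ t ≤ u (x₀, t₀)) →
      (∃ ε > 0, ∀ x ∈ ball x₀ ε,
        sSup ((fun t => u (x, t) - φ t) '' Ioo (t₀ - δ₁) (t₀ + δ₁)) =
          sSup ((fun t => u (x₀, t) - φ t) '' Ioo (t₀ - δ₁) (t₀ + δ₁))) →
      deriv φ t₀ ≤ f (x₀, t₀))

/-- Viscosity supersolution of `∂ₜ u - G(x,t)[u(·,t)] = f` on `Q`. -/
def ViscSupersolOp {n : ℕ} (G : Euc n × ℝ → (Euc n → ℝ) → ℝ) (f : Euc n × ℝ → ℝ)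
    (Q : Set (Euc n × ℝ)) (u : Euc n × ℝ → ℝ) : Prop :=
  ∀ x₀ : Euc n, ∀ t₀ : ℝ, (x₀, t₀) ∈ Q →
    (∀ φ : Euc n × ℝ → ℝ, IsTestC21 φ →
      IsLocalMinOn (fun z => u z - φ z) Q (x₀, t₀) →
      gradient (fun x => φ (x, t₀)) x₀ ≠ 0 →
      f (x₀, t₀) ≤ deriv (fun s => φ (x₀, s)) t₀ - G (x₀, t₀) (fun x => φ (x, t₀))) ∧
    (∀ δ₁ : ℝ, 0 < δ₁ → ∀ φ : ℝ → ℝ, ContDiff ℝ 1 φ → φ t₀ = 0 →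
      (∀ t ∈ Ioo (t₀ - δ₁) (t₀ + δ₁), u (x₀, t₀) ≤ u (x₀, t) - φ t) →
      (∃ ε > 0, ∀ x ∈ ball x₀ ε,
        sInf ((fun t => u (x, t) - φ t) '' Ioo (t₀ - δ₁) (t₀ + δ₁)) =
          sInf ((fun t => u (x₀, t) - φ t) '' Ioo (t₀ - δ₁) (t₀ + δ₁))) →
      f (x₀, t₀) ≤ deriv φ t₀)

/-- Viscosity solution for a general spatial operator. -/
def ViscSolOp {n : ℕ} (G : Euc n × ℝ → (Euc n → ℝ) → ℝ) (f : Euc n × ℝ → ℝ)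
    (Q : Set (Euc n × ℝ)) (u : Euc n × ℝ → ℝ) : Prop :=
  ContinuousOn u Q ∧ ViscSubsolOp G f Q u ∧ ViscSupersolOp G f Q u

/-- The spatial operator `ℋ(x,t,∇φ) Δ_p^N φ` of the paper. -/
def Gpq {n : ℕ} (p pp qq : ℝ) (a : Euc n × ℝ → ℝ) : Euc n × ℝ → (Euc n → ℝ) → ℝ :=
  fun z ψ => Hop pp qq a z (gradient ψ z.1) * pLapN p ψ z.1

/-- Viscosity subsolution of `∂ₜ u - ℋ(x,t,∇u) Δ_p^N u = f` on `Q`. -/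
def ViscSubsol {n : ℕ} (p pp qq : ℝ) (a f : Euc n × ℝ → ℝ) (Q : Set (Euc n × ℝ))
    (u : Euc n × ℝ → ℝ) : Prop :=
  ViscSubsolOp (Gpq p pp qq a) f Q u

/-- Viscosity supersolution of `∂ₜ u - ℋ(x,t,∇u) Δ_p^N u = f` on `Q`. -/
def ViscSupersol {n : ℕ} (p pp qq : ℝ) (a f : Euc n × ℝ → ℝ) (Q : Set (Euc n × ℝ))
    (u : Euc n × ℝ → ℝ) : Prop :=
  ViscSupersolOp (Gpq p pp qq a) f Q u

/-- (Continuous) viscosity solution of `∂ₜ u - ℋ(x,t,∇u) Δ_p^N u = f` on `Q`. -/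
def ViscSol {n : ℕ} (p pp qq : ℝ) (a f : Euc n × ℝ → ℝ) (Q : Set (Euc n × ℝ))
    (u : Euc n × ℝ → ℝ) : Prop :=
  ContinuousOn u Q ∧ ViscSubsol p pp qq a f Q u ∧ ViscSupersol p pp qq a f Q u

/-- The sup of `|g|` over a set (the `L^∞` norm on `Q`). -/
def supAbs {α : Type*} (g : α → ℝ) (Q : Set α) : ℝ :=
  sSup ((fun z => |g z|) '' Q)

/-- The oscillation of `g` over a set. -/
def oscOn {α : Type*} (g : α → ℝ) (Q : Set α) : ℝ :=
  sSup (g '' Q) - sInf (g '' Q)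

/-- `g` is bounded on `Q`. -/
def BddOn {α : Type*} (g : α → ℝ) (Q : Set α) : Prop :=
  ∃ M, ∀ z ∈ Q, |g z| ≤ M

/-- Structural hypotheses (H2)–(H3) on the modulating coefficient over `Q₁`. -/
def HypA (n : ℕ) (a : Euc n × ℝ → ℝ) (aminus aplus A0 : ℝ) : Prop :=
  0 < aminus ∧ (∀ z ∈ Qcyl n 1, aminus ≤ a z ∧ a z ≤ aplus) ∧
    (∀ t ∈ Ioc (-1 : ℝ) 0, ContDiffOn ℝ 1 (fun x => a (x, t)) (ball (0 : Euc n) 1)) ∧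
    (∀ x ∈ ball (0 : Euc n) 1, ContDiffOn ℝ 1 (fun s => a (x, s)) (Ioc (-1 : ℝ) 0)) ∧
    ∀ z ∈ Qcyl n 1,
      ‖fderivWithin ℝ (fun x => a (x, z.2)) (ball (0 : Euc n) 1) z.1‖ ≤ A0 ∧
      ‖fderivWithin ℝ (fun s => a (z.1, s)) (Ioc (-1 : ℝ) 0) z.2‖ ≤ A0

/-- (H4): the source term is continuous and bounded on `Q`. -/
def HypF {n : ℕ} (f : Euc n × ℝ → ℝ) (Q : Set (Euc n × ℝ)) : Prop :=
  ContinuousOn f Q ∧ BddOn f Q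

/-- A Lipschitz-in-space bound for the coefficient `𝔞` on `Q`. -/
def LipXBound {n : ℕ} (a : Euc n × ℝ → ℝ) (Q : Set (Euc n × ℝ)) (L : ℝ) : Prop :=
  ∀ x y : Euc n, ∀ t : ℝ, (x, t) ∈ Q → (y, t) ∈ Q → |a (x, t) - a (y, t)| ≤ L * ‖x - y‖

section Jensen

variable {V : Type*} [NormedAddCommGroup V] [InnerProductSpace ℝ V]

/-- `p` is a subgradient of `G` at `x`. -/
def IsSubgrad (G : V → ℝ) (x p : V) : Prop := ∀ x', G x + inner ℝ p (x' - x) ≤ G x'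

lemma abs_sub_le_of_small_quadratic {ψ : ℝ → ℝ} {ε C : ℝ} (hC : 0 ≤ C)
    (h : ∀ s s', 0 ≤ s → s ≤ s' → s' ≤ 1 → |ψ s' - ψ s| ≤ ε * (s' - s) + C * (s' - s) ^ 2) :
    |ψ 1 - ψ 0| ≤ ε := by
  apply le_of_forall_pos_le_add
  intro η hη
  obtain ⟨N, hN⟩ := exists_nat_gt (C / η)
  have hN0 : (0 : ℝ) < N := lt_of_le_of_lt (by positivity) hN
  have tele : ψ 1 - ψ 0 = ∑ i ∈ Finset.range N, (ψ ((i + 1 : ℕ) / N) - ψ ((i : ℕ) / N)) := by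
    rw [Finset.sum_range_sub (fun i : ℕ => ψ (i / N))]
    simp [hN0.ne']
  rw [tele]
  refine (Finset.abs_sum_le_sum_abs _ _).trans ?_
  have : ∀ i ∈ Finset.range N, |ψ ((i + 1 : ℕ) / N) - ψ ((i : ℕ) / N)| ≤
      ε * (1 / N) + C * (1 / N) ^ 2 := by
    intro i hi
    have hi' : i + 1 ≤ N := Finset.mem_range.1 hi
    have e : (((i + 1 : ℕ) : ℝ) / N - (i : ℝ) / N) = 1 / N := by
      push_cast; field_simp; ring
    have := h ((i : ℕ) / N) ((i + 1 : ℕ) / N) (by positivity) (by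
      gcongr; simp) (by rw [div_le_one hN0]; exact_mod_cast hi')
    rwa [e] at this
  refine (Finset.sum_le_sum this).trans ?_
  rw [Finset.sum_const, Finset.card_range, nsmul_eq_mul]
  have : (N : ℝ) * (ε * (1 / N) + C * (1 / N) ^ 2) = ε + C / N := by
    field_simp
  rw [this]
  have : C / N ≤ η := by
    rw [div_le_iff₀ hN0]; rw [div_lt_iff₀ hη] at hN; linarith
  linarith

lemma IsSubgrad.mono {G : V → ℝ} {x₁ x₂ p₁ p₂ : V} (h₁ : IsSubgrad G x₁ p₁)
    (h₂ : IsSubgrad G x₂ p₂) : 0 ≤ inner ℝ (p₁ - p₂) (x₁ - x₂) := by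
  have a := h₁ x₂
  have b := h₂ x₁
  simp only [inner_sub_left, inner_sub_right] at *
  linarith

lemma continuous_of_subgrad {G : V → ℝ} {R : ℝ}
    (hsub : ∀ x, ∃ p, ‖p‖ ≤ R ∧ IsSubgrad G x p) : Continuous G := by
  have key : ∀ x y, G x - G y ≤ R * ‖x - y‖ := by
    intro x y
    obtain ⟨p, hp, h⟩ := hsub x
    have := h y
    have h2 : inner ℝ p (x - y) ≤ R * ‖x - y‖ :=
      (real_inner_le_norm _ _).trans (by gcongr)
    have h3 : inner ℝ p (y - x) = - inner ℝ p (x - y) := by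
      rw [← inner_neg_right]; simp
    linarith
  have : LipschitzWith (Real.toNNReal R) G := by
    apply LipschitzWith.of_dist_le_mul
    intro x y
    have hR : 0 ≤ R := by
      obtain ⟨p, hp, h⟩ := hsub x
      exact (norm_nonneg _).trans hp
    rw [Real.dist_eq, Real.coe_toNNReal _ hR, dist_eq_norm, abs_le]
    have := key x y
    have := key y x
    rw [norm_sub_rev] at this
    constructor <;> linarith
  exact this.continuous

lemma quad_le_of_eventually_le {A B : V →L[ℝ] V}
    (h : ∀ η > 0, ∀ᶠ a in nhds (0 : V), inner ℝ (A a) a ≤ inner ℝ (B a) a + η * ‖a‖ ^ 2) (a : V) :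
    inner ℝ (A a) a ≤ inner ℝ (B a) a := by
  have key : ∀ η > 0, inner ℝ (A a) a ≤ inner ℝ (B a) a + η * ‖a‖ ^ 2 := by
    intro η hη
    have ht : Tendsto (fun t : ℝ => t • a) (nhdsWithin 0 (Ioi 0)) (nhds 0) := by
      have : Tendsto (fun t : ℝ => t • a) (nhds 0) (nhds ((0 : ℝ) • a)) :=
        (continuous_id.smul continuous_const).tendsto _
      rw [zero_smul] at this
      exact this.mono_left nhdsWithin_le_nhds
    obtain ⟨t, ht1, ht0⟩ := ((ht.eventually (h η hη)).and self_mem_nhdsWithin).exists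
    have ht0 : 0 < t := ht0
    simp only [map_smul, inner_smul_left, inner_smul_right, norm_smul, conj_trivial,
      Real.norm_of_nonneg ht0.le] at ht1
    have : t ^ 2 * inner ℝ (A a) a ≤ t ^ 2 * (inner ℝ (B a) a + η * ‖a‖ ^ 2) := by nlinarith
    exact le_of_mul_le_mul_left this (by positivity)
  apply le_of_forall_pos_le_add
  intro ε hε
  have := key (ε / (‖a‖ ^ 2 + 1)) (by positivity)
  have h2 : ε / (‖a‖ ^ 2 + 1) * ‖a‖ ^ 2 ≤ ε := by
    rw [div_mul_eq_mul_div, div_le_iff₀ (by positivity)]; nlinarith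
  linarith

lemma inner_clm_le (S : V →L[ℝ] V) (a : V) : inner ℝ (S a) a ≤ ‖S‖ * ‖a‖ ^ 2 := by
  calc inner ℝ (S a) a ≤ ‖S a‖ * ‖a‖ := real_inner_le_norm _ _
    _ ≤ (‖S‖ * ‖a‖) * ‖a‖ := by gcongr; exact S.le_opNorm a
    _ = _ := by ring

variable [FiniteDimensional ℝ V]

lemma exists_resolvent {G : V → ℝ} {R : ℝ}
    (hsub : ∀ x, ∃ p, ‖p‖ ≤ R ∧ IsSubgrad G x p) (y : V) : ∃ z, IsSubgrad G z (y - z) := by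
  have hG := continuous_of_subgrad hsub
  have hR : 0 ≤ R := by
    obtain ⟨p, hp, h⟩ := hsub y
    exact (norm_nonneg _).trans hp
  have hK : IsCompact (closedBall y (2 * R + 1)) := isCompact_closedBall _ _
  obtain ⟨z, hzK, hz⟩ := hK.exists_isMinOn ⟨y, mem_closedBall_self (by positivity)⟩
    (f := fun x => G x + ‖x - y‖ ^ 2 / 2) (by fun_prop)
  have hz' : ∀ x, G z + ‖z - y‖ ^ 2 / 2 ≤ G x + ‖x - y‖ ^ 2 / 2 := by
    intro x
    by_cases hx : x ∈ closedBall y (2 * R + 1)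
    · exact hz hx
    · have hy := hz (mem_closedBall_self (x := y) (ε := 2 * R + 1) (by positivity))
      simp only [mem_ofPred_eq, sub_self, norm_zero] at hy
      obtain ⟨p, hp, h⟩ := hsub y
      have h1 := h x
      have h2 : -(R * ‖x - y‖) ≤ inner ℝ p (x - y) := by
        have := abs_real_inner_le_norm p (x - y)
        have h3 : ‖p‖ * ‖x - y‖ ≤ R * ‖x - y‖ := by gcongr
        linarith [neg_abs_le (inner ℝ p (x - y))]
      rw [mem_closedBall, dist_eq_norm, not_le] at hx
      nlinarith
  refine ⟨z, fun x' => ?_⟩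
  have hconv : ∀ t : ℝ, 0 ≤ t → t ≤ 1 →
      G (z + t • (x' - z)) ≤ G z + t * (G x' - G z) := by
    intro t ht ht1
    obtain ⟨p, hp, h⟩ := hsub (z + t • (x' - z))
    have a := h z
    have b := h x'
    have e1 : z - (z + t • (x' - z)) = (-t) • (x' - z) := by module
    have e2 : x' - (z + t • (x' - z)) = (1 - t) • (x' - z) := by module
    rw [e1, inner_smul_right] at a
    rw [e2, inner_smul_right] at b
    nlinarith
  have hlim : ∀ t : ℝ, 0 < t → t ≤ 1 →
      G z + inner ℝ (y - z) (x' - z) - t * (‖x' - z‖ ^ 2 / 2) ≤ G x' := by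
    intro t ht ht1
    have a := hz' (z + t • (x' - z))
    have b := hconv t ht.le ht1
    have e : z + t • (x' - z) - y = t • (x' - z) - (y - z) := by module
    have e' : ‖z - y‖ = ‖y - z‖ := norm_sub_rev _ _
    rw [e, e', norm_sub_sq_real (t • (x' - z)), norm_smul, inner_smul_left,
      Real.norm_of_nonneg ht.le] at a
    simp only [conj_trivial] at a
    rw [real_inner_comm] at a
    have : t * (G z + inner ℝ (y - z) (x' - z) - t * (‖x' - z‖ ^ 2 / 2)) ≤ t * G x' := by
      nlinarith
    exact le_of_mul_le_mul_left this ht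
  apply le_of_forall_pos_le_add
  intro ε hε
  set c := ‖x' - z‖ ^ 2 / 2 with hc
  have hc0 : 0 ≤ c := by positivity
  have h := hlim (min 1 (ε / (c + 1))) (by positivity) (min_le_left _ _)
  have : min 1 (ε / (c + 1)) * c ≤ ε := by
    calc min 1 (ε / (c + 1)) * c ≤ (ε / (c + 1)) * c := by gcongr; exact min_le_right _ _
      _ ≤ (ε / (c + 1)) * (c + 1) := by gcongr; linarith
      _ = ε := by field_simp
  linarith

lemma exists_notMem_image_of_lipschitz [MeasurableSpace V] [BorelSpace V] {J T : V → V}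
    {K K' : NNReal} (hJ : LipschitzWith K J) (hT : LipschitzWith K' T) {δ : ℝ} (hδ : 0 < δ) :
    ∃ P : V, ‖P‖ < δ ∧ ∀ y, T y = P → DifferentiableAt ℝ J y := by
  let μ : Measure V := Measure.hausdorffMeasure (Module.finrank ℝ V)
  have hae : ∀ᵐ x ∂μ, DifferentiableAt ℝ J x := hJ.ae_differentiableAt
  have h0 : μ {x | ¬ DifferentiableAt ℝ J x} = 0 := hae
  have h1 : μ (T '' {x | ¬ DifferentiableAt ℝ J x}) = 0 := by
    have := hT.hausdorffMeasure_image_le (d := (Module.finrank ℝ V : ℝ)) (by positivity)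
      {x | ¬ DifferentiableAt ℝ J x}
    have h2 : Measure.hausdorffMeasure (Module.finrank ℝ V : ℝ)
      {x | ¬ DifferentiableAt ℝ J x} = 0 := h0
    rw [h2, mul_zero] at this
    exact le_antisymm this bot_le
  have h3 : ¬ (ball (0 : V) δ ⊆ T '' {x | ¬ DifferentiableAt ℝ J x}) := by
    intro hs
    have : μ (ball (0 : V) δ) ≤ 0 := h1 ▸ measure_mono hs
    have h4 : 0 < μ (ball (0 : V) δ) := isOpen_ball.measure_pos μ ⟨0, mem_ball_self hδ⟩
    exact absurd this (not_le.2 h4)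
  obtain ⟨P, hP, hPn⟩ := Set.not_subset.1 h3
  refine ⟨P, by simpa using hP, fun y hy => ?_⟩
  by_contra hd
  exact hPn ⟨y, hd, hy⟩

/-- Second order expansion of a function with subgradients at a point where its resolvent is
differentiable and where it is touched from above by a paraboloid. -/
lemma expansion_of_resolvent {G : V → ℝ} {R : ℝ} (hsub : ∀ x, ∃ p, ‖p‖ ≤ R ∧ IsSubgrad G x p)
    {J : V → V} (hJ : ∀ y, IsSubgrad G (J y) (y - J y))
    (hJu : ∀ y z, IsSubgrad G z (y - z) → J y = z) (S : V →L[ℝ] V) {Z p : V}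
    (hp : IsSubgrad G Z p)
    (hup : ∀ᶠ a in nhds (0 : V), G (Z + a) ≤ G Z + inner ℝ p a + 1 / 2 * inner ℝ (S a) a)
    (hJnon : ∀ y y', ‖J y - J y'‖ ≤ ‖y - y'‖)
    (hdiff : DifferentiableAt ℝ J (Z + p)) :
    ∃ H : V →L[ℝ] V, (∀ a, inner ℝ (H a) a ≤ inner ℝ (S a) a) ∧ ∀ η > 0, ∀ᶠ a in nhds (0 : V),
      |G (Z + a) - G Z - inner ℝ p a - 1 / 2 * inner ℝ (H a) a| ≤ η * ‖a‖ ^ 2 := by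
  have hJ0 : J (Z + p) = Z := hJu _ _ (by simpa using hp)
  obtain ⟨ρ, hρ, hupρ⟩ := Metric.eventually_nhds_iff.1 hup
  simp only [dist_zero_right] at hupρ
  set K := 2 * ‖S‖ with hK
  have hK0 : 0 ≤ K := by positivity
  -- subgradients near `Z` are close to `p`
  have hclose : ∀ a p', 2 * ‖a‖ < ρ → IsSubgrad G (Z + a) p' → ‖p' - p‖ ≤ K * ‖a‖ := by
    intro a p' ha hp'
    rcases eq_or_ne p' p with rfl | hne
    · simpa using by positivity
    have hn : 0 < ‖p' - p‖ := norm_pos_iff.2 (sub_ne_zero.2 hne)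
    have key : ∀ b : V, ‖b‖ ≤ ‖a‖ → inner ℝ (p' - p) b ≤ K * ‖a‖ ^ 2 := by
      intro b hb
      have hab : ‖a + b‖ ≤ 2 * ‖a‖ := (norm_add_le _ _).trans (by linarith)
      have h1 := hp' (Z + (a + b))
      have e : Z + (a + b) - (Z + a) = b := by abel
      rw [e] at h1
      have h2 := hupρ (lt_of_le_of_lt hab ha)
      have h3 := hp (Z + a)
      have e2 : Z + a - Z = a := by abel
      rw [e2] at h3
      have h4 := inner_clm_le S (a + b)
      have h5 : ‖S‖ * ‖a + b‖ ^ 2 ≤ ‖S‖ * (2 * ‖a‖) ^ 2 := by gcongr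
      rw [inner_add_right] at h2
      rw [inner_sub_left]
      nlinarith
    rcases eq_or_ne a 0 with rfl | ha0
    · simp only [add_zero] at hp'
      exfalso
      have h1 : ∀ᶠ s in nhds (0 : ℝ), ‖s • (p' - p)‖ < ρ := by
        have : Tendsto (fun s : ℝ => ‖s • (p' - p)‖) (nhds 0) (nhds ‖(0 : ℝ) • (p' - p)‖) :=
          ((continuous_id.smul continuous_const).norm).tendsto _
        rw [zero_smul, norm_zero] at this
        exact this.eventually (gt_mem_nhds hρ)
      have h2 : ∀ᶠ s in nhds (0 : ℝ), s * (1 / 2 * ‖S‖) < 1 := by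
        have : Tendsto (fun s : ℝ => s * (1 / 2 * ‖S‖)) (nhds 0) (nhds (0 * (1 / 2 * ‖S‖))) :=
          (continuous_id.mul continuous_const).tendsto _
        rw [zero_mul] at this
        exact this.eventually (gt_mem_nhds one_pos)
      obtain ⟨s, ⟨hs1, hs2⟩, hs0⟩ := (((h1.and h2).filter_mono nhdsWithin_le_nhds).and
        (self_mem_nhdsWithin : Ioi (0 : ℝ) ∈ nhdsWithin 0 (Ioi 0))).exists
      have hs0 : 0 < s := hs0
      have h3 := hupρ hs1
      have h4 := hp' (Z + s • (p' - p))
      have e2 : Z + s • (p' - p) - Z = s • (p' - p) := by abel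
      rw [e2] at h4
      have h5 := inner_clm_le S (s • (p' - p))
      rw [norm_smul, Real.norm_of_nonneg hs0.le] at h5
      have h6 : inner ℝ p' (s • (p' - p)) - inner ℝ p (s • (p' - p)) = s * ‖p' - p‖ ^ 2 := by
        rw [← inner_sub_left, inner_smul_right, real_inner_self_eq_norm_sq]
      have h7 : s * ‖p' - p‖ ^ 2 ≤ (s * ‖p' - p‖ ^ 2) * (s * (1 / 2 * ‖S‖)) := by nlinarith
      have h8 : 0 < s * ‖p' - p‖ ^ 2 := by positivity
      nlinarith
    · have ha : 0 < ‖a‖ := norm_pos_iff.2 ha0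
      have := key ((‖a‖ / ‖p' - p‖) • (p' - p)) (by
        rw [norm_smul, Real.norm_of_nonneg (by positivity)]; field_simp; rfl)
      rw [inner_smul_right, real_inner_self_eq_norm_sq] at this
      have e : ‖a‖ / ‖p' - p‖ * ‖p' - p‖ ^ 2 = ‖a‖ * ‖p' - p‖ := by field_simp
      rw [e] at this
      have : ‖a‖ * ‖p' - p‖ ≤ ‖a‖ * (K * ‖a‖) := by nlinarith
      exact le_of_mul_le_mul_left this ha
  obtain ⟨L, hL⟩ := hdiff
  rw [hasFDerivAt_iff_isLittleO_nhds_zero] at hL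
  rw [hJ0] at hL
  have hLs : ∀ c > 0, ∃ r > 0, ∀ h : V, ‖h‖ < r → ‖J (Z + p + h) - Z - L h‖ ≤ c * ‖h‖ := by
    intro c hc
    obtain ⟨r, hr, h⟩ := Metric.eventually_nhds_iff.1 (hL.def hc)
    exact ⟨r, hr, fun x hx => h (by simpa using hx)⟩
  have hLlow : ∀ h, ‖h‖ ≤ (1 + K) * ‖L h‖ := by
    intro h
    rcases eq_or_ne h 0 with rfl | hne
    · simp
    have hh : 0 < ‖h‖ := norm_pos_iff.2 hne
    have key : ∀ c > 0, ‖h‖ ≤ (1 + K) * (‖L h‖ + c * ‖h‖) := by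
      intro c hc
      obtain ⟨r, hr, hrr⟩ := hLs c hc
      set s := min (r / 2) (ρ / 4) / ‖h‖ with hs
      have hs0 : 0 < s := by positivity
      have hsn : ‖s • h‖ = min (r / 2) (ρ / 4) := by
        rw [norm_smul, Real.norm_of_nonneg hs0.le, hs]; field_simp
      have h1 := hrr (s • h) (by rw [hsn]; linarith [min_le_left (r / 2) (ρ / 4)])
      set y' := Z + p + s • h with hy'
      have h2 : ‖J y' - Z‖ ≤ ‖s • h‖ := by
        have := hJnon y' (Z + p)
        rw [hJ0] at this
        simpa [hy'] using this
      have h3 := hclose (J y' - Z) (y' - J y') (by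
        rw [hsn] at h2; linarith [min_le_right (r / 2) (ρ / 4)]) (by
          simpa using hJ y')
      have e : s • h = (J y' - Z) + (y' - J y' - p) := by rw [hy']; abel
      have h4 : ‖s • h‖ ≤ (1 + K) * ‖J y' - Z‖ := by
        calc ‖s • h‖ = ‖(J y' - Z) + (y' - J y' - p)‖ := by rw [← e]
          _ ≤ _ := norm_add_le _ _
          _ ≤ _ := by linarith
      have h5 : ‖J y' - Z‖ ≤ ‖L (s • h)‖ + c * ‖s • h‖ := by
        have : J y' - Z = (J y' - Z - L (s • h)) + L (s • h) := by abel
        calc ‖J y' - Z‖ = ‖(J y' - Z - L (s • h)) + L (s • h)‖ := by rw [← this]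
          _ ≤ _ := norm_add_le _ _
          _ ≤ _ := by linarith
      rw [map_smul, norm_smul, norm_smul, Real.norm_of_nonneg hs0.le] at h5
      rw [norm_smul, Real.norm_of_nonneg hs0.le] at h4
      have : s * ‖h‖ ≤ s * ((1 + K) * (‖L h‖ + c * ‖h‖)) := by
        calc s * ‖h‖ ≤ (1 + K) * ‖J y' - Z‖ := h4
          _ ≤ (1 + K) * (s * ‖L h‖ + c * (s * ‖h‖)) := by gcongr
          _ = _ := by ring
      exact le_of_mul_le_mul_left this hs0
    apply le_of_forall_pos_le_add
    intro ε hε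
    have h1 := key (ε / ((1 + K) * ‖h‖)) (by positivity)
    have h2 : (1 + K) * (‖L h‖ + ε / ((1 + K) * ‖h‖) * ‖h‖) = (1 + K) * ‖L h‖ + ε := by
      field_simp
    linarith
  have hker : LinearMap.ker (L : V →ₗ[ℝ] V) = ⊥ := by
    rw [LinearMap.ker_eq_bot']
    intro m hm
    have := hLlow m
    have hm' : L m = 0 := hm
    rw [hm', norm_zero, mul_zero] at this
    exact norm_le_zero_iff.1 this
  obtain ⟨M0, hM0⟩ := (L : V →ₗ[ℝ] V).exists_leftInverse_of_injective hker
  let M : V →L[ℝ] V := LinearMap.toContinuousLinearMap M0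
  have hM : ∀ h, M (L h) = h := fun h => by
    have := congrArg (fun f : V →ₗ[ℝ] V => f h) hM0
    exact this
  let H : V →L[ℝ] V := M - ContinuousLinearMap.id ℝ V
  -- first order expansion of subgradients
  have hfirst : ∀ η > 0, ∃ r > 0, ∀ a p', ‖a‖ < r → IsSubgrad G (Z + a) p' →
      ‖p' - p - H a‖ ≤ η * ‖a‖ := by
    intro η hη
    obtain ⟨r, hr, hrr⟩ := hLs (η / ((‖M‖ + 1) * (1 + K))) (by positivity)
    refine ⟨min (ρ / 2) (r / (1 + K)), by positivity, fun a p' ha hp' => ?_⟩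
    have ha1 : 2 * ‖a‖ < ρ := by linarith [ha.trans_le (min_le_left _ _)]
    have ha2 : (1 + K) * ‖a‖ < r := by
      have := ha.trans_le (min_le_right _ _)
      rw [lt_div_iff₀ (by positivity)] at this; linarith
    have h1 := hclose a p' ha1 hp'
    set h := a + (p' - p) with hh
    have hhn : ‖h‖ ≤ (1 + K) * ‖a‖ := (norm_add_le _ _).trans (by linarith)
    have h2 := hrr h (hhn.trans_lt ha2)
    have e : Z + p + h = (Z + a) + p' := by rw [hh]; abel
    have hJy : J (Z + p + h) = Z + a := hJu _ _ (by rw [e]; simpa using hp')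
    rw [hJy] at h2
    have e2 : Z + a - Z - L h = a - L h := by abel
    rw [e2] at h2
    have e3 : p' - p - H a = - M (a - L h) := by
      simp only [map_sub, hM, H, sub_apply, ContinuousLinearMap.id_apply]
      rw [hh]; abel
    rw [e3, norm_neg]
    calc ‖M (a - L h)‖ ≤ ‖M‖ * ‖a - L h‖ := M.le_opNorm _
      _ ≤ (‖M‖ + 1) * (η / ((‖M‖ + 1) * (1 + K)) * ((1 + K) * ‖a‖)) := by
        gcongr
        · linarith
        · exact h2.trans (by gcongr)
      _ = η * ‖a‖ := by field_simp
  have hexp : ∀ η > 0, ∀ᶠ a in nhds (0 : V),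
      |G (Z + a) - G Z - inner ℝ p a - 1 / 2 * inner ℝ (H a) a| ≤ η * ‖a‖ ^ 2 := by
    intro η hη
    obtain ⟨r, hr, hrr⟩ := hfirst η hη
    refine Metric.eventually_nhds_iff.2 ⟨r, hr, fun {a} ha => ?_⟩
    rw [dist_zero_right] at ha
    set ψ : ℝ → ℝ := fun s =>
      G (Z + s • a) - s * inner ℝ p a - 1 / 2 * s ^ 2 * inner ℝ (H a) a with hψ
    have hsg : ∀ s, 0 ≤ s → s ≤ 1 → ∃ d, |d - inner ℝ p a - s * inner ℝ (H a) a| ≤ η * ‖a‖ ^ 2 ∧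
        ∀ s', G (Z + s • a) + (s' - s) * d ≤ G (Z + s' • a) := by
      intro s hs hs1
      obtain ⟨p', -, hp'⟩ := hsub (Z + s • a)
      have hsa : ‖s • a‖ ≤ ‖a‖ := by
        rw [norm_smul, Real.norm_of_nonneg hs]
        exact mul_le_of_le_one_left (norm_nonneg _) hs1
      refine ⟨inner ℝ p' a, ?_, fun s' => ?_⟩
      · have h1 := hrr (s • a) p' (hsa.trans_lt ha) hp'
        have e : inner ℝ p' a - inner ℝ p a - s * inner ℝ (H a) a
            = inner ℝ (p' - p - H (s • a)) a := by
          simp only [inner_sub_left, map_smul, inner_smul_left, conj_trivial]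
        rw [e]
        calc _ ≤ ‖p' - p - H (s • a)‖ * ‖a‖ := abs_real_inner_le_norm _ _
          _ ≤ (η * ‖a‖) * ‖a‖ := by gcongr; exact h1.trans (by gcongr)
          _ = _ := by ring
      · have := hp' (Z + s' • a)
        have e : Z + s' • a - (Z + s • a) = (s' - s) • a := by module
        rwa [e, inner_smul_right] at this
    have := abs_sub_le_of_small_quadratic (ψ := ψ) (ε := η * ‖a‖ ^ 2)
      (C := |inner ℝ (H a) a|) (abs_nonneg _) (by
        intro s s' hs hss hs'
        obtain ⟨d, hd, hd2⟩ := hsg s hs (hss.trans hs')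
        obtain ⟨d', hd', hd2'⟩ := hsg s' (hs.trans hss) hs'
        have i1 := hd2 s'
        have i2 := hd2' s
        have hq := abs_nonneg (inner ℝ (H a) a)
        have hq1 := le_abs_self (inner ℝ (H a) a)
        have hq2 := neg_abs_le (inner ℝ (H a) a)
        rw [abs_le] at hd hd'
        have hds : 0 ≤ s' - s := sub_nonneg.2 hss
        set Q := inner ℝ (H a) a
        set P := inner ℝ p a
        set X := η * ‖a‖ ^ 2
        have j1 : (s' - s) * d ≥ (s' - s) * (P + s * Q - X) := by
          gcongr; linarith
        have j2 : (s' - s) * d' ≤ (s' - s) * (P + s' * Q + X) := by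
          gcongr; linarith
        have k1 : (s' - s) ^ 2 * Q ≤ (s' - s) ^ 2 * |Q| := by gcongr
        have k2 : (s' - s) ^ 2 * (-|Q|) ≤ (s' - s) ^ 2 * Q := by gcongr
        have k3 : 0 ≤ (s' - s) ^ 2 * |Q| := by positivity
        rw [abs_le]
        simp only [hψ]
        constructor <;> nlinarith)
    simp only [hψ, one_smul, zero_smul, add_zero] at this
    convert this using 2
    ring
  refine ⟨H, quad_le_of_eventually_le fun η hη => ?_, hexp⟩
  filter_upwards [hup, hexp (η / 2) (by positivity)] with a h1 h2
  have := (abs_le.1 h2).1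
  linarith

/-- Jensen's lemma combined with Alexandrov's theorem: near a strict maximum point of the sum of a
convex Lipschitz function and a quadratic form there are points of second order
differentiability where the function is touched from above by a translate of the quadratic form. -/
lemma exists_expansion_near_max {G : V → ℝ} {R : ℝ}
    (hsub : ∀ x, ∃ p, ‖p‖ ≤ R ∧ IsSubgrad G x p) (S : V →L[ℝ] V)
    (hS : ∀ a b, inner ℝ (S a) b = inner ℝ (S b) a) {r c : ℝ} (hr : 0 < r) (hc : 0 < c)
    (hmax : ∀ Z : V, ‖Z‖ ≤ r → G Z - 1 / 2 * inner ℝ (S Z) Z + c * ‖Z‖ ^ 2 ≤ G 0)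
    {ε : ℝ} (hε : 0 < ε) :
    ∃ (Z p : V) (H : V →L[ℝ] V), ‖Z‖ < ε ∧ ‖p - S Z‖ < ε ∧
      (∀ p₀, IsSubgrad G Z p₀ → p₀ = p) ∧
      (∀ a, inner ℝ (H a) a ≤ inner ℝ (S a) a) ∧ ∀ η > 0, ∀ᶠ a in nhds (0 : V),
      |G (Z + a) - G Z - inner ℝ p a - 1 / 2 * inner ℝ (H a) a| ≤ η * ‖a‖ ^ 2 := by
  let _ : MeasurableSpace V := borel V
  have : BorelSpace V := ⟨rfl⟩
  have hGc := continuous_of_subgrad hsub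
  choose J hJ using fun y => exists_resolvent hsub y
  have hJnon : ∀ y y', ‖J y - J y'‖ ≤ ‖y - y'‖ := by
    intro y y'
    have h := (hJ y).mono (hJ y')
    have e : y - J y - (y' - J y') = (y - y') - (J y - J y') := by abel
    rw [e, inner_sub_left, real_inner_self_eq_norm_sq] at h
    have h2 := real_inner_le_norm (y - y') (J y - J y')
    by_contra hlt
    push Not at hlt
    nlinarith [norm_nonneg (y - y')]
  have hJu : ∀ y z, IsSubgrad G z (y - z) → J y = z := by
    intro y z hz
    have h := (hJ y).mono hz
    have e : y - J y - (y - z) = -(J y - z) := by abel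
    rw [e, inner_neg_left, real_inner_self_eq_norm_sq] at h
    have : ‖J y - z‖ = 0 := by nlinarith [norm_nonneg (J y - z)]
    exact sub_eq_zero.1 (norm_eq_zero.1 this)
  have hJl : LipschitzWith 1 J := LipschitzWith.of_dist_le_mul fun y y' => by
    simpa [dist_eq_norm] using hJnon y y'
  have hTl := (LipschitzWith.id.sub hJl).sub (S.lipschitz.comp hJl)
  set δ := min ε (c * min ε r) with hδ
  obtain ⟨P, hP, hPd⟩ := exists_notMem_image_of_lipschitz hJl hTl (δ := δ) (by positivity)
  obtain ⟨Z, hZr, hZ⟩ := (isCompact_closedBall (0 : V) r).exists_isMaxOn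
    ⟨0, mem_closedBall_self hr.le⟩
    (f := fun Z => G Z - 1 / 2 * inner ℝ (S Z) Z - inner ℝ P Z) (by fun_prop)
  rw [mem_closedBall_zero_iff] at hZr
  have hZn : ‖Z‖ < min ε r := by
    have h1 := hZ (mem_closedBall_self (x := (0 : V)) hr.le)
    simp only [mem_ofPred_eq, map_zero, inner_zero_right] at h1
    have h2 := hmax Z hZr
    have h3 := abs_real_inner_le_norm P Z
    have h4 := neg_abs_le (inner ℝ P Z)
    by_contra hlt
    push Not at hlt
    have h5 : ‖P‖ < c * min ε r := hP.trans_le (min_le_right _ _)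
    have h6 : 0 < min ε r := by positivity
    have h7 : ‖P‖ * ‖Z‖ < c * ‖Z‖ * ‖Z‖ := by
      have : 0 < ‖Z‖ := h6.trans_le hlt
      have : c * min ε r ≤ c * ‖Z‖ := by gcongr
      nlinarith
    nlinarith
  have hup : ∀ᶠ a in nhds (0 : V),
      G (Z + a) ≤ G Z + inner ℝ (S Z + P) a + 1 / 2 * inner ℝ (S a) a := by
    have hpos : 0 < r - ‖Z‖ := sub_pos.2 (hZn.trans_le (min_le_right _ _))
    refine Metric.eventually_nhds_iff.2 ⟨r - ‖Z‖, hpos, fun {a} ha => ?_⟩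
    rw [dist_zero_right] at ha
    have := hZ (show Z + a ∈ closedBall (0 : V) r by
      rw [mem_closedBall_zero_iff]; exact (norm_add_le _ _).trans (by linarith))
    simp only [mem_ofPred_eq, map_add, inner_add_left, inner_add_right] at this
    rw [inner_add_left]
    have := hS a Z
    linarith
  have huniq : ∀ p₀, IsSubgrad G Z p₀ → p₀ = S Z + P := by
    intro p₀ hp₀
    by_contra hne
    have hn : 0 < ‖p₀ - (S Z + P)‖ := norm_pos_iff.2 (sub_ne_zero.2 hne)
    set d := p₀ - (S Z + P) with hd
    have ht : Tendsto (fun t : ℝ => t • d) (nhdsWithin 0 (Ioi 0)) (nhds 0) := by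
      have : Tendsto (fun t : ℝ => t • d) (nhds 0) (nhds ((0 : ℝ) • d)) :=
        (continuous_id.smul continuous_const).tendsto _
      rw [zero_smul] at this
      exact this.mono_left nhdsWithin_le_nhds
    have h2 : ∀ᶠ s in nhdsWithin (0 : ℝ) (Ioi 0), s * (1 / 2 * ‖S‖) < 1 := by
      have : Tendsto (fun s : ℝ => s * (1 / 2 * ‖S‖)) (nhds 0) (nhds (0 * (1 / 2 * ‖S‖))) :=
        (continuous_id.mul continuous_const).tendsto _
      rw [zero_mul] at this
      exact (this.mono_left nhdsWithin_le_nhds).eventually (gt_mem_nhds one_pos)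
    obtain ⟨t, ⟨ht1, ht2⟩, ht0⟩ := (((ht.eventually hup).and h2).and self_mem_nhdsWithin).exists
    have ht0 : 0 < t := ht0
    have h3 := hp₀ (Z + t • d)
    have e : Z + t • d - Z = t • d := by abel
    rw [e] at h3
    have h5 := inner_clm_le S (t • d)
    rw [norm_smul, Real.norm_of_nonneg ht0.le] at h5
    have h6 : inner ℝ p₀ (t • d) - inner ℝ (S Z + P) (t • d) = t * ‖d‖ ^ 2 := by
      rw [← inner_sub_left, ← hd, inner_smul_right, real_inner_self_eq_norm_sq]
    have h7 : t * ‖d‖ ^ 2 ≤ (t * ‖d‖ ^ 2) * (t * (1 / 2 * ‖S‖)) := by nlinarith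
    have h8 : 0 < t * ‖d‖ ^ 2 := by positivity
    nlinarith
  obtain ⟨p₀, -, hp₀⟩ := hsub Z
  obtain rfl := huniq p₀ hp₀
  have hJ0 : J (Z + (S Z + P)) = Z := hJu _ _ (by simpa using hp₀)
  obtain ⟨H, hH1, hH2⟩ := expansion_of_resolvent hsub hJ hJu S hp₀ hup hJnon
    (hPd _ (by simp [hJ0]))
  exact ⟨Z, S Z + P, H, hZn.trans_le (min_le_left _ _), by
    simpa using hP.trans_le (min_le_left _ _), huniq, hH1, hH2⟩

end Jensen

section Quad

variable {W W' : Type*} [AddCommGroup W] [Module ℝ W] [AddCommGroup W'] [Module ℝ W']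

/-- `q` is a quadratic form, i.e. the diagonal of a bilinear form. -/
def IsQuad (q : W → ℝ) : Prop := ∃ B : W →ₗ[ℝ] W →ₗ[ℝ] ℝ, ∀ z, q z = B z z

lemma IsQuad.add {q q' : W → ℝ} (h : IsQuad q) (h' : IsQuad q') : IsQuad fun z => q z + q' z := by
  obtain ⟨B, hB⟩ := h
  obtain ⟨B', hB'⟩ := h'
  exact ⟨B + B', fun z => by simp [hB, hB']⟩

lemma IsQuad.const_mul {q : W → ℝ} (h : IsQuad q) (c : ℝ) : IsQuad fun z => c * q z := by
  obtain ⟨B, hB⟩ := h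
  exact ⟨c • B, fun z => by simp [hB]⟩

lemma IsQuad.neg {q : W → ℝ} (h : IsQuad q) : IsQuad fun z => - q z := by
  simpa using h.const_mul (-1)

lemma IsQuad.sub {q q' : W → ℝ} (h : IsQuad q) (h' : IsQuad q') : IsQuad fun z => q z - q' z := by
  simpa [sub_eq_add_neg] using h.add h'.neg

lemma IsQuad.comp {q : W → ℝ} (h : IsQuad q) (f : W' →ₗ[ℝ] W) : IsQuad fun z => q (f z) := by
  obtain ⟨B, hB⟩ := h
  exact ⟨B.compl₁₂ f f, fun z => by simp [hB]⟩

lemma isQuad_inner {V : Type*} [NormedAddCommGroup V] [InnerProductSpace ℝ V] (f g : W →ₗ[ℝ] V) :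
    IsQuad fun z => inner ℝ (f z) (g z) :=
  ⟨(innerₗ V).compl₁₂ f g, fun z => by simp⟩

lemma isQuad_norm_sq {V : Type*} [NormedAddCommGroup V] [InnerProductSpace ℝ V] (f : W →ₗ[ℝ] V) :
    IsQuad fun z => ‖f z‖ ^ 2 := by
  simpa [real_inner_self_eq_norm_sq] using isQuad_inner f f

lemma isQuad_sq (f : W →ₗ[ℝ] ℝ) : IsQuad fun z => (f z) ^ 2 := by
  simpa using isQuad_norm_sq f

lemma IsQuad.exists_symm {V : Type*} [NormedAddCommGroup V] [InnerProductSpace ℝ V]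
    [FiniteDimensional ℝ V] {q : V → ℝ} (h : IsQuad q) :
    ∃ A : V →L[ℝ] V, (∀ a b, inner ℝ (A a) b = inner ℝ (A b) a) ∧ ∀ a, q a = inner ℝ (A a) a := by
  obtain ⟨B, hB⟩ := h
  have := FiniteDimensional.complete ℝ V
  let A : V →ₗ[ℝ] V :=
    { toFun := fun z => (InnerProductSpace.toDual ℝ V).symm
        (LinearMap.toContinuousLinearMap ((1 / 2 : ℝ) • (B z + B.flip z)))
      map_add' := fun x y => by simp only [map_add, smul_add]; abel
      map_smul' := fun c x => by
        simp only [map_smul, map_add, RingHom.id_apply]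
        simp only [smul_add]
        congr 1 <;> rw [smul_comm] }
  have hA : ∀ a b, inner ℝ (A a) b = 1 / 2 * (B a b + B b a) := fun a b => by
    simp only [A, LinearMap.coe_mk, AddHom.coe_mk, InnerProductSpace.toDual_symm_apply]
    simp; ring
  refine ⟨LinearMap.toContinuousLinearMap A, fun a b => ?_, fun a => ?_⟩
  · simp only [LinearMap.coe_toContinuousLinearMap', hA]; ring
  · simp only [LinearMap.coe_toContinuousLinearMap', hA, hB]; ring

end Quad

section Sums

variable {V : Type*} [NormedAddCommGroup V] [InnerProductSpace ℝ V] [FiniteDimensional ℝ V]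

lemma sum_sup_convolution_bound {N A c x y : ℝ} (hA : 0 ≤ A) (hc : 0 < c)
    (hN : A + (A + 2 * c) ^ 2 / c ≤ N) :
    (A + 2 * c) * (x * y) - (N / 2 - A / 2 + c) * y ^ 2 ≤ c / 2 * x ^ 2 := by
  have h1 : (A + 2 * c) ^ 2 / (2 * c) ≤ N / 2 - A / 2 + c := by
    have : (A + 2 * c) ^ 2 / (2 * c) = (A + 2 * c) ^ 2 / c / 2 := by field_simp
    rw [this]; linarith
  have h2 : (A + 2 * c) ^ 2 / (2 * c) * y ^ 2 ≤ (N / 2 - A / 2 + c) * y ^ 2 := by gcongr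
  have h3 : c / 2 * x ^ 2 - (A + 2 * c) * (x * y) + (A + 2 * c) ^ 2 / (2 * c) * y ^ 2
      = (c * x - (A + 2 * c) * y) ^ 2 / (2 * c) := by
    field_simp; ring
  have h4 : 0 ≤ (c * x - (A + 2 * c) * y) ^ 2 / (2 * c) := by positivity
  linarith

lemma inner_withLp_prod (Z Z' : WithLp 2 (V × V)) :
    inner ℝ Z Z' = inner ℝ Z.fst Z'.fst + inner ℝ Z.snd Z'.snd :=
  WithLp.prod_inner_apply _ _

set_option maxHeartbeats 2000000 in
/-- The theorem on sums, in a neighbourhood of a strict maximum. -/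
theorem theorem_on_sums {U₁ U₂ : V → ℝ} {r c : ℝ} (hr : 0 < r) (hc : 0 < c)
    (h₁ : ContinuousOn U₁ (closedBall 0 r)) (h₂ : ContinuousOn U₂ (closedBall 0 r))
    {q : V × V → ℝ} (hq : IsQuad q)
    (hmax : ∀ z w, ‖z‖ ≤ r → ‖w‖ ≤ r →
      U₁ z + U₂ w + c * (‖z‖ ^ 2 + ‖w‖ ^ 2) ≤ U₁ 0 + U₂ 0 + 1 / 2 * q (z, w))
    {ε : ℝ} (hε : 0 < ε) :
    ∃ (z w p p' : V) (X Y : V →L[ℝ] V), ‖z‖ < ε ∧ ‖w‖ < ε ∧ ‖p‖ < ε ∧ ‖p'‖ < ε ∧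
      (∀ η > 0, ∀ᶠ a in nhds (0 : V),
        U₁ (z + a) ≤ U₁ z + inner ℝ p a + 1 / 2 * inner ℝ (X a) a + η * ‖a‖ ^ 2) ∧
      (∀ η > 0, ∀ᶠ a in nhds (0 : V),
        U₂ (w + a) ≤ U₂ w + inner ℝ p' a + 1 / 2 * inner ℝ (Y a) a + η * ‖a‖ ^ 2) ∧
      ∀ a b, inner ℝ (X a) a + inner ℝ (Y b) b ≤ q (a, b) := by
  have hK : IsCompact (closedBall (0 : V) r) := isCompact_closedBall _ _
  have h0K : (0 : V) ∈ closedBall (0 : V) r := mem_closedBall_self hr.le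
  obtain ⟨A, hAs, hA⟩ := (hq.comp
    ((WithLp.linearEquiv 2 ℝ (V × V) : WithLp 2 (V × V) ≃ₗ[ℝ] V × V) : WithLp 2 (V × V) →ₗ[ℝ] V × V)).exists_symm (V := WithLp 2 (V × V))
  have hA' : ∀ Z : WithLp 2 (V × V), q (Z.fst, Z.snd) = inner ℝ (A Z) Z := hA
  set N : ℝ := 1 + ‖A‖ + (‖A‖ + 2 * c) ^ 2 / c with hN
  have hN1 : 1 ≤ N := by rw [hN]; linarith [norm_nonneg A, show 0 ≤ (‖A‖ + 2 * c) ^ 2 / c by positivity]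
  have hN0 : 0 < N := by linarith
  have ex : ∀ U : V → ℝ, ContinuousOn U (closedBall 0 r) → ∃ m : V → V, ∀ z',
      m z' ∈ closedBall (0 : V) r ∧ ∀ z ∈ closedBall (0 : V) r,
        N * inner ℝ z z' + U z - N / 2 * ‖z‖ ^ 2 ≤
          N * inner ℝ (m z') z' + U (m z') - N / 2 * ‖m z'‖ ^ 2 := by
    intro U hU
    have : ∀ z' : V, ∃ m ∈ closedBall (0 : V) r, ∀ z ∈ closedBall (0 : V) r,
        N * inner ℝ z z' + U z - N / 2 * ‖z‖ ^ 2 ≤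
          N * inner ℝ m z' + U m - N / 2 * ‖m‖ ^ 2 := by
      intro z'
      obtain ⟨m, hm, h⟩ := hK.exists_isMaxOn ⟨0, h0K⟩
        (f := fun z => N * inner ℝ z z' + U z - N / 2 * ‖z‖ ^ 2) (by fun_prop)
      exact ⟨m, hm, fun z hz => h hz⟩
    choose m hm using this
    exact ⟨m, hm⟩
  obtain ⟨m₁, hm₁⟩ := ex U₁ h₁
  obtain ⟨m₂, hm₂⟩ := ex U₂ h₂
  let g₁ : V → ℝ := fun z' => N * inner ℝ (m₁ z') z' + U₁ (m₁ z') - N / 2 * ‖m₁ z'‖ ^ 2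
  let g₂ : V → ℝ := fun z' => N * inner ℝ (m₂ z') z' + U₂ (m₂ z') - N / 2 * ‖m₂ z'‖ ^ 2
  have hg₁ : ∀ z z', ‖z‖ ≤ r → N * inner ℝ z z' + U₁ z - N / 2 * ‖z‖ ^ 2 ≤ g₁ z' :=
    fun z z' hz => (hm₁ z').2 z (by simpa using hz)
  have hg₂ : ∀ z z', ‖z‖ ≤ r → N * inner ℝ z z' + U₂ z - N / 2 * ‖z‖ ^ 2 ≤ g₂ z' :=
    fun z z' hz => (hm₂ z').2 z (by simpa using hz)
  have hmr₁ : ∀ z', ‖m₁ z'‖ ≤ r := fun z' => by simpa using (hm₁ z').1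
  have hmr₂ : ∀ z', ‖m₂ z'‖ ≤ r := fun z' => by simpa using (hm₂ z').1
  let G : WithLp 2 (V × V) → ℝ := fun Z => g₁ Z.fst + g₂ Z.snd
  let mm : WithLp 2 (V × V) → WithLp 2 (V × V) := fun Z => WithLp.toLp 2 (m₁ Z.fst, m₂ Z.snd)
  have hmm : ∀ Z, IsSubgrad G Z (N • mm Z) := by
    intro Z Z'
    have a := hg₁ (m₁ Z.fst) Z'.fst (hmr₁ _)
    have b := hg₂ (m₂ Z.snd) Z'.snd (hmr₂ _)
    simp only [G, g₁, g₂, mm, inner_smul_left, inner_withLp_prod, inner_sub_right,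
      conj_trivial,
      WithLp.toLp_fst, WithLp.toLp_snd] at a b ⊢
    linarith
  have hsub : ∀ Z, ∃ p, ‖p‖ ≤ N * (2 * r) ∧ IsSubgrad G Z p := by
    intro Z
    refine ⟨N • mm Z, ?_, hmm Z⟩
    rw [norm_smul, Real.norm_of_nonneg hN0.le]
    gcongr
    have h1 := WithLp.prod_norm_sq_eq_of_L2 (mm Z)
    have h2 : ‖(mm Z).fst‖ ≤ r := hmr₁ _
    have h3 : ‖(mm Z).snd‖ ≤ r := hmr₂ _
    have h4 : ‖mm Z‖ ^ 2 ≤ (2 * r) ^ 2 := by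
      rw [h1]
      have := pow_le_pow_left₀ (norm_nonneg _) h2 2
      have := pow_le_pow_left₀ (norm_nonneg _) h3 2
      nlinarith
    exact le_of_sq_le_sq h4 (by positivity)
  let S : WithLp 2 (V × V) →L[ℝ] WithLp 2 (V × V) := A + N • ContinuousLinearMap.id ℝ (WithLp 2 (V × V))
  have hSa : ∀ Z Z' : WithLp 2 (V × V), inner ℝ (S Z) Z' = inner ℝ (A Z) Z' + N * inner ℝ Z Z' := by
    intro Z Z'
    simp [S, inner_add_left, inner_smul_left]
  have hG0 : U₁ 0 + U₂ 0 ≤ G 0 := by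
    have a := hg₁ 0 0 (by simpa using hr.le)
    have b := hg₂ 0 0 (by simpa using hr.le)
    simp only [inner_zero_left, norm_zero] at a b
    simp only [G, WithLp.zero_fst, WithLp.zero_snd]
    nlinarith
  have hmaxG : ∀ Z : WithLp 2 (V × V), ‖Z‖ ≤ 1 → G Z - 1 / 2 * inner ℝ (S Z) Z + c / 2 * ‖Z‖ ^ 2 ≤ G 0 := by
    intro Z _
    refine le_trans ?_ hG0
    obtain ⟨D, hD⟩ : ∃ D, mm Z = Z + D := ⟨mm Z - Z, by abel⟩
    have e1 : G Z = N * inner ℝ (mm Z) Z + (U₁ (mm Z).fst + U₂ (mm Z).snd) -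
        N / 2 * ‖mm Z‖ ^ 2 := by
      rw [WithLp.prod_norm_sq_eq_of_L2]
      simp only [G, g₁, g₂, mm, inner_withLp_prod, WithLp.toLp_fst, WithLp.toLp_snd]
      ring
    have e2 := hmax (mm Z).fst (mm Z).snd (hmr₁ _) (hmr₂ _)
    rw [← WithLp.prod_norm_sq_eq_of_L2, hA'] at e2
    have e3 : inner ℝ (A (mm Z)) (mm Z) = inner ℝ (A Z) Z + 2 * inner ℝ (A Z) D
        + inner ℝ (A D) D := by
      rw [hD]; simp only [map_add, inner_add_left, inner_add_right]
      rw [hAs D Z]; ring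
    have e4 : ‖mm Z‖ ^ 2 = ‖Z‖ ^ 2 + 2 * inner ℝ Z D + ‖D‖ ^ 2 := by
      rw [hD, norm_add_sq_real]
    have e5 : inner ℝ (mm Z) Z = ‖Z‖ ^ 2 + inner ℝ Z D := by
      rw [hD, inner_add_left, real_inner_self_eq_norm_sq, real_inner_comm]
    rw [e3, e4] at e2
    rw [e1, e4, e5, hSa, real_inner_self_eq_norm_sq]
    have f1 : inner ℝ (A Z) D ≤ ‖A‖ * (‖Z‖ * ‖D‖) := by
      calc _ ≤ ‖A Z‖ * ‖D‖ := real_inner_le_norm _ _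
        _ ≤ (‖A‖ * ‖Z‖) * ‖D‖ := by gcongr; exact A.le_opNorm _
        _ = _ := by ring
    have f2 := inner_clm_le A D
    have f3 : -inner ℝ Z D ≤ ‖Z‖ * ‖D‖ := by
      have := abs_real_inner_le_norm Z D
      have := neg_abs_le (inner ℝ Z D)
      linarith
    have f4 := sum_sup_convolution_bound (N := N) (x := ‖Z‖) (y := ‖D‖) (norm_nonneg A) hc
      (by rw [hN]; linarith)
    nlinarith
  set ε' := min ε r / (4 * N * (1 + ‖A‖)) with hε'
  have hε'0 : 0 < ε' := by positivity
  obtain ⟨Z, p, H, hZ, hp, hpu, hH, hexp⟩ := exists_expansion_near_max hsub S (fun a b => by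
    rw [hSa, hSa, hAs, real_inner_comm a b]) one_pos (half_pos hc) hmaxG hε'0
  obtain rfl := hpu _ (hmm Z)
  have hSZ : S Z = A Z + N • Z := by simp [S]
  have hε'e : ε' * (1 + ‖A‖) * (4 * N) = min ε r := by rw [hε']; field_simp
  have hNd : N * ‖mm Z - Z‖ ≤ ε' * (1 + ‖A‖) := by
    have : N • (mm Z - Z) = (N • mm Z - S Z) + A Z := by rw [hSZ, smul_sub]; abel
    calc N * ‖mm Z - Z‖ = ‖N • (mm Z - Z)‖ := by rw [norm_smul, Real.norm_of_nonneg hN0.le]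
      _ ≤ ‖N • mm Z - S Z‖ + ‖A Z‖ := by rw [this]; exact norm_add_le _ _
      _ ≤ ε' + ‖A‖ * ε' := by
        gcongr
        exact (A.le_opNorm _).trans (by gcongr)
      _ = _ := by ring
  have hx0 : 0 < ε' * (1 + ‖A‖) := by positivity
  have hmin : 4 * (ε' * (1 + ‖A‖)) ≤ min ε r := by
    rw [← hε'e]; nlinarith
  have hfst : ∀ Z : WithLp 2 (V × V), ‖Z.fst‖ ≤ ‖Z‖ := fun Z => by
    have := WithLp.prod_norm_sq_eq_of_L2 Z
    exact le_of_sq_le_sq (by nlinarith [sq_nonneg ‖Z.snd‖]) (norm_nonneg _)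
  have hsnd : ∀ Z : WithLp 2 (V × V), ‖Z.snd‖ ≤ ‖Z‖ := fun Z => by
    have := WithLp.prod_norm_sq_eq_of_L2 Z
    exact le_of_sq_le_sq (by nlinarith [sq_nonneg ‖Z.fst‖]) (norm_nonneg _)
  have hmmn : ‖mm Z‖ < min ε r := by
    have h1 : ‖mm Z - Z‖ ≤ N * ‖mm Z - Z‖ := le_mul_of_one_le_left (norm_nonneg _) hN1
    have h2 : ‖mm Z‖ ≤ ‖mm Z - Z‖ + ‖Z‖ := by
      simpa using norm_add_le (mm Z - Z) Z
    have h3 : ε' ≤ ε' * (1 + ‖A‖) := by nlinarith [norm_nonneg A]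
    linarith
  have hNdn : ‖N • (mm Z - Z)‖ < ε := by
    rw [norm_smul, Real.norm_of_nonneg hN0.le]
    linarith [min_le_left ε r]
  let i₁ : V →L[ℝ] WithLp 2 (V × V) := LinearMap.toContinuousLinearMap
    ((WithLp.linearEquiv 2 ℝ (V × V)).symm.toLinearMap ∘ₗ LinearMap.inl ℝ V V)
  let i₂ : V →L[ℝ] WithLp 2 (V × V) := LinearMap.toContinuousLinearMap
    ((WithLp.linearEquiv 2 ℝ (V × V)).symm.toLinearMap ∘ₗ LinearMap.inr ℝ V V)
  let π₁ : WithLp 2 (V × V) →L[ℝ] V := LinearMap.toContinuousLinearMap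
    (LinearMap.fst ℝ V V ∘ₗ (WithLp.linearEquiv 2 ℝ (V × V)).toLinearMap)
  let π₂ : WithLp 2 (V × V) →L[ℝ] V := LinearMap.toContinuousLinearMap
    (LinearMap.snd ℝ V V ∘ₗ (WithLp.linearEquiv 2 ℝ (V × V)).toLinearMap)
  have hi₁ : ∀ a, i₁ a = WithLp.toLp 2 (a, 0) := fun a => rfl
  have hi₂ : ∀ a, i₂ a = WithLp.toLp 2 (0, a) := fun a => rfl
  have hπ₁ : ∀ a, π₁ a = a.fst := fun a => rfl
  have hπ₂ : ∀ a, π₂ a = a.snd := fun a => rfl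
  have hin₁ : ∀ a, ‖i₁ a‖ = ‖a‖ := fun a => by simp [hi₁]
  have hin₂ : ∀ a, ‖i₂ a‖ = ‖a‖ := fun a => by simp [hi₂]
  have hii₁ : ∀ Z a, inner ℝ Z (i₁ a) = inner ℝ Z.fst a := fun Z a => by
    simp [hi₁]
  have hii₂ : ∀ Z a, inner ℝ Z (i₂ a) = inner ℝ Z.snd a := fun Z a => by
    simp [hi₂]
  have ht₁ : Tendsto i₁ (nhds 0) (nhds 0) := by simpa using i₁.continuous.tendsto 0
  have ht₂ : Tendsto i₂ (nhds 0) (nhds 0) := by simpa using i₂.continuous.tendsto 0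
  have hs₁ : Tendsto π₁ (nhds 0) (nhds 0) := by simpa using π₁.continuous.tendsto 0
  have hs₂ : Tendsto π₂ (nhds 0) (nhds 0) := by simpa using π₂.continuous.tendsto 0
  have hG₁ : ∀ a, G (Z + i₁ a) - G Z = g₁ (Z.fst + a) - g₁ Z.fst := fun a => by
    simp [G, hi₁]
  have hG₂ : ∀ a, G (Z + i₂ a) - G Z = g₂ (Z.snd + a) - g₂ Z.snd := fun a => by
    simp [G, hi₂]
  let X : V →L[ℝ] V := π₁.comp (H.comp i₁) - N • ContinuousLinearMap.id ℝ V
  let Y : V →L[ℝ] V := π₂.comp (H.comp i₂) - N • ContinuousLinearMap.id ℝ V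
  have hX : ∀ a, inner ℝ (X a) a = inner ℝ (H (i₁ a)) (i₁ a) - N * ‖a‖ ^ 2 := fun a => by
    simp [X, inner_sub_left, inner_smul_left, hπ₁, hii₁]
  have hY : ∀ a, inner ℝ (Y a) a = inner ℝ (H (i₂ a)) (i₂ a) - N * ‖a‖ ^ 2 := fun a => by
    simp [Y, inner_sub_left, inner_smul_left, hπ₂, hii₂]
  have hjet : ∀ {U g : V → ℝ} {z z' : V}, ‖z‖ < r →
      (∀ z z', ‖z‖ ≤ r → N * inner ℝ z z' + U z - N / 2 * ‖z‖ ^ 2 ≤ g z') →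
      g z' = N * inner ℝ z z' + U z - N / 2 * ‖z‖ ^ 2 →
      ∀ᶠ a in nhds (0 : V), U (z + a) ≤ U z + (g (z' + a) - g z' - N * inner ℝ z a)
        + inner ℝ (N • (z - z')) a - N / 2 * ‖a‖ ^ 2 := by
    intro U g z z' hz hg hgz
    refine Metric.eventually_nhds_iff.2 ⟨r - ‖z‖, sub_pos.2 hz, fun {a} ha => ?_⟩
    rw [dist_zero_right] at ha
    have h1 := hg (z + a) (z' + a) ((norm_add_le _ _).trans (by linarith))
    rw [norm_add_sq_real] at h1
    simp only [inner_add_left, inner_add_right, inner_smul_left, inner_sub_left, conj_trivial,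
      real_inner_self_eq_norm_sq] at h1 ⊢
    rw [real_inner_comm z' a] at *
    nlinarith
  refine ⟨(mm Z).fst, (mm Z).snd, N • ((mm Z).fst - Z.fst), N • ((mm Z).snd - Z.snd), X, Y,
    (hfst _).trans_lt (hmmn.trans_le (min_le_left _ _)),
    (hsnd _).trans_lt (hmmn.trans_le (min_le_left _ _)), (hfst _).trans_lt hNdn,
    (hsnd _).trans_lt hNdn, ?_, ?_, ?_⟩
  · intro η hη
    filter_upwards [ht₁.eventually (hexp η hη), hjet (U := U₁) (g := g₁) (z' := Z.fst)
      ((hfst (mm Z)).trans_lt (hmmn.trans_le (min_le_right _ _))) hg₁ rfl] with a h1 h2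
    rw [hG₁, hin₁, hii₁] at h1
    have h3 := (abs_le.1 h1).2
    have h4 : inner ℝ (N • mm Z).fst a = N * inner ℝ (mm Z).fst a := by
      simp [inner_smul_left]
    rw [h4] at h3
    rw [hX]
    linarith
  · intro η hη
    filter_upwards [ht₂.eventually (hexp η hη), hjet (U := U₂) (g := g₂) (z' := Z.snd)
      ((hsnd (mm Z)).trans_lt (hmmn.trans_le (min_le_right _ _))) hg₂ rfl] with a h1 h2
    rw [hG₂, hin₂, hii₂] at h1
    have h3 := (abs_le.1 h1).2
    have h4 : inner ℝ (N • mm Z).snd a = N * inner ℝ (mm Z).snd a := by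
      simp [inner_smul_left]
    rw [h4] at h3
    rw [hY]
    linarith
  · intro a b
    let H' : WithLp 2 (V × V) →L[ℝ] WithLp 2 (V × V) := i₁.comp (π₁.comp (H.comp (i₁.comp π₁))) +
      i₂.comp (π₂.comp (H.comp (i₂.comp π₂)))
    have hH' : ∀ Z : WithLp 2 (V × V), inner ℝ (H' Z) Z = inner ℝ (H (i₁ Z.fst)) (i₁ Z.fst) +
        inner ℝ (H (i₂ Z.snd)) (i₂ Z.snd) := fun Z => by
      simp only [H', add_apply, ContinuousLinearMap.comp_apply,
        inner_add_left, hπ₁, hπ₂]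
      rw [real_inner_comm Z (i₁ _), real_inner_comm Z (i₂ _), hii₁, hii₂, hii₁, hii₂,
        real_inner_comm Z.fst, real_inner_comm Z.snd]
    have hle := quad_le_of_eventually_le (A := H') (B := S) (fun η hη => by
      filter_upwards [(ht₁.comp hs₁).eventually (hexp (η / 6) (by positivity)),
        (ht₂.comp hs₂).eventually (hexp (η / 6) (by positivity)), hexp (η / 6) (by positivity)]
        with Z' h1 h2 h3
      simp only [Function.comp_apply, hπ₁, hπ₂, hin₁, hin₂, hG₁, hG₂, hii₁, hii₂] at h1 h2
      have e : G (Z + Z') - G Z = (g₁ (Z.fst + Z'.fst) - g₁ Z.fst) +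
          (g₂ (Z.snd + Z'.snd) - g₂ Z.snd) := by
        simp only [G, WithLp.add_fst, WithLp.add_snd]; ring
      rw [e, inner_withLp_prod] at h3
      have h1' := (abs_le.1 h1).1
      have h2' := (abs_le.1 h2).1
      have h3' := (abs_le.1 h3).2
      have n1 : η / 6 * ‖Z'.fst‖ ^ 2 ≤ η / 6 * ‖Z'‖ ^ 2 := by gcongr; exact hfst Z'
      have n2 : η / 6 * ‖Z'.snd‖ ^ 2 ≤ η / 6 * ‖Z'‖ ^ 2 := by gcongr; exact hsnd Z'
      have h4 := hH Z'
      rw [hH', hii₁, hii₂]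
      linarith) (WithLp.toLp 2 (a, b))
    rw [hH', hSa, ← hA', real_inner_self_eq_norm_sq, WithLp.prod_norm_sq_eq_of_L2] at hle
    simp only [WithLp.toLp_fst, WithLp.toLp_snd] at hle
    rw [hX, hY]
    linarith

end Sums

section TwoPoint

variable {n : ℕ}

/-- The standard orthonormal basis of `Euc n`. -/
abbrev stdb (n : ℕ) : OrthonormalBasis (Fin n) ℝ (Euc n) := EuclideanSpace.basisFun (Fin n) ℝ

/-- `trace (σᵀ X σ)`. -/
def trQ (X σ : Euc n →L[ℝ] Euc n) : ℝ := ∑ i, inner ℝ (X (σ (stdb n i))) (σ (stdb n i))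

/-- `u` is a viscosity subsolution of `∂ₜ u ≤ trace (σ(∇u)ᵀ D²u σ(∇u)) + M` in `Ω`, tested with
quadratic polynomials with gradient in `G`. -/
def VisSub (σ : Euc n → Euc n →L[ℝ] Euc n) (G : Set (Euc n)) (M : ℝ) (Ω : Set (Euc n × ℝ))
    (u : Euc n → ℝ → ℝ) : Prop :=
  ∀ x t, (x, t) ∈ Ω → ∀ ξ ∈ G, ∀ (τ C : ℝ) (X : Euc n →L[ℝ] Euc n),
    (∀ᶠ w in nhds (0 : Euc n × ℝ), u (x + w.1) (t + w.2) ≤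
      u x t + τ * w.2 + C * w.2 ^ 2 + inner ℝ ξ w.1 + 1 / 2 * inner ℝ (X w.1) w.1) →
    τ ≤ trQ X (σ ξ) + M

lemma trQ_comp_isometry (X σ : Euc n →L[ℝ] Euc n) (R : Euc n ≃ₗᵢ[ℝ] Euc n) :
    ∑ i, inner ℝ (X (σ (R (stdb n i)))) (σ (R (stdb n i))) = trQ X σ := by
  let T : Euc n →L[ℝ] Euc n := (ContinuousLinearMap.adjoint σ).comp (X.comp σ)
  have h : ∀ v, inner ℝ (X (σ v)) (σ v) = inner ℝ v (T v) := fun v => by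
    simp only [T, ContinuousLinearMap.comp_apply, ContinuousLinearMap.adjoint_inner_right]
    exact real_inner_comm _ _
  unfold trQ
  simp only [h]
  have h1 := (T : Euc n →ₗ[ℝ] Euc n).trace_eq_sum_inner (stdb n)
  have h2 := (T : Euc n →ₗ[ℝ] Euc n).trace_eq_sum_inner ((stdb n).map R)
  simp only [OrthonormalBasis.map_apply] at h2
  exact h2.symm.trans h1

lemma exists_penalization {Z : Type*} [TopologicalSpace Z] [T2Space Z] {K : Set Z} {F g : Z → ℝ}
    (hK : IsCompact K) (hF : ContinuousOn F K) (hg : ContinuousOn g K) (hg0 : ∀ k ∈ K, 0 ≤ g k)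
    {c : ℝ} (hlt : ∀ k ∈ K, g k = 0 → F k < c) : ∃ j : ℕ, ∀ k ∈ K, F k - j * g k < c := by
  by_contra! hcon
  let T : ℕ → Set Z := fun j => K ∩ {k | c ≤ F k - j * g k}
  have hcl : ∀ j, IsCompact (T j) := fun j => by
    have : ContinuousOn (fun k => F k - j * g k) K := by fun_prop
    have := this.preimage_isClosed_of_isClosed hK.isClosed (isClosed_Ici (a := c))
    exact hK.of_isClosed_subset this inter_subset_left
  obtain ⟨k, hk⟩ := IsCompact.nonempty_iInter_of_sequence_nonempty_isCompact_isClosed T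
    (fun j k hk => ⟨hk.1, by
      have h1 : c ≤ F k - ((j + 1 : ℕ) : ℝ) * g k := hk.2
      have h2 := hg0 k hk.1
      push_cast at h1
      show c ≤ F k - j * g k
      linarith⟩) (fun j => by obtain ⟨k, hk, h⟩ := hcon j; exact ⟨k, hk, h⟩) (hcl 0)
    (fun j => (hcl j).isClosed)
  rw [mem_iInter] at hk
  have hkK := (hk 0).1
  rcases (hg0 k hkK).eq_or_lt with h0 | h0
  · have h1 : c ≤ F k - (0 : ℕ) * g k := (hk 0).2
    have := hlt k hkK h0.symm
    simp at h1
    linarith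
  · obtain ⟨j, hj⟩ := exists_nat_gt ((F k - c) / g k)
    have h1 : c ≤ F k - j * g k := (hk j).2
    rw [div_lt_iff₀ h0] at hj
    linarith

/-- A Hilbert space `V` presented as the orthogonal sum of `E` and a time axis. -/
structure TimeSplit (E V : Type*) [NormedAddCommGroup E] [InnerProductSpace ℝ E]
    [NormedAddCommGroup V] [InnerProductSpace ℝ V] where
  /-- the space component -/
  sp : V →L[ℝ] E
  /-- the time component -/
  tm : V →L[ℝ] ℝ
  /-- the inclusion of space -/
  inc : E →L[ℝ] V
  /-- the time direction -/
  dir : V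
  sp_inc : ∀ a, sp (inc a) = a
  tm_inc : ∀ a, tm (inc a) = 0
  sp_dir : sp dir = 0
  tm_dir : tm dir = 1
  inner_eq : ∀ Z Z', inner ℝ Z Z' = inner ℝ (sp Z) (sp Z') + tm Z * tm Z'

lemma exists_timeSplit (E : Type) [NormedAddCommGroup E] [InnerProductSpace ℝ E]
    [FiniteDimensional ℝ E] :
    Nonempty (TimeSplit E (WithLp 2 (E × ℝ))) :=
  ⟨{ sp := LinearMap.toContinuousLinearMap
      (LinearMap.fst ℝ E ℝ ∘ₗ (WithLp.linearEquiv 2 ℝ (E × ℝ)).toLinearMap)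
     tm := LinearMap.toContinuousLinearMap
      (LinearMap.snd ℝ E ℝ ∘ₗ (WithLp.linearEquiv 2 ℝ (E × ℝ)).toLinearMap)
     inc := LinearMap.toContinuousLinearMap
      ((WithLp.linearEquiv 2 ℝ (E × ℝ)).symm.toLinearMap ∘ₗ LinearMap.inl ℝ E ℝ)
     dir := WithLp.toLp 2 (0, 1)
     sp_inc := fun a => rfl
     tm_inc := fun a => rfl
     sp_dir := rfl
     tm_dir := rfl
     inner_eq := fun Z Z' => by
       rw [WithLp.prod_inner_apply]
       congr 1
       exact mul_comm _ _ }⟩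

section Jets
variable {V : Type*} [NormedAddCommGroup V] [InnerProductSpace ℝ V]

lemma TimeSplit.norm_sq (S : TimeSplit (Euc n) V) (Z : V) : ‖Z‖ ^ 2 = ‖S.sp Z‖ ^ 2 + S.tm Z ^ 2 := by
  rw [← real_inner_self_eq_norm_sq, S.inner_eq, real_inner_self_eq_norm_sq]; ring

lemma VisSub.of_jet (S : TimeSplit (Euc n) V) {σ : Euc n → Euc n →L[ℝ] Euc n} {G : Set (Euc n)} {M : ℝ}
    {Ω : Set (Euc n × ℝ)} {u : Euc n → ℝ → ℝ} (hu : VisSub σ G M Ω u) {x : Euc n} {t : ℝ}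
    (hx : (x, t) ∈ Ω) {ξ : Euc n} (hξ : ξ ∈ G) {τ : ℝ} {X : V →L[ℝ] V}
    (h : ∀ η > 0, ∀ᶠ w in nhds (0 : V), u (x + S.sp w) (t + S.tm w) ≤
      u x t + τ * S.tm w + inner ℝ ξ (S.sp w) + 1 / 2 * inner ℝ (X w) w + η * ‖w‖ ^ 2) :
    τ ≤ ∑ i, inner ℝ (X (S.inc (σ ξ (stdb n i)))) (S.inc (σ ξ (stdb n i))) + M := by
  set Sg := ∑ i, ‖σ ξ (stdb n i)‖ ^ 2 with hSg
  have hSg0 : 0 ≤ Sg := by positivity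
  have hin : ∀ Z a, inner ℝ Z (S.inc a) = inner ℝ (S.sp Z) a := fun Z a => by
    simp [S.inner_eq, S.sp_inc, S.tm_inc]
  have key : ∀ η > 0, τ ≤ ∑ i, inner ℝ (X (S.inc (σ ξ (stdb n i))))
      (S.inc (σ ξ (stdb n i))) + M + 4 * η * Sg := by
    intro η hη
    have := hu x t hx ξ hξ τ (‖X‖ ^ 2 / (4 * η) + ‖X‖ / 2 + η)
      (S.sp.comp (X.comp S.inc) + (4 * η) • ContinuousLinearMap.id ℝ _) (by
      have ht : Tendsto (fun w : Euc n × ℝ => S.inc w.1 + w.2 • S.dir) (nhds 0) (nhds 0) := by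
        have : Continuous fun w : Euc n × ℝ => S.inc w.1 + w.2 • S.dir := by fun_prop
        simpa using this.tendsto 0
      filter_upwards [ht.eventually (h η hη)] with w hw
      set s : V := w.2 • S.dir with hs
      have hsp : S.sp (S.inc w.1 + s) = w.1 := by simp [hs, S.sp_inc, S.sp_dir]
      have htm : S.tm (S.inc w.1 + s) = w.2 := by simp [hs, S.tm_inc, S.tm_dir]
      rw [S.norm_sq, hsp, htm] at hw
      have hsn : ‖s‖ = |w.2| := by
        rw [← sq_eq_sq₀ (norm_nonneg _) (abs_nonneg _), S.norm_sq]
        simp [hs, S.sp_dir, S.tm_dir]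
      have hιn : ‖S.inc w.1‖ = ‖w.1‖ := by
        rw [← sq_eq_sq₀ (norm_nonneg _) (norm_nonneg _), S.norm_sq]
        simp [S.sp_inc, S.tm_inc]
      have b : ∀ Z Z', inner ℝ (X Z) Z' ≤ ‖X‖ * ‖Z‖ * ‖Z'‖ := fun Z Z' =>
        (real_inner_le_norm _ _).trans (by gcongr; exact X.le_opNorm _)
      have b1 := b (S.inc w.1) s
      have b2 := b s (S.inc w.1)
      have b3 := b s s
      have e2 : inner ℝ (X (S.inc w.1 + s)) (S.inc w.1 + s) =
          inner ℝ (X (S.inc w.1)) (S.inc w.1) +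
          inner ℝ (X (S.inc w.1)) s + inner ℝ (X s) (S.inc w.1) + inner ℝ (X s) s := by
        simp only [map_add, inner_add_left, inner_add_right]; ring
      rw [e2] at hw
      rw [hιn, hsn] at *
      have e3 : inner ℝ ((S.sp.comp (X.comp S.inc) +
          (4 * η) • ContinuousLinearMap.id ℝ (Euc n)) w.1) w.1
          = inner ℝ (X (S.inc w.1)) (S.inc w.1) + 4 * η * ‖w.1‖ ^ 2 := by
        simp [inner_add_left, inner_smul_left, hin]
      rw [e3]
      have b4 : ‖X‖ * ‖w.1‖ * |w.2| ≤ η * ‖w.1‖ ^ 2 + ‖X‖ ^ 2 / (4 * η) * w.2 ^ 2 := by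
        have : η * ‖w.1‖ ^ 2 + ‖X‖ ^ 2 / (4 * η) * w.2 ^ 2 - ‖X‖ * ‖w.1‖ * |w.2| =
            (2 * η * ‖w.1‖ - ‖X‖ * |w.2|) ^ 2 / (4 * η) := by
          rw [← sq_abs w.2]; field_simp; ring
        have : 0 ≤ (2 * η * ‖w.1‖ - ‖X‖ * |w.2|) ^ 2 / (4 * η) := by positivity
        linarith
      have b5 : ‖X‖ * |w.2| * |w.2| = ‖X‖ * w.2 ^ 2 := by rw [← sq_abs w.2]; ring
      have b6 : ‖X‖ * |w.2| * ‖w.1‖ = ‖X‖ * ‖w.1‖ * |w.2| := by ring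
      rw [b5] at b3
      rw [b6] at b2
      linarith)
    refine this.trans (le_of_eq ?_)
    have e : trQ (S.sp.comp (X.comp S.inc) + (4 * η) • ContinuousLinearMap.id ℝ (Euc n)) (σ ξ) =
      ∑ i, inner ℝ (X (S.inc (σ ξ (stdb n i))))
      (S.inc (σ ξ (stdb n i))) + 4 * η * Sg := by
      rw [hSg, Finset.mul_sum, ← Finset.sum_add_distrib]
      refine Finset.sum_congr rfl fun i _ => ?_
      rw [hin]
      simp [inner_add_left, inner_smul_left]
    rw [e]; ring
  apply le_of_forall_pos_le_add
  intro ε hε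
  have := key (ε / (4 * (Sg + 1))) (by positivity)
  have h2 : 4 * (ε / (4 * (Sg + 1))) * Sg ≤ ε := by
    have : 4 * (ε / (4 * (Sg + 1))) * Sg = ε * (Sg / (Sg + 1)) := by field_simp
    rw [this]
    have : Sg / (Sg + 1) ≤ 1 := by rw [div_le_one (by positivity)]; linarith
    nlinarith
  linarith

end Jets
end TwoPoint

section TwoPointMax

variable {n : ℕ}

lemma IsQuad.exists_expansion {q : Euc n × Euc n → ℝ} (hq : IsQuad q) :
    ∃ A₁ A₂ : Euc n × Euc n →L[ℝ] Euc n, (∀ z, q z = inner ℝ (A₁ z) z.1 + inner ℝ (A₂ z) z.2) ∧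
      ∀ z z', q (z + z') = q z + 2 * inner ℝ (A₁ z) z'.1 + 2 * inner ℝ (A₂ z) z'.2 + q z' := by
  obtain ⟨B, hB⟩ := hq
  have key : ∀ J : Euc n →ₗ[ℝ] Euc n × Euc n, ∃ A : Euc n × Euc n →L[ℝ] Euc n, ∀ z a,
      inner ℝ (A z) a = 1 / 2 * (B z (J a) + B (J a) z) := by
    intro J
    refine ⟨LinearMap.toContinuousLinearMap (∑ i, ((1 / 2 : ℝ) • (B.flip (J (stdb n i)) +
      B (J (stdb n i)))).smulRight (stdb n i)), fun z a => ?_⟩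
    have ha : a = ∑ i, inner ℝ (stdb n i) a • stdb n i := ((stdb n).sum_repr' a).symm
    conv_rhs => rw [ha]
    rw [LinearMap.coe_toContinuousLinearMap']
    simp only [LinearMap.sum_apply, LinearMap.smulRight_apply,
      LinearMap.smul_apply, LinearMap.add_apply, LinearMap.flip_apply, sum_inner, inner_smul_left,
      map_sum, map_smul, smul_eq_mul, RCLike.conj_to_real]
    rw [← Finset.sum_add_distrib, Finset.mul_sum]
    exact Finset.sum_congr rfl fun i _ => by ring
  obtain ⟨A₁, h₁⟩ := key (LinearMap.inl ℝ _ _)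
  obtain ⟨A₂, h₂⟩ := key (LinearMap.inr ℝ _ _)
  have hz : ∀ z : Euc n × Euc n, z = (z.1, 0) + (0, z.2) := fun z => by simp
  have h3 : ∀ z z' : Euc n × Euc n, inner ℝ (A₁ z) z'.1 + inner ℝ (A₂ z) z'.2 =
      1 / 2 * (B z z' + B z' z) := fun z z' => by
    rw [h₁, h₂]
    conv_rhs => rw [hz z']
    simp only [LinearMap.inl_apply, LinearMap.inr_apply, map_add, LinearMap.add_apply]
    ring
  refine ⟨A₁, A₂, fun z => by rw [h3, hB]; ring, fun z z' => ?_⟩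
  have := h3 z z'
  rw [hB, hB, hB]
  simp only [map_add, LinearMap.add_apply]
  linarith

lemma VisSub.trQ_rotate {V : Type*} [NormedAddCommGroup V] [InnerProductSpace ℝ V]
    (S : TimeSplit (Euc n) V) (X : V →L[ℝ] V) (σ : Euc n →L[ℝ] Euc n) (R : Euc n ≃ₗᵢ[ℝ] Euc n) :
    ∑ i, inner ℝ (X (S.inc (σ (stdb n i)))) (S.inc (σ (stdb n i))) =
      ∑ i, inner ℝ (X (S.inc (σ (R (stdb n i))))) (S.inc (σ (R (stdb n i)))) := by
  have h := trQ_comp_isometry (S.sp.comp (X.comp S.inc)) σ R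
  have hin : ∀ Z a, inner ℝ Z (S.inc a) = inner ℝ (S.sp Z) a := fun Z a => by
    simp [S.inner_eq, S.sp_inc, S.tm_inc]
  simp only [hin]
  exact h.symm

/-- Approximate form of the parabolic two-point maximum principle. -/
lemma two_point_approx {V : Type*} [NormedAddCommGroup V] [InnerProductSpace ℝ V]
    [FiniteDimensional ℝ V] (S : TimeSplit (Euc n) V)
    {σ₁ σ₂ : Euc n → Euc n →L[ℝ] Euc n} {G₁ G₂ : Set (Euc n)}
    {M₁ M₂ : ℝ} {Ω₁ Ω₂ : Set (Euc n × ℝ)} {u₁ u₂ : Euc n → ℝ → ℝ}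
    (hu₁ : VisSub σ₁ G₁ M₁ Ω₁ u₁) (hu₂ : VisSub σ₂ G₂ M₂ Ω₂ u₂)
    (hΩ₁ : IsOpen Ω₁) (hΩ₂ : IsOpen Ω₂) (hG₁ : IsOpen G₁) (hG₂ : IsOpen G₂)
    (hc₁ : ContinuousOn (fun z : Euc n × ℝ => u₁ z.1 z.2) Ω₁)
    (hc₂ : ContinuousOn (fun z : Euc n × ℝ => u₂ z.1 z.2) Ω₂)
    {x y : Euc n} {t : ℝ} (hx : (x, t) ∈ Ω₁) (hy : (y, t) ∈ Ω₂) {ξ₁ ξ₂ : Euc n}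
    (hξ₁ : ξ₁ ∈ G₁) (hξ₂ : ξ₂ ∈ G₂) {τ C : ℝ} {q : Euc n × Euc n → ℝ} (hq : IsQuad q)
    (h : ∀ᶠ w in nhds (0 : Euc n × Euc n × ℝ),
      u₁ (x + w.1) (t + w.2.2) + u₂ (y + w.2.1) (t + w.2.2) ≤ u₁ x t + u₂ y t + τ * w.2.2 +
        C * w.2.2 ^ 2 + inner ℝ ξ₁ w.1 + inner ℝ ξ₂ w.2.1 + 1 / 2 * q (w.1, w.2.1))
    (R : Euc n ≃ₗᵢ[ℝ] Euc n) {δ : ℝ} (hδ : 0 < δ) :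
    ∃ (e r : ℝ) (v₁ v₂ : Euc n), |e| < δ ∧ |r| < δ ∧ ‖v₁‖ < δ ∧ ‖v₂‖ < δ ∧
      τ ≤ ∑ i, q (σ₁ (ξ₁ + v₁) (stdb n i), σ₂ (ξ₂ + v₂) (R (stdb n i))) +
        e * ∑ i, (‖σ₁ (ξ₁ + v₁) (stdb n i)‖ ^ 2 + ‖σ₂ (ξ₂ + v₂) (R (stdb n i))‖ ^ 2) +
        M₁ + M₂ + r := by
  obtain ⟨A₁, A₂, hA, hAq⟩ := hq.exists_expansion
  obtain ⟨δ', hδ', hδ'δ, hδ₁, hδ₂⟩ : ∃ δ' > 0, δ' ≤ δ ∧ (∀ v : Euc n, ‖v‖ < δ' → ξ₁ + v ∈ G₁) ∧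
      ∀ v : Euc n, ‖v‖ < δ' → ξ₂ + v ∈ G₂ := by
    obtain ⟨r1, hr1, h1⟩ := Metric.isOpen_iff.1 hG₁ ξ₁ hξ₁
    obtain ⟨r2, hr2, h2⟩ := Metric.isOpen_iff.1 hG₂ ξ₂ hξ₂
    exact ⟨min δ (min r1 r2), by positivity, min_le_left _ _,
      fun v hv => h1 (by
        simpa using hv.trans_le ((min_le_right _ _).trans (min_le_left _ _))),
      fun v hv => h2 (by
        simpa using hv.trans_le ((min_le_right _ _).trans (min_le_right _ _)))⟩
  suffices H : ∃ (e r : ℝ) (v₁ v₂ : Euc n), |e| < δ' ∧ |r| < δ' ∧ ‖v₁‖ < δ' ∧ ‖v₂‖ < δ' ∧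
      τ ≤ ∑ i, q (σ₁ (ξ₁ + v₁) (stdb n i), σ₂ (ξ₂ + v₂) (R (stdb n i))) +
        e * ∑ i, (‖σ₁ (ξ₁ + v₁) (stdb n i)‖ ^ 2 + ‖σ₂ (ξ₂ + v₂) (R (stdb n i))‖ ^ 2) +
        M₁ + M₂ + r by
    obtain ⟨e, r, v₁, v₂, h1, h2, h3, h4, h5⟩ := H
    exact ⟨e, r, v₁, v₂, h1.trans_le hδ'δ, h2.trans_le hδ'δ, h3.trans_le hδ'δ,
      h4.trans_le hδ'δ, h5⟩
  clear hδ'δ hδ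
  clear δ
  rename' δ' => δ, hδ' => hδ
  set ε₀ : ℝ := δ / 7 with hε₀
  have hε₀' : 0 < ε₀ := by positivity
  -- smallness scales
  obtain ⟨ρ, hρ, hρ₁, hρ₂, hρh⟩ : ∃ ρ > 0, (∀ Z : V, ‖Z‖ ≤ ρ → (x + S.sp Z, t + S.tm Z) ∈ Ω₁) ∧
      (∀ Z : V, ‖Z‖ ≤ ρ → (y + S.sp Z, t + S.tm Z) ∈ Ω₂) ∧
      ∀ Z W : V, ‖Z‖ ≤ ρ → ‖W‖ ≤ ρ → S.tm Z = S.tm W →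
      u₁ (x + S.sp Z) (t + S.tm Z) + u₂ (y + S.sp W) (t + S.tm W) ≤ u₁ x t + u₂ y t +
        τ * S.tm Z + C * S.tm Z ^ 2 + inner ℝ ξ₁ (S.sp Z) + inner ℝ ξ₂ (S.sp W) +
        1 / 2 * q (S.sp Z, S.sp W) := by
    have e1 : ∀ᶠ Z in nhds (0 : V), (x + S.sp Z, t + S.tm Z) ∈ Ω₁ := by
      have : Continuous fun Z : V => (x + S.sp Z, t + S.tm Z) := by fun_prop
      exact this.continuousAt.eventually_mem (hΩ₁.mem_nhds (by simpa using hx))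
    have e2 : ∀ᶠ Z in nhds (0 : V), (y + S.sp Z, t + S.tm Z) ∈ Ω₂ := by
      have : Continuous fun Z : V => (y + S.sp Z, t + S.tm Z) := by fun_prop
      exact this.continuousAt.eventually_mem (hΩ₂.mem_nhds (by simpa using hy))
    have e3 := (show Tendsto (fun Z : V × V => (S.sp Z.1, S.sp Z.2, S.tm Z.1)) (nhds 0) (nhds 0) by
      have : Continuous fun Z : V × V => (S.sp Z.1, S.sp Z.2, S.tm Z.1) := by fun_prop
      have := this.tendsto 0
      simp only [Prod.fst_zero, Prod.snd_zero, map_zero] at this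
      exact this).eventually h
    obtain ⟨r1, hr1, h1⟩ := Metric.eventually_nhds_iff.1 e1
    obtain ⟨r2, hr2, h2⟩ := Metric.eventually_nhds_iff.1 e2
    obtain ⟨r3, hr3, h3⟩ := Metric.eventually_nhds_iff.1 e3
    refine ⟨min r1 (min r2 r3) / 2, by positivity, fun Z hZ => h1 ?_, fun Z hZ => h2 ?_,
      fun Z W hZ hW hZW => ?_⟩
    · rw [dist_zero_right]
      have := min_le_left r1 (min r2 r3)
      linarith
    · rw [dist_zero_right]
      have := (min_le_right r1 (min r2 r3)).trans (min_le_left _ _)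
      linarith
    · have := (min_le_right r1 (min r2 r3)).trans (min_le_right _ _)
      have h4 := @h3 (Z, W) (by
        rw [dist_zero_right, Prod.norm_def]
        exact max_lt (by dsimp only; linarith) (by dsimp only; linarith))
      dsimp only at h4
      rw [← hZW]
      exact h4
  obtain ⟨ρ', hρ', hρ'ρ, hρ's, hρ'v⟩ : ∃ ρ' > 0, ρ' < ρ ∧ |C + 4 * ε₀| * (2 * ρ') < δ / 2 ∧
      (‖A₁‖ + ‖A₂‖ + 4 * ε₀) * ρ' < δ / 2 := by
    have : ∀ᶠ r in nhdsWithin (0 : ℝ) (Ioi 0), r < ρ ∧ |C + 4 * ε₀| * (2 * r) < δ / 2 ∧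
      (‖A₁‖ + ‖A₂‖ + 4 * ε₀) * r < δ / 2 := by
      have t1 : Tendsto (fun r : ℝ => |C + 4 * ε₀| * (2 * r)) (nhdsWithin 0 (Ioi 0)) (nhds 0) := by
        have : Continuous fun r : ℝ => |C + 4 * ε₀| * (2 * r) := by fun_prop
        simpa using (this.tendsto 0).mono_left nhdsWithin_le_nhds
      have t2 : Tendsto (fun r : ℝ => (‖A₁‖ + ‖A₂‖ + 4 * ε₀) * r) (nhdsWithin 0 (Ioi 0))
          (nhds 0) := by
        have : Continuous fun r : ℝ => (‖A₁‖ + ‖A₂‖ + 4 * ε₀) * r := by fun_prop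
        simpa using (this.tendsto 0).mono_left nhdsWithin_le_nhds
      filter_upwards [t1.eventually_lt_const (half_pos hδ), t2.eventually_lt_const (half_pos hδ),
        nhdsWithin_le_nhds (Iio_mem_nhds hρ)] with r h1 h2 h3 using ⟨h3, h1, h2⟩
    obtain ⟨r, h1, h2⟩ := (this.and self_mem_nhdsWithin).exists
    exact ⟨r, h2, h1⟩
  have htm : ∀ Z : V, |S.tm Z| ≤ ‖Z‖ := fun Z => by
    refine abs_le_of_sq_le_sq ?_ (norm_nonneg _)
    rw [S.norm_sq]; nlinarith [sq_nonneg ‖S.sp Z‖]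
  have hsp : ∀ Z : V, ‖S.sp Z‖ ≤ ‖Z‖ := fun Z => by
    rw [← sq_le_sq₀ (norm_nonneg _) (norm_nonneg _), S.norm_sq]; nlinarith [sq_nonneg (S.tm Z)]
  let P : V → V → ℝ := fun Z W => τ / 2 * (S.tm Z + S.tm W) + inner ℝ ξ₁ (S.sp Z) +
    inner ℝ ξ₂ (S.sp W) + 1 / 2 * q (S.sp Z, S.sp W) + (C / 2 + 2 * ε₀) * (S.tm Z ^ 2 + S.tm W ^ 2)
    + 2 * ε₀ * (‖S.sp Z‖ ^ 2 + ‖S.sp W‖ ^ 2)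
  let K : Set (V × V) := (closedBall 0 ρ) \ ball 0 ρ'
  let F : V × V → ℝ := fun k => u₁ (x + S.sp k.1) (t + S.tm k.1) + u₂ (y + S.sp k.2) (t + S.tm k.2)
    - P k.1 k.2
  have hq0 : q 0 = 0 := by simp [hA]
  have hF0 : F 0 = u₁ x t + u₂ y t := by
    have : q (0, 0) = 0 := hq0
    simp [F, P, this]
  have hqc : Continuous q := by
    have : q = fun z => inner ℝ (A₁ z) z.1 + inner ℝ (A₂ z) z.2 := funext hA
    rw [this]; fun_prop
  have hmem : ∀ k : V × V, k ∈ closedBall (0 : V × V) ρ ↔ ‖k.1‖ ≤ ρ ∧ ‖k.2‖ ≤ ρ := fun k => by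
    rw [mem_closedBall_zero_iff, Prod.norm_def, max_le_iff]
  have hFc : ContinuousOn F (closedBall 0 ρ) := by
    have c1 : ContinuousOn (fun k : V × V => u₁ (x + S.sp k.1) (t + S.tm k.1)) (closedBall 0 ρ) :=
      hc₁.comp (f := fun k : V × V => (x + S.sp k.1, t + S.tm k.1)) (by fun_prop)
        fun k hk => hρ₁ _ ((hmem k).1 hk).1
    have c2 : ContinuousOn (fun k : V × V => u₂ (y + S.sp k.2) (t + S.tm k.2)) (closedBall 0 ρ) :=
      hc₂.comp (f := fun k : V × V => (y + S.sp k.2, t + S.tm k.2)) (by fun_prop)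
        fun k hk => hρ₂ _ ((hmem k).1 hk).2
    have c3 : Continuous fun k : V × V => P k.1 k.2 := by
      have : Continuous fun k : V × V => q (S.sp k.1, S.sp k.2) := hqc.comp (by fun_prop)
      simp only [P]; fun_prop
    exact (c1.add c2).sub c3.continuousOn
  have hKc : IsCompact (closedBall (0 : V × V) ρ) := isCompact_closedBall _ _
  obtain ⟨j, hj⟩ := exists_penalization (K := K) (F := F)
    (g := fun k => 1 / 2 * (S.tm k.1 - S.tm k.2) ^ 2) (c := F 0)
    (hKc.diff isOpen_ball) (hFc.mono sdiff_subset) (by fun_prop) (fun k _ => by positivity) (by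
      intro k hk h0
      have h1 : S.tm k.1 = S.tm k.2 := by
        have : (S.tm k.1 - S.tm k.2) ^ 2 = 0 := by linarith
        exact sub_eq_zero.1 (pow_eq_zero_iff two_ne_zero |>.1 this)
      obtain ⟨hk1, hk2⟩ := (hmem k).1 hk.1
      have h2 := hρh k.1 k.2 hk1 hk2 h1
      have h3 : 0 < ‖k.1‖ ^ 2 + ‖k.2‖ ^ 2 := by
        have : ρ' ≤ ‖k‖ := by simpa using hk.2
        rw [Prod.norm_def, le_max_iff] at this
        rcases this with h | h
        · have : 0 < ‖k.1‖ := by linarith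
          positivity
        · have : 0 < ‖k.2‖ := by linarith
          positivity
      rw [S.norm_sq, S.norm_sq] at h3
      rw [hF0]
      simp only [F, P]
      rw [← h1] at h3 h2 ⊢
      nlinarith)
  -- interior maximum
  let g : V × V → ℝ := fun k => 1 / 2 * (S.tm k.1 - S.tm k.2) ^ 2
  obtain ⟨k₀, hk₀, hmax⟩ := hKc.exists_isMaxOn ⟨0, mem_closedBall_self hρ.le⟩
    (f := fun k => F k - j * g k) (hFc.sub (by fun_prop))
  have hk₀' : ‖k₀‖ < ρ' := by
    by_contra! hcon
    have h1 := hj k₀ ⟨hk₀, by simpa using hcon⟩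
    have h2 : F 0 - j * g 0 ≤ F k₀ - j * g k₀ := hmax (mem_closedBall_self hρ.le)
    simp only [g] at h2
    simp at h2 h1
    linarith
  obtain ⟨Z₀, W₀⟩ := k₀
  rw [Prod.norm_def, max_lt_iff] at hk₀'
  obtain ⟨hZ₀, hW₀⟩ := hk₀'
  dsimp only at hZ₀ hW₀
  set ξ₁' := ξ₁ + A₁ (S.sp Z₀, S.sp W₀) + (4 * ε₀) • S.sp Z₀ with hξ₁'
  set ξ₂' := ξ₂ + A₂ (S.sp Z₀, S.sp W₀) + (4 * ε₀) • S.sp W₀ with hξ₂'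
  set τ₁ := τ / 2 + (C + 4 * ε₀) * S.tm Z₀ + j * (S.tm Z₀ - S.tm W₀) with hτ₁
  set τ₂ := τ / 2 + (C + 4 * ε₀) * S.tm W₀ - j * (S.tm Z₀ - S.tm W₀) with hτ₂
  let U₁ : V → ℝ := fun z => u₁ (x + S.sp (Z₀ + z)) (t + S.tm (Z₀ + z)) - τ₁ * S.tm z -
    inner ℝ ξ₁' (S.sp z)
  let U₂ : V → ℝ := fun z => u₂ (y + S.sp (W₀ + z)) (t + S.tm (W₀ + z)) - τ₂ * S.tm z -
    inner ℝ ξ₂' (S.sp z)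
  let Q : V × V → ℝ := fun k => q (S.sp k.1, S.sp k.2) + (C + 4 * ε₀) * (S.tm k.1 ^ 2 + S.tm k.2 ^ 2)
    + 4 * ε₀ * (‖S.sp k.1‖ ^ 2 + ‖S.sp k.2‖ ^ 2) + j * (S.tm k.1 - S.tm k.2) ^ 2
    + 2 * ε₀ * (‖k.1‖ ^ 2 + ‖k.2‖ ^ 2)
  have hQ : IsQuad Q := by
    have l1 : V × V →ₗ[ℝ] V := LinearMap.fst ℝ V V
    have a1 := hq.comp ((S.sp.toLinearMap ∘ₗ LinearMap.fst ℝ V V).prod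
      (S.sp.toLinearMap ∘ₗ LinearMap.snd ℝ V V))
    have a2 := isQuad_sq (S.tm.toLinearMap ∘ₗ LinearMap.fst ℝ V V)
    have a3 := isQuad_sq (S.tm.toLinearMap ∘ₗ LinearMap.snd ℝ V V)
    have a4 := isQuad_norm_sq (S.sp.toLinearMap ∘ₗ LinearMap.fst ℝ V V)
    have a5 := isQuad_norm_sq (S.sp.toLinearMap ∘ₗ LinearMap.snd ℝ V V)
    have a6 := isQuad_sq (S.tm.toLinearMap ∘ₗ LinearMap.fst ℝ V V -
      S.tm.toLinearMap ∘ₗ LinearMap.snd ℝ V V)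
    have a7 := isQuad_norm_sq (LinearMap.fst ℝ V V)
    have a8 := isQuad_norm_sq (LinearMap.snd ℝ V V)
    exact (((a1.add ((a2.add a3).const_mul (C + 4 * ε₀))).add
      ((a4.add a5).const_mul (4 * ε₀))).add (a6.const_mul j)).add
      ((a7.add a8).const_mul (2 * ε₀))
  have hball : ∀ (Z₀ z : V), ‖Z₀‖ < ρ' → ‖z‖ ≤ ρ - ρ' → ‖Z₀ + z‖ ≤ ρ := fun Z₀ z h0 hz =>
    (norm_add_le _ _).trans (by linarith)
  have hU₁c : ContinuousOn U₁ (closedBall 0 (ρ - ρ')) := by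
    have c1 : ContinuousOn (fun z : V => u₁ (x + S.sp (Z₀ + z)) (t + S.tm (Z₀ + z)))
        (closedBall 0 (ρ - ρ')) :=
      hc₁.comp (f := fun z : V => (x + S.sp (Z₀ + z), t + S.tm (Z₀ + z))) (by fun_prop)
        fun z hz => hρ₁ _ (hball _ _ hZ₀ (by simpa using hz))
    exact (c1.sub (by fun_prop)).sub (by fun_prop)
  have hU₂c : ContinuousOn U₂ (closedBall 0 (ρ - ρ')) := by
    have c1 : ContinuousOn (fun z : V => u₂ (y + S.sp (W₀ + z)) (t + S.tm (W₀ + z)))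
        (closedBall 0 (ρ - ρ')) :=
      hc₂.comp (f := fun z : V => (y + S.sp (W₀ + z), t + S.tm (W₀ + z))) (by fun_prop)
        fun z hz => hρ₂ _ (hball _ _ hW₀ (by simpa using hz))
    exact (c1.sub (by fun_prop)).sub (by fun_prop)
  have hr : 0 < min (ρ - ρ') (δ / 4) := lt_min (by linarith) (by positivity)
  have hns : ∀ a b : Euc n, ‖a + b‖ ^ 2 = ‖a‖ ^ 2 + 2 * inner ℝ a b + ‖b‖ ^ 2 :=
    fun a b => norm_add_sq_real a b
  obtain ⟨z, w, p, p', X, Y, hz, hw, hp, hp', hX, hY, hXY⟩ := theorem_on_sums (r := ρ - ρ')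
    (by linarith) hε₀' hU₁c hU₂c hQ (by
      intro z w hz hw
      have h1 := hmax ((hmem (Z₀ + z, W₀ + w)).2 ⟨hball _ _ hZ₀ hz, hball _ _ hW₀ hw⟩)
      have h2 := hAq (S.sp Z₀, S.sp W₀) (S.sp z, S.sp w)
      simp only [Prod.mk_add_mk] at h2
      rw [mem_ofPred_eq] at h1
      simp only [F, P, g, map_add, h2, hns] at h1
      simp only [U₁, U₂, Q, map_add, map_zero, hξ₁', hξ₂', inner_add_left, inner_smul_left,
        inner_add_right, RCLike.conj_to_real, inner_zero_right, add_zero, hτ₁, hτ₂] at h1 ⊢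
      linarith) hr
  obtain ⟨hz1, hz2⟩ := lt_min_iff.1 hz
  obtain ⟨hw1, hw2⟩ := lt_min_iff.1 hw
  obtain ⟨hp1, hp2⟩ := lt_min_iff.1 hp
  obtain ⟨hp1', hp2'⟩ := lt_min_iff.1 hp'
  have hv : ∀ (A : Euc n × Euc n →L[ℝ] Euc n), ‖A‖ ≤ ‖A₁‖ + ‖A₂‖ → ∀ Z p : V, ‖Z‖ < ρ' →
      ‖p‖ < δ / 4 → ‖A (S.sp Z₀, S.sp W₀) + (4 * ε₀) • S.sp Z + S.sp p‖ < δ := by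
    intro A hA Z p hZ hp
    have n1 : ‖A (S.sp Z₀, S.sp W₀)‖ ≤ (‖A₁‖ + ‖A₂‖) * ρ' :=
      (A.le_opNorm _).trans (mul_le_mul hA (by
        rw [Prod.norm_def]
        exact max_le ((hsp _).trans hZ₀.le) ((hsp _).trans hW₀.le)) (norm_nonneg _) (by positivity))
    have n2 : ‖(4 * ε₀) • S.sp Z‖ ≤ 4 * ε₀ * ρ' := by
      rw [norm_smul, Real.norm_of_nonneg (by positivity)]
      gcongr
      exact (hsp _).trans hZ.le
    have n3 := hsp p
    have := norm_add₃_le (a := A (S.sp Z₀, S.sp W₀)) (b := (4 * ε₀) • S.sp Z) (c := S.sp p)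
    linarith
  have hv₁ := hv A₁ (by linarith [norm_nonneg A₂]) Z₀ p hZ₀ hp2
  have hv₂ := hv A₂ (by linarith [norm_nonneg A₁]) W₀ p' hW₀ hp2'
  have hJ : ∀ (P a : V), inner ℝ P a = inner ℝ (S.sp P) (S.sp a) + S.tm P * S.tm a := S.inner_eq
  have j₁ := hu₁.of_jet S (x := x + S.sp (Z₀ + z)) (t := t + S.tm (Z₀ + z))
    (hρ₁ _ (hball _ _ hZ₀ hz1.le)) (hδ₁ _ hv₁) (τ := τ₁ + S.tm p) (X := X) (fun η hη => by
      filter_upwards [hX η hη] with a ha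
      simp only [U₁, ← add_assoc, hJ p, map_add, hξ₁', inner_add_left,
        inner_add_right] at ha ⊢
      linarith)
  have j₂ := hu₂.of_jet S (x := y + S.sp (W₀ + w)) (t := t + S.tm (W₀ + w))
    (hρ₂ _ (hball _ _ hW₀ hw1.le)) (hδ₂ _ hv₂) (τ := τ₂ + S.tm p') (X := Y) (fun η hη => by
      filter_upwards [hY η hη] with a ha
      simp only [U₂, ← add_assoc, hJ p', map_add, hξ₂', inner_add_left,
        inner_add_right] at ha ⊢
      linarith)
  rw [VisSub.trQ_rotate S Y _ R] at j₂
  refine ⟨6 * ε₀, -((C + 4 * ε₀) * (S.tm Z₀ + S.tm W₀) + S.tm p + S.tm p'), _, _, ?_, ?_,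
    hv₁, hv₂, ?_⟩
  · rw [abs_of_pos (by positivity), hε₀]; linarith
  · rw [abs_neg]
    have n1 : |(C + 4 * ε₀) * (S.tm Z₀ + S.tm W₀)| ≤ |C + 4 * ε₀| * (2 * ρ') := by
      rw [abs_mul]
      gcongr
      have := abs_add_le (S.tm Z₀) (S.tm W₀)
      have := htm Z₀
      have := htm W₀
      linarith
    have := htm p
    have := htm p'
    have := abs_add_three ((C + 4 * ε₀) * (S.tm Z₀ + S.tm W₀)) (S.tm p) (S.tm p')
    linarith
  · have hsum : (∑ i, inner ℝ (X (S.inc (σ₁ (ξ₁ + (A₁ (S.sp Z₀, S.sp W₀) + (4 * ε₀) • S.sp Z₀ +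
        S.sp p)) (stdb n i)))) (S.inc (σ₁ (ξ₁ + (A₁ (S.sp Z₀, S.sp W₀) + (4 * ε₀) • S.sp Z₀ +
        S.sp p)) (stdb n i)))) +
        (∑ i, inner ℝ (Y (S.inc (σ₂ (ξ₂ + (A₂ (S.sp Z₀, S.sp W₀) + (4 * ε₀) • S.sp W₀ +
        S.sp p')) (R (stdb n i))))) (S.inc (σ₂ (ξ₂ + (A₂ (S.sp Z₀, S.sp W₀) +
        (4 * ε₀) • S.sp W₀ + S.sp p')) (R (stdb n i))))) ≤
        ∑ i, q (σ₁ (ξ₁ + (A₁ (S.sp Z₀, S.sp W₀) + (4 * ε₀) • S.sp Z₀ +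
        S.sp p)) (stdb n i), σ₂ (ξ₂ + (A₂ (S.sp Z₀, S.sp W₀) + (4 * ε₀) • S.sp W₀ +
        S.sp p')) (R (stdb n i))) + 6 * ε₀ * ∑ i, (‖σ₁ (ξ₁ + (A₁ (S.sp Z₀, S.sp W₀) +
        (4 * ε₀) • S.sp Z₀ + S.sp p)) (stdb n i)‖ ^ 2 + ‖σ₂ (ξ₂ + (A₂ (S.sp Z₀, S.sp W₀) +
        (4 * ε₀) • S.sp W₀ + S.sp p')) (R (stdb n i))‖ ^ 2) := by
      rw [← Finset.sum_add_distrib, Finset.mul_sum, ← Finset.sum_add_distrib]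
      refine Finset.sum_le_sum fun i _ => (hXY _ _).trans (le_of_eq ?_)
      simp only [Q, S.norm_sq, S.sp_inc, S.tm_inc]
      ring
    linarith

end TwoPointMax

section TwoPointThm

variable {n : ℕ}

lemma IsQuad.continuous {q : Euc n × Euc n → ℝ} (hq : IsQuad q) : Continuous q := by
  obtain ⟨A₁, A₂, hA, -⟩ := hq.exists_expansion
  have : q = fun z => inner ℝ (A₁ z) z.1 + inner ℝ (A₂ z) z.2 := funext hA
  rw [this]; fun_prop

/-- The parabolic two-point maximum principle. -/
theorem two_point {σ₁ σ₂ : Euc n → Euc n →L[ℝ] Euc n} {G₁ G₂ : Set (Euc n)}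
    {M₁ M₂ : ℝ} {Ω₁ Ω₂ : Set (Euc n × ℝ)} {u₁ u₂ : Euc n → ℝ → ℝ}
    (hu₁ : VisSub σ₁ G₁ M₁ Ω₁ u₁) (hu₂ : VisSub σ₂ G₂ M₂ Ω₂ u₂)
    (hΩ₁ : IsOpen Ω₁) (hΩ₂ : IsOpen Ω₂) (hG₁ : IsOpen G₁) (hG₂ : IsOpen G₂)
    (hc₁ : ContinuousOn (fun z : Euc n × ℝ => u₁ z.1 z.2) Ω₁)
    (hc₂ : ContinuousOn (fun z : Euc n × ℝ => u₂ z.1 z.2) Ω₂)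
    {x y : Euc n} {t : ℝ} (hx : (x, t) ∈ Ω₁) (hy : (y, t) ∈ Ω₂) {ξ₁ ξ₂ : Euc n}
    (hξ₁ : ξ₁ ∈ G₁) (hξ₂ : ξ₂ ∈ G₂) (hσ₁ : ContinuousAt σ₁ ξ₁) (hσ₂ : ContinuousAt σ₂ ξ₂)
    {τ C : ℝ} {q : Euc n × Euc n → ℝ} (hq : IsQuad q)
    (h : ∀ᶠ w in nhds (0 : Euc n × Euc n × ℝ),
      u₁ (x + w.1) (t + w.2.2) + u₂ (y + w.2.1) (t + w.2.2) ≤ u₁ x t + u₂ y t + τ * w.2.2 +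
        C * w.2.2 ^ 2 + inner ℝ ξ₁ w.1 + inner ℝ ξ₂ w.2.1 + 1 / 2 * q (w.1, w.2.1))
    (R : Euc n ≃ₗᵢ[ℝ] Euc n) :
    τ ≤ ∑ i, q (σ₁ ξ₁ (stdb n i), σ₂ ξ₂ (R (stdb n i))) + M₁ + M₂ := by
  obtain ⟨S⟩ := exists_timeSplit (Euc n)
  have happ := fun δ (hδ : 0 < δ) => two_point_approx S hu₁ hu₂ hΩ₁ hΩ₂ hG₁ hG₂ hc₁ hc₂ hx hy hξ₁ hξ₂
    hq h R (δ := δ) hδ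
  let Φ : (ℝ × ℝ) × Euc n × Euc n → ℝ := fun k =>
    ∑ i, q (σ₁ (ξ₁ + k.2.1) (stdb n i), σ₂ (ξ₂ + k.2.2) (R (stdb n i))) +
        k.1.1 * ∑ i, (‖σ₁ (ξ₁ + k.2.1) (stdb n i)‖ ^ 2 + ‖σ₂ (ξ₂ + k.2.2) (R (stdb n i))‖ ^ 2) +
        M₁ + M₂ + k.1.2
  have t₁ : ∀ v, Tendsto (fun k : (ℝ × ℝ) × Euc n × Euc n => σ₁ (ξ₁ + k.2.1) v) (nhds 0)
      (nhds (σ₁ ξ₁ v)) := fun v => by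
    have h1 : Tendsto (fun k : (ℝ × ℝ) × Euc n × Euc n => ξ₁ + k.2.1) (nhds 0) (nhds ξ₁) := by
      have : Continuous fun k : (ℝ × ℝ) × Euc n × Euc n => ξ₁ + k.2.1 := by fun_prop
      simpa using this.tendsto 0
    exact ((ContinuousLinearMap.apply ℝ (Euc n) v).continuous.tendsto _).comp (hσ₁.tendsto.comp h1)
  have t₂ : ∀ v, Tendsto (fun k : (ℝ × ℝ) × Euc n × Euc n => σ₂ (ξ₂ + k.2.2) v) (nhds 0)
      (nhds (σ₂ ξ₂ v)) := fun v => by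
    have h1 : Tendsto (fun k : (ℝ × ℝ) × Euc n × Euc n => ξ₂ + k.2.2) (nhds 0) (nhds ξ₂) := by
      have : Continuous fun k : (ℝ × ℝ) × Euc n × Euc n => ξ₂ + k.2.2 := by fun_prop
      simpa using this.tendsto 0
    exact ((ContinuousLinearMap.apply ℝ (Euc n) v).continuous.tendsto _).comp (hσ₂.tendsto.comp h1)
  have t₃ : Tendsto (fun k : (ℝ × ℝ) × Euc n × Euc n => k.1.1) (nhds 0) (nhds 0) :=
    (show Continuous fun k : (ℝ × ℝ) × Euc n × Euc n => k.1.1 by fun_prop).tendsto 0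
  have t₄ : Tendsto (fun k : (ℝ × ℝ) × Euc n × Euc n => k.1.2) (nhds 0) (nhds 0) :=
    (show Continuous fun k : (ℝ × ℝ) × Euc n × Euc n => k.1.2 by fun_prop).tendsto 0
  have hΦ : Tendsto Φ (nhds 0) (nhds (∑ i, q (σ₁ ξ₁ (stdb n i), σ₂ ξ₂ (R (stdb n i))) +
      0 * ∑ i, (‖σ₁ ξ₁ (stdb n i)‖ ^ 2 + ‖σ₂ ξ₂ (R (stdb n i))‖ ^ 2) + M₁ + M₂ + 0)) := by
    refine Tendsto.add (Tendsto.add (Tendsto.add (Tendsto.add ?_ (t₃.mul ?_)) tendsto_const_nhds)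
      tendsto_const_nhds) t₄
    · exact tendsto_finsetSum _ fun i _ => (hq.continuous.tendsto _).comp
        ((t₁ _).prodMk_nhds (t₂ _))
    · exact tendsto_finsetSum _ fun i _ => ((t₁ _).norm.pow 2).add ((t₂ _).norm.pow 2)
  have hf : ∃ᶠ k in nhds (0 : (ℝ × ℝ) × Euc n × Euc n), τ ≤ Φ k := by
    rw [Metric.nhds_basis_ball.frequently_iff]
    intro δ hδ
    obtain ⟨e, r, v₁, v₂, h1, h2, h3, h4, h5⟩ := happ δ hδ
    exact ⟨((e, r), v₁, v₂), by simp [Prod.norm_def, h1, h2, h3, h4], h5⟩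
  have := ge_of_tendsto_of_frequently hΦ hf
  linarith

end TwoPointThm

section Coupling

variable {n : ℕ}

/-- Continuous viscosity solutions tested by quadratic polynomials with gradient in `G`. -/
structure VisSol (σ : Euc n → Euc n →L[ℝ] Euc n) (G : Set (Euc n)) (M : ℝ) (Ω : Set (Euc n × ℝ))
    (u : Euc n → ℝ → ℝ) : Prop where
  sub : VisSub σ G M Ω u
  super : VisSub (fun ξ => σ (-ξ)) {ξ | -ξ ∈ G} M Ω fun x t => -u x t
  cont : ContinuousOn (fun z : Euc n × ℝ => u z.1 z.2) Ω

lemma radial_expansion_scalar {s m κ η D i x : ℝ} (hs : 0 < s) (hm : 0 ≤ m) (hD0 : 0 ≤ D)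
    (hi1 : |i| ≤ D) (hd2 : D < s / 2) (hd3 : D * (2 * (m / s ^ 2 + 3 * |κ| / s + 1)) ≤ η)
    (hx0 : 0 ≤ x) (hN : x ^ 2 = (s + i) ^ 2 + (D ^ 2 - i ^ 2)) (hxs : |x - s| ≤ D) :
    m * (x - s) + κ / 2 * (x - s) ^ 2 ≤ m * i +
      1 / 2 * (m / s * (D ^ 2 - i ^ 2) + κ * i ^ 2 + η * D ^ 2) := by
  have hi2 : i ^ 2 ≤ D ^ 2 := by rw [← sq_abs]; gcongr
  have hsi : s / 2 < s + i := by have := neg_abs_le i; linarith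
  have hxl : s + i ≤ x := by
    rw [← sq_le_sq₀ (by linarith) hx0, hN]; linarith
  have hxu : x - (s + i) ≤ (D ^ 2 - i ^ 2) / (2 * (s + i)) := by
    rw [le_div_iff₀ (by linarith)]; nlinarith
  have hxu2 : x - (s + i) ≤ (D ^ 2 - i ^ 2) / (2 * s) + D ^ 3 / s ^ 2 := by
    refine hxu.trans ?_
    have e1 : (D ^ 2 - i ^ 2) / (2 * (s + i)) = (D ^ 2 - i ^ 2) / (2 * s) +
        (D ^ 2 - i ^ 2) * (-i) / (2 * s * (s + i)) := by
      have : s + i ≠ 0 := by linarith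
      field_simp; ring
    rw [e1]
    have e2 : (D ^ 2 - i ^ 2) * (-i) / (2 * s * (s + i)) ≤ D ^ 3 / s ^ 2 := by
      have h5 : (D ^ 2 - i ^ 2) * (-i) ≤ D ^ 3 := by
        have h6 := neg_abs_le i
        have : -i ≤ D := by linarith
        calc (D ^ 2 - i ^ 2) * (-i) ≤ (D ^ 2 - i ^ 2) * D := by gcongr
          _ ≤ D ^ 2 * D := by gcongr; nlinarith
          _ = D ^ 3 := by ring
      have h6 : s ^ 2 ≤ 2 * s * (s + i) := by nlinarith
      have h7 : 0 ≤ D ^ 3 := by positivity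
      exact div_le_div₀ h7 h5 (by positivity) h6
    linarith
  have hsq : |(x - s) ^ 2 - i ^ 2| ≤ 3 * D * (D ^ 2 / s) := by
    have e1 : (x - s) ^ 2 - i ^ 2 = (x - s - i) * (x - s + i) := by ring
    rw [e1, abs_mul, mul_comm]
    have h5 : |x - s + i| ≤ 3 * D := (abs_add_le _ _).trans (by linarith)
    have h6 : |x - s - i| ≤ D ^ 2 / s := by
      rw [abs_of_nonneg (by linarith)]
      have : (D ^ 2 - i ^ 2) / (2 * (s + i)) ≤ D ^ 2 / s :=
        div_le_div₀ (sq_nonneg D) (by linarith [sq_nonneg i]) hs (by linarith)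
      linarith
    gcongr
  have hκ : κ / 2 * (x - s) ^ 2 ≤ κ / 2 * i ^ 2 + |κ| / 2 * (3 * D * (D ^ 2 / s)) := by
    have : κ / 2 * ((x - s) ^ 2 - i ^ 2) ≤ |κ| / 2 * (3 * D * (D ^ 2 / s)) := by
      refine (le_abs_self _).trans ?_
      rw [abs_mul, abs_div, abs_two]
      gcongr
    linarith
  have hm2 : m * (x - s) ≤ m * i + m * ((D ^ 2 - i ^ 2) / (2 * s) + D ^ 3 / s ^ 2) := by
    have := mul_le_mul_of_nonneg_left hxu2 hm
    linarith
  have hfin : m * (D ^ 3 / s ^ 2) + |κ| / 2 * (3 * D * (D ^ 2 / s)) ≤ η / 2 * D ^ 2 := by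
    have e1 : m * (D ^ 3 / s ^ 2) + |κ| / 2 * (3 * D * (D ^ 2 / s)) =
        D ^ 2 * (D * (m / s ^ 2 + 3 * |κ| / s / 2)) := by ring
    rw [e1, mul_comm (η / 2)]
    refine mul_le_mul_of_nonneg_left ?_ (sq_nonneg D)
    have h9 : 0 ≤ D * (3 * |κ| / s) := by positivity
    linarith
  have e3 : m * ((D ^ 2 - i ^ 2) / (2 * s) + D ^ 3 / s ^ 2) =
      1 / 2 * (m / s * (D ^ 2 - i ^ 2)) + m * (D ^ 3 / s ^ 2) := by field_simp
  rw [e3] at hm2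
  linarith

/-- Second order upper expansion of `φ |z|`. -/
lemma radial_expansion {φ : ℝ → ℝ} {s m κ : ℝ} (hs : 0 < s) (hm : 0 ≤ m)
    (hφ : ∀ᶠ s' in nhds s, φ s' ≤ φ s + m * (s' - s) + κ / 2 * (s' - s) ^ 2)
    {e z : Euc n} (he : ‖e‖ = 1) (hz : z = s • e) {η : ℝ} (hη : 0 < η) :
    ∀ᶠ d in nhds (0 : Euc n), φ ‖z + d‖ ≤ φ s + m * inner ℝ e d +
      1 / 2 * (m / s * (‖d‖ ^ 2 - inner ℝ e d ^ 2) + κ * inner ℝ e d ^ 2 + η * ‖d‖ ^ 2) := by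
  have hzs : ‖z‖ = s := by rw [hz, norm_smul, he, mul_one, Real.norm_of_nonneg hs.le]
  have hcont : Tendsto (fun d : Euc n => ‖z + d‖) (nhds 0) (nhds s) := by
    have : Continuous fun d : Euc n => ‖z + d‖ := by fun_prop
    simpa [hzs] using this.tendsto 0
  have hd1 : ∀ A > 0, ∀ᶠ d in nhds (0 : Euc n), ‖d‖ < A := fun A hA => by
    filter_upwards [ball_mem_nhds (0 : Euc n) hA] with d hd
    simpa using hd
  set A : ℝ := min (s / 2) (η / (2 * (m / s ^ 2 + 3 * |κ| / s + 1))) with hA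
  have hden : 0 < 2 * (m / s ^ 2 + 3 * |κ| / s + 1) := by positivity
  have hApos : 0 < A := by positivity
  filter_upwards [hcont.eventually hφ, hd1 A hApos] with d h1 h2
  refine h1.trans ?_
  have hd2 : ‖d‖ < s / 2 := h2.trans_le (min_le_left _ _)
  have hd3 : ‖d‖ * (2 * (m / s ^ 2 + 3 * |κ| / s + 1)) ≤ η := by
    rw [← le_div_iff₀ hden]; exact h2.le.trans (min_le_right _ _)
  set i : ℝ := inner ℝ e d with hi
  have hi1 : |i| ≤ ‖d‖ := by simpa [he] using abs_real_inner_le_norm e d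
  have hN : ‖z + d‖ ^ 2 = (s + i) ^ 2 + (‖d‖ ^ 2 - i ^ 2) := by
    rw [norm_add_sq_real, hzs, hz, inner_smul_left]; simp [hi]; ring
  have hxs : |‖z + d‖ - s| ≤ ‖d‖ := by
    have := abs_norm_sub_norm_le (z + d) z
    simpa [hzs] using this
  have := radial_expansion_scalar hs hm (norm_nonneg d) hi1 hd2 hd3 (norm_nonneg _) hN hxs (κ := κ)
  linarith

/-- The algebra of reflection coupling. -/
lemma exists_reflection {σ₁ σ₂ : Euc n →L[ℝ] Euc n} {e : Euc n} (he : ‖e‖ = 1) {c₀ Δ : ℝ}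
    (hc : 0 < c₀) (hσ : ∀ v, c₀ * ‖v‖ ≤ ‖σ₂ v‖) (hΔ : ‖σ₁ - σ₂‖ ≤ Δ) (hΔc : Δ ≤ c₀) :
    ∃ R : Euc n ≃ₗᵢ[ℝ] Euc n,
      (∀ i, ‖σ₁ (stdb n i) - σ₂ (R (stdb n i))‖ ^ 2 -
        inner ℝ e (σ₁ (stdb n i) - σ₂ (R (stdb n i))) ^ 2 ≤ Δ ^ 2) ∧
      c₀ ^ 2 ≤ ∑ i, inner ℝ e (σ₁ (stdb n i) - σ₂ (R (stdb n i))) ^ 2 := by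
  have hinj : Function.Injective (σ₂ : Euc n →ₗ[ℝ] Euc n) := by
    rw [injective_iff_map_eq_zero]
    intro v hv
    have := hσ v
    have h0 : σ₂ v = 0 := hv
    rw [h0, norm_zero] at this
    have : ‖v‖ ≤ 0 := by nlinarith [norm_nonneg v]
    exact norm_le_zero_iff.1 this
  obtain ⟨ν₀, hν₀⟩ := LinearMap.surjective_of_injective hinj e
  have hν₀' : σ₂ ν₀ = e := hν₀
  have hν₀n : ν₀ ≠ 0 := by
    rintro rfl
    rw [map_zero] at hν₀'
    rw [← hν₀', norm_zero] at he
    exact zero_ne_one he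
  set l : ℝ := ‖ν₀‖⁻¹ with hl
  have hl0 : 0 < l := by positivity
  set ν : Euc n := l • ν₀ with hν
  have hν1 : ‖ν‖ = 1 := by rw [hν, norm_smul, Real.norm_of_nonneg hl0.le]; simp [hl, hν₀n]
  have hσν : σ₂ ν = l • e := by rw [hν, map_smul, hν₀']
  have hlc : c₀ ≤ l := by
    have := hσ ν
    rwa [hσν, hν1, norm_smul, he, Real.norm_of_nonneg hl0.le, mul_one, mul_one] at this
  let R : Euc n ≃ₗᵢ[ℝ] Euc n := (Submodule.span ℝ {ν})ᗮ.reflection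
  have hR : ∀ v, R v = v - (2 * inner ℝ ν v) • ν := fun v => by
    simp only [R]
    rw [Submodule.reflection_orthogonal_apply, Submodule.reflection_singleton_apply]
    simp only [hν1]
    simp [two_smul, two_mul, add_smul]
  have hd : ∀ v, σ₁ v - σ₂ (R v) = (σ₁ - σ₂) v + (2 * inner ℝ ν v * l) • e := fun v => by
    rw [hR, map_sub, map_smul, hσν, smul_smul, sub_apply]; abel
  have hee : inner ℝ e e = (1 : ℝ) := by rw [real_inner_self_eq_norm_sq, he]; norm_num
  have hΔ0 : 0 ≤ Δ := (norm_nonneg _).trans hΔ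
  refine ⟨R, fun i => ?_, ?_⟩
  · rw [hd]
    set a := (σ₁ - σ₂) (stdb n i)
    set k := 2 * inner ℝ ν (stdb n i) * l
    have h1 : ‖a + k • e‖ ^ 2 - inner ℝ e (a + k • e) ^ 2 = ‖a‖ ^ 2 - inner ℝ e a ^ 2 := by
      rw [norm_add_sq_real, inner_add_right, inner_smul_right, inner_smul_right, norm_smul, he, hee,
        real_inner_comm a e, Real.norm_eq_abs, mul_one, sq_abs]
      ring
    rw [h1]
    have h2 : ‖a‖ ≤ Δ := by
      have := (σ₁ - σ₂).le_of_opNorm_le hΔ (stdb n i)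
      rwa [(stdb n).norm_eq_one, mul_one] at this
    nlinarith [norm_nonneg a, sq_nonneg (inner ℝ e a : ℝ)]
  · set T := ContinuousLinearMap.adjoint (σ₁ - σ₂) with hT
    have h1 : ∀ v, inner ℝ e (σ₁ v - σ₂ (R v)) = inner ℝ (T e + (2 * l) • ν) v := fun v => by
      rw [hd, inner_add_right, inner_smul_right, hee, inner_add_left, inner_smul_left ν v (2 * l), hT,
        ContinuousLinearMap.adjoint_inner_left, RCLike.conj_to_real]
      ring
    simp only [h1]
    have h2 : ∑ i, inner ℝ (T e + (2 * l) • ν) (stdb n i) ^ 2 = ‖T e + (2 * l) • ν‖ ^ 2 := by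
      have := (stdb n).sum_sq_norm_inner_left (T e + (2 * l) • ν)
      simpa using this
    rw [h2]
    have h3 : ‖T e‖ ≤ Δ := by
      have h4 : ‖T‖ ≤ Δ := by rw [hT, LinearIsometryEquiv.norm_map]; exact hΔ
      have := T.le_of_opNorm_le h4 e
      rwa [he, mul_one] at this
    have h4 : ‖(2 * l) • ν‖ = 2 * l := by rw [norm_smul, hν1, Real.norm_of_nonneg (by positivity), mul_one]
    have h5 : ‖(2 * l) • ν‖ - ‖T e‖ ≤ ‖T e + (2 * l) • ν‖ := by
      have := norm_sub_le (T e + (2 * l) • ν) (T e)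
      rw [add_sub_cancel_left] at this
      linarith
    have h6 : c₀ ≤ ‖T e + (2 * l) • ν‖ := by linarith
    gcongr

lemma isQuad_coupling (e : Euc n) (a b c d : ℝ) :
    IsQuad fun z : Euc n × Euc n => a * (‖z.1 - z.2‖ ^ 2 - inner ℝ e (z.1 - z.2) ^ 2) +
      b * inner ℝ e (z.1 - z.2) ^ 2 + c * ‖z.1 - z.2‖ ^ 2 + d * ‖z.1‖ ^ 2 := by
  have a1 := isQuad_norm_sq (LinearMap.fst ℝ (Euc n) (Euc n) - LinearMap.snd ℝ (Euc n) (Euc n))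
  have a2 := isQuad_sq ((innerₛₗ ℝ e : Euc n →ₗ[ℝ] ℝ).comp
    (LinearMap.fst ℝ (Euc n) (Euc n) - LinearMap.snd ℝ (Euc n) (Euc n)))
  have a3 := isQuad_norm_sq (LinearMap.fst ℝ (Euc n) (Euc n))
  exact ((((a1.sub a2).const_mul a).add (a2.const_mul b)).add (a1.const_mul c)).add
    (a3.const_mul d)

/-- Reflection coupling at an interior maximum of the doubled function. -/
theorem reflection_coupling {σ : Euc n → Euc n →L[ℝ] Euc n} {G : Set (Euc n)} {M : ℝ}
    {Ω : Set (Euc n × ℝ)} {u : Euc n → ℝ → ℝ} (hu : VisSol σ G M Ω u) (hΩ : IsOpen Ω)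
    (hG : IsOpen G) {x y x₀ e : Euc n} {t s m κ K τ C c₀ C₀ Δ : ℝ} {φ : ℝ → ℝ}
    (hx : (x, t) ∈ Ω) (hy : (y, t) ∈ Ω) (hs : 0 < s) (he : ‖e‖ = 1) (hxy : x - y = s • e)
    (hm : 0 ≤ m) (hκ : κ ≤ 0) (hK : 0 ≤ K)
    (hξ₁ : m • e + (2 * K) • (x - x₀) ∈ G) (hξ₂ : m • e ∈ G)
    (hσ₁ : ContinuousAt σ (m • e + (2 * K) • (x - x₀))) (hσ₂ : ContinuousAt σ (m • e))
    (hc₀ : 0 < c₀) (hel : ∀ v, c₀ * ‖v‖ ≤ ‖σ (m • e) v‖)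
    (hel' : ∀ v, ‖σ (m • e + (2 * K) • (x - x₀)) v‖ ≤ C₀ * ‖v‖)
    (hΔ : ‖σ (m • e + (2 * K) • (x - x₀)) - σ (m • e)‖ ≤ Δ) (hΔc : Δ ≤ c₀)
    (hφ : ∀ᶠ s' in nhds s, φ s' ≤ φ s + m * (s' - s) + κ / 2 * (s' - s) ^ 2)
    (hmax : ∀ᶠ w in nhds (0 : Euc n × Euc n × ℝ),
      u (x + w.1) (t + w.2.2) - u (y + w.2.1) (t + w.2.2) ≤ u x t - u y t +
        (φ ‖x + w.1 - (y + w.2.1)‖ - φ s) + K * (‖x + w.1 - x₀‖ ^ 2 - ‖x - x₀‖ ^ 2) +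
        τ * w.2.2 + C * w.2.2 ^ 2) :
    τ ≤ c₀ ^ 2 * κ + n * (m / s) * Δ ^ 2 + 2 * K * n * C₀ ^ 2 + 2 * M := by
  set ξ₁ := m • e + (2 * K) • (x - x₀) with hξ₁d
  obtain ⟨R, hR1, hR2⟩ := exists_reflection (σ₁ := σ ξ₁) (σ₂ := σ (m • e)) he hc₀ hel hΔ hΔc
  obtain ⟨Sg, hSg⟩ : ∃ S, S = ∑ i, ‖σ ξ₁ (stdb n i) - σ (m • e) (R (stdb n i))‖ ^ 2 := ⟨_, rfl⟩
  have hSg0 : 0 ≤ Sg := hSg ▸ Finset.sum_nonneg fun i _ => sq_nonneg _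
  have key : ∀ η > 0, τ ≤ c₀ ^ 2 * κ + n * (m / s) * Δ ^ 2 + 2 * K * n * C₀ ^ 2 + 2 * M +
      η * Sg := by
    intro η hη
    let q : Euc n × Euc n → ℝ := fun z => m / s * (‖z.1 - z.2‖ ^ 2 - inner ℝ e (z.1 - z.2) ^ 2) +
      κ * inner ℝ e (z.1 - z.2) ^ 2 + η * ‖z.1 - z.2‖ ^ 2 + 2 * K * ‖z.1‖ ^ 2
    have hq : IsQuad q := isQuad_coupling e (m / s) κ η (2 * K)
    have hexp := radial_expansion hs hm hφ he hxy hη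
    have ht : Tendsto (fun w : Euc n × Euc n × ℝ => w.1 - w.2.1) (nhds 0) (nhds 0) := by
      have : Continuous fun w : Euc n × Euc n × ℝ => w.1 - w.2.1 := by fun_prop
      simpa using this.tendsto 0
    have htp := two_point hu.sub hu.super hΩ hΩ hG (hG.preimage continuous_neg) hu.cont hu.cont.neg
      hx hy hξ₁ (ξ₂ := -(m • e)) (by simpa using hξ₂) hσ₁
      (by
        have : ContinuousAt σ (- -(m • e)) := by simpa using hσ₂
        exact this.comp (f := fun ξ : Euc n => -ξ) continuous_neg.continuousAt) hq (τ := τ) (C := C) (by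
        filter_upwards [hmax, ht.eventually hexp] with w h1 h2
        have e1 : x + w.1 - (y + w.2.1) = x - y + (w.1 - w.2.1) := by abel
        have e2 : ‖x + w.1 - x₀‖ ^ 2 = ‖x - x₀‖ ^ 2 + 2 * inner ℝ (x - x₀) w.1 + ‖w.1‖ ^ 2 := by
          rw [← norm_add_sq_real]; congr 2; abel
        rw [e1, e2] at h1
        have e3 : inner ℝ ξ₁ w.1 + inner ℝ (-(m • e)) w.2.1 =
            m * inner ℝ e (w.1 - w.2.1) + 2 * K * inner ℝ (x - x₀) w.1 := by
          rw [hξ₁d, inner_add_left, inner_smul_left, inner_smul_left, inner_neg_left,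
            inner_smul_left, inner_sub_right]
          simp only [RCLike.conj_to_real]; ring
        simp only [q]
        linarith) R
    refine htp.trans ?_
    simp only [neg_neg]
    have hsum : ∑ i, q (σ ξ₁ (stdb n i), σ (m • e) (R (stdb n i))) ≤
        c₀ ^ 2 * κ + n * (m / s) * Δ ^ 2 + 2 * K * n * C₀ ^ 2 + η * Sg := by
      have hms : 0 ≤ m / s := by positivity
      calc ∑ i, q (σ ξ₁ (stdb n i), σ (m • e) (R (stdb n i)))
          ≤ ∑ i, (m / s * Δ ^ 2 +
            κ * inner ℝ e (σ ξ₁ (stdb n i) - σ (m • e) (R (stdb n i))) ^ 2 +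
            η * ‖σ ξ₁ (stdb n i) - σ (m • e) (R (stdb n i))‖ ^ 2 + 2 * K * C₀ ^ 2) := by
            refine Finset.sum_le_sum fun i _ => ?_
            have h1 := mul_le_mul_of_nonneg_left (hR1 i) hms
            have h2 : ‖σ ξ₁ (stdb n i)‖ ^ 2 ≤ C₀ ^ 2 := by
              have := hel' (stdb n i)
              rw [(stdb n).norm_eq_one, mul_one] at this
              gcongr
            have h3 := mul_le_mul_of_nonneg_left h2 (show 0 ≤ 2 * K by positivity)
            simp only [q]
            linarith
        _ = κ * ∑ i, inner ℝ e (σ ξ₁ (stdb n i) - σ (m • e) (R (stdb n i))) ^ 2 +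
            n * (m / s) * Δ ^ 2 + 2 * K * n * C₀ ^ 2 + η * Sg := by
            simp only [Finset.sum_add_distrib, Finset.sum_const, Finset.card_univ, Fintype.card_fin,
              nsmul_eq_mul, ← Finset.mul_sum, hSg]
            ring
        _ ≤ _ := by
            have := mul_le_mul_of_nonpos_left hR2 hκ
            linarith
    linarith
  apply le_of_forall_pos_le_add
  intro ε hε
  have := key (ε / (Sg + 1)) (by positivity)
  have h2 : ε / (Sg + 1) * Sg ≤ ε := by
    rw [div_mul_eq_mul_div, div_le_iff₀ (by positivity)]
    nlinarith
  linarith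

end Coupling

section Improve

/-- A maximum with a time penalization which is admissible for parabolic equations. -/
lemma exists_parabolic_max {P : Type*} [TopologicalSpace P] {K : Set P} (hK : IsCompact K)
    {F : P → ℝ → ℝ} {t₁ T T' : ℝ} (h₁ : t₁ ≤ T) (h₂ : T < T')
    (hF : ContinuousOn (fun z : P × ℝ => F z.1 z.2) (K ×ˢ Icc t₁ T')) {p₀ : P} (hp₀ : p₀ ∈ K)
    (hpos : 0 < F p₀ T) :
    ∃ L ≥ 0, ∃ p ∈ K, ∃ t ∈ Ico t₁ T', 0 < F p t ∧ ∀ p' ∈ K, ∀ t' ∈ Icc t₁ T',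
      F p' t' ≤ F p t + 2 * L * max (t - T) 0 * (t' - t) + L * (t' - t) ^ 2 := by
  have hc : IsCompact (K ×ˢ Icc t₁ T') := hK.prod isCompact_Icc
  have hmem : (p₀, T) ∈ K ×ˢ Icc t₁ T' := ⟨hp₀, h₁, h₂.le⟩
  obtain ⟨z, hz, hzmax⟩ := hc.exists_isMaxOn ⟨_, hmem⟩ hF
  set B := F z.1 z.2 with hB
  have hB0 : 0 < B := hpos.trans_le (hzmax hmem)
  set L := B / (T' - T) ^ 2 with hL
  have hTT : 0 < T' - T := by linarith
  have hL0 : 0 < L := by positivity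
  have hG : ContinuousOn (fun z : P × ℝ => F z.1 z.2 - L * max (z.2 - T) 0 ^ 2)
      (K ×ˢ Icc t₁ T') := by
    refine hF.sub (Continuous.continuousOn ?_)
    fun_prop
  obtain ⟨⟨p, t⟩, hm, hmax⟩ := hc.exists_isMaxOn ⟨_, hmem⟩ hG
  have h0 := hmax hmem
  simp only [mem_ofPred_eq, sub_self, max_self] at h0
  have hLn : 0 ≤ L * max (t - T) 0 ^ 2 := by positivity
  have htT : t < T' := by
    refine lt_of_le_of_ne hm.2.2 ?_
    rintro rfl
    have h3 : F p t ≤ B := hzmax hm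
    rw [max_eq_left hTT.le, hL, div_mul_cancel₀ _ (by positivity)] at h0
    linarith
  refine ⟨L, hL0.le, p, hm.1, t, ⟨hm.2.1, htT⟩, by linarith, fun p' hp' t' ht' => ?_⟩
  have h4 : F p' t' - L * max (t' - T) 0 ^ 2 ≤ F p t - L * max (t - T) 0 ^ 2 :=
    hmax (show (p', t') ∈ K ×ˢ Icc t₁ T' from ⟨hp', ht'⟩)
  have h5 : max (t' - T) 0 ^ 2 ≤ (max (t - T) 0 + (t' - t)) ^ 2 := by
    rcases le_total T t with h | h
    · rw [max_eq_left (by linarith : 0 ≤ t - T)]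
      rcases le_total T t' with h' | h'
      · rw [max_eq_left (by linarith)]; nlinarith
      · rw [max_eq_right (by linarith)]; nlinarith
    · rw [max_eq_right (by linarith : t - T ≤ 0)]
      rcases le_total T t' with h' | h'
      · rw [max_eq_left (by linarith)]; nlinarith
      · rw [max_eq_right (by linarith)]; nlinarith
  have h6 := mul_le_mul_of_nonneg_left h5 hL0.le
  linarith

variable {n : ℕ}

/-- The doubling argument: a modulus of continuity that is a strict supersolution of the
one-dimensional comparison equation propagates to the center of a cylinder. -/
theorem improve_modulus {σ : Euc n → Euc n →L[ℝ] Euc n} {G : Set (Euc n)} {M : ℝ}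
    {Ω : Set (Euc n × ℝ)} {u : Euc n → ℝ → ℝ} (hu : VisSol σ G M Ω u) (hΩ : IsOpen Ω)
    (hG : IsOpen G) {x₀ : Euc n} {t₀ r₀ τ₀ ρ h K Kt : ℝ} {φ m κ W c₀ C₀ Lσ : ℝ → ℝ}
    (hr₀ : 0 ≤ r₀) (hτ₀ : 0 ≤ τ₀) (hh : 0 < h) (hK : 0 ≤ K) (hKt : 0 ≤ Kt)
    (hΩx : ∀ x y t, ‖x - x₀‖ ≤ r₀ → ‖x - y‖ ≤ ρ → t ∈ Icc (t₀ - τ₀) (t₀ + h) →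
      (x, t) ∈ Ω ∧ (y, t) ∈ Ω)
    (hφc : ContinuousOn φ (Icc 0 ρ)) (hφ0 : 0 ≤ φ 0)
    (hm : ∀ s ∈ Ioo 0 ρ, 0 ≤ m s) (hκ : ∀ s ∈ Ioo 0 ρ, κ s ≤ 0)
    (hφ : ∀ s ∈ Ioo 0 ρ, ∀ᶠ s' in nhds s,
      φ s' ≤ φ s + m s * (s' - s) + κ s / 2 * (s' - s) ^ 2)
    (hc₀ : ∀ s ∈ Ioo 0 ρ, 0 < c₀ s) (hLσ : ∀ s ∈ Ioo 0 ρ, 0 ≤ Lσ s)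
    (hell : ∀ s ∈ Ioo 0 ρ, ∀ ξ₁ ξ₂ : Euc n, ‖ξ₂‖ = m s → ‖ξ₁ - ξ₂‖ ≤ 2 * K * r₀ →
      ξ₁ ∈ G ∧ ξ₂ ∈ G ∧ ContinuousAt σ ξ₁ ∧ ContinuousAt σ ξ₂ ∧ (∀ v, c₀ s * ‖v‖ ≤ ‖σ ξ₂ v‖) ∧
      (∀ v, ‖σ ξ₁ v‖ ≤ C₀ s * ‖v‖) ∧ ‖σ ξ₁ - σ ξ₂‖ ≤ Lσ s * ‖ξ₁ - ξ₂‖)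
    (hLc : ∀ s ∈ Ioo 0 ρ, Lσ s * (2 * K * r₀) ≤ c₀ s)
    (hW : ∀ x y t, ‖x - x₀‖ ≤ r₀ → ‖x - y‖ < ρ → t ∈ Icc (t₀ - τ₀) (t₀ + h) →
      u x t - u y t - φ ‖x - y‖ ≤ W ‖x - y‖)
    (hρ : ∀ x y t, ‖x - x₀‖ ≤ r₀ → ‖x - y‖ = ρ → t ∈ Icc (t₀ - τ₀) (t₀ + h) →
      u x t - u y t ≤ φ ρ)
    (hWK : ∀ s ∈ Ioo 0 ρ, W s ≤ K * r₀ ^ 2) (hWt : ∀ s ∈ Ioo 0 ρ, W s ≤ Kt * τ₀ ^ 2)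
    (hmain : ∀ s ∈ Ioo 0 ρ, 2 * Kt * τ₀ + n * (m s / s) * (Lσ s ^ 2 * (4 * K * W s)) +
      2 * K * n * C₀ s ^ 2 + 2 * M < c₀ s ^ 2 * (-κ s))
    {y₀ : Euc n} (hy₀ : ‖x₀ - y₀‖ ≤ ρ) :
    u x₀ t₀ - u y₀ t₀ ≤ φ ‖x₀ - y₀‖ := by
  by_contra! hcon
  let A : Set (Euc n × Euc n) := {p | ‖p.1 - x₀‖ ≤ r₀ ∧ ‖p.1 - p.2‖ ≤ ρ}
  have hA : IsCompact A := by
    have hcl : IsClosed A := by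
      have h1 : Continuous fun p : Euc n × Euc n => ‖p.1 - x₀‖ := by fun_prop
      have h2 : Continuous fun p : Euc n × Euc n => ‖p.1 - p.2‖ := by fun_prop
      exact (isClosed_le h1 continuous_const).inter (isClosed_le h2 continuous_const)
    refine ((isCompact_closedBall x₀ r₀).prod (isCompact_closedBall x₀ (r₀ + ρ))).of_isClosed_subset
      hcl fun p hp => ?_
    refine ⟨by simpa [dist_eq_norm] using hp.1, ?_⟩
    rw [mem_closedBall, dist_eq_norm]
    have : p.2 - x₀ = (p.1 - x₀) - (p.1 - p.2) := by abel
    rw [this]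
    exact (norm_sub_le _ _).trans (add_le_add hp.1 hp.2)
  let F : Euc n × Euc n → ℝ → ℝ := fun p t =>
    u p.1 t - u p.2 t - φ ‖p.1 - p.2‖ - K * ‖p.1 - x₀‖ ^ 2 - Kt * (t - t₀) ^ 2
  have hF : ContinuousOn (fun z : (Euc n × Euc n) × ℝ => F z.1 z.2)
      (A ×ˢ Icc (t₀ - τ₀) (t₀ + h)) := by
    have c1 : ContinuousOn (fun z : (Euc n × Euc n) × ℝ => u z.1.1 z.2)
        (A ×ˢ Icc (t₀ - τ₀) (t₀ + h)) :=
      hu.cont.comp (f := fun z : (Euc n × Euc n) × ℝ => (z.1.1, z.2))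
        (Continuous.continuousOn (by fun_prop)) fun z hz => (hΩx _ _ _ hz.1.1 hz.1.2 hz.2).1
    have c2 : ContinuousOn (fun z : (Euc n × Euc n) × ℝ => u z.1.2 z.2)
        (A ×ˢ Icc (t₀ - τ₀) (t₀ + h)) :=
      hu.cont.comp (f := fun z : (Euc n × Euc n) × ℝ => (z.1.2, z.2))
        (Continuous.continuousOn (by fun_prop)) fun z hz => (hΩx _ _ _ hz.1.1 hz.1.2 hz.2).2
    have c3 : ContinuousOn (fun z : (Euc n × Euc n) × ℝ => φ ‖z.1.1 - z.1.2‖)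
        (A ×ˢ Icc (t₀ - τ₀) (t₀ + h)) :=
      hφc.comp (Continuous.continuousOn (by fun_prop)) fun z hz => ⟨norm_nonneg _, hz.1.2⟩
    exact (((c1.sub c2).sub c3).sub (Continuous.continuousOn (by fun_prop))).sub
      (Continuous.continuousOn (by fun_prop))
  have hp₀ : ((x₀, y₀) : Euc n × Euc n) ∈ A := ⟨by simpa using hr₀, hy₀⟩
  obtain ⟨L, hL, ⟨x, y⟩, hxy, t, ht, hpos, hmax⟩ := exists_parabolic_max hA
    (by linarith : t₀ - τ₀ ≤ t₀) (by linarith : t₀ < t₀ + h) hF hp₀ (by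
      simp only [F, sub_self, norm_zero]
      linarith)
  have htI : t ∈ Icc (t₀ - τ₀) (t₀ + h) := ⟨ht.1, ht.2.le⟩
  have hx1 : ‖x - x₀‖ ≤ r₀ := hxy.1
  have hxy1 : ‖x - y‖ ≤ ρ := hxy.2
  have hposF : 0 < u x t - u y t - φ ‖x - y‖ - K * ‖x - x₀‖ ^ 2 - Kt * (t - t₀) ^ 2 := hpos
  have hn1 : 0 ≤ K * ‖x - x₀‖ ^ 2 := by positivity
  have hn2 : 0 ≤ Kt * (t - t₀) ^ 2 := by positivity
  obtain ⟨s, hs⟩ : ∃ s, s = ‖x - y‖ := ⟨_, rfl⟩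
  have hs0 : 0 < s := by
    rw [hs, norm_pos_iff]
    intro h0
    rw [sub_eq_zero] at h0
    subst h0
    simp only [sub_self, norm_zero] at hposF
    linarith
  have hsρ : s < ρ := by
    rw [hs]
    refine lt_of_le_of_ne hxy1 fun h0 => ?_
    have := hρ x y t hx1 h0 htI
    rw [h0] at hposF
    linarith
  have hsI : s ∈ Ioo 0 ρ := ⟨hs0, hsρ⟩
  have hWs := hW x y t hx1 (hs ▸ hsρ) htI
  rw [← hs] at hWs hposF
  have hKW : K * ‖x - x₀‖ ^ 2 < W s := by linarith
  have hxr : ‖x - x₀‖ < r₀ := by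
    have h1 : K * ‖x - x₀‖ ^ 2 < K * r₀ ^ 2 := hKW.trans_le (hWK s hsI)
    have h2 : ‖x - x₀‖ ^ 2 < r₀ ^ 2 := lt_of_mul_lt_mul_left h1 hK
    exact lt_of_pow_lt_pow_left₀ 2 hr₀ h2
  have htt : t₀ - τ₀ < t := by
    refine lt_of_le_of_ne ht.1 fun h0 => ?_
    have h1 := hWt s hsI
    have h2 : (t - t₀) ^ 2 = τ₀ ^ 2 := by rw [← h0]; ring
    rw [h2] at hposF
    linarith
  obtain ⟨e, he⟩ : ∃ e : Euc n, e = s⁻¹ • (x - y) := ⟨_, rfl⟩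
  have he1 : ‖e‖ = 1 := by
    rw [he, norm_smul, ← hs, Real.norm_of_nonneg (by positivity), inv_mul_cancel₀ hs0.ne']
  have hse : x - y = s • e := by rw [he, smul_smul, mul_inv_cancel₀ hs0.ne', one_smul]
  obtain ⟨hxΩ, hyΩ⟩ := hΩx x y t hx1 hxy1 htI
  have hdiff : ‖m s • e + (2 * K) • (x - x₀) - m s • e‖ = 2 * K * ‖x - x₀‖ := by
    rw [add_sub_cancel_left, norm_smul, Real.norm_of_nonneg (by positivity)]
  have hdle : 2 * K * ‖x - x₀‖ ≤ 2 * K * r₀ := by gcongr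
  obtain ⟨g1, g2, g3, g4, g5, g6, g7⟩ := hell s hsI (m s • e + (2 * K) • (x - x₀)) (m s • e)
    (by rw [norm_smul, he1, mul_one, Real.norm_of_nonneg (hm s hsI)]) (by rw [hdiff]; exact hdle)
  rw [hdiff] at g7
  have hΔc : Lσ s * (2 * K * ‖x - x₀‖) ≤ c₀ s :=
    (mul_le_mul_of_nonneg_left hdle (hLσ s hsI)).trans (hLc s hsI)
  have hopen : ∀ᶠ w in nhds (0 : Euc n × Euc n × ℝ), ‖x + w.1 - x₀‖ < r₀ ∧
      ‖x + w.1 - (y + w.2.1)‖ < ρ ∧ t + w.2.2 ∈ Ioo (t₀ - τ₀) (t₀ + h) := by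
    have c1 : Continuous fun w : Euc n × Euc n × ℝ => ‖x + w.1 - x₀‖ := by fun_prop
    have c2 : Continuous fun w : Euc n × Euc n × ℝ => ‖x + w.1 - (y + w.2.1)‖ := by fun_prop
    have c3 : Continuous fun w : Euc n × Euc n × ℝ => t + w.2.2 := by fun_prop
    refine ((c1.tendsto 0).eventually_lt_const (by simpa using hxr)).and
      (((c2.tendsto 0).eventually_lt_const (by simpa [← hs] using hsρ)).and
      ((c3.tendsto 0).eventually_mem (Ioo_mem_nhds ?_ ?_)))
    · simpa using htt
    · simpa using ht.2
  have hrc := reflection_coupling hu hΩ hG hxΩ hyΩ hs0 he1 hse (hm s hsI) (hκ s hsI) hK g1 g2 g3 g4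
    (hc₀ s hsI) g5 g6 g7 hΔc (hφ s hsI) (τ := 2 * L * max (t - t₀) 0 + 2 * Kt * (t - t₀))
    (C := L + Kt) (by
      filter_upwards [hopen] with w hw
      have := hmax (x + w.1, y + w.2.1) ⟨hw.1.le, hw.2.1.le⟩ (t + w.2.2) ⟨hw.2.2.1.le, hw.2.2.2.le⟩
      simp only [F, ← hs] at this
      linarith)
  have hτ : -(2 * Kt * τ₀) ≤ 2 * L * max (t - t₀) 0 + 2 * Kt * (t - t₀) := by
    have h1 : 0 ≤ 2 * L * max (t - t₀) 0 := by positivity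
    have h2 : 2 * Kt * (-τ₀) ≤ 2 * Kt * (t - t₀) := by gcongr; linarith
    linarith
  have hΔ2 : (Lσ s * (2 * K * ‖x - x₀‖)) ^ 2 ≤ Lσ s ^ 2 * (4 * K * W s) := by
    have h1 : (Lσ s * (2 * K * ‖x - x₀‖)) ^ 2 = Lσ s ^ 2 * (4 * K * (K * ‖x - x₀‖ ^ 2)) := by ring
    rw [h1]; gcongr
  have hfin : n * (m s / s) * (Lσ s * (2 * K * ‖x - x₀‖)) ^ 2 ≤
      n * (m s / s) * (Lσ s ^ 2 * (4 * K * W s)) :=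
    mul_le_mul_of_nonneg_left hΔ2 (mul_nonneg (Nat.cast_nonneg n)
      (div_nonneg (hm s hsI) hs0.le))
  have := hmain s hsI
  linarith

end Improve

section Lipschitz

variable {n : ℕ}

/-- Uniform ellipticity and Lipschitz continuity of the diffusion matrix on `G`. -/
structure EllOn (σ : Euc n → Euc n →L[ℝ] Euc n) (G : Set (Euc n)) (c C L : ℝ) : Prop where
  lower : ∀ ξ ∈ G, ∀ v, c * ‖v‖ ≤ ‖σ ξ v‖
  upper : ∀ ξ ∈ G, ∀ v, ‖σ ξ v‖ ≤ C * ‖v‖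
  lip : ∀ ξ ∈ G, ∀ ξ' ∈ G, ‖σ ξ - σ ξ'‖ ≤ L * ‖ξ - ξ'‖

lemma EllOn.mono {σ : Euc n → Euc n →L[ℝ] Euc n} {G G' : Set (Euc n)} {c C L : ℝ}
    (h : EllOn σ G c C L) (hG : G' ⊆ G) : EllOn σ G' c C L :=
  ⟨fun ξ hξ => h.lower ξ (hG hξ), fun ξ hξ => h.upper ξ (hG hξ),
    fun ξ hξ ξ' hξ' => h.lip ξ (hG hξ) ξ' (hG hξ')⟩

lemma EllOn.continuousAt {σ : Euc n → Euc n →L[ℝ] Euc n} {G : Set (Euc n)} {c C L : ℝ}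
    (h : EllOn σ G c C L) (hG : IsOpen G) {ξ : Euc n} (hξ : ξ ∈ G) : ContinuousAt σ ξ := by
  rw [ContinuousAt, tendsto_iff_norm_sub_tendsto_zero]
  have h1 : Tendsto (fun ζ => L * ‖ζ - ξ‖) (nhds ξ) (nhds 0) := by
    have : Continuous fun ζ : Euc n => L * ‖ζ - ξ‖ := by fun_prop
    simpa using this.tendsto ξ
  refine tendsto_of_tendsto_of_tendsto_of_le_of_le' tendsto_const_nhds h1
    (Eventually.of_forall fun _ => norm_nonneg _) ?_
  filter_upwards [hG.mem_nhds hξ] with ζ hζ using h.lip ζ hζ ξ hξ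

/-- Open parabolic cylinder. -/
def oCyl (n : ℕ) (r : ℝ) : Set (Euc n × ℝ) := {z | ‖z.1‖ < r ∧ -(r ^ 2) < z.2 ∧ z.2 < 0}

lemma isOpen_oCyl (r : ℝ) : IsOpen (oCyl n r) := by
  have h1 : Continuous fun z : Euc n × ℝ => ‖z.1‖ := by fun_prop
  have h2 : Continuous fun z : Euc n × ℝ => z.2 := by fun_prop
  exact (isOpen_lt h1 continuous_const).inter
    ((isOpen_lt continuous_const h2).inter (isOpen_lt h2 continuous_const))

/-- Spatial Lipschitz bound. -/
def LipX (l : ℝ) (Q : Set (Euc n × ℝ)) (v : Euc n → ℝ → ℝ) : Prop :=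
  ∀ x y t, (x, t) ∈ Q → (y, t) ∈ Q → v x t - v y t ≤ l * ‖x - y‖

/-- Small solutions of uniformly elliptic equations have small slope. -/
theorem lip_of_small (n : ℕ) {c C L : ℝ} (hc : 0 < c) (hL : 0 ≤ L) :
    ∃ η > 0, ∀ (σ : Euc n → Euc n →L[ℝ] Euc n) (M : ℝ) (w : Euc n → ℝ → ℝ),
      EllOn σ (ball 0 6) c C L → M ≤ η → VisSol σ (ball 0 6) M (oCyl n 1) w →
      (∀ x t, (x, t) ∈ oCyl n 1 → |w x t| ≤ η) → LipX 16 (oCyl n 1) w →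
      LipX 1 (oCyl n (1 / 2)) w := by
  obtain ⟨η, hη⟩ : ∃ η, η = min (1 / 64) (min (c / (16 * L + 1))
    (4 * c ^ 2 / (19 + 2048 * n * L ^ 2 + 64 * n * C ^ 2))) := ⟨_, rfl⟩
  have hη0 : 0 < η := by rw [hη]; positivity
  have h1 : η ≤ 1 / 64 := hη ▸ min_le_left _ _
  have h2 : η * (16 * L + 1) ≤ c := by
    rw [← le_div_iff₀ (by positivity), hη]; exact (min_le_right _ _).trans (min_le_left _ _)
  have h3 : η * (19 + 2048 * n * L ^ 2 + 64 * n * C ^ 2) ≤ 4 * c ^ 2 := by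
    rw [← le_div_iff₀ (by positivity), hη]; exact (min_le_right _ _).trans (min_le_right _ _)
  clear hη
  refine ⟨η, hη0, fun σ M w hell hM hw hwη hlip => ?_⟩
  intro x₀ y₀ t₀ hx₀ hy₀
  have hdom : ∀ x t, (x, t) ∈ oCyl n (1 / 2) → (x, t) ∈ oCyl n 1 := fun x t h =>
    ⟨h.1.trans (by norm_num), lt_trans (by norm_num) h.2.1, h.2.2⟩
  have hosc : ∀ x y t, (x, t) ∈ oCyl n 1 → (y, t) ∈ oCyl n 1 → w x t - w y t ≤ 2 * η :=
    fun x y t hx hy => by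
      have a1 := abs_le.1 (hwη x t hx); have a2 := abs_le.1 (hwη y t hy); linarith
  by_cases hfar : 1 / 8 ≤ ‖x₀ - y₀‖
  · have := hosc _ _ _ (hdom _ _ hx₀) (hdom _ _ hy₀)
    linarith
  push Not at hfar
  obtain ⟨hx0, ht0, ht0'⟩ := hx₀
  simp only at hx0 ht0 ht0'
  have hΩ : ∀ x y t, ‖x - x₀‖ ≤ 1 / 4 → ‖x - y‖ ≤ 1 / 8 → t ∈ Icc (t₀ - 1 / 4) (t₀ + -t₀ / 2) →
      (x, t) ∈ oCyl n 1 ∧ (y, t) ∈ oCyl n 1 := fun x y t hx hxy ht => by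
    have b1 : ‖x‖ < 3 / 4 := by
      have := norm_add_le (x - x₀) x₀
      rw [sub_add_cancel] at this; linarith
    have b2 : ‖y‖ < 1 := by
      have := norm_sub_le x (x - y)
      rw [sub_sub_cancel] at this; linarith
    have b3 : -(1 : ℝ) ^ 2 < t := by have := ht.1; linarith
    have b4 : t < 0 := by have := ht.2; linarith
    exact ⟨⟨by simp only; linarith, b3, b4⟩, b2, b3, b4⟩
  have key := improve_modulus hw (isOpen_oCyl 1) isOpen_ball (x₀ := x₀) (t₀ := t₀) (r₀ := 1 / 4)
    (τ₀ := 1 / 4) (ρ := 1 / 8) (h := -t₀ / 2) (K := 32 * η) (Kt := 32 * η)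
    (φ := fun s => s - 2 * s ^ 2) (m := fun s => 1 - 4 * s) (κ := fun _ => -4)
    (W := fun s => min (16 * s) (2 * η)) (c₀ := fun _ => c) (C₀ := fun _ => C) (Lσ := fun _ => L)
    (by norm_num) (by norm_num) (by linarith) (by positivity) (by positivity) hΩ
    (Continuous.continuousOn (by fun_prop)) (by norm_num)
    (fun s hs => by have := hs.2; linarith) (fun _ _ => by norm_num)
    (fun s _ => Eventually.of_forall fun s' => le_of_eq (by ring)) (fun _ _ => hc) (fun _ _ => hL)
    (fun s hs ξ₁ ξ₂ hξ hd => by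
      have d1 : ‖ξ₂‖ ≤ 1 := by rw [hξ]; have := hs.1; linarith
      have d2 : ξ₂ ∈ ball (0 : Euc n) 6 := by rw [mem_ball_zero_iff]; linarith
      have d3 : ξ₁ ∈ ball (0 : Euc n) 6 := by
        rw [mem_ball_zero_iff]
        have := norm_add_le (ξ₁ - ξ₂) ξ₂
        rw [sub_add_cancel] at this; linarith
      exact ⟨d3, d2, hell.continuousAt isOpen_ball d3, hell.continuousAt isOpen_ball d2,
        hell.lower _ d2, hell.upper _ d3, hell.lip _ d3 _ d2⟩)
    (fun s _ => by linarith)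
    (fun x y t hx hxy ht => by
      obtain ⟨e1, e2⟩ := hΩ x y t hx hxy.le ht
      have e3 : 0 ≤ ‖x - y‖ - 2 * ‖x - y‖ ^ 2 := by nlinarith [norm_nonneg (x - y)]
      refine le_min ?_ ?_
      · have := hlip x y t e1 e2; linarith
      · have := hosc x y t e1 e2; linarith)
    (fun x y t hx hxy ht => by
      obtain ⟨e1, e2⟩ := hΩ x y t hx hxy.le ht
      have := hosc x y t e1 e2; linarith)
    (fun s _ => (min_le_right _ _).trans (by linarith))
    (fun s _ => (min_le_right _ _).trans (by linarith))
    (fun s hs => by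
      have hs0 : 0 < s := hs.1
      have f1 : (1 - 4 * s) / s * min (16 * s) (2 * η) ≤ 16 := by
        have hs8 : s < 1 / 8 := hs.2
        calc (1 - 4 * s) / s * min (16 * s) (2 * η) ≤ (1 - 4 * s) / s * (16 * s) := by
              refine mul_le_mul_of_nonneg_left (min_le_left _ _) (div_nonneg ?_ hs0.le)
              linarith
          _ = (1 - 4 * s) * 16 := by field_simp
          _ ≤ 16 := by linarith
      have f2 := mul_le_mul_of_nonneg_left f1 (show 0 ≤ n * L ^ 2 * (4 * (32 * η)) by positivity)
      linarith)
    hfar.le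
  have := sq_nonneg ‖x₀ - y₀‖
  linarith

/-- A gradient deficit at one scale improves the Lipschitz constant at smaller scales. -/
theorem lip_improve (n : ℕ) {c C L r τ : ℝ} (hc : 0 < c) (hL : 0 ≤ L) (hr : 0 < r)
    (hr1 : r ≤ 1 / 2) (hτ : 0 < τ) (hτ1 : τ ≤ 1) :
    ∃ ρ₀ > 0, ∀ ρ, 0 < ρ → ρ ≤ ρ₀ → ∀ δ' > 0, ∃ δ > 0, δ ≤ 1 / 8 ∧ ∃ η > 0,
      ∀ (σ : Euc n → Euc n →L[ℝ] Euc n) (M : ℝ) (v : Euc n → ℝ → ℝ),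
      EllOn σ {ξ | 1 / 4 < ‖ξ‖ ∧ ‖ξ‖ < 3} c C L → M ≤ η →
      VisSol σ {ξ | 1 / 4 < ‖ξ‖ ∧ ‖ξ‖ < 3} M (oCyl n 1) v → LipX 1 (oCyl n 1) v →
      (∀ e z t, ‖e‖ = 1 → ‖z‖ < r → -τ < t → t < 0 → v (z + ρ • e) t - v z t ≤ (1 - δ') * ρ) →
      ∀ r₁, r₁ ≤ ρ / 2 → r₁ ^ 2 ≤ τ / 2 → LipX (1 - δ) (oCyl n r₁) v := by
  have hGo : IsOpen {ξ : Euc n | 1 / 4 < ‖ξ‖ ∧ ‖ξ‖ < 3} :=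
    (isOpen_lt continuous_const continuous_norm).inter (isOpen_lt continuous_norm continuous_const)
  obtain ⟨S, hS⟩ : ∃ S, S = 8 / τ + (16 * n * L ^ 2 + 4 * n * C ^ 2) * 16 / r ^ 2 := ⟨_, rfl⟩
  have hS0 : 0 < S := by rw [hS]; positivity
  obtain ⟨ρ₀, hρ₀⟩ : ∃ ρ₀, ρ₀ = min 1 (min (r / 16) (min (c * r / (16 * L + 1))
    (c ^ 2 / (2 * S)))) := ⟨_, rfl⟩
  have hρ₀0 : 0 < ρ₀ := by rw [hρ₀]; positivity
  refine ⟨ρ₀, hρ₀0, fun ρ hρ hρle δ' hδ' => ?_⟩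
  have p1 : ρ ≤ 1 := hρle.trans (hρ₀ ▸ min_le_left _ _)
  have p2 : ρ ≤ r / 16 := hρle.trans (hρ₀ ▸ (min_le_right _ _).trans (min_le_left _ _))
  have p3 : ρ * (16 * L + 1) ≤ c * r := by
    rw [← le_div_iff₀ (by positivity)]
    exact hρle.trans (hρ₀ ▸ (min_le_right _ _).trans ((min_le_right _ _).trans (min_le_left _ _)))
  have p4 : ρ * S ≤ c ^ 2 / 2 := by
    have : ρ ≤ c ^ 2 / (2 * S) := hρle.trans
      (hρ₀ ▸ (min_le_right _ _).trans ((min_le_right _ _).trans (min_le_right _ _)))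
    rw [le_div_iff₀ (by positivity)] at this
    linarith
  clear hρ₀ hρle
  obtain ⟨δ, hδd⟩ : ∃ δ, δ = min (1 / 8) (δ' / 2) := ⟨_, rfl⟩
  have hδ : 0 < δ := by rw [hδd]; positivity
  have hδ8 : δ ≤ 1 / 8 := hδd ▸ min_le_left _ _
  have hδδ : δ ≤ δ' / 2 := hδd ▸ min_le_right _ _
  refine ⟨δ, hδ, hδ8, δ * c ^ 2 / (4 * ρ), by positivity, ?_⟩
  intro σ M v hell hM hv hlip hdef r₁ hr₁ hr₁τ x₀ y₀ t₀ hx₀ hy₀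
  obtain ⟨hx0, ht0, ht0'⟩ := hx₀
  simp only at hx0 ht0 ht0'
  have hfar : ‖x₀ - y₀‖ ≤ ρ := by
    have := norm_sub_le x₀ y₀
    have := hy₀.1
    simp only at this; linarith
  have hΩ' : ∀ x y t, ‖x - x₀‖ ≤ r / 4 → ‖x - y‖ ≤ ρ → t ∈ Icc (t₀ - τ / 2) (t₀ + -t₀ / 2) →
      ‖x‖ < r ∧ ‖y‖ < r ∧ -τ < t ∧ t < 0 := fun x y t hx hxy ht => by
    have b1 : ‖x‖ < r / 2 := by
      have := norm_add_le (x - x₀) x₀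
      rw [sub_add_cancel] at this; linarith
    have b2 : ‖y‖ < r := by
      have := norm_sub_le x (x - y)
      rw [sub_sub_cancel] at this; linarith
    exact ⟨by linarith, b2, by have := ht.1; linarith, by have := ht.2; linarith⟩
  have hΩ : ∀ x y t, ‖x - x₀‖ ≤ r / 4 → ‖x - y‖ ≤ ρ → t ∈ Icc (t₀ - τ / 2) (t₀ + -t₀ / 2) →
      (x, t) ∈ oCyl n 1 ∧ (y, t) ∈ oCyl n 1 := fun x y t hx hxy ht => by
    obtain ⟨b1, b2, b3, b4⟩ := hΩ' x y t hx hxy ht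
    have b5 : -(1 : ℝ) ^ 2 < t := by linarith
    exact ⟨⟨by simp only; linarith, b5, b4⟩, by simp only; linarith, b5, b4⟩
  have hKr : 2 * (2 * δ * ρ / (r / 4) ^ 2) * (r / 4) = 16 * δ * ρ / r := by field_simp; ring
  have hKr' : 16 * δ * ρ / r ≤ δ := by
    rw [div_le_iff₀ hr]; nlinarith
  have key := improve_modulus hv (isOpen_oCyl 1) hGo (x₀ := x₀) (t₀ := t₀) (r₀ := r / 4)
    (τ₀ := τ / 2) (ρ := ρ) (h := -t₀ / 2) (K := 2 * δ * ρ / (r / 4) ^ 2)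
    (Kt := 2 * δ * ρ / (τ / 2) ^ 2)
    (φ := fun s => (1 - δ) * s - δ / ρ * s ^ 2) (m := fun s => 1 - δ - 2 * (δ / ρ) * s)
    (κ := fun _ => -(2 * (δ / ρ)))
    (W := fun s => 2 * δ * s) (c₀ := fun _ => c) (C₀ := fun _ => C) (Lσ := fun _ => L)
    (by positivity) (by positivity) (by linarith) (by positivity) (by positivity) hΩ
    (Continuous.continuousOn (by fun_prop)) (by norm_num)
    (fun s hs => by
      have : δ / ρ * s ≤ δ := by rw [div_mul_eq_mul_div, div_le_iff₀ hρ]; have := hs.2; gcongr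
      linarith) (fun _ _ => by rw [neg_nonpos]; positivity)
    (fun s _ => Eventually.of_forall fun s' => le_of_eq (by ring)) (fun _ _ => hc) (fun _ _ => hL)
    (fun s hs ξ₁ ξ₂ hξ hd => by
      have hs0 := hs.1
      have d0 : δ / ρ * s ≤ δ := by rw [div_mul_eq_mul_div, div_le_iff₀ hρ]; have := hs.2; gcongr
      have d0' : 0 ≤ δ / ρ * s := by positivity
      rw [hKr] at hd
      have d2 : ξ₂ ∈ {ξ : Euc n | 1 / 4 < ‖ξ‖ ∧ ‖ξ‖ < 3} := by
        constructor <;> · rw [hξ]; linarith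
      have d3 : ξ₁ ∈ {ξ : Euc n | 1 / 4 < ‖ξ‖ ∧ ‖ξ‖ < 3} := by
        have e1 := norm_add_le (ξ₁ - ξ₂) ξ₂
        have e2 := norm_sub_le ξ₁ (ξ₁ - ξ₂)
        rw [sub_add_cancel] at e1
        rw [sub_sub_cancel] at e2
        constructor <;> linarith
      exact ⟨d3, d2, hell.continuousAt hGo d3, hell.continuousAt hGo d2,
        hell.lower _ d2, hell.upper _ d3, hell.lip _ d3 _ d2⟩)
    (fun s _ => by
      rw [hKr, mul_div_assoc', div_le_iff₀ hr]
      calc L * (16 * δ * ρ) = δ * (ρ * (16 * L)) := by ring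
        _ ≤ 1 * (c * r) := by
          refine mul_le_mul (by linarith) (by linarith) (by positivity) (by norm_num)
        _ = c * r := one_mul _)
    (fun x y t hx hxy ht => by
      obtain ⟨e1, e2⟩ := hΩ x y t hx hxy.le ht
      have := hlip x y t e1 e2
      have e3 : δ / ρ * ‖x - y‖ ^ 2 ≤ δ * ‖x - y‖ := by
        rw [div_mul_eq_mul_div, div_le_iff₀ hρ, mul_assoc]
        have := mul_le_mul_of_nonneg_left hxy.le (norm_nonneg (x - y))
        gcongr
        linarith
      linarith)
    (fun x y t hx hxy ht => by
      obtain ⟨e1, e2, e3, e4⟩ := hΩ' x y t hx hxy.le ht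
      have := hdef (ρ⁻¹ • (x - y)) y t
        (by rw [norm_smul, hxy, Real.norm_of_nonneg (by positivity), inv_mul_cancel₀ hρ.ne'])
        e2 e3 e4
      rw [smul_smul, mul_inv_cancel₀ hρ.ne', one_smul, add_sub_cancel] at this
      refine this.trans ?_
      have : (1 - δ) * ρ - δ / ρ * ρ ^ 2 = (1 - 2 * δ) * ρ := by field_simp; ring
      rw [this]
      gcongr
      linarith)
    (fun s hs => by
      have : 2 * δ * ρ / (r / 4) ^ 2 * (r / 4) ^ 2 = 2 * δ * ρ := by field_simp
      rw [this]; have := hs.2.le; gcongr)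
    (fun s hs => by
      have : 2 * δ * ρ / (τ / 2) ^ 2 * (τ / 2) ^ 2 = 2 * δ * ρ := by field_simp
      rw [this]; have := hs.2.le; gcongr)
    (fun s hs => by
      have hs0 : 0 < s := hs.1
      have g1 : (1 - δ - 2 * (δ / ρ) * s) / s * (2 * δ * s) ≤ 2 * δ := by
        rw [div_mul_eq_mul_div, div_le_iff₀ hs0]
        have : 0 ≤ δ / ρ * s := by positivity
        have : 1 - δ - 2 * (δ / ρ) * s ≤ 1 := by linarith
        calc _ ≤ 1 * (2 * δ * s) := by gcongr
          _ = _ := by ring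
      have g2 := mul_le_mul_of_nonneg_left g1
        (show 0 ≤ n * L ^ 2 * (4 * (2 * δ * ρ / (r / 4) ^ 2)) by positivity)
      have g3 : 2 * (2 * δ * ρ / (τ / 2) ^ 2) * (τ / 2) + n * L ^ 2 * (4 * (2 * δ * ρ / (r / 4) ^ 2))
          * (2 * δ) + 2 * (2 * δ * ρ / (r / 4) ^ 2) * n * C ^ 2 ≤ δ * c ^ 2 / (2 * ρ) := by
        have g4 : 2 * (2 * δ * ρ / (τ / 2) ^ 2) * (τ / 2) +
            n * L ^ 2 * (4 * (2 * δ * ρ / (r / 4) ^ 2)) * (2 * δ) +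
            2 * (2 * δ * ρ / (r / 4) ^ 2) * n * C ^ 2 =
            δ * ρ * (8 / τ + (16 * n * L ^ 2 * δ + 4 * n * C ^ 2) * 16 / r ^ 2) := by
          field_simp; ring
        rw [g4]
        have g5 : 8 / τ + (16 * n * L ^ 2 * δ + 4 * n * C ^ 2) * 16 / r ^ 2 ≤ S := by
          rw [hS]
          have h9 : 16 * n * L ^ 2 * δ ≤ 16 * n * L ^ 2 * 1 := by gcongr; linarith
          have h10 : 16 * n * L ^ 2 * δ + 4 * n * C ^ 2 ≤ 16 * n * L ^ 2 + 4 * n * C ^ 2 := by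
            linarith
          exact add_le_add le_rfl (div_le_div_of_nonneg_right
            (mul_le_mul_of_nonneg_right h10 (by norm_num)) (by positivity))
        calc δ * ρ * (8 / τ + (16 * n * L ^ 2 * δ + 4 * n * C ^ 2) * 16 / r ^ 2) ≤ δ * ρ * S := by
              gcongr
          _ = δ * (ρ * S) := by ring
          _ ≤ δ * (c ^ 2 / 2) := by gcongr
          _ ≤ δ * c ^ 2 / (2 * ρ) := by
            rw [le_div_iff₀ (by positivity)]
            have : 0 < δ * c ^ 2 := by positivity
            nlinarith
      have g6 : c ^ 2 * (2 * (δ / ρ)) = 4 * (δ * c ^ 2 / (2 * ρ)) := by field_simp; ring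
      have g7 : 2 * M ≤ δ * c ^ 2 / (2 * ρ) := by
        have : δ * c ^ 2 / (2 * ρ) = 2 * (δ * c ^ 2 / (4 * ρ)) := by field_simp; ring
        rw [this]; gcongr
      have g8 : 0 < δ * c ^ 2 / (2 * ρ) := by positivity
      simp only [neg_neg]
      rw [g6]
      linarith)
    hfar
  have : 0 ≤ δ / ρ * ‖x₀ - y₀‖ ^ 2 := by positivity
  linarith

end Lipschitz

section Spread

variable {n : ℕ}

lemma norm_add_le_expansion {z d e : Euc n} {s : ℝ} (hs : 0 < s) (he : ‖e‖ = 1) (hz : z = s • e) :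
    ‖z + d‖ ≤ s + inner ℝ e d + ‖d‖ ^ 2 / (2 * s) := by
  have h1 : ‖z + d‖ ^ 2 = s ^ 2 + 2 * s * inner ℝ e d + ‖d‖ ^ 2 := by
    rw [norm_add_sq_real, hz, norm_smul, he, inner_smul_left, Real.norm_of_nonneg hs.le]
    simp; ring
  have h2 : 2 * s * (s + inner ℝ e d + ‖d‖ ^ 2 / (2 * s)) = ‖z + d‖ ^ 2 + s ^ 2 := by
    rw [h1]; field_simp; ring
  nlinarith [sq_nonneg (‖z + d‖ - s)]

lemma bump_expansion_scalar {q₀ a b w A Z Om rt N D : ℝ} (hq : 0 < q₀) (hN : 0 ≤ N)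
    (hrt : rt ^ 2 = Om) (hrt0 : 0 ≤ rt) (hrt1 : rt ≤ 1) (hOm : Om ≤ 2 * A ^ 2 + 2 * w ^ 2 * Z ^ 2)
    (hOm2 : Om ≤ q₀ / 8) (hab : |a - w * b| ≤ D * rt)
    (hsm : |-2 * (a - w * b) - Om| ≤ 1) :
    q₀ ^ 2 + (-N * q₀ ^ 2 + 4 * q₀ * b) * w - 4 * q₀ * a + a ^ 2 - 5 * q₀ * A ^ 2 -
      (2 * b ^ 2 + 5 * q₀ * Z ^ 2 + 2 * (N * (2 * q₀ + 1) * (2 * D + 1)) ^ 2 / q₀) * w ^ 2 ≤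
      (1 - N * w) * (q₀ + (-2 * (a - w * b) - Om)) ^ 2 := by
  obtain ⟨δ, hδ⟩ : ∃ δ, δ = -2 * (a - w * b) - Om := ⟨_, rfl⟩
  rw [← hδ] at hsm ⊢
  have hOm0 : 0 ≤ Om := hrt ▸ sq_nonneg rt
  have h1 : a ^ 2 - 2 * w ^ 2 * b ^ 2 - Om ^ 2 ≤ δ ^ 2 := by
    have e1 : δ ^ 2 = 4 * (a - w * b) ^ 2 + 4 * (a - w * b) * Om + Om ^ 2 := by rw [hδ]; ring
    nlinarith [sq_nonneg (a - 2 * w * b), sq_nonneg ((a - w * b) + Om)]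
  have h2 : |δ| ≤ (2 * D + 1) * rt := by
    rw [hδ]
    calc |-2 * (a - w * b) - Om| ≤ |-2 * (a - w * b)| + |Om| := abs_sub _ _
      _ = 2 * |a - w * b| + Om := by rw [abs_mul, abs_of_nonneg hOm0]; norm_num
      _ ≤ 2 * (D * rt) + rt * 1 := by
        have : Om ≤ rt * 1 := by rw [← hrt, pow_two]; gcongr
        gcongr
      _ = _ := by ring
  obtain ⟨B, hB⟩ : ∃ B, B = N * (2 * q₀ + 1) * (2 * D + 1) := ⟨_, rfl⟩
  rw [← hB]
  have h3 : N * w * (2 * q₀ * δ + δ ^ 2) ≤ B * (|w| * rt) := by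
    have e1 : |2 * q₀ * δ + δ ^ 2| ≤ (2 * q₀ + 1) * ((2 * D + 1) * rt) := by
      have : 2 * q₀ * δ + δ ^ 2 = (2 * q₀ + δ) * δ := by ring
      rw [this, abs_mul]
      have e2 : |2 * q₀ + δ| ≤ 2 * q₀ + 1 := by
        refine (abs_add_le _ _).trans ?_
        rw [abs_of_nonneg (by positivity)]; gcongr
      gcongr
    calc N * w * (2 * q₀ * δ + δ ^ 2) ≤ |N * w * (2 * q₀ * δ + δ ^ 2)| := le_abs_self _
      _ = N * |w| * |2 * q₀ * δ + δ ^ 2| := by rw [abs_mul, abs_mul, abs_of_nonneg hN]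
      _ ≤ N * |w| * ((2 * q₀ + 1) * ((2 * D + 1) * rt)) := by gcongr
      _ = B * (|w| * rt) := by rw [hB]; ring
  have h4 : B * (|w| * rt) ≤ q₀ / 8 * Om + 2 * B ^ 2 / q₀ * w ^ 2 := by
    have e1 : 0 ≤ (q₀ / 8) * (rt - 4 * B / q₀ * |w|) ^ 2 := by positivity
    have e2 : (q₀ / 8) * (rt - 4 * B / q₀ * |w|) ^ 2 =
        q₀ / 8 * rt ^ 2 + 2 * B ^ 2 / q₀ * |w| ^ 2 - B * (|w| * rt) := by field_simp; ring
    rw [e2, hrt, sq_abs] at e1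
    linarith
  have h5 : Om ^ 2 ≤ q₀ / 8 * Om := by rw [pow_two]; gcongr
  have h6 : q₀ * Om ≤ q₀ * (2 * A ^ 2 + 2 * w ^ 2 * Z ^ 2) := by gcongr
  have h7 : 0 ≤ q₀ * A ^ 2 := by positivity
  have h8 : 0 ≤ q₀ * (w ^ 2 * Z ^ 2) := by positivity
  have e : (1 - N * w) * (q₀ + δ) ^ 2 = q₀ ^ 2 + 2 * q₀ * δ + δ ^ 2 - N * q₀ ^ 2 * w -
      N * w * (2 * q₀ * δ + δ ^ 2) := by ring
  have e2 : 2 * q₀ * δ = -4 * q₀ * a + 4 * q₀ * b * w - 2 * (q₀ * Om) := by rw [hδ]; ring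
  rw [e]
  linarith

/-- Lower expansion of the moving bump `exp (-N t) (k - |y - c - t ζ|²)²`. -/
lemma bump_expansion {k N E : ℝ} (hN : 0 ≤ N) (hE : 0 ≤ E) {d ζ : Euc n}
    (hq : 0 < k - ‖d‖ ^ 2) :
    ∃ C, ∀ᶠ w in nhds (0 : Euc n × ℝ),
      E * ((k - ‖d‖ ^ 2) ^ 2 + (-N * (k - ‖d‖ ^ 2) ^ 2 + 4 * (k - ‖d‖ ^ 2) * inner ℝ d ζ) * w.2 -
        4 * (k - ‖d‖ ^ 2) * inner ℝ d w.1 + inner ℝ d w.1 ^ 2 - 5 * (k - ‖d‖ ^ 2) * ‖w.1‖ ^ 2 -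
        C * w.2 ^ 2) ≤
      E * Real.exp (-N * w.2) * max (k - ‖d + w.1 - w.2 • ζ‖ ^ 2) 0 ^ 2 := by
  refine ⟨2 * inner ℝ d ζ ^ 2 + 5 * (k - ‖d‖ ^ 2) * ‖ζ‖ ^ 2 + 2 * (N * (2 * (k - ‖d‖ ^ 2) + 1) *
    (2 * ‖d‖ + 1)) ^ 2 / (k - ‖d‖ ^ 2), ?_⟩
  have c1 : Continuous fun w : Euc n × ℝ => ‖w.1 - w.2 • ζ‖ := by fun_prop
  have c2 : Continuous fun w : Euc n × ℝ => ‖w.1 - w.2 • ζ‖ ^ 2 := by fun_prop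
  have c3 : Continuous fun w : Euc n × ℝ =>
    |-2 * (inner ℝ d w.1 - w.2 * inner ℝ d ζ) - ‖w.1 - w.2 • ζ‖ ^ 2| := by fun_prop
  have c4 : Continuous fun w : Euc n × ℝ => ‖d + w.1 - w.2 • ζ‖ ^ 2 := by fun_prop
  filter_upwards [(c1.tendsto 0).eventually_le_const (u := 1) (by simp),
    (c2.tendsto 0).eventually_le_const (u := (k - ‖d‖ ^ 2) / 8) (by simpa using hq),
    (c3.tendsto 0).eventually_le_const (u := 1) (by simp),
    (c4.tendsto 0).eventually_lt_const (u := k) (by simpa using hq)] with w h1 h2 h3 h4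
  rw [max_eq_left (by linarith), mul_assoc E (Real.exp _)]
  refine mul_le_mul_of_nonneg_left ?_ hE
  have e1 : k - ‖d + w.1 - w.2 • ζ‖ ^ 2 = (k - ‖d‖ ^ 2) +
      (-2 * (inner ℝ d w.1 - w.2 * inner ℝ d ζ) - ‖w.1 - w.2 • ζ‖ ^ 2) := by
    have : d + w.1 - w.2 • ζ = d + (w.1 - w.2 • ζ) := by abel
    rw [this, norm_add_sq_real d, inner_sub_right, inner_smul_right]; ring
  rw [e1]
  have hex : 1 - N * w.2 ≤ Real.exp (-N * w.2) := by
    have := Real.add_one_le_exp (-N * w.2); linarith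
  refine le_trans ?_ (mul_le_mul_of_nonneg_right hex (sq_nonneg _))
  refine bump_expansion_scalar (Z := ‖ζ‖) (D := ‖d‖) hq hN rfl (norm_nonneg _) h1 ?_ h2 ?_ h3
  · have := norm_sub_le w.1 (w.2 • ζ)
    rw [norm_smul, Real.norm_eq_abs] at this
    calc ‖w.1 - w.2 • ζ‖ ^ 2 ≤ (‖w.1‖ + |w.2| * ‖ζ‖) ^ 2 := by gcongr
      _ ≤ 2 * ‖w.1‖ ^ 2 + 2 * (|w.2| ^ 2 * ‖ζ‖ ^ 2) := by
        nlinarith [sq_nonneg (‖w.1‖ - |w.2| * ‖ζ‖)]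
      _ = _ := by rw [sq_abs]; ring
  · have := abs_real_inner_le_norm d (w.1 - w.2 • ζ)
    rwa [inner_sub_right, inner_smul_right] at this

lemma sum_inner_sq_ge {A : Euc n →L[ℝ] Euc n} {c : ℝ} (hc : 0 < c) (hA : ∀ v, c * ‖v‖ ≤ ‖A v‖)
    (d : Euc n) : c ^ 2 * ‖d‖ ^ 2 ≤ ∑ i, inner ℝ d (A (stdb n i)) ^ 2 := by
  have hinj : Function.Injective (A : Euc n →ₗ[ℝ] Euc n) := by
    rw [injective_iff_map_eq_zero]
    intro v hv
    have := hA v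
    have h0 : A v = 0 := hv
    rw [h0, norm_zero] at this
    have : ‖v‖ ≤ 0 := by nlinarith [norm_nonneg v]
    exact norm_le_zero_iff.1 this
  obtain ⟨v, hv⟩ := LinearMap.surjective_of_injective hinj d
  have hv' : A v = d := hv
  have h1 : ∑ i, inner ℝ d (A (stdb n i)) ^ 2 = ‖ContinuousLinearMap.adjoint A d‖ ^ 2 := by
    have := (stdb n).sum_sq_norm_inner_left (ContinuousLinearMap.adjoint A d)
    simp only [ContinuousLinearMap.adjoint_inner_left] at this
    simpa using this
  rw [h1, ← mul_pow]
  refine pow_le_pow_left₀ (by positivity) ?_ 2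
  have h2 : ‖d‖ ^ 2 ≤ ‖ContinuousLinearMap.adjoint A d‖ * ‖v‖ := by
    rw [← real_inner_self_eq_norm_sq]
    nth_rewrite 2 [← hv']
    rw [← ContinuousLinearMap.adjoint_inner_left]
    exact real_inner_le_norm _ _
  have h3 := hA v
  rw [hv'] at h3
  rcases (norm_nonneg d).eq_or_lt with h | h
  · rw [← h]; simp
  · have : c * ‖d‖ ^ 2 ≤ ‖ContinuousLinearMap.adjoint A d‖ * ‖d‖ := by
      calc c * ‖d‖ ^ 2 ≤ c * (‖ContinuousLinearMap.adjoint A d‖ * ‖v‖) := by gcongr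
        _ = ‖ContinuousLinearMap.adjoint A d‖ * (c * ‖v‖) := by ring
        _ ≤ _ := by gcongr
    nlinarith

lemma isQuad_spread (d : Euc n) (a b c : ℝ) :
    IsQuad fun z : Euc n × Euc n => a * ‖z.1 - z.2‖ ^ 2 +
      b * (c * ‖z.2‖ ^ 2 - inner ℝ d z.2 ^ 2) := by
  have a1 := isQuad_norm_sq (LinearMap.fst ℝ (Euc n) (Euc n) - LinearMap.snd ℝ (Euc n) (Euc n))
  have a2 := isQuad_sq ((innerₛₗ ℝ d : Euc n →ₗ[ℝ] ℝ).comp (LinearMap.snd ℝ (Euc n) (Euc n)))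
  have a3 := isQuad_norm_sq (LinearMap.snd ℝ (Euc n) (Euc n))
  exact (a1.const_mul a).add (((a3.const_mul c).sub a2).const_mul b)

/-- Synchronous coupling against a moving bump. -/
lemma bump_coupling {σ : Euc n → Euc n →L[ℝ] Euc n} {G : Set (Euc n)} {M : ℝ}
    {Ω : Set (Euc n × ℝ)} {u : Euc n → ℝ → ℝ} (hu : VisSol σ G M Ω u) (hΩ : IsOpen Ω)
    (hG : IsOpen G) {c C L : ℝ} (hell : EllOn σ G c C L) (hc : 0 < c)
    {x y e' a d ζ : Euc n} {t s ε c' E k N τ Ct : ℝ}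
    (hx : (x, t) ∈ Ω) (hy : (y, t) ∈ Ω) (hs : 0 < s) (he' : ‖e'‖ = 1) (hxy : x - y = s • e')
    (hε : 0 ≤ ε) (hc' : 0 ≤ c') (hE : 0 ≤ E) (hN : 0 ≤ N) (hq : 0 < k - ‖d‖ ^ 2) (hτ : 0 ≤ τ)
    (hξ₁ : e' + (2 * ε * c') • (x - y - a) ∈ G)
    (hξ₂ : e' + (2 * ε * c') • (x - y - a) - (4 * ε * E * (k - ‖d‖ ^ 2)) • d ∈ G)
    (hmax : ∀ᶠ w in nhds (0 : Euc n × Euc n × ℝ),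
      u (x + w.1) (t + w.2.2) - u (y + w.2.1) (t + w.2.2) ≤ u x t - u y t +
        (‖x + w.1 - (y + w.2.1)‖ - s) + ε * c' * (‖x + w.1 - (y + w.2.1) - a‖ ^ 2 -
          ‖x - y - a‖ ^ 2) - ε * (E * Real.exp (-N * w.2.2) *
          max (k - ‖d + w.2.1 - w.2.2 • ζ‖ ^ 2) 0 ^ 2 - E * (k - ‖d‖ ^ 2) ^ 2) +
        τ * w.2.2 + Ct * w.2.2 ^ 2) :
    ε * E * (N * (k - ‖d‖ ^ 2) ^ 2 - 4 * (k - ‖d‖ ^ 2) * inner ℝ d ζ) ≤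
      n * (1 / s + 2 * (ε * c')) * L ^ 2 * (4 * ε * E * (k - ‖d‖ ^ 2) * ‖d‖) ^ 2 +
      2 * ε * E * (5 * (k - ‖d‖ ^ 2) * (n * C ^ 2) - c ^ 2 * ‖d‖ ^ 2) + 2 * M := by
  obtain ⟨Cb, hCb⟩ := bump_expansion hN hE hq (ζ := ζ)
  obtain ⟨q₀, hq₀⟩ : ∃ q₀, q₀ = k - ‖d‖ ^ 2 := ⟨_, rfl⟩
  simp only [← hq₀] at *
  obtain ⟨ξ₁, hξ₁d⟩ : ∃ ξ₁, ξ₁ = e' + (2 * ε * c') • (x - y - a) := ⟨_, rfl⟩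
  obtain ⟨ξ₂, hξ₂d⟩ : ∃ ξ₂, ξ₂ = ξ₁ - (4 * ε * E * q₀) • d := ⟨_, rfl⟩
  rw [← hξ₁d] at hξ₁ hξ₂
  rw [← hξ₂d] at hξ₂
  have ht : Tendsto (fun w : Euc n × Euc n × ℝ => w.2) (nhds 0) (nhds 0) :=
    (show Continuous fun w : Euc n × Euc n × ℝ => w.2 by fun_prop).tendsto 0
  have htp := two_point hu.sub hu.super hΩ hΩ hG (hG.preimage continuous_neg) hu.cont hu.cont.neg
    hx hy hξ₁ (ξ₂ := -ξ₂) (by simpa using hξ₂) (hell.continuousAt hG hξ₁)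
    (by
      have : ContinuousAt σ (- -ξ₂) := by simpa using hell.continuousAt hG hξ₂
      exact this.comp (f := fun ξ : Euc n => -ξ) continuous_neg.continuousAt)
    (isQuad_spread d (1 / s + 2 * (ε * c')) (2 * ε * E) (5 * q₀))
    (τ := τ - ε * E * (-N * q₀ ^ 2 + 4 * q₀ * inner ℝ d ζ)) (C := Ct + ε * E * Cb) (by
      filter_upwards [hmax, ht.eventually hCb] with w h1 h2
      have e1 : x + w.1 - (y + w.2.1) = x - y + (w.1 - w.2.1) := by abel
      have e2 : ‖x - y + (w.1 - w.2.1) - a‖ ^ 2 = ‖x - y - a‖ ^ 2 +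
          2 * inner ℝ (x - y - a) (w.1 - w.2.1) + ‖w.1 - w.2.1‖ ^ 2 := by
        rw [← norm_add_sq_real]; congr 2; abel
      rw [e1, e2] at h1
      have e3 := norm_add_le_expansion (d := w.1 - w.2.1) hs he' hxy
      have e4 : inner ℝ ξ₁ w.1 + inner ℝ (-ξ₂) w.2.1 = inner ℝ e' (w.1 - w.2.1) +
          2 * ε * c' * inner ℝ (x - y - a) (w.1 - w.2.1) + 4 * ε * E * q₀ * inner ℝ d w.2.1 := by
        rw [hξ₂d, hξ₁d, inner_neg_left, inner_sub_left, inner_smul_left d _ (4 * ε * E * q₀),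
          inner_add_left, inner_add_left, inner_smul_left, inner_smul_left, inner_sub_right,
          inner_sub_right]
        simp only [RCLike.conj_to_real]; ring
      have e5 := mul_le_mul_of_nonneg_left h2 hε
      have e6 : ‖w.1 - w.2.1‖ ^ 2 / (2 * s) = 1 / 2 * (1 / s * ‖w.1 - w.2.1‖ ^ 2) := by field_simp
      rw [e6] at e3
      linarith) (LinearIsometryEquiv.refl ℝ (Euc n))
  simp only [neg_neg, LinearIsometryEquiv.coe_refl, id] at htp
  have hdiff : ‖ξ₁ - ξ₂‖ = 4 * ε * E * q₀ * ‖d‖ := by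
    rw [hξ₂d, sub_sub_cancel, norm_smul, Real.norm_of_nonneg (by positivity)]
  have hσd : ∀ i, ‖σ ξ₁ (stdb n i) - σ ξ₂ (stdb n i)‖ ^ 2 ≤ L ^ 2 * (4 * ε * E * q₀ * ‖d‖) ^ 2 := by
    intro i
    have h1 := (σ ξ₁ - σ ξ₂).le_of_opNorm_le (hell.lip _ hξ₁ _ hξ₂) (stdb n i)
    rw [(stdb n).norm_eq_one, mul_one, hdiff, sub_apply] at h1
    rw [← mul_pow]; gcongr
  have hσ2 : ∀ i, ‖σ ξ₂ (stdb n i)‖ ^ 2 ≤ C ^ 2 := by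
    intro i
    have h1 := hell.upper _ hξ₂ (stdb n i)
    rw [(stdb n).norm_eq_one, mul_one] at h1
    gcongr
  have hlow := sum_inner_sq_ge hc (hell.lower _ hξ₂) d
  have hsum : ∑ i, ((1 / s + 2 * (ε * c')) * ‖σ ξ₁ (stdb n i) - σ ξ₂ (stdb n i)‖ ^ 2 +
      2 * ε * E * (5 * q₀ * ‖σ ξ₂ (stdb n i)‖ ^ 2 - inner ℝ d (σ ξ₂ (stdb n i)) ^ 2)) ≤
      n * (1 / s + 2 * (ε * c')) * L ^ 2 * (4 * ε * E * q₀ * ‖d‖) ^ 2 +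
      2 * ε * E * (5 * q₀ * (n * C ^ 2) - c ^ 2 * ‖d‖ ^ 2) := by
    have hεE : 0 ≤ 2 * ε * E := by positivity
    calc _ ≤ ∑ i, ((1 / s + 2 * (ε * c')) * (L ^ 2 * (4 * ε * E * q₀ * ‖d‖) ^ 2) +
          2 * ε * E * (5 * q₀ * C ^ 2 - inner ℝ d (σ ξ₂ (stdb n i)) ^ 2)) := by
          refine Finset.sum_le_sum fun i _ => ?_
          have := hσd i
          have := hσ2 i
          gcongr
      _ = n * (1 / s + 2 * (ε * c')) * L ^ 2 * (4 * ε * E * q₀ * ‖d‖) ^ 2 +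
          2 * ε * E * (5 * q₀ * (n * C ^ 2) - ∑ i, inner ℝ d (σ ξ₂ (stdb n i)) ^ 2) := by
          simp only [Finset.sum_add_distrib, Finset.sum_const, Finset.card_univ, Fintype.card_fin,
              nsmul_eq_mul, ← Finset.mul_sum, Finset.sum_sub_distrib]
          ring
      _ ≤ _ := by gcongr
  linarith

end Spread

section SpreadThm

variable {n : ℕ}

lemma spread_scalar {ε E N q Z c k L C M dz d2 s ρ nn : ℝ} (hε : 0 < ε) (hE : 0 < E) (hE1 : E ≤ 1)
    (hc : 0 < c) (hk : 0 < k) (hk1 : k ≤ 1) (hρ : 0 < ρ) (hs : ρ / 2 ≤ s) (hq : 0 < q)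
    (hqd : q = k - d2) (hd2 : 0 ≤ d2) (hdz : dz ≤ Z) (hnn : 0 ≤ nn) (hε1 : ε ≤ 1)
    (hεL : ε * (16 * nn * (2 / ρ + 2) * L ^ 2 + 1) ≤ c ^ 2)
    (hN : N = (c ^ 2 + (4 * Z + 10 * nn * C ^ 2)) ^ 2 / (2 * c ^ 2 * k))
    (h : ε * E * (N * q ^ 2 - 4 * q * dz) ≤ nn * (1 / s + 2 * (ε * k)) * L ^ 2 *
      ((4 * ε * E * q) ^ 2 * d2) + 2 * ε * E * (5 * q * (nn * C ^ 2) - c ^ 2 * d2) + 2 * M) :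
    ε * E * (c ^ 2 * k / 2) ≤ 2 * M := by
  have hs0 : 0 < s := by linarith
  have h1 : nn * (1 / s + 2 * (ε * k)) * L ^ 2 * ((4 * ε * E * q) ^ 2 * d2) ≤
      ε * E * (c ^ 2 * d2) := by
    have e1 : 1 / s + 2 * (ε * k) ≤ 2 / ρ + 2 := by
      have : 1 / s ≤ 2 / ρ := by rw [div_le_div_iff₀ hs0 hρ]; linarith
      have : ε * k ≤ 1 := mul_le_one₀ hε1 hk.le hk1
      linarith
    have e2 : nn * (2 / ρ + 2) * L ^ 2 * 16 * ε ≤ c ^ 2 := by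
      have := hε.le
      linarith
    have hq1 : q ≤ 1 := by linarith
    have e3 : E * q ^ 2 ≤ 1 := mul_le_one₀ hE1 (by positivity) (pow_le_one₀ hq.le hq1)
    calc nn * (1 / s + 2 * (ε * k)) * L ^ 2 * ((4 * ε * E * q) ^ 2 * d2)
        ≤ nn * (2 / ρ + 2) * L ^ 2 * ((4 * ε * E * q) ^ 2 * d2) := by gcongr
      _ = (nn * (2 / ρ + 2) * L ^ 2 * 16 * ε) * (E * q ^ 2) * (ε * E * d2) := by ring
      _ ≤ c ^ 2 * 1 * (ε * E * d2) := by gcongr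
      _ = _ := by ring
  have h2 : ε * E * (N * q ^ 2 - 4 * q * Z - 10 * q * (nn * C ^ 2) + c ^ 2 * d2) ≤ 2 * M := by
    have e1 : ε * E * (q * dz) ≤ ε * E * (q * Z) := by gcongr
    linarith
  refine le_trans ?_ h2
  refine mul_le_mul_of_nonneg_left ?_ (by positivity)
  have h3 : N * q ^ 2 - 4 * q * Z - 10 * q * (nn * C ^ 2) + c ^ 2 * d2 - c ^ 2 * k / 2 =
      ((c ^ 2 + (4 * Z + 10 * nn * C ^ 2)) * q - c ^ 2 * k) ^ 2 / (2 * c ^ 2 * k) := by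
    have : d2 = k - q := by linarith
    rw [hN, this]
    field_simp
    ring
  have : 0 ≤ ((c ^ 2 + (4 * Z + 10 * nn * C ^ 2)) * q - c ^ 2 * k) ^ 2 / (2 * c ^ 2 * k) := by
    positivity
  linarith

set_option maxHeartbeats 2000000 in
/-- A directional deficit of the Lipschitz bound spreads in space and forward in time. -/
theorem spread_deficit (n : ℕ) {c C L δ₀ τ ρ : ℝ} (hc : 0 < c) (hL : 0 ≤ L) (hδ₀ : 0 < δ₀)
    (hδ₀1 : δ₀ ≤ 1) (hτ : 0 < τ) (hτ1 : τ ≤ 1 / 4) (hρ : 0 < ρ) (hρ1 : ρ ≤ 1 / 8) :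
    ∃ δ' > 0, ∃ η > 0, ∀ (σ : Euc n → Euc n →L[ℝ] Euc n) (M : ℝ) (v : Euc n → ℝ → ℝ),
      EllOn σ {ξ | 1 / 4 < ‖ξ‖ ∧ ‖ξ‖ < 3} c C L → M ≤ η →
      VisSol σ {ξ | 1 / 4 < ‖ξ‖ ∧ ‖ξ‖ < 3} M (oCyl n 1) v → LipX 1 (oCyl n 1) v →
      ∀ e z₀, ‖e‖ = 1 → ‖z₀‖ ≤ 1 / 4 →
      v (z₀ + ρ • e) (-(2 * τ)) - v z₀ (-(2 * τ)) ≤ (1 - δ₀) * ρ →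
      ∀ z t, ‖z‖ < 1 / 16 → -τ < t → t < 0 → v (z + ρ • e) t - v z t ≤ (1 - δ') * ρ := by
  have hGo : IsOpen {ξ : Euc n | 1 / 4 < ‖ξ‖ ∧ ‖ξ‖ < 3} :=
    (isOpen_lt continuous_const continuous_norm).inter (isOpen_lt continuous_norm continuous_const)
  obtain ⟨κ, hκd⟩ : ∃ κ, κ = δ₀ * ρ / 8 := ⟨_, rfl⟩
  have hκ : 0 < κ := by rw [hκd]; positivity
  have hκ1 : κ ≤ ρ / 8 := by
    rw [hκd]; have : δ₀ * ρ ≤ 1 * ρ := by gcongr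
    linarith
  obtain ⟨k, hk⟩ : ∃ k, k = κ ^ 2 := ⟨_, rfl⟩
  have hk0 : 0 < k := by rw [hk]; positivity
  have hkκ : k ≤ κ := by rw [hk]; nlinarith
  obtain ⟨ε, hε⟩ : ∃ ε, ε = min (1 / 64) (c ^ 2 / (16 * n * (2 / ρ + 2) * L ^ 2 + 1)) := ⟨_, rfl⟩
  have hε0 : 0 < ε := by rw [hε]; positivity
  have hε1 : ε ≤ 1 / 64 := hε ▸ min_le_left _ _
  have hεL : ε * (16 * n * (2 / ρ + 2) * L ^ 2 + 1) ≤ c ^ 2 := by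
    rw [← le_div_iff₀ (by positivity), hε]; exact min_le_right _ _
  clear hε
  obtain ⟨N, hN⟩ : ∃ N, N = (c ^ 2 + (4 * (1 / τ) + 10 * n * C ^ 2)) ^ 2 / (2 * c ^ 2 * k) :=
    ⟨_, rfl⟩
  have hN0 : 0 ≤ N := by rw [hN]; positivity
  refine ⟨ε * Real.exp (-N * (2 * τ)) * k ^ 2 / ρ, by positivity,
    ε * Real.exp (-N * (2 * τ)) * (c ^ 2 * k) / 8, by positivity, ?_⟩
  intro σ M v hell hM hv hlip e z₀ he hz₀ hdef z ts hz hts hts0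
  obtain ⟨a, ha⟩ : ∃ a, a = ρ • e := ⟨_, rfl⟩
  have han : ‖a‖ = ρ := by rw [ha, norm_smul, he, mul_one, Real.norm_of_nonneg hρ.le]
  rw [← ha] at hdef ⊢
  by_contra! hcon
  obtain ⟨t₁, ht₁⟩ : ∃ t₁, t₁ = -(2 * τ) := ⟨_, rfl⟩
  rw [← ht₁] at hdef
  have hts1 : 0 < ts - t₁ := by linarith
  obtain ⟨ζ, hζ⟩ : ∃ ζ : Euc n, ζ = (ts - t₁)⁻¹ • (z - z₀) := ⟨_, rfl⟩
  have hzz : ‖z - z₀‖ ≤ 5 / 16 := by have := norm_sub_le z z₀; linarith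
  have hζn : ‖ζ‖ = (ts - t₁)⁻¹ * ‖z - z₀‖ := by
    rw [hζ, norm_smul, Real.norm_of_nonneg (by positivity)]
  have hζ1 : (ts - t₁) * ‖ζ‖ ≤ 5 / 16 := by
    rw [hζn, mul_inv_cancel_left₀ hts1.ne']; exact hzz
  have hζτ : ‖ζ‖ ≤ 1 / τ := by
    rw [le_div_iff₀ hτ]
    have : ‖ζ‖ * τ ≤ ‖ζ‖ * (ts - t₁) := by gcongr; linarith
    linarith
  obtain ⟨h, hh⟩ : ∃ h, h = min (-ts / 2) (τ / 5) := ⟨_, rfl⟩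
  have hh0 : 0 < h := by rw [hh]; exact lt_min (by linarith) (by positivity)
  have hh1 : h ≤ -ts / 2 := hh ▸ min_le_left _ _
  have hh2 : h ≤ τ / 5 := hh ▸ min_le_right _ _
  clear hh
  let A : Set (Euc n × Euc n) := {p | ‖p.2‖ ≤ 3 / 4 ∧ ‖p.1 - p.2 - a‖ ≤ κ}
  have hAx : ∀ p ∈ A, ‖p.1‖ < 1 := fun p hp => by
    have h1 : p.1 = (p.1 - p.2 - a) + a + p.2 := by abel
    have h2 := norm_add₃_le (a := p.1 - p.2 - a) (b := a) (c := p.2)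
    rw [← h1] at h2
    have := hp.1; have := hp.2; linarith
  have hA : IsCompact A := by
    have hcl : IsClosed A := by
      have h1 : Continuous fun p : Euc n × Euc n => ‖p.2‖ := by fun_prop
      have h2 : Continuous fun p : Euc n × Euc n => ‖p.1 - p.2 - a‖ := by fun_prop
      exact (isClosed_le h1 continuous_const).inter (isClosed_le h2 continuous_const)
    refine ((isCompact_closedBall 0 1).prod (isCompact_closedBall 0 1)).of_isClosed_subset
      hcl fun p hp => ⟨?_, ?_⟩
    · rw [mem_closedBall_zero_iff]; exact (hAx p hp).le
    · rw [mem_closedBall_zero_iff]; have := hp.1; linarith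
  have hΩ : ∀ p ∈ A, ∀ t ∈ Icc t₁ (ts + h), (p.1, t) ∈ oCyl n 1 ∧ (p.2, t) ∈ oCyl n 1 :=
    fun p hp t ht => by
      have b1 : -(1 : ℝ) ^ 2 < t := by have := ht.1; linarith
      have b2 : t < 0 := by have := ht.2; linarith
      exact ⟨⟨hAx p hp, b1, b2⟩, by have := hp.1; simp only; linarith, b1, b2⟩
  let F : Euc n × Euc n → ℝ → ℝ := fun p t => v p.1 t - v p.2 t - ‖p.1 - p.2‖ +
    ε * (Real.exp (-N * (t - t₁)) * max (k - ‖p.2 - z₀ - (t - t₁) • ζ‖ ^ 2) 0 ^ 2) -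
    ε * k * ‖p.1 - p.2 - a‖ ^ 2
  have hF : ContinuousOn (fun z : (Euc n × Euc n) × ℝ => F z.1 z.2) (A ×ˢ Icc t₁ (ts + h)) := by
    have c1 : ContinuousOn (fun z : (Euc n × Euc n) × ℝ => v z.1.1 z.2)
        (A ×ˢ Icc t₁ (ts + h)) :=
      hv.cont.comp (f := fun z : (Euc n × Euc n) × ℝ => (z.1.1, z.2))
        (Continuous.continuousOn (by fun_prop)) fun z hz => (hΩ _ hz.1 _ hz.2).1
    have c2 : ContinuousOn (fun z : (Euc n × Euc n) × ℝ => v z.1.2 z.2)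
        (A ×ˢ Icc t₁ (ts + h)) :=
      hv.cont.comp (f := fun z : (Euc n × Euc n) × ℝ => (z.1.2, z.2))
        (Continuous.continuousOn (by fun_prop)) fun z hz => (hΩ _ hz.1 _ hz.2).2
    exact (((c1.sub c2).sub (Continuous.continuousOn (by fun_prop))).add
      (Continuous.continuousOn (by fun_prop))).sub (Continuous.continuousOn (by fun_prop))
  have hp₀ : ((z + a, z) : Euc n × Euc n) ∈ A :=
    ⟨by simp only; linarith, by simpa using hκ.le⟩
  obtain ⟨Lt, hLt, ⟨x, y⟩, hxy, t, ht, hpos, hmax⟩ := exists_parabolic_max hA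
    (by linarith : t₁ ≤ ts) (by linarith : ts < ts + h) hF hp₀ (by
      have h1 : z - z₀ - (ts - t₁) • ζ = 0 := by
        rw [hζ, smul_smul, mul_inv_cancel₀ hts1.ne', one_smul, sub_self]
      simp only [F, h1, add_sub_cancel_left, han, sub_self, norm_zero]
      have h2 : max (k - 0 ^ 2) 0 = k := by rw [max_eq_left] <;> simp [hk0.le]
      rw [h2]
      have h3 : Real.exp (-N * (2 * τ)) ≤ Real.exp (-N * (ts - t₁)) := by
        rw [Real.exp_le_exp]
        exact mul_le_mul_of_nonpos_left (by linarith) (by linarith)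
      have h4 : ε * (Real.exp (-N * (2 * τ)) * k ^ 2) ≤ ε * (Real.exp (-N * (ts - t₁)) * k ^ 2) := by
        gcongr
      have h5 : (1 - ε * Real.exp (-N * (2 * τ)) * k ^ 2 / ρ) * ρ =
          ρ - ε * (Real.exp (-N * (2 * τ)) * k ^ 2) := by field_simp
      rw [h5] at hcon
      linarith)
  have htI : t ∈ Icc t₁ (ts + h) := ⟨ht.1, ht.2.le⟩
  have ht0 : t < 0 := by have := ht.2; linarith
  obtain ⟨hxΩ, hyΩ⟩ := hΩ _ hxy t htI
  simp only at hxΩ hyΩ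
  have hxya : ‖x - y - a‖ ≤ κ := hxy.2
  obtain ⟨d, hd⟩ : ∃ d, d = y - z₀ - (t - t₁) • ζ := ⟨_, rfl⟩
  obtain ⟨E, hE⟩ : ∃ E, E = Real.exp (-N * (t - t₁)) := ⟨_, rfl⟩
  have hE0 : 0 < E := hE ▸ Real.exp_pos _
  have hE1 : E ≤ 1 := by 
    rw [hE, Real.exp_le_one_iff]
    exact mul_nonpos_of_nonpos_of_nonneg (by linarith) (by linarith [ht.1])
  have hposF : 0 < v x t - v y t - ‖x - y‖ + ε * (E * max (k - ‖d‖ ^ 2) 0 ^ 2) -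
      ε * k * ‖x - y - a‖ ^ 2 := by rw [hE, hd]; exact hpos
  have hlipxy := hlip x y t hxΩ hyΩ
  have hn1 : 0 ≤ ε * k * ‖x - y - a‖ ^ 2 := by positivity
  have hq : 0 < k - ‖d‖ ^ 2 := by
    by_contra! hq
    rw [max_eq_right hq] at hposF
    linarith
  rw [max_eq_left hq.le] at hposF
  have hdκ : ‖d‖ < κ := by
    refine lt_of_pow_lt_pow_left₀ 2 hκ.le ?_
    rw [← hk]; linarith
  have hgk : E * (k - ‖d‖ ^ 2) ^ 2 ≤ 1 * k ^ 2 := by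
    have : k - ‖d‖ ^ 2 ≤ k := by linarith [sq_nonneg ‖d‖]
    gcongr
  have hxya' : ‖x - y - a‖ < κ := by
    refine lt_of_le_of_ne hxya fun h0 => ?_
    rw [h0, ← hk] at hposF
    have := mul_le_mul_of_nonneg_left hgk hε0.le
    linarith
  have hsl : ρ - κ ≤ ‖x - y‖ := by
    have := norm_sub_le (x - y) (x - y - a)
    rw [sub_sub_cancel, han] at this
    linarith
  have htt : t₁ < t := by
    refine lt_of_le_of_ne ht.1 fun h0 => ?_
    rw [← h0, sub_self, zero_smul, sub_zero] at hd
    rw [← h0] at hposF hxΩ hyΩ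
    have hz0Ω : (z₀, t₁) ∈ oCyl n 1 :=
      ⟨by simp only; linarith, by simp only; linarith, by simp only; linarith⟩
    have hz0aΩ : (z₀ + a, t₁) ∈ oCyl n 1 :=
      ⟨by have := norm_add_le z₀ a; simp only; linarith, by simp only; linarith, by simp only; linarith⟩
    have l1 := hlip x (z₀ + a) t₁ hxΩ hz0aΩ
    have l2 := hlip z₀ y t₁ hz0Ω hyΩ
    have l3 : ‖x - (z₀ + a)‖ ≤ 2 * κ := by
      have e1 : x - (z₀ + a) = (x - y - a) + d := by rw [hd]; abel
      rw [e1]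
      have := norm_add_le (x - y - a) d
      linarith
    have l4 : ‖z₀ - y‖ ≤ κ := by rw [norm_sub_rev, ← hd]; exact hdκ.le
    have l5 := mul_le_mul_of_nonneg_left hgk hε0.le
    have l6 : ε * (1 * k ^ 2) ≤ 1 * (1 * κ) := by
      have : k ^ 2 ≤ κ := (pow_le_of_le_one hk0.le (by linarith) two_ne_zero).trans hkκ
      gcongr
      linarith
    have l7 : δ₀ * ρ = 8 * κ := by rw [hκd]; ring
    linarith
  have hy34 : ‖y‖ < 3 / 4 := by
    have e1 : y = d + z₀ + (t - t₁) • ζ := by rw [hd]; abel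
    have e2 := norm_add₃_le (a := d) (b := z₀) (c := (t - t₁) • ζ)
    rw [← e1, norm_smul, Real.norm_of_nonneg (by linarith)] at e2
    have e3 : (t - t₁) * ‖ζ‖ ≤ (6 / 5 * (ts - t₁)) * ‖ζ‖ := by
      have := htI.2
      gcongr
      linarith
    linarith
  obtain ⟨s, hs⟩ : ∃ s, s = ‖x - y‖ := ⟨_, rfl⟩
  have hsρ : ρ / 2 ≤ s := by linarith
  have hs0 : 0 < s := by linarith
  obtain ⟨e', he'⟩ : ∃ e' : Euc n, e' = s⁻¹ • (x - y) := ⟨_, rfl⟩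
  have he'1 : ‖e'‖ = 1 := by
    rw [he', norm_smul, ← hs, Real.norm_of_nonneg (by positivity), inv_mul_cancel₀ hs0.ne']
  have hse : x - y = s • e' := by rw [he', smul_smul, mul_inv_cancel₀ hs0.ne', one_smul]
  have hopen : ∀ᶠ w in nhds (0 : Euc n × Euc n × ℝ), ‖y + w.2.1‖ < 3 / 4 ∧
      ‖x + w.1 - (y + w.2.1) - a‖ < κ ∧ t + w.2.2 ∈ Ioo t₁ (ts + h) := by
    have c1 : Continuous fun w : Euc n × Euc n × ℝ => ‖y + w.2.1‖ := by fun_prop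
    have c2 : Continuous fun w : Euc n × Euc n × ℝ => ‖x + w.1 - (y + w.2.1) - a‖ := by fun_prop
    have c3 : Continuous fun w : Euc n × Euc n × ℝ => t + w.2.2 := by fun_prop
    refine ((c1.tendsto 0).eventually_lt_const (by simpa using hy34)).and
      (((c2.tendsto 0).eventually_lt_const (by simpa using hxya')).and
      ((c3.tendsto 0).eventually_mem (Ioo_mem_nhds ?_ ?_)))
    · simpa using htt
    · simpa using ht.2
  have hdc : ‖(2 * ε * k) • (x - y - a)‖ ≤ 1 / 16 := by
    rw [norm_smul, Real.norm_of_nonneg (by positivity)]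
    calc 2 * ε * k * ‖x - y - a‖ ≤ 2 * (1 / 64) * 1 * 1 := by gcongr <;> linarith
      _ ≤ _ := by norm_num
  have hdd : ‖(4 * ε * E * (k - ‖d‖ ^ 2)) • d‖ ≤ 1 / 16 := by
    rw [norm_smul, Real.norm_of_nonneg (by positivity)]
    calc 4 * ε * E * (k - ‖d‖ ^ 2) * ‖d‖ ≤ 4 * (1 / 64) * 1 * 1 * 1 := by
          gcongr
          · linarith [sq_nonneg ‖d‖]
          · linarith
      _ ≤ _ := by norm_num
  have hG1 : e' + (2 * ε * k) • (x - y - a) ∈ {ξ : Euc n | 1 / 4 < ‖ξ‖ ∧ ‖ξ‖ < 3} := by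
    have g1 := norm_add_le e' ((2 * ε * k) • (x - y - a))
    have g2 := norm_sub_le (e' + (2 * ε * k) • (x - y - a)) ((2 * ε * k) • (x - y - a))
    rw [add_sub_cancel_right] at g2
    constructor <;> linarith
  have hG2 : e' + (2 * ε * k) • (x - y - a) - (4 * ε * E * (k - ‖d‖ ^ 2)) • d ∈
      {ξ : Euc n | 1 / 4 < ‖ξ‖ ∧ ‖ξ‖ < 3} := by
    obtain ⟨ξ₁, hξ₁⟩ : ∃ ξ₁, ξ₁ = e' + (2 * ε * k) • (x - y - a) := ⟨_, rfl⟩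
    have g1 := norm_add_le e' ((2 * ε * k) • (x - y - a))
    have g2 := norm_sub_le (e' + (2 * ε * k) • (x - y - a)) ((2 * ε * k) • (x - y - a))
    rw [add_sub_cancel_right] at g2
    rw [← hξ₁] at g1 g2 ⊢
    have g3 := norm_sub_le ξ₁ ((4 * ε * E * (k - ‖d‖ ^ 2)) • d)
    have g4 := norm_add_le (ξ₁ - (4 * ε * E * (k - ‖d‖ ^ 2)) • d) ((4 * ε * E * (k - ‖d‖ ^ 2)) • d)
    rw [sub_add_cancel] at g4
    constructor <;> linarith
  have hbc := bump_coupling hv (isOpen_oCyl 1) hGo hell hc hxΩ hyΩ hs0 he'1 hse hε0.le hk0.le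
    hE0.le hN0 hq (τ := 2 * Lt * max (t - ts) 0) (Ct := Lt) (by positivity) hG1 hG2 (ζ := ζ) (by
      filter_upwards [hopen] with w hw
      have := hmax (x + w.1, y + w.2.1) ⟨hw.1.le, hw.2.1.le⟩ (t + w.2.2) ⟨hw.2.2.1.le, hw.2.2.2.le⟩
      have e1 : Real.exp (-N * (t + w.2.2 - t₁)) = E * Real.exp (-N * w.2.2) := by
        rw [hE, ← Real.exp_add]; congr 1; ring
      have e2 : y + w.2.1 - z₀ - (t + w.2.2 - t₁) • ζ = d + w.2.1 - w.2.2 • ζ := by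
        rw [hd]; module
      simp only [F, ← hs, e1, e2, ← hd, ← hE, max_eq_left hq.le] at this
      linarith)
  rw [mul_pow (4 * ε * E * (k - ‖d‖ ^ 2))] at hbc
  have hdz : inner ℝ d ζ ≤ 1 / τ := by
    refine (real_inner_le_norm d ζ).trans ?_
    have : ‖d‖ ≤ 1 := by linarith
    calc ‖d‖ * ‖ζ‖ ≤ 1 * (1 / τ) := by gcongr
      _ = _ := one_mul _
  have hfin := spread_scalar hε0 hE0 hE1 hc hk0 (by linarith) hρ hsρ hq rfl (sq_nonneg _) hdz
    (Nat.cast_nonneg n) (by linarith) hεL hN hbc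
  have hEl : Real.exp (-N * (2 * τ)) ≤ E := by
    rw [hE, Real.exp_le_exp]
    exact mul_le_mul_of_nonpos_left (by linarith [htI.2]) (by linarith)
  have hpos8 : 0 < ε * Real.exp (-N * (2 * τ)) * (c ^ 2 * k) := by positivity
  have : ε * Real.exp (-N * (2 * τ)) * (c ^ 2 * k / 2) ≤ ε * E * (c ^ 2 * k / 2) := by gcongr
  linarith

end SpreadThm

section Scaling

variable {n : ℕ}

/-- Parabolic comparison with paraboloids of moderate slope. -/
def VisPara (Λ g M : ℝ) (Ω : Set (Euc n × ℝ)) (u : Euc n → ℝ → ℝ) : Prop :=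
  ∀ x t, (x, t) ∈ Ω → ∀ ξ : Euc n, ‖ξ‖ ≤ g → ∀ τ C B : ℝ, 0 ≤ B →
    (∀ᶠ w in nhds (0 : Euc n × ℝ), u (x + w.1) (t + w.2) ≤
      u x t + τ * w.2 + C * w.2 ^ 2 + inner ℝ ξ w.1 + B * ‖w.1‖ ^ 2) →
    τ ≤ Λ * B + M

/-- Affine parabolic rescaling. -/
def rescale (u : Euc n → ℝ → ℝ) (x₀ : Euc n) (t₀ r θ μ : ℝ) (ℓ : Euc n) (c : ℝ) :
    Euc n → ℝ → ℝ :=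
  fun x t => (u (x₀ + r • x) (t₀ + θ * t) - r * inner ℝ ℓ x - c) / (r * μ)

lemma jet_rescale {u : Euc n → ℝ → ℝ} {x₀ ℓ : Euc n} {t₀ r θ μ c : ℝ} (hr : 0 < r) (hθ : 0 < θ)
    (hμ : 0 < μ) {x ξ : Euc n} {t τ C : ℝ} {Q : Euc n → ℝ}
    (h : ∀ᶠ w in nhds (0 : Euc n × ℝ), rescale u x₀ t₀ r θ μ ℓ c (x + w.1) (t + w.2) ≤
      rescale u x₀ t₀ r θ μ ℓ c x t + τ * w.2 + C * w.2 ^ 2 + inner ℝ ξ w.1 + Q w.1) :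
    ∀ᶠ w in nhds (0 : Euc n × ℝ), u (x₀ + r • x + w.1) (t₀ + θ * t + w.2) ≤
      u (x₀ + r • x) (t₀ + θ * t) + (r * μ * τ / θ) * w.2 + (r * μ * C / θ ^ 2) * w.2 ^ 2 +
        inner ℝ (ℓ + μ • ξ) w.1 + r * μ * Q (r⁻¹ • w.1) := by
  have hc : Continuous fun w : Euc n × ℝ => ((r⁻¹ • w.1, θ⁻¹ * w.2) : Euc n × ℝ) := by fun_prop
  have h0 : Tendsto (fun w : Euc n × ℝ => ((r⁻¹ • w.1, θ⁻¹ * w.2) : Euc n × ℝ)) (nhds 0)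
      (nhds 0) := hc.tendsto' 0 0 (by simp [Prod.ext_iff])
  filter_upwards [h0.eventually h] with w hw
  simp only [rescale] at hw
  have e1 : x₀ + r • (x + r⁻¹ • w.1) = x₀ + r • x + w.1 := by
    rw [smul_add, smul_smul, mul_inv_cancel₀ hr.ne', one_smul, add_assoc]
  have e2 : t₀ + θ * (t + θ⁻¹ * w.2) = t₀ + θ * t + w.2 := by field_simp; ring
  rw [e1, e2, inner_add_right, inner_smul_right, inner_smul_right] at hw
  have hrμ : 0 < r * μ := by positivity
  have := mul_le_mul_of_nonneg_left hw hrμ.le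
  rw [mul_div_cancel₀ _ hrμ.ne'] at this
  rw [inner_add_left, inner_smul_left, RCLike.conj_to_real]
  have e3 : r * μ * ((u (x₀ + r • x) (t₀ + θ * t) - r * inner ℝ ℓ x - c) / (r * μ) +
      τ * (θ⁻¹ * w.2) + C * (θ⁻¹ * w.2) ^ 2 + r⁻¹ * inner ℝ ξ w.1 + Q (r⁻¹ • w.1)) =
      u (x₀ + r • x) (t₀ + θ * t) - r * inner ℝ ℓ x - c + r * μ * τ / θ * w.2 +
      r * μ * C / θ ^ 2 * w.2 ^ 2 + μ * inner ℝ ξ w.1 + r * μ * Q (r⁻¹ • w.1) := by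
    field_simp
  rw [e3] at this
  have e4 : r * (inner ℝ ℓ x + r⁻¹ * inner ℝ ℓ w.1) = r * inner ℝ ℓ x + inner ℝ ℓ w.1 := by
    field_simp
  rw [e4] at this
  linarith

lemma trQ_smul (X σ : Euc n →L[ℝ] Euc n) (a b : ℝ) :
    trQ (a • X) (b • σ) = a * b ^ 2 * trQ X σ := by
  simp only [trQ, smul_apply, map_smul, inner_smul_left, inner_smul_right,
    RCLike.conj_to_real, Finset.mul_sum]
  exact Finset.sum_congr rfl fun i _ => by ring

lemma VisSub.rescale {σ : Euc n → Euc n →L[ℝ] Euc n} {G : Set (Euc n)} {M : ℝ}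
    {Ω : Set (Euc n × ℝ)} {u : Euc n → ℝ → ℝ} (h : VisSub σ G M Ω u) {r θ μ : ℝ} (hr : 0 < r)
    (hθ : 0 < θ) (hμ : 0 < μ) (x₀ : Euc n) (t₀ : ℝ) (ℓ : Euc n) (c : ℝ) :
    VisSub (fun ξ => (Real.sqrt θ / r) • σ (ℓ + μ • ξ)) {ξ | ℓ + μ • ξ ∈ G} (M * θ / (r * μ))
      {z | (x₀ + r • z.1, t₀ + θ * z.2) ∈ Ω} (rescale u x₀ t₀ r θ μ ℓ c) := by
  intro x t hz ξ hξ τ C X hjet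
  have h1 := h _ _ hz _ hξ (r * μ * τ / θ) (r * μ * C / θ ^ 2) ((μ / r) • X) (by
    filter_upwards [jet_rescale hr hθ hμ (Q := fun a => 1 / 2 * inner ℝ (X a) a) hjet] with w hw
    refine hw.trans_eq ?_
    simp only [map_smul, inner_smul_left, inner_smul_right, RCLike.conj_to_real,
      smul_apply]
    field_simp)
  have h2 : trQ X ((Real.sqrt θ / r) • σ (ℓ + μ • ξ)) = θ / r ^ 2 * trQ X (σ (ℓ + μ • ξ)) := by
    have := trQ_smul X (σ (ℓ + μ • ξ)) 1 (Real.sqrt θ / r)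
    rw [one_smul, div_pow, Real.sq_sqrt hθ.le, one_mul] at this
    exact this
  have h3 := trQ_smul X (σ (ℓ + μ • ξ)) (μ / r) 1
  rw [one_smul] at h3
  rw [h3] at h1
  rw [h2]
  have h4 : 0 < θ / (r * μ) := by positivity
  have h5 := mul_le_mul_of_nonneg_left h1 h4.le
  have e1 : θ / (r * μ) * (r * μ * τ / θ) = τ := by field_simp
  have e2 : θ / (r * μ) * (μ / r * 1 ^ 2 * trQ X (σ (ℓ + μ • ξ)) + M) =
      θ / r ^ 2 * trQ X (σ (ℓ + μ • ξ)) + M * θ / (r * μ) := by field_simp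
  linarith

lemma neg_rescale (u : Euc n → ℝ → ℝ) (x₀ : Euc n) (t₀ r θ μ : ℝ) (ℓ : Euc n) (c : ℝ) :
    (fun x t => -rescale u x₀ t₀ r θ μ ℓ c x t) =
      rescale (fun x t => -u x t) x₀ t₀ r θ μ (-ℓ) (-c) := by
  funext x t
  simp only [rescale, inner_neg_left, ← neg_div]
  congr 1
  ring

lemma VisSol.rescale {σ : Euc n → Euc n →L[ℝ] Euc n} {G : Set (Euc n)} {M : ℝ}
    {Ω : Set (Euc n × ℝ)} {u : Euc n → ℝ → ℝ} (h : VisSol σ G M Ω u) {r θ μ : ℝ} (hr : 0 < r)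
    (hθ : 0 < θ) (hμ : 0 < μ) (x₀ : Euc n) (t₀ : ℝ) (ℓ : Euc n) (c : ℝ) :
    VisSol (fun ξ => (Real.sqrt θ / r) • σ (ℓ + μ • ξ)) {ξ | ℓ + μ • ξ ∈ G} (M * θ / (r * μ))
      {z | (x₀ + r • z.1, t₀ + θ * z.2) ∈ Ω} (rescale u x₀ t₀ r θ μ ℓ c) := by
  refine ⟨h.sub.rescale hr hθ hμ x₀ t₀ ℓ c, ?_, ?_⟩
  · have e := h.super.rescale hr hθ hμ x₀ t₀ (-ℓ) (-c)
    rw [neg_rescale]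
    have e1 : ∀ ξ : Euc n, -(-ℓ + μ • ξ) = ℓ + μ • (-ξ) := fun ξ => by rw [smul_neg]; abel
    simp only [e1, mem_ofPred_eq] at e
    exact e
  · have c1 : ContinuousOn (fun z : Euc n × ℝ => u (x₀ + r • z.1) (t₀ + θ * z.2))
        {z | (x₀ + r • z.1, t₀ + θ * z.2) ∈ Ω} :=
      h.cont.comp (f := fun z : Euc n × ℝ => (x₀ + r • z.1, t₀ + θ * z.2))
        (Continuous.continuousOn (by fun_prop)) fun z hz => hz
    exact ((c1.sub (Continuous.continuousOn (by fun_prop))).sub continuousOn_const).div_const _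

lemma VisPara.rescale {Λ g g' M : ℝ} {Ω : Set (Euc n × ℝ)} {u : Euc n → ℝ → ℝ}
    (h : VisPara Λ g M Ω u) {r θ μ : ℝ} (hr : 0 < r)
    (hθ : 0 < θ) (hμ : 0 < μ) (x₀ : Euc n) (t₀ : ℝ) (ℓ : Euc n) (c : ℝ) (hg : ‖ℓ‖ + μ * g' ≤ g) :
    VisPara (Λ * θ / r ^ 2) g' (M * θ / (r * μ))
      {z | (x₀ + r • z.1, t₀ + θ * z.2) ∈ Ω} (rescale u x₀ t₀ r θ μ ℓ c) := by
  intro x t hz ξ hξ τ C B hB hjet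
  have h1 := h _ _ hz (ℓ + μ • ξ) (by
    refine (norm_add_le _ _).trans ?_
    rw [norm_smul, Real.norm_of_nonneg hμ.le]
    have := mul_le_mul_of_nonneg_left hξ hμ.le
    linarith) (r * μ * τ / θ) (r * μ * C / θ ^ 2) (μ / r * B) (by positivity) (by
    filter_upwards [jet_rescale hr hθ hμ (Q := fun a => B * ‖a‖ ^ 2) hjet] with w hw
    refine hw.trans_eq ?_
    simp only [norm_smul, norm_inv, Real.norm_of_nonneg hr.le]
    field_simp)
  have h4 : 0 < θ / (r * μ) := by positivity
  have h5 := mul_le_mul_of_nonneg_left h1 h4.le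
  have e1 : θ / (r * μ) * (r * μ * τ / θ) = τ := by field_simp
  have e2 : θ / (r * μ) * (Λ * (μ / r * B) + M) = Λ * θ / r ^ 2 * B + M * θ / (r * μ) := by
    field_simp
  linarith

lemma VisSub.mono {σ : Euc n → Euc n →L[ℝ] Euc n} {G G' : Set (Euc n)} {M M' : ℝ}
    {Ω Ω' : Set (Euc n × ℝ)} {u : Euc n → ℝ → ℝ} (h : VisSub σ G M Ω u) (hG : G' ⊆ G)
    (hM : M ≤ M') (hΩ : Ω' ⊆ Ω) : VisSub σ G' M' Ω' u := fun x t hz ξ hξ τ C X hj =>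
  (h x t (hΩ hz) ξ (hG hξ) τ C X hj).trans (by linarith)

lemma VisSol.mono {σ : Euc n → Euc n →L[ℝ] Euc n} {G G' : Set (Euc n)} {M M' : ℝ}
    {Ω Ω' : Set (Euc n × ℝ)} {u : Euc n → ℝ → ℝ} (h : VisSol σ G M Ω u) (hG : G' ⊆ G)
    (hM : M ≤ M') (hΩ : Ω' ⊆ Ω) : VisSol σ G' M' Ω' u :=
  ⟨h.sub.mono hG hM hΩ, h.super.mono (fun _ hξ => hG hξ) hM hΩ, h.cont.mono hΩ⟩

lemma VisPara.mono {Λ Λ' g g' M M' : ℝ} {Ω Ω' : Set (Euc n × ℝ)} {u : Euc n → ℝ → ℝ}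
    (h : VisPara Λ g M Ω u) (hΛ : Λ ≤ Λ') (hg : g' ≤ g) (hM : M ≤ M') (hΩ : Ω' ⊆ Ω) :
    VisPara Λ' g' M' Ω' u := fun x t hz ξ hξ τ C B hB hj =>
  (h x t (hΩ hz) ξ (hξ.trans hg) τ C B hB hj).trans (by gcongr)

/-- Upward propagation in time of an affine upper bound. -/
lemma upper_barrier {Λ M N : ℝ} {v : Euc n → ℝ → ℝ}
    (hN : Λ * 16 + M < N)
    (hv : VisPara Λ 5 M (oCyl n 1) v) (hcont : ContinuousOn (fun z => v z.1 z.2) (oCyl n 1))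
    (hlip : LipX 1 (oCyl n 1) v) {e : Euc n} (he : ‖e‖ = 1) {t₁ c₀ : ℝ} (ht₁ : -1 < t₁)
    (hinit : ∀ x, ‖x‖ ≤ 1 / 4 → v x t₁ ≤ c₀ + inner ℝ e x + 16 * ‖x‖ ^ 2)
    {x' : Euc n} {t' : ℝ} (hx' : ‖x'‖ ≤ 1 / 4) (ht'1 : t₁ ≤ t') (ht'0 : t' < 0) :
    v x' t' ≤ c₀ + inner ℝ e x' + 16 * ‖x'‖ ^ 2 + N * (t' - t₁) := by
  by_contra! hcon
  let F : Euc n → ℝ → ℝ := fun x t => v x t - c₀ - inner ℝ e x - 16 * ‖x‖ ^ 2 - N * (t - t₁)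
  have hΩ : ∀ x : Euc n, ‖x‖ ≤ 1 / 4 → ∀ t ∈ Icc t₁ (t' / 2), (x, t) ∈ oCyl n 1 :=
    fun x hx t ht => ⟨by simp only; linarith, by have := ht.1; simp only; linarith,
      by have := ht.2; simp only; linarith⟩
  have hF : ContinuousOn (fun z : Euc n × ℝ => F z.1 z.2)
      (closedBall 0 (1 / 4) ×ˢ Icc t₁ (t' / 2)) := by
    have c1 : ContinuousOn (fun z : Euc n × ℝ => v z.1 z.2)
        (closedBall 0 (1 / 4) ×ˢ Icc t₁ (t' / 2)) :=
      hcont.mono fun z hz => hΩ z.1 (by simpa using hz.1) z.2 hz.2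
    exact (((c1.sub continuousOn_const).sub (Continuous.continuousOn (by fun_prop))).sub
      (Continuous.continuousOn (by fun_prop))).sub (Continuous.continuousOn (by fun_prop))
  obtain ⟨P, hP, x, hx, t, ht, hpos, hmax⟩ := exists_parabolic_max (isCompact_closedBall 0 (1 / 4))
    ht'1 (by linarith : t' < t' / 2) hF (p₀ := x') (by simpa using hx') (by
      simp only [F]; linarith)
  rw [mem_closedBall_zero_iff] at hx
  have htI : t ∈ Icc t₁ (t' / 2) := ⟨ht.1, ht.2.le⟩
  have ht1 : t₁ < t := by
    refine lt_of_le_of_ne ht.1 fun h0 => ?_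
    have := hinit x hx
    simp only [F, ← h0] at hpos
    linarith
  have hx8 : ‖x‖ ≤ 1 / 8 := by
    have h1 := hmax 0 (by simp) t htI
    simp only [F, inner_zero_right, norm_zero, sub_self] at h1
    have h2 := hlip x 0 t (hΩ x hx t htI) (hΩ 0 (by simp) t htI)
    rw [sub_zero] at h2
    have h3 : -‖x‖ ≤ inner ℝ e x := by
      have := abs_real_inner_le_norm e x
      rw [he, one_mul] at this
      exact (abs_le.1 this).1
    have h4 : 16 * ‖x‖ ^ 2 ≤ 2 * ‖x‖ := by linarith
    by_contra! h5
    nlinarith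
  have hnb : ∀ᶠ w in nhds (0 : Euc n × ℝ), ‖x + w.1‖ < 1 / 4 ∧ t + w.2 ∈ Ioo t₁ (t' / 2) := by
    have c2 : Continuous fun w : Euc n × ℝ => ‖x + w.1‖ := by fun_prop
    have c3 : Continuous fun w : Euc n × ℝ => t + w.2 := by fun_prop
    refine ((c2.tendsto 0).eventually_lt_const (u := 1 / 4) ?_).and
      ((c3.tendsto 0).eventually_mem (Ioo_mem_nhds ?_ ?_))
    · simp only [Prod.fst_zero, add_zero]; linarith
    · simpa using ht1
    · simpa using ht.2
  have := hv x t (hΩ x hx t htI) (e + (32 : ℝ) • x) (by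
    refine (norm_add_le _ _).trans ?_
    rw [norm_smul, he, Real.norm_of_nonneg (by norm_num)]
    linarith) (N + 2 * P * max (t - t') 0) P 16 (by norm_num) (by
    filter_upwards [hnb] with w hw
    have h1 := hmax (x + w.1) (by simpa using hw.1.le) (t + w.2) ⟨hw.2.1.le, hw.2.2.le⟩
    simp only [F, norm_add_sq_real, inner_add_right] at h1
    rw [inner_add_left, inner_smul_left, RCLike.conj_to_real]
    linarith)
  have h2 : 0 ≤ 2 * P * max (t - t') 0 := by positivity
  linarith

end Scaling

section OneStep

variable {n : ℕ}

lemma norm_add_smul_le_affine {e x : Euc n} {R : ℝ} (hR : 0 < R) (he : ‖e‖ = 1) :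
    ‖x + R • e‖ ≤ R + inner ℝ e x + ‖x‖ ^ 2 / (2 * R) := by
  have h1 : ‖x + R • e‖ ^ 2 = R ^ 2 + 2 * R * inner ℝ e x + ‖x‖ ^ 2 := by
    rw [norm_add_sq_real, inner_smul_right, norm_smul, he, Real.norm_of_nonneg hR.le,
      real_inner_comm x e]
    ring
  have h2 : 2 * R * ‖x + R • e‖ ≤ ‖x + R • e‖ ^ 2 + R ^ 2 := by
    linarith [sq_nonneg (‖x + R • e‖ - R)]
  have h3 : R + inner ℝ e x + ‖x‖ ^ 2 / (2 * R) =
      (2 * R ^ 2 + 2 * R * inner ℝ e x + ‖x‖ ^ 2) / (2 * R) := by field_simp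
  rw [h3, le_div_iff₀ (by positivity)]
  linarith

lemma chain_increment {g : Euc n → ℝ} {e : Euc n} {ρ a : ℝ} {m : ℕ}
    (x : Euc n) (h : ∀ j : ℕ, j < m → a ≤ g (x + (j * ρ) • e + ρ • e) - g (x + (j * ρ) • e)) :
    m * a ≤ g (x + (m * ρ) • e) - g x := by
  induction m with
  | zero => simp
  | succ m ih =>
    have h1 := ih fun j hj => h j (hj.trans (Nat.lt_succ_self m))
    have h2 := h m (Nat.lt_succ_self m)
    have e1 : x + ((m + 1 : ℕ) * ρ) • e = x + (m * ρ) • e + ρ • e := by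
      push_cast; rw [add_assoc, ← add_smul]; congr 2; ring
    rw [e1]
    push_cast
    linarith

/-- A unit-speed function without directional deficit is close to affine. -/
lemma affine_of_no_deficit {g : Euc n → ℝ} {e : Euc n} {ρ δ₀ : ℝ} {m : ℕ} (hρ : 0 < ρ)
    (hm : m * ρ = 1 / 4) (he : ‖e‖ = 1)
    (hg : ∀ x y, ‖x‖ ≤ 1 / 4 → ‖y‖ ≤ 1 / 4 → g x - g y ≤ ‖x - y‖)
    (hno : ∀ z, ‖z‖ ≤ 1 / 4 → (1 - δ₀) * ρ ≤ g (z + ρ • e) - g z) {x : Euc n}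
    (hx : ‖x‖ ≤ 1 / 4) :
    |g x - g 0 - inner ℝ e x| ≤ δ₀ / 4 + 2 * ‖x‖ ^ 2 := by
  have hne : ∀ s : ℝ, ‖s • e‖ = |s| := fun s => by rw [norm_smul, he, mul_one, Real.norm_eq_abs]
  have h1 : (1 - δ₀) * (1 / 4) ≤ g ((1 / 4 : ℝ) • e) - g 0 := by
    have := chain_increment (m := m) (0 : Euc n) (e := e) (ρ := ρ) (g := g) fun j hj => hno _ (by
      rw [zero_add, hne, abs_of_nonneg (by positivity), ← hm]
      gcongr)
    rw [hm, zero_add, ← mul_assoc, mul_comm _ (1 - δ₀), mul_assoc, hm] at this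
    exact this
  have h2 : (1 - δ₀) * (1 / 4) ≤ g 0 - g ((-(1 / 4) : ℝ) • e) := by
    have := chain_increment (m := m) ((-(1 / 4) : ℝ) • e) (e := e) (ρ := ρ) (g := g) fun j hj =>
      hno _ (by
      have hj1 : (j : ℝ) * ρ ≤ 1 / 4 := by rw [← hm]; gcongr
      have hj2 : 0 ≤ (j : ℝ) * ρ := by positivity
      rw [← add_smul, hne, abs_le]
      constructor <;> linarith)
    rw [hm, ← mul_assoc, mul_comm _ (1 - δ₀), mul_assoc, hm, ← add_smul, neg_add_cancel,
      zero_smul] at this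
    exact this
  have h3 := hg x ((-(1 / 4) : ℝ) • e) hx (by rw [hne]; norm_num)
  have h4 := hg ((1 / 4 : ℝ) • e) x (by rw [hne]; norm_num) hx
  have h5 := norm_add_smul_le_affine (x := x) (R := 1 / 4) (by norm_num) he
  have h6 := norm_add_smul_le_affine (x := -x) (R := 1 / 4) (by norm_num) he
  rw [inner_neg_right, norm_neg] at h6
  have e1 : x - (-(1 / 4) : ℝ) • e = x + (1 / 4 : ℝ) • e := by rw [neg_smul, sub_neg_eq_add]
  have e2 : (1 / 4 : ℝ) • e - x = -x + (1 / 4 : ℝ) • e := by abel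
  rw [e1] at h3
  rw [e2] at h4
  have h7 : ‖x‖ ^ 2 / (2 * (1 / 4)) = 2 * ‖x‖ ^ 2 := by ring
  rw [h7] at h5 h6
  rw [abs_le]
  constructor <;> linarith

/-- Affine approximation forward in time. -/
lemma affine_forward {Λ M N : ℝ} {v : Euc n → ℝ → ℝ} (hN : Λ * 16 + M < N)
    (hv : VisPara Λ 5 M (oCyl n 1) v) (hv' : VisPara Λ 5 M (oCyl n 1) fun x t => -v x t)
    (hcont : ContinuousOn (fun z => v z.1 z.2) (oCyl n 1))
    (hlip : LipX 1 (oCyl n 1) v) {e : Euc n} (he : ‖e‖ = 1) {t₁ c₀ a : ℝ} (ht₁ : -1 < t₁)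
    (hinit : ∀ x, ‖x‖ ≤ 1 / 4 → |v x t₁ - c₀ - inner ℝ e x| ≤ a + 2 * ‖x‖ ^ 2)
    {x : Euc n} {t : ℝ} (hx : ‖x‖ ≤ 1 / 4) (ht1 : t₁ ≤ t) (ht0 : t < 0) :
    |v x t - c₀ - inner ℝ e x| ≤ a + 16 * ‖x‖ ^ 2 + N * (t - t₁) := by
  have h1 := upper_barrier hN hv hcont hlip he (c₀ := c₀ + a) ht₁ (fun y hy => by
    have := (abs_le.1 (hinit y hy)).2
    linarith [sq_nonneg ‖y‖]) hx ht1 ht0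
  have h2 := upper_barrier hN hv' hcont.neg (fun x y t hx hy => by
    have := hlip y x t hy hx
    rw [norm_sub_rev] at this
    linarith) (by rw [norm_neg, he] : ‖-e‖ = 1) (c₀ := -c₀ + a) ht₁ (fun y hy => by
    have := (abs_le.1 (hinit y hy)).1
    rw [inner_neg_left]
    linarith [sq_nonneg ‖y‖]) hx ht1 ht0
  rw [inner_neg_left] at h2
  rw [abs_le]
  constructor <;> linarith

lemma annulus_of_near_unit {e ξ : Euc n} (he : ‖e‖ = 1) (hξ : ‖ξ‖ < 6) :
    1 / 4 < ‖e + (1 / 8 : ℝ) • ξ‖ ∧ ‖e + (1 / 8 : ℝ) • ξ‖ < 3 := by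
  have h1 := norm_add_le e ((1 / 8 : ℝ) • ξ)
  have h2 := norm_sub_le (e + (1 / 8 : ℝ) • ξ) ((1 / 8 : ℝ) • ξ)
  rw [add_sub_cancel_right] at h2
  rw [norm_smul, Real.norm_of_nonneg (by norm_num : (0 : ℝ) ≤ 1 / 8)] at h1 h2
  constructor <;> linarith

/-- Slope improvement close to a unit-slope affine function. -/
lemma lip_of_near_affine (n : ℕ) {c C L : ℝ} (hc : 0 < c) (hL : 0 ≤ L) :
    ∃ η' > 0, ∀ r, 0 < r → r ≤ 1 → ∀ (σ : Euc n → Euc n →L[ℝ] Euc n) (M : ℝ) (v : Euc n → ℝ → ℝ),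
      EllOn σ {ξ | 1 / 4 < ‖ξ‖ ∧ ‖ξ‖ < 3} c C L → M ≤ η' →
      VisSol σ {ξ | 1 / 4 < ‖ξ‖ ∧ ‖ξ‖ < 3} M (oCyl n 1) v → LipX 1 (oCyl n 1) v →
      ∀ (e : Euc n) (c₀ : ℝ), ‖e‖ = 1 →
      (∀ x t, (x, t) ∈ oCyl n r → |v x t - c₀ - inner ℝ e x| ≤ η' * r) →
      LipX (1 / 8) (oCyl n (r / 2)) fun x t => v x t - inner ℝ e x := by
  obtain ⟨η, hη, H⟩ := lip_of_small n (c := c) (C := C) (L := L) hc hL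
  refine ⟨η / 8, by positivity, fun r hr hr1 σ M v hell hM hv hlip e c₀ he happ => ?_⟩
  have hsub : ∀ z : Euc n × ℝ, z ∈ oCyl n 1 → (r • z.1, r ^ 2 * z.2) ∈ oCyl n r := by
    rintro ⟨x, t⟩ ⟨h1, h2, h3⟩
    simp only at h1 h2 h3
    have hr2 : 0 < r ^ 2 := by positivity
    refine ⟨?_, ?_, ?_⟩ <;> simp only
    · rw [norm_smul, Real.norm_of_nonneg hr.le]
      calc r * ‖x‖ < r * 1 := by gcongr
        _ = r := mul_one r
    · have := mul_lt_mul_of_pos_left h2 hr2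
      linarith
    · exact mul_neg_of_pos_of_neg hr2 h3
  have hr1' : oCyl n r ⊆ oCyl n 1 := fun z hz => by
    have : r ^ 2 ≤ 1 := pow_le_one₀ hr.le hr1
    exact ⟨hz.1.trans_le hr1, by have := hz.2.1; linarith, hz.2.2⟩
  have hw := hv.rescale hr (by positivity : 0 < r ^ 2) (by norm_num : (0 : ℝ) < 1 / 8) 0 0 e c₀
  have hwd : ∀ x t, rescale v 0 0 r (r ^ 2) (1 / 8) e c₀ x t =
      (v (r • x) (r ^ 2 * t) - c₀ - inner ℝ e (r • x)) * (8 / r) := fun x t => by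
    simp only [rescale, zero_add, inner_smul_right]
    field_simp
    ring
  have e1 : Real.sqrt (r ^ 2) / r = 1 := by rw [Real.sqrt_sq hr.le, div_self hr.ne']
  simp only [e1, one_smul, zero_add] at hw
  have hmem : ∀ ξ ∈ ball (0 : Euc n) 6, e + (1 / 8 : ℝ) • ξ ∈ {ξ : Euc n | 1 / 4 < ‖ξ‖ ∧ ‖ξ‖ < 3} :=
    fun ξ hξ => annulus_of_near_unit he (by simpa using hξ)
  have h1 := H (fun ξ => σ (e + (1 / 8 : ℝ) • ξ)) η (rescale v 0 0 r (r ^ 2) (1 / 8) e c₀)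
    ⟨fun ξ hξ => hell.lower _ (hmem ξ hξ), fun ξ hξ => hell.upper _ (hmem ξ hξ),
      fun ξ hξ ξ' hξ' => (hell.lip _ (hmem ξ hξ) _ (hmem ξ' hξ')).trans (by
        rw [add_sub_add_left_eq_sub, ← smul_sub, norm_smul, Real.norm_of_nonneg (by norm_num)]
        have : 0 ≤ L * ‖ξ - ξ'‖ := by positivity
        linarith)⟩ le_rfl (hw.mono hmem (by
      rw [show M * r ^ 2 / (r * (1 / 8)) = 8 * (M * r) by field_simp]
      have : M * r ≤ η / 8 * 1 := by
        by_cases hM0 : 0 ≤ M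
        · gcongr
        · have : M * r ≤ 0 := mul_nonpos_of_nonpos_of_nonneg (by linarith) hr.le
          linarith
      linarith) fun z hz => hr1' (hsub z hz)) (fun x t hz => by
      rw [hwd, abs_mul, abs_of_pos (by positivity : 0 < 8 / r)]
      have := happ _ _ (hsub _ hz)
      calc _ ≤ η / 8 * r * (8 / r) := by gcongr
        _ = η := by field_simp) (fun x y t hx hy => by
      rw [hwd, hwd, ← sub_mul]
      have h2 := hlip _ _ _ (hr1' (hsub (x, t) hx)) (hr1' (hsub (y, t) hy))
      have h3 := real_inner_le_norm e (r • y - r • x)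
      rw [he, one_mul, norm_sub_rev, inner_sub_right] at h3
      simp only at h2
      have h4 : ‖r • x - r • y‖ = r * ‖x - y‖ := by
        rw [← smul_sub, norm_smul, Real.norm_of_nonneg hr.le]
      calc _ ≤ (2 * (r * ‖x - y‖)) * (8 / r) := by
            gcongr
            linarith
        _ = _ := by field_simp; ring)
  intro x y t hx hy
  have hup : ∀ z : Euc n × ℝ, z ∈ oCyl n (r / 2) → (r⁻¹ • z.1, (r ^ 2)⁻¹ * z.2) ∈ oCyl n (1 / 2) := by
    rintro ⟨x, t⟩ ⟨h1, h2, h3⟩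
    simp only at h1 h2 h3
    refine ⟨?_, ?_, ?_⟩ <;> simp only
    · rw [norm_smul, norm_inv, Real.norm_of_nonneg hr.le, inv_mul_lt_iff₀ hr]
      linarith
    · rw [inv_mul_eq_div, lt_div_iff₀ (by positivity)]
      linarith
    · exact mul_neg_of_pos_of_neg (by positivity) h3
  have h2 := h1 _ _ _ (hup (x, t) hx) (hup (y, t) hy)
  have ex : ∀ z : Euc n, r • r⁻¹ • z = z := fun z => by
    rw [smul_smul, mul_inv_cancel₀ hr.ne', one_smul]
  have et : r ^ 2 * ((r ^ 2)⁻¹ * t) = t := mul_inv_cancel_left₀ (by positivity) t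
  simp only [hwd, ex, et] at h2
  rw [← sub_mul, ← smul_sub, norm_smul, norm_inv, Real.norm_of_nonneg hr.le, one_mul,
    mul_div_assoc', div_le_iff₀ hr] at h2
  have e3 : r⁻¹ * ‖x - y‖ * r = ‖x - y‖ := by field_simp
  rw [e3] at h2
  linarith

/-- Dichotomy: either the slope bound improves or the solution is close to affine. -/
theorem one_step (n : ℕ) {c C L Λ : ℝ} (hc : 0 < c) (hL : 0 ≤ L) (hΛ : 0 ≤ Λ) :
    ∃ r > 0, r ≤ 1 / 4 ∧ ∃ δ > 0, δ ≤ 1 / 8 ∧ ∃ η > 0,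
      ∀ (σ : Euc n → Euc n →L[ℝ] Euc n) (v : Euc n → ℝ → ℝ),
      EllOn σ {ξ | 1 / 4 < ‖ξ‖ ∧ ‖ξ‖ < 3} c C L →
      VisSol σ {ξ | 1 / 4 < ‖ξ‖ ∧ ‖ξ‖ < 3} η (oCyl n 1) v →
      VisPara Λ 5 η (oCyl n 1) v → VisPara Λ 5 η (oCyl n 1) (fun x t => -v x t) →
      LipX 1 (oCyl n 1) v →
      LipX (1 - δ) (oCyl n r) v ∨
        ∃ e : Euc n, ‖e‖ = 1 ∧ LipX (1 / 8) (oCyl n r) fun x t => v x t - inner ℝ e x := by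
  obtain ⟨η', hη', HA⟩ := lip_of_near_affine n (c := c) (C := C) (L := L) hc hL
  obtain ⟨N, hNd⟩ : ∃ N, N = Λ * 16 + 2 := ⟨_, rfl⟩
  have hN : 0 < N := by rw [hNd]; positivity
  obtain ⟨r, hrd⟩ : ∃ r, r = min (1 / 4) (min (η' / 64) (η' / (16 * N))) := ⟨_, rfl⟩
  have hr : 0 < r := by rw [hrd]; positivity
  have hr4 : r ≤ 1 / 4 := hrd ▸ min_le_left _ _
  have hr2 : 16 * r ≤ η' / 4 := by
    have : r ≤ η' / 64 := hrd ▸ (min_le_right _ _).trans (min_le_left _ _)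
    linarith
  have hr3 : N * r ≤ η' / 16 := by
    have : r ≤ η' / (16 * N) := hrd ▸ (min_le_right _ _).trans (min_le_right _ _)
    rw [le_div_iff₀ (by positivity)] at this
    linarith
  clear hrd
  have hr21 : r ^ 2 ≤ 1 / 16 := by nlinarith
  obtain ⟨δ₀, hδ₀d⟩ : ∃ δ₀, δ₀ = min 1 (η' * r) := ⟨_, rfl⟩
  have hδ₀ : 0 < δ₀ := by rw [hδ₀d]; positivity
  have hδ₀1 : δ₀ ≤ 1 := hδ₀d ▸ min_le_left _ _
  have hδ₀2 : δ₀ ≤ η' * r := hδ₀d ▸ min_le_right _ _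
  clear hδ₀d
  have hτ : 0 < r ^ 2 := by positivity
  obtain ⟨ρ₀, hρ₀, HB⟩ := lip_improve n (c := c) (C := C) (L := L) (r := 1 / 16) (τ := r ^ 2) hc hL
    (by norm_num) (by norm_num) hτ (by linarith)
  obtain ⟨m, hm⟩ := exists_nat_gt (max 2 (1 / (4 * ρ₀)))
  have hm2 : (2 : ℝ) < m := (le_max_left _ _).trans_lt hm
  have hm3 : 1 / (4 * ρ₀) < m := (le_max_right _ _).trans_lt hm
  obtain ⟨ρ, hρd⟩ : ∃ ρ : ℝ, ρ = 1 / (4 * m) := ⟨_, rfl⟩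
  have hρ : 0 < ρ := by rw [hρd]; positivity
  have hmρ : m * ρ = 1 / 4 := by rw [hρd]; field_simp
  have hρ8 : ρ ≤ 1 / 8 := by
    rw [hρd, div_le_div_iff₀ (by positivity) (by norm_num)]; linarith
  have hρρ : ρ ≤ ρ₀ := by
    rw [div_lt_iff₀ (by positivity)] at hm3
    rw [hρd, div_le_iff₀ (by positivity)]
    linarith
  obtain ⟨δ', hδ', η₁, hη₁, HC⟩ := spread_deficit n (c := c) (C := C) (L := L) (δ₀ := δ₀)
    (τ := r ^ 2) (ρ := ρ) hc hL hδ₀ hδ₀1 hτ (by linarith) hρ hρ8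
  obtain ⟨δ, hδ, hδ8, η₂, hη₂, HB⟩ := HB ρ hρ hρρ δ' hδ'
  obtain ⟨η, hηd⟩ : ∃ η, η = min (min 1 η') (min η₁ η₂) := ⟨_, rfl⟩
  have hη : 0 < η := by rw [hηd]; positivity
  have hηa : η ≤ 1 := hηd ▸ (min_le_left _ _).trans (min_le_left _ _)
  have hηb : η ≤ η' := hηd ▸ (min_le_left _ _).trans (min_le_right _ _)
  have hηc : η ≤ η₁ := hηd ▸ (min_le_right _ _).trans (min_le_left _ _)
  have hηe : η ≤ η₂ := hηd ▸ (min_le_right _ _).trans (min_le_right _ _)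
  clear hηd
  obtain ⟨r₁, hr₁d⟩ : ∃ r₁, r₁ = min (r / 2) (ρ / 2) := ⟨_, rfl⟩
  have hr₁ : 0 < r₁ := by rw [hr₁d]; positivity
  have hr₁a : r₁ ≤ r / 2 := hr₁d ▸ min_le_left _ _
  have hr₁b : r₁ ≤ ρ / 2 := hr₁d ▸ min_le_right _ _
  have hr₁sq : r₁ ^ 2 ≤ (r / 2) ^ 2 := by gcongr
  refine ⟨r₁, hr₁, by linarith, δ, hδ, hδ8, η, hη, fun σ v hell hv hpar hpar' hlip => ?_⟩
  have ht₁ : -1 < -(2 * r ^ 2) := by linarith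
  by_cases hcase : ∀ e : Euc n, ‖e‖ = 1 → ∃ z₀ : Euc n, ‖z₀‖ ≤ 1 / 4 ∧
      v (z₀ + ρ • e) (-(2 * r ^ 2)) - v z₀ (-(2 * r ^ 2)) ≤ (1 - δ₀) * ρ
  · left
    refine HB σ η v hell hηe hv hlip (fun e z t he hz ht1 ht2 => ?_) r₁ hr₁b (by linarith)
    obtain ⟨z₀, hz₀, hd⟩ := hcase e he
    exact HC σ η v hell hηc hv hlip e z₀ he hz₀ hd z t hz ht1 ht2
  · right
    push Not at hcase
    obtain ⟨e, he, hno⟩ := hcase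
    refine ⟨e, he, ?_⟩
    have hmem : ∀ x : Euc n, ‖x‖ ≤ 1 / 4 → (x, -(2 * r ^ 2)) ∈ oCyl n 1 := fun x hx =>
      ⟨by simp only; linarith, by simp only; linarith, by simp only; linarith⟩
    have haff : ∀ x : Euc n, ‖x‖ ≤ 1 / 4 →
        |v x (-(2 * r ^ 2)) - v 0 (-(2 * r ^ 2)) - inner ℝ e x| ≤ δ₀ / 4 + 2 * ‖x‖ ^ 2 :=
      fun x hx => affine_of_no_deficit (g := fun x => v x (-(2 * r ^ 2))) hρ hmρ he
        (fun x y hx hy => (hlip x y _ (hmem x hx) (hmem y hy)).trans_eq (one_mul _))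
        (fun z hz => (hno z hz).le) hx
    have hfin := HA r hr (by linarith) σ η v hell hηb hv hlip e (v 0 (-(2 * r ^ 2))) he
      fun x t hz => by
        have hx : ‖x‖ < r := hz.1
        have ht1 : -(r ^ 2) < t := hz.2.1
        have ht0 : t < 0 := hz.2.2
        refine (affine_forward (N := N) (by linarith) hpar hpar' hv.cont hlip he ht₁ haff
          (by linarith : ‖x‖ ≤ 1 / 4) (by linarith) ht0).trans ?_
        have h1 : ‖x‖ ^ 2 ≤ r ^ 2 := by gcongr
        have h2 : N * (t - -(2 * r ^ 2)) ≤ N * (2 * r ^ 2) := by gcongr; linarith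
        have h3 : 16 * r * r ≤ η' / 4 * r := by gcongr
        have h4 : N * r * r ≤ η' / 16 * r := by gcongr
        have h5 : 0 < η' * r := by positivity
        linarith
    exact fun x y t hx hy => hfin x y t ⟨hx.1.trans_le hr₁a, by have := hx.2.1; simp only at this ⊢; linarith, hx.2.2⟩
      ⟨hy.1.trans_le hr₁a, by have := hy.2.1; simp only at this ⊢; linarith, hy.2.2⟩

end OneStep

section Iteration

variable {n : ℕ}

/-- Open cylinder with vertex `(x₀, t₀)`. -/
def pCyl (x₀ : Euc n) (t₀ r θ : ℝ) : Set (Euc n × ℝ) :=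
  {z | ‖z.1 - x₀‖ < r ∧ t₀ - θ < z.2 ∧ z.2 < t₀}

lemma pCyl_subset {x₀ : Euc n} {t₀ r r' θ θ' : ℝ} (hr : r ≤ r') (hθ : θ ≤ θ') :
    pCyl x₀ t₀ r θ ⊆ pCyl x₀ t₀ r' θ' := fun z hz =>
  ⟨hz.1.trans_le hr, by have := hz.2.1; linarith, hz.2.2⟩

lemma LipX.mono {l l' : ℝ} {Q Q' : Set (Euc n × ℝ)} {v : Euc n → ℝ → ℝ} (h : LipX l Q v)
    (hl : l ≤ l') (hQ : Q' ⊆ Q) : LipX l' Q' v := fun x y t hx hy =>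
  (h x y t (hQ hx) (hQ hy)).trans (by gcongr)

/-- Quasilinear diffusion with homogeneous-type degeneracy at zero gradient. -/
structure IsDeg (σ : Euc n → Euc n →L[ℝ] Euc n) (h : ℝ → ℝ) (k : ℕ) (c C L : ℝ) : Prop where
  pos : ∀ s, 0 < s → 0 < h s
  mono : ∀ s s', 0 < s → s ≤ s' → h s ≤ h s'
  scale : ∀ κ s, 0 < κ → κ ≤ 1 → 0 < s → κ ^ k * h s ≤ h (κ * s)
  ell : ∀ l, 0 < l → EllOn (fun ζ => (1 / Real.sqrt (h l)) • σ (l • ζ))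
    {ζ | 1 / 8 < ‖ζ‖ ∧ ‖ζ‖ < 4} c C L

lemma LipX.norm_sub_le {a b r θ t₀ : ℝ} {x₀ ℓ ℓ' : Euc n} {u : Euc n → ℝ → ℝ} (hr : 0 < r)
    (hθ : 0 < θ) (ha : 0 ≤ a) (hb : 0 ≤ b) (h : LipX a (pCyl x₀ t₀ r θ) fun x t => u x t - inner ℝ ℓ x)
    (h' : LipX b (pCyl x₀ t₀ r θ) fun x t => u x t - inner ℝ ℓ' x) : ‖ℓ - ℓ'‖ ≤ a + b := by
  by_cases h0 : ℓ - ℓ' = 0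
  · rw [h0, norm_zero]; exact add_nonneg ha hb
  have hn : 0 < ‖ℓ - ℓ'‖ := norm_pos_iff.2 h0
  set s := r / (2 * ‖ℓ - ℓ'‖) with hs
  have hs0 : 0 < s := by positivity
  have hsn : ‖s • (ℓ - ℓ')‖ = r / 2 := by
    rw [norm_smul, Real.norm_of_nonneg hs0.le, hs]; field_simp
  have hx : (x₀ + s • (ℓ - ℓ'), t₀ - θ / 2) ∈ pCyl x₀ t₀ r θ :=
    ⟨by simp only [add_sub_cancel_left, hsn]; linarith, by simp only; linarith,
      by simp only; linarith⟩
  have hy : (x₀, t₀ - θ / 2) ∈ pCyl x₀ t₀ r θ :=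
    ⟨by simpa using hr, by simp only; linarith, by simp only; linarith⟩
  have h1 := h _ _ _ hy hx
  have h2 := h' _ _ _ hx hy
  rw [sub_add_cancel_left, norm_neg, hsn] at h1
  rw [add_sub_cancel_left, hsn] at h2
  simp only [inner_add_right, inner_smul_right] at h1 h2
  have h3 : s * ‖ℓ - ℓ'‖ ^ 2 = r / 2 * ‖ℓ - ℓ'‖ := by rw [hs]; field_simp
  rw [← real_inner_self_eq_norm_sq, inner_sub_left] at h3
  have h4 : r / 2 * ‖ℓ - ℓ'‖ ≤ r / 2 * (a + b) := by linarith
  exact le_of_mul_le_mul_left h4 (by positivity)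

/-- The one-step dichotomy at a general scale. -/
lemma one_step_rescaled (n : ℕ) {c C L Λ : ℝ} {k : ℕ} (hc : 0 < c) (hL : 0 ≤ L) (hΛ : 0 ≤ Λ) :
    ∃ r₁ > 0, r₁ ≤ 1 / 4 ∧ ∃ δ > 0, δ ≤ 1 / 8 ∧ ∃ η > 0,
      ∀ (σ : Euc n → Euc n →L[ℝ] Euc n) (h : ℝ → ℝ), IsDeg σ h k c C L →
      ∀ (u : Euc n → ℝ → ℝ) (Ω : Set (Euc n × ℝ)) (M : ℝ), VisSol σ {0}ᶜ M Ω u →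
      (∀ s, 0 < s → VisPara (Λ * h s) s M Ω u) →
      (∀ s, 0 < s → VisPara (Λ * h s) s M Ω fun x t => -u x t) →
      ∀ (x₀ ℓ : Euc n) (t₀ r l μ : ℝ), 0 < r → 0 < l → 0 < μ → M * r ≤ η * (h l * μ) →
      (ℓ = 0 ∧ μ = l ∨ 3 / 4 * l ≤ ‖ℓ‖ ∧ ‖ℓ‖ ≤ 5 / 4 * l ∧ μ ≤ l / 8) →
      pCyl x₀ t₀ r (r ^ 2 / h l) ⊆ Ω →
      (LipX μ (pCyl x₀ t₀ r (r ^ 2 / h l)) fun x t => u x t - inner ℝ ℓ x) →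
      (LipX ((1 - δ) * μ) (pCyl x₀ t₀ (r₁ * r) ((r₁ * r) ^ 2 / h l)) fun x t =>
          u x t - inner ℝ ℓ x) ∨
        ∃ e : Euc n, ‖e‖ = 1 ∧ LipX (μ / 8) (pCyl x₀ t₀ (r₁ * r) ((r₁ * r) ^ 2 / h l)) fun x t =>
          u x t - inner ℝ (ℓ + μ • e) x := by
  obtain ⟨r₁, hr₁, hr₁4, δ, hδ, hδ8, η, hη, H⟩ := one_step n (c := c) (C := C) (L := L)
    (Λ := Λ * 5 ^ k) hc hL (by positivity)
  refine ⟨r₁, hr₁, hr₁4, δ, hδ, hδ8, η, hη, ?_⟩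
  intro σ h hdeg u Ω M hu hp hp' x₀ ℓ t₀ r l μ hr hl hμ hM hℓ hΩ hlip
  have hh := hdeg.pos l hl
  obtain ⟨θ, hθd⟩ : ∃ θ, θ = r ^ 2 / h l := ⟨_, rfl⟩
  have hθ : 0 < θ := by rw [hθd]; positivity
  have hθr : θ / r ^ 2 = 1 / h l := by rw [hθd]; field_simp
  rw [← hθd] at hΩ hlip
  have hμl : μ ≤ l := by
    rcases hℓ with ⟨-, h1⟩ | ⟨-, -, h1⟩ <;> linarith
  have hℓl : ‖ℓ‖ + μ * 5 ≤ 5 * l := by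
    rcases hℓ with ⟨h0, h1⟩ | ⟨-, h1, h2⟩
    · rw [h0, norm_zero, h1]; linarith
    · linarith
  have hsub : ∀ z : Euc n × ℝ, z ∈ oCyl n 1 → (x₀ + r • z.1, t₀ + θ * z.2) ∈ pCyl x₀ t₀ r θ := by
    rintro ⟨x, t⟩ ⟨h1, h2, h3⟩
    simp only at h1 h2 h3
    refine ⟨?_, ?_, ?_⟩ <;> simp only
    · rw [add_sub_cancel_left, norm_smul, Real.norm_of_nonneg hr.le]
      calc r * ‖x‖ < r * 1 := by gcongr
        _ = r := mul_one r
    · have := mul_lt_mul_of_pos_left h2 hθ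
      linarith
    · have := mul_neg_of_pos_of_neg hθ h3
      linarith
  have hMη : M * θ / (r * μ) ≤ η := by
    rw [hθd, div_le_iff₀ (by positivity), mul_div_assoc', div_le_iff₀ hh]
    have := mul_le_mul_of_nonneg_left hM hr.le
    linarith
  have hmem : ∀ ξ ∈ {ξ : Euc n | 1 / 4 < ‖ξ‖ ∧ ‖ξ‖ < 3},
      l⁻¹ • (ℓ + μ • ξ) ∈ {ζ : Euc n | 1 / 8 < ‖ζ‖ ∧ ‖ζ‖ < 4} := fun ξ hξ => by
    obtain ⟨h1, h2⟩ := hξ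
    simp only [mem_ofPred_eq, norm_smul, norm_inv, Real.norm_of_nonneg hl.le]
    rw [lt_inv_mul_iff₀ hl, inv_mul_lt_iff₀ hl]
    rcases hℓ with ⟨h3, h4⟩ | ⟨h3, h4, h5⟩
    · rw [h3, zero_add, norm_smul, Real.norm_of_nonneg hμ.le, h4]
      constructor
      · have := mul_lt_mul_of_pos_left h1 hl; linarith
      · have := mul_lt_mul_of_pos_left h2 hl; linarith
    · have e1 := norm_add_le ℓ (μ • ξ)
      have e2 := norm_sub_le (ℓ + μ • ξ) (μ • ξ)
      rw [add_sub_cancel_right] at e2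
      rw [norm_smul, Real.norm_of_nonneg hμ.le] at e1 e2
      have e3 : μ * ‖ξ‖ ≤ l / 8 * 3 := by gcongr
      constructor <;> linarith
  have hne : ∀ ξ ∈ {ξ : Euc n | 1 / 4 < ‖ξ‖ ∧ ‖ξ‖ < 3}, ℓ + μ • ξ ∈ ({0}ᶜ : Set (Euc n)) :=
    fun ξ hξ h0 => by
      have h1 := (hmem ξ hξ).1
      rw [mem_singleton_iff] at h0
      rw [h0, smul_zero, norm_zero] at h1
      linarith
  have hsq : Real.sqrt θ / r = 1 / Real.sqrt (h l) := by
    rw [hθd, Real.sqrt_div' _ hh.le, Real.sqrt_sq hr.le]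
    field_simp
  have hv := (hu.rescale hr hθ hμ x₀ t₀ ℓ 0).mono hne hMη (fun z hz => hΩ (hsub z hz))
  have hell := hdeg.ell l hl
  have hσ : ∀ ξ : Euc n, (Real.sqrt θ / r) • σ (ℓ + μ • ξ) =
      (fun ζ => (1 / Real.sqrt (h l)) • σ (l • ζ)) (l⁻¹ • (ℓ + μ • ξ)) := fun ξ => by
    simp only [smul_smul l, mul_inv_cancel₀ hl.ne', one_smul, hsq]
  have hΛ5 : Λ * h (5 * l) * θ / r ^ 2 ≤ Λ * 5 ^ k := by
    have h1 := hdeg.scale (1 / 5) (5 * l) (by norm_num) (by norm_num) (by positivity)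
    rw [show (1 / 5 : ℝ) * (5 * l) = l by ring, one_div, inv_pow, inv_mul_le_iff₀ (by positivity)] at h1
    rw [mul_div_assoc, hθr, mul_one_div, div_le_iff₀ hh]
    have := mul_le_mul_of_nonneg_left h1 hΛ
    linarith
  have hpar := ((hp (5 * l) (by positivity)).rescale hr hθ hμ x₀ t₀ ℓ 0 hℓl).mono hΛ5 le_rfl hMη
    (fun z hz => hΩ (hsub z hz))
  have hpar' := ((hp' (5 * l) (by positivity)).rescale hr hθ hμ x₀ t₀ (-ℓ) (-0) (g' := 5)
    (by rwa [norm_neg])).mono hΛ5 le_rfl hMη (fun z hz => hΩ (hsub z hz))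
  rw [← neg_rescale] at hpar'
  have hvd : ∀ x t, rescale u x₀ t₀ r θ μ ℓ 0 x t =
      (u (x₀ + r • x) (t₀ + θ * t) - inner ℝ ℓ (x₀ + r • x) + inner ℝ ℓ x₀) / (r * μ) := fun x t => by
    simp only [rescale, inner_add_right, inner_smul_right]
    congr 1; ring
  have hrμ : 0 < r * μ := by positivity
  have hvlip : LipX 1 (oCyl n 1) (rescale u x₀ t₀ r θ μ ℓ 0) := fun x y t hx hy => by
    have h1 := hlip _ _ _ (hsub (x, t) hx) (hsub (y, t) hy)
    simp only at h1
    rw [hvd, hvd, ← sub_div, div_le_iff₀ hrμ]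
    rw [add_sub_add_left_eq_sub, ← smul_sub, norm_smul, Real.norm_of_nonneg hr.le] at h1
    linarith
  have hup : ∀ z : Euc n × ℝ, z ∈ pCyl x₀ t₀ (r₁ * r) ((r₁ * r) ^ 2 / h l) →
      (r⁻¹ • (z.1 - x₀), θ⁻¹ * (z.2 - t₀)) ∈ oCyl n r₁ := by
    rintro ⟨x, t⟩ ⟨h1, h2, h3⟩
    simp only at h1 h2 h3
    refine ⟨?_, ?_, ?_⟩ <;> simp only
    · rw [norm_smul, norm_inv, Real.norm_of_nonneg hr.le, inv_mul_lt_iff₀ hr]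
      linarith
    · rw [lt_inv_mul_iff₀ hθ]
      have e : (r₁ * r) ^ 2 / h l = θ * r₁ ^ 2 := by rw [hθd]; field_simp
      rw [e] at h2
      linarith
    · exact mul_neg_of_pos_of_neg (by positivity) (by linarith)
  have ex : ∀ z : Euc n, x₀ + r • r⁻¹ • (z - x₀) = z := fun z => by
    rw [smul_smul, mul_inv_cancel₀ hr.ne', one_smul, add_sub_cancel]
  have et : ∀ t, t₀ + θ * (θ⁻¹ * (t - t₀)) = t := fun t => by
    rw [mul_inv_cancel_left₀ hθ.ne']; ring
  have en : ∀ x y : Euc n, ‖r⁻¹ • (x - x₀) - r⁻¹ • (y - x₀)‖ = r⁻¹ * ‖x - y‖ := fun x y => by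
    rw [← smul_sub, sub_sub_sub_cancel_right, norm_smul, norm_inv, Real.norm_of_nonneg hr.le]
  rcases H _ _ (by
    refine ⟨fun ξ hξ => ?_, fun ξ hξ => ?_, fun ξ hξ ξ' hξ' => ?_⟩
    · rw [hσ]; exact hell.lower _ (hmem ξ hξ)
    · rw [hσ]; exact hell.upper _ (hmem ξ hξ)
    · rw [hσ, hσ]
      refine (hell.lip _ (hmem ξ hξ) _ (hmem ξ' hξ')).trans ?_
      rw [← smul_sub, add_sub_add_left_eq_sub, ← smul_sub, norm_smul, norm_smul, norm_inv,
        Real.norm_of_nonneg hl.le, Real.norm_of_nonneg hμ.le, ← mul_assoc l⁻¹]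
      gcongr
      have : l⁻¹ * μ ≤ 1 := by rw [inv_mul_le_iff₀ hl]; linarith
      exact mul_le_of_le_one_left (norm_nonneg _) this) hv hpar hpar' hvlip with hI | ⟨e, he, hII⟩
  · left
    intro x y t hx hy
    have h1 := hI _ _ _ (hup (x, t) hx) (hup (y, t) hy)
    simp only [hvd, ex, et, en] at h1
    rw [← sub_div, div_le_iff₀ hrμ] at h1
    have e1 : (1 - δ) * (r⁻¹ * ‖x - y‖) * (r * μ) = (1 - δ) * μ * ‖x - y‖ := by field_simp
    linarith
  · right
    refine ⟨e, he, fun x y t hx hy => ?_⟩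
    have h1 := hII _ _ _ (hup (x, t) hx) (hup (y, t) hy)
    simp only [hvd, ex, et, en, inner_smul_right, inner_sub_right] at h1
    have h2 := mul_le_mul_of_nonneg_right h1 hrμ.le
    have e1 : 1 / 8 * (r⁻¹ * ‖x - y‖) * (r * μ) = μ / 8 * ‖x - y‖ := by field_simp
    have e2 : ((u x t - inner ℝ ℓ x + inner ℝ ℓ x₀) / (r * μ) -
        r⁻¹ * (inner ℝ e x - inner ℝ e x₀) -
        ((u y t - inner ℝ ℓ y + inner ℝ ℓ x₀) / (r * μ) -
        r⁻¹ * (inner ℝ e y - inner ℝ e x₀))) * (r * μ) =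
        u x t - inner ℝ ℓ x - μ * inner ℝ e x - (u y t - inner ℝ ℓ y - μ * inner ℝ e y) := by
      field_simp; ring
    rw [e1, e2] at h2
    simp only [inner_add_left, real_inner_smul_left]
    linarith

end Iteration

section Campanato

variable {n : ℕ}

/-- Geometric decay of the oscillation of the gradient along shrinking cylinders. -/
lemma campanato_decay (n : ℕ) {c C L Λ : ℝ} {k : ℕ} (hc : 0 < c) (hL : 0 ≤ L) (hΛ : 0 ≤ Λ) :
    ∃ γ > 0, γ < 1 ∧ ∃ ρ > 0, ρ < 1 ∧ ∃ η > 0,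
      ∀ (σ : Euc n → Euc n →L[ℝ] Euc n) (h : ℝ → ℝ), IsDeg σ h k c C L →
      ∀ (u : Euc n → ℝ → ℝ) (Ω : Set (Euc n × ℝ)) (M : ℝ), VisSol σ {0}ᶜ M Ω u → 0 ≤ M →
      (∀ s, 0 < s → VisPara (Λ * h s) s M Ω u) →
      (∀ s, 0 < s → VisPara (Λ * h s) s M Ω fun x t => -u x t) →
      ∀ (x₀ : Euc n) (t₀ r l : ℝ), 0 < r → 0 < l → 8 * (M * r) ≤ η * (h l * l) →
      pCyl x₀ t₀ r (r ^ 2 / h l) ⊆ Ω →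
      LipX l (pCyl x₀ t₀ r (r ^ 2 / h l)) u →
      ∀ j : ℕ, ∃ ℓ : Euc n, LipX (γ ^ j * l) (pCyl x₀ t₀ (ρ ^ j * r) ((ρ ^ j * r) ^ 2 / h l))
        fun x t => u x t - inner ℝ ℓ x := by
  obtain ⟨r₁, hr₁, hr₁4, δ, hδ, hδ8, η, hη, H⟩ := one_step_rescaled n (k := k) (c := c) (C := C)
    (L := L) (Λ := Λ) hc hL hΛ
  obtain ⟨γ, hγd⟩ : ∃ γ, γ = 1 - δ := ⟨_, rfl⟩
  have hγ0 : 0 < γ := by linarith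
  have hγ1 : γ < 1 := by linarith
  have hγ8 : 1 / 8 ≤ γ := by linarith
  rw [← hγd] at H
  obtain ⟨ρ, hρd⟩ : ∃ ρ, ρ = r₁ * γ ^ (k + 1) := ⟨_, rfl⟩
  have hρ0 : 0 < ρ := by rw [hρd]; positivity
  have hγk1 : γ ^ (k + 1) ≤ 1 := pow_le_one₀ hγ0.le hγ1.le
  have hρr : ρ ≤ r₁ := by rw [hρd]; exact mul_le_of_le_one_right hr₁.le hγk1
  have hργ : ρ ≤ γ ^ (k + 1) := by
    rw [hρd]; exact mul_le_of_le_one_left (by positivity) (by linarith)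
  have hργ2 : ρ ^ 2 ≤ r₁ ^ 2 * γ ^ k := by
    rw [hρd, mul_pow]
    gcongr
    rw [← pow_mul]
    exact pow_le_pow_of_le_one hγ0.le hγ1.le (by omega)
  refine ⟨γ, hγ0, hγ1, ρ, hρ0, by linarith, η, hη, ?_⟩
  intro σ h hdeg u Ω M hu hM hp hp' x₀ t₀ r l hr hl hMη hΩ hlip
  have hhl := hdeg.pos l hl
  have hsmall : ∀ j : ℕ, ∀ lam μ : ℝ, γ ^ j * l ≤ lam → γ ^ j * l / 8 ≤ μ →
      M * (ρ ^ j * r) ≤ η * (h lam * μ) := fun j lam μ h1 h2 => by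
    have hj : 0 < γ ^ j := by positivity
    have e1 : (γ ^ j) ^ k * h l ≤ h lam := (hdeg.scale (γ ^ j) l hj
      (pow_le_one₀ hγ0.le hγ1.le) hl).trans (hdeg.mono _ _ (by positivity) h1)
    have e2 : ρ ^ j ≤ (γ ^ j) ^ k * γ ^ j := by
      rw [← pow_succ, pow_right_comm]
      exact pow_le_pow_left₀ hρ0.le hργ j
    have e3 : (γ ^ j) ^ k * h l * (γ ^ j * l / 8) ≤ h lam * μ := by
      gcongr
      exact (by positivity : 0 ≤ (γ ^ j) ^ k * h l).trans e1
    calc M * (ρ ^ j * r) = ρ ^ j * (M * r) := by ring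
      _ ≤ (γ ^ j) ^ k * γ ^ j * (M * r) := by gcongr
      _ = (γ ^ j) ^ k * γ ^ j / 8 * (8 * (M * r)) := by ring
      _ ≤ (γ ^ j) ^ k * γ ^ j / 8 * (η * (h l * l)) := by gcongr
      _ = η * ((γ ^ j) ^ k * h l * (γ ^ j * l / 8)) := by ring
      _ ≤ η * (h lam * μ) := by gcongr
  have hcyl : ∀ j : ℕ, ∀ lam, 0 < lam → pCyl x₀ t₀ (ρ ^ (j + 1) * r) ((ρ ^ (j + 1) * r) ^ 2 / h lam) ⊆
      pCyl x₀ t₀ (r₁ * (ρ ^ j * r)) ((r₁ * (ρ ^ j * r)) ^ 2 / h lam) := fun j lam hlam => by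
    have e : ρ ^ (j + 1) * r ≤ r₁ * (ρ ^ j * r) := by
      rw [pow_succ, mul_comm (ρ ^ j), mul_assoc]; gcongr
    refine pCyl_subset e ?_
    have := hdeg.pos lam hlam
    gcongr
  have hcyl' : ∀ j : ℕ, ∀ lam, 0 < lam →
      pCyl x₀ t₀ (ρ ^ (j + 1) * r) ((ρ ^ (j + 1) * r) ^ 2 / h (γ * lam)) ⊆
      pCyl x₀ t₀ (r₁ * (ρ ^ j * r)) ((r₁ * (ρ ^ j * r)) ^ 2 / h lam) := fun j lam hlam => by
    have e : ρ ^ (j + 1) * r ≤ r₁ * (ρ ^ j * r) := by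
      rw [pow_succ, mul_comm (ρ ^ j), mul_assoc]; gcongr
    refine pCyl_subset e ?_
    have h1 := hdeg.pos lam hlam
    have h2 := hdeg.pos (γ * lam) (by positivity)
    have h3 := hdeg.scale γ lam hγ0 hγ1.le hlam
    rw [div_le_div_iff₀ h2 h1]
    calc (ρ ^ (j + 1) * r) ^ 2 * h lam = ρ ^ 2 * ((ρ ^ j * r) ^ 2 * h lam) := by ring
      _ ≤ r₁ ^ 2 * γ ^ k * ((ρ ^ j * r) ^ 2 * h lam) := by gcongr
      _ = (r₁ * (ρ ^ j * r)) ^ 2 * (γ ^ k * h lam) := by ring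
      _ ≤ (r₁ * (ρ ^ j * r)) ^ 2 * h (γ * lam) := by gcongr
  have hinΩ : ∀ j : ℕ, ∀ lam, 0 < lam → (γ ^ j) * l ≤ lam →
      pCyl x₀ t₀ (ρ ^ j * r) ((ρ ^ j * r) ^ 2 / h lam) ⊆ Ω := fun j lam hlam hlg => by
    refine Subset.trans (pCyl_subset ?_ ?_) hΩ
    · exact mul_le_of_le_one_left hr.le (pow_le_one₀ hρ0.le (by linarith))
    · have hj : 0 < γ ^ j := by positivity
      have e1 : (γ ^ j) ^ k * h l ≤ h lam := (hdeg.scale (γ ^ j) l hj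
        (pow_le_one₀ hγ0.le hγ1.le) hl).trans (hdeg.mono _ _ (by positivity) hlg)
      have e2 : (ρ ^ j) ^ 2 ≤ (γ ^ j) ^ k := by
        rw [pow_right_comm, pow_right_comm γ]
        refine pow_le_pow_left₀ (by positivity) (hργ2.trans ?_) j
        exact mul_le_of_le_one_left (by positivity) (pow_le_one₀ hr₁.le (by linarith))
      rw [div_le_div_iff₀ (hdeg.pos _ hlam) hhl]
      calc (ρ ^ j * r) ^ 2 * h l = (ρ ^ j) ^ 2 * (r ^ 2 * h l) := by ring
        _ ≤ (γ ^ j) ^ k * (r ^ 2 * h l) := by gcongr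
        _ = r ^ 2 * ((γ ^ j) ^ k * h l) := by ring
        _ ≤ r ^ 2 * h lam := by gcongr
  have key : ∀ j : ℕ,
      LipX (γ ^ j * l) (pCyl x₀ t₀ (ρ ^ j * r) ((ρ ^ j * r) ^ 2 / h (γ ^ j * l))) u ∨
      ∃ lam μ : ℝ, ∃ ℓ₀ ℓ : Euc n, ‖ℓ₀‖ = lam ∧ γ ^ j * l / 8 ≤ μ ∧ μ ≤ lam / 8 ∧ μ ≤ γ ^ j * l ∧
        γ ^ j * l ≤ lam ∧ lam ≤ l ∧
        (LipX (lam / 8) (pCyl x₀ t₀ (ρ ^ j * r) ((ρ ^ j * r) ^ 2 / h lam)) fun x t =>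
          u x t - inner ℝ ℓ₀ x) ∧
        LipX μ (pCyl x₀ t₀ (ρ ^ j * r) ((ρ ^ j * r) ^ 2 / h lam)) fun x t =>
          u x t - inner ℝ ℓ x := by
    intro j
    induction j with
    | zero => left; simpa using hlip
    | succ j ih =>
      have hj : 0 < γ ^ j := by positivity
      have hj1 : γ ^ j ≤ 1 := pow_le_one₀ hγ0.le hγ1.le
      have hrj : 0 < ρ ^ j * r := by positivity
      have hgs : γ ^ (j + 1) = γ * γ ^ j := by ring
      rcases ih with ih | ⟨lam, μ, ℓ₀, ℓ, hℓ₀, hμ1, hμ2, hμ3, hl1, hl2, hL0, hL1⟩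
      · obtain ⟨lam, hlam⟩ : ∃ lam, lam = γ ^ j * l := ⟨_, rfl⟩
        rw [← hlam] at ih
        have hlam0 : 0 < lam := by rw [hlam]; positivity
        rcases H σ h hdeg u Ω M hu hp hp' x₀ 0 t₀ (ρ ^ j * r) lam lam hrj hlam0 hlam0
          (hsmall j lam lam hlam.ge (by rw [hlam]; have := mul_pos hj hl; linarith))
          (Or.inl ⟨rfl, rfl⟩) (hinΩ j lam hlam0 hlam.ge) (by simpa using ih) with h1 | ⟨e, he, h1⟩
        · left
          have h2 : γ ^ (j + 1) * l = γ * lam := by rw [hlam, hgs]; ring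
          rw [h2]
          refine LipX.mono (by simpa using h1) le_rfl (hcyl' j lam hlam0)
        · right
          have hm := h1.mono le_rfl (hcyl j lam hlam0)
          rw [zero_add] at hm
          refine ⟨lam, lam / 8, lam • e, lam • e, ?_, ?_, le_rfl, ?_, ?_, ?_, hm, hm⟩
          · rw [norm_smul, he, Real.norm_of_nonneg hlam0.le, mul_one]
          · rw [hgs, mul_assoc, ← hlam]; nlinarith
          · rw [hgs, mul_assoc, ← hlam]; nlinarith
          · rw [hgs, mul_assoc, ← hlam]; nlinarith
          · rw [hlam]; nlinarith
      · have hgl : 0 < γ ^ j * l := mul_pos hj hl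
        have hlam0 : 0 < lam := hgl.trans_le hl1
        have hμ0 : 0 < μ := by linarith
        have hD : 0 < (ρ ^ j * r) ^ 2 / h lam := by
          have := hdeg.pos lam hlam0
          positivity
        have hdist : ‖ℓ - ℓ₀‖ ≤ μ + lam / 8 :=
          LipX.norm_sub_le hrj hD hμ0.le (by positivity) hL1 hL0
        have hlo : 3 / 4 * lam ≤ ‖ℓ‖ := by
          have := norm_sub_norm_le ℓ₀ ℓ
          rw [norm_sub_rev] at this
          linarith
        have hup : ‖ℓ‖ ≤ 5 / 4 * lam := by
          have := norm_sub_norm_le ℓ ℓ₀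
          linarith
        have hgl' : γ ^ (j + 1) * l = γ * (γ ^ j * l) := by rw [hgs]; ring
        have hle : γ ^ (j + 1) * l ≤ γ ^ j * l := by
          rw [hgl']; exact mul_le_of_le_one_left hgl.le hγ1.le
        have b1 : γ ^ (j + 1) * l / 8 ≤ γ * μ := by
          rw [hgl', mul_div_assoc]; gcongr
        have b2 : γ * μ ≤ lam / 8 := (mul_le_of_le_one_left hμ0.le hγ1.le).trans hμ2
        have b3 : γ * μ ≤ γ ^ (j + 1) * l := by rw [hgl']; gcongr
        right
        rcases H σ h hdeg u Ω M hu hp hp' x₀ ℓ t₀ (ρ ^ j * r) lam μ hrj hlam0 hμ0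
          (hsmall j lam μ hl1 hμ1) (Or.inr ⟨hlo, hup, hμ2⟩) (hinΩ j lam hlam0 hl1) hL1
          with h1 | ⟨e, he, h1⟩
        · refine ⟨lam, γ * μ, ℓ₀, ℓ, hℓ₀, b1, b2, b3, hle.trans hl1, hl2, ?_, ?_⟩
          · refine hL0.mono le_rfl ((hcyl j lam hlam0).trans (pCyl_subset ?_ ?_))
            · exact mul_le_of_le_one_left hrj.le (by linarith)
            · have := hdeg.pos lam hlam0
              have h9 := mul_le_of_le_one_left hrj.le (hr₁4.trans (by norm_num : (1 / 4 : ℝ) ≤ 1))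
              exact div_le_div_of_nonneg_right (pow_le_pow_left₀ (by positivity) h9 2) this.le
          · exact h1.mono le_rfl (hcyl j lam hlam0)
        · refine ⟨lam, γ * μ, ℓ₀, ℓ + μ • e, hℓ₀, b1, b2, b3, hle.trans hl1, hl2, ?_, ?_⟩
          · refine hL0.mono le_rfl ((hcyl j lam hlam0).trans (pCyl_subset ?_ ?_))
            · exact mul_le_of_le_one_left hrj.le (by linarith)
            · have := hdeg.pos lam hlam0
              have h9 := mul_le_of_le_one_left hrj.le (hr₁4.trans (by norm_num : (1 / 4 : ℝ) ≤ 1))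
              exact div_le_div_of_nonneg_right (pow_le_pow_left₀ (by positivity) h9 2) this.le
          · refine h1.mono ?_ (hcyl j lam hlam0)
            nlinarith
  intro j
  have hj : 0 < γ ^ j := by positivity
  have hmono : ∀ lam, 0 < lam → lam ≤ l → pCyl x₀ t₀ (ρ ^ j * r) ((ρ ^ j * r) ^ 2 / h l) ⊆
      pCyl x₀ t₀ (ρ ^ j * r) ((ρ ^ j * r) ^ 2 / h lam) := fun lam h0 h1 => by
    refine pCyl_subset le_rfl ?_
    have := hdeg.pos lam h0
    have := hdeg.mono lam l h0 h1
    gcongr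
  rcases key j with h1 | ⟨lam, μ, ℓ₀, ℓ, -, -, -, h3, h4, h5, -, h6⟩
  · refine ⟨0, ?_⟩
    have := h1.mono le_rfl (hmono _ (by positivity)
      (mul_le_of_le_one_left hl.le (pow_le_one₀ hγ0.le hγ1.le)))
    simpa using this
  · exact ⟨ℓ, h6.mono h3 (hmono lam ((by positivity : 0 < γ ^ j * l).trans_le h4) h5)⟩

end Campanato

section Campanato

/-- Pointwise `C^{1+α}` expansion, with a gradient valid on all smaller cylinders. -/
lemma campanato (n : ℕ) {c C L Λ α₀ : ℝ} {k : ℕ} (hc : 0 < c) (hL : 0 ≤ L) (hΛ : 0 ≤ Λ)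
    (hα₀ : 0 < α₀) :
    ∃ α > 0, α < α₀ ∧ ∃ K > 0, ∃ η > 0,
      ∀ (σ : Euc n → Euc n →L[ℝ] Euc n) (h : ℝ → ℝ), IsDeg σ h k c C L →
      ∀ (u : Euc n → ℝ → ℝ) (Ω : Set (Euc n × ℝ)) (M : ℝ), VisSol σ {0}ᶜ M Ω u → 0 ≤ M →
      (∀ s, 0 < s → VisPara (Λ * h s) s M Ω u) →
      (∀ s, 0 < s → VisPara (Λ * h s) s M Ω fun x t => -u x t) →
      ∀ (x₀ : Euc n) (t₀ r l : ℝ), 0 < r → 0 < l → 8 * (M * r) ≤ η * (h l * l) →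
      pCyl x₀ t₀ r (r ^ 2 / h l) ⊆ Ω →
      LipX l (pCyl x₀ t₀ r (r ^ 2 / h l)) u →
      ∃ ℓ : Euc n, ∀ s, 0 < s → s ≤ r →
        LipX (K * l * (s / r) ^ α) (pCyl x₀ t₀ s (s ^ 2 / h l)) fun x t => u x t - inner ℝ ℓ x := by
  obtain ⟨γ, hγ0, hγ1, ρ, hρ0, hρ1, η, hη, H⟩ := campanato_decay n (k := k) (c := c) (C := C)
    (L := L) (Λ := Λ) hc hL hΛ
  have hlγ : Real.log γ < 0 := Real.log_neg hγ0 hγ1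
  have hlρ : Real.log ρ < 0 := Real.log_neg hρ0 hρ1
  obtain ⟨α, hαd⟩ : ∃ α, α = min (α₀ / 2) (Real.log γ / Real.log ρ) := ⟨_, rfl⟩
  have hα : 0 < α := by rw [hαd]; exact lt_min (by positivity) (div_pos_of_neg_of_neg hlγ hlρ)
  have hγα : γ ≤ ρ ^ α := by
    rw [Real.rpow_def_of_pos hρ0, ← Real.log_le_iff_le_exp hγ0]
    have : α ≤ Real.log γ / Real.log ρ := by rw [hαd]; exact min_le_right _ _
    rw [le_div_iff_of_neg hlρ] at this
    linarith
  have h1γ : 0 < 1 - γ := by linarith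
  refine ⟨α, hα, ?_, (1 + 2 / (1 - γ)) * (ρ ^ α)⁻¹, by positivity, η, hη, ?_⟩
  · rw [hαd]; exact (min_le_left _ _).trans_lt (by linarith)
  intro σ h hdeg u Ω M hu hM hp hp' x₀ t₀ r l hr hl hMη hΩ hlip
  have hhl := hdeg.pos l hl
  choose ℓ hℓ using H σ h hdeg u Ω M hu hM hp hp' x₀ t₀ r l hr hl hMη hΩ hlip
  have hstep : ∀ j, dist (ℓ j) (ℓ (j + 1)) ≤ 2 * l * γ ^ j := fun j => by
    have hrj : 0 < ρ ^ (j + 1) * r := by positivity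
    have hle : ρ ^ (j + 1) * r ≤ ρ ^ j * r := by
      rw [pow_succ, mul_right_comm]
      exact mul_le_of_le_one_right (by positivity) hρ1.le
    have hsub : pCyl x₀ t₀ (ρ ^ (j + 1) * r) ((ρ ^ (j + 1) * r) ^ 2 / h l) ⊆
        pCyl x₀ t₀ (ρ ^ j * r) ((ρ ^ j * r) ^ 2 / h l) := by
      refine pCyl_subset hle (div_le_div_of_nonneg_right (pow_le_pow_left₀ hrj.le hle 2) hhl.le)
    have h1 : γ ^ (j + 1) * l ≤ γ ^ j * l := by
      rw [pow_succ, mul_right_comm]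
      exact mul_le_of_le_one_right (by positivity) hγ1.le
    have := LipX.norm_sub_le hrj (by positivity) (by positivity) (by positivity)
      ((hℓ j).mono le_rfl hsub) ((hℓ (j + 1)).mono h1 Subset.rfl)
    rw [dist_eq_norm]
    linarith
  obtain ⟨a, ha⟩ := cauchySeq_tendsto_of_complete (cauchySeq_of_le_geometric γ (2 * l) hγ1 hstep)
  refine ⟨a, fun s hs hsr => ?_⟩
  obtain ⟨j, hj1, hj2⟩ := exists_nat_pow_near_of_lt_one (x := s / r) (y := ρ) (by positivity)
    ((div_le_one hr).2 hsr) hρ0 hρ1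
  have hd := dist_le_of_le_geometric_of_tendsto γ (2 * l) hγ1 hstep ha j
  rw [dist_eq_norm] at hd
  have hsj : s ≤ ρ ^ j * r := (div_le_iff₀ hr).1 hj2
  have hj3 : γ ^ j ≤ (ρ ^ α)⁻¹ * (s / r) ^ α := by
    rw [← div_eq_inv_mul, ← Real.div_rpow (by positivity) hρ0.le]
    calc γ ^ j ≤ (ρ ^ α) ^ j := pow_le_pow_left₀ hγ0.le hγα j
      _ = (ρ ^ j) ^ α := by
        rw [← Real.rpow_natCast, ← Real.rpow_natCast, ← Real.rpow_mul hρ0.le, ← Real.rpow_mul hρ0.le,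
          mul_comm]
      _ ≤ (s / r / ρ) ^ α := by
        refine Real.rpow_le_rpow (by positivity) ?_ hα.le
        rw [le_div_iff₀ hρ0, ← pow_succ]
        exact hj1.le
  have hsub : pCyl x₀ t₀ s (s ^ 2 / h l) ⊆ pCyl x₀ t₀ (ρ ^ j * r) ((ρ ^ j * r) ^ 2 / h l) :=
    pCyl_subset hsj (div_le_div_of_nonneg_right (pow_le_pow_left₀ hs.le hsj 2) hhl.le)
  intro x y t hx hy
  have h1 := hℓ j x y t (hsub hx) (hsub hy)
  have h2 : inner ℝ (ℓ j - a) (x - y) ≤ 2 * l * γ ^ j / (1 - γ) * ‖x - y‖ :=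
    (real_inner_le_norm _ _).trans (by gcongr)
  rw [inner_sub_left, inner_sub_right, inner_sub_right] at h2
  simp only at h1 ⊢
  have h3 : (1 + 2 / (1 - γ)) * l * γ ^ j ≤
      (1 + 2 / (1 - γ)) * (ρ ^ α)⁻¹ * l * (s / r) ^ α := by
    calc (1 + 2 / (1 - γ)) * l * γ ^ j ≤
        (1 + 2 / (1 - γ)) * l * ((ρ ^ α)⁻¹ * (s / r) ^ α) := by gcongr
      _ = _ := by ring
  have h4 := mul_le_mul_of_nonneg_right h3 (norm_nonneg (x - y))
  have h5 : (1 + 2 / (1 - γ)) * l * γ ^ j * ‖x - y‖ =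
    γ ^ j * l * ‖x - y‖ + 2 * l * γ ^ j / (1 - γ) * ‖x - y‖ := by ring
  linarith

end Campanato

section PQCoefficient

variable {n : ℕ}

/-- Unit vector in the direction of `ξ`. -/
def unitDir (ξ : Euc n) : Euc n := ‖ξ‖⁻¹ • ξ

lemma norm_unitDir {ξ : Euc n} (h : ξ ≠ 0) : ‖unitDir ξ‖ = 1 := by
  rw [unitDir, norm_smul, norm_inv, norm_norm, inv_mul_cancel₀ (norm_ne_zero_iff.2 h)]

lemma unitDir_smul {ξ : Euc n} {l : ℝ} (hl : 0 < l) : unitDir (l • ξ) = unitDir ξ := by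
  rw [unitDir, unitDir, norm_smul, Real.norm_of_nonneg hl.le, smul_smul, mul_inv, mul_comm l⁻¹,
    mul_assoc, inv_mul_cancel₀ hl.ne', mul_one]

lemma norm_unitDir_sub {ξ η : Euc n} (hξ : ξ ≠ 0) (hη : η ≠ 0) :
    ‖unitDir ξ - unitDir η‖ ≤ 2 * ‖ξ‖⁻¹ * ‖ξ - η‖ := by
  have h1 : unitDir ξ - unitDir η = ‖ξ‖⁻¹ • (ξ - η) + (‖ξ‖⁻¹ * (‖η‖ - ‖ξ‖)) • unitDir η := by
    have : ‖η‖ • unitDir η = η := by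
      rw [unitDir, smul_smul, mul_inv_cancel₀ (norm_ne_zero_iff.2 hη), one_smul]
    rw [mul_sub, sub_smul, mul_smul, this, inv_mul_cancel₀ (norm_ne_zero_iff.2 hξ), one_smul,
      smul_sub, unitDir]
    abel
  rw [h1]
  refine (norm_add_le _ _).trans ?_
  rw [norm_smul, norm_smul, norm_unitDir hη, norm_mul, norm_inv, norm_norm, mul_one]
  have h2 : ‖‖η‖ - ‖ξ‖‖ ≤ ‖ξ - η‖ := by
    rw [norm_sub_rev ξ]; exact abs_norm_sub_norm_le η ξ
  have := mul_le_mul_of_nonneg_left h2 (inv_nonneg.2 (norm_nonneg ξ))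
  linarith

/-- The operator `A I + B e ⊗ e`. -/
def rankOne (A B : ℝ) (e : Euc n) : Euc n →L[ℝ] Euc n :=
  A • ContinuousLinearMap.id ℝ (Euc n) + B • (innerSL ℝ e).smulRight e

lemma rankOne_apply (A B : ℝ) (e v : Euc n) :
    rankOne A B e v = A • v + (B * inner ℝ e v) • e := by
  simp [rankOne, smul_smul]

lemma norm_rankOne_sq (A B : ℝ) {e : Euc n} (he : ‖e‖ = 1) (v : Euc n) :
    ‖rankOne A B e v‖ ^ 2 = A ^ 2 * (‖v‖ ^ 2 - inner ℝ e v ^ 2) + (A + B) ^ 2 * inner ℝ e v ^ 2 := by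
  rw [rankOne_apply, norm_add_sq_real, norm_smul, norm_smul, he, real_inner_smul_left,
    inner_smul_right, real_inner_comm]
  simp only [mul_pow, Real.norm_eq_abs, sq_abs, mul_one]
  ring

lemma norm_rankOne_sub_le (A B A' B' : ℝ) {e e' : Euc n} (he : ‖e‖ = 1) (he' : ‖e'‖ = 1) :
    ‖rankOne A B e - rankOne A' B' e'‖ ≤ |A - A'| + |B - B'| + |B'| * (2 * ‖e - e'‖) := by
  refine ContinuousLinearMap.opNorm_le_bound _ (by positivity) fun v => ?_
  have h : (rankOne A B e - rankOne A' B' e') v = (A - A') • v + ((B - B') * inner ℝ e v) • e +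
      (B' * inner ℝ (e - e') v) • e + (B' * inner ℝ e' v) • (e - e') := by
    rw [sub_apply, rankOne_apply, rankOne_apply, inner_sub_left]
    module
  rw [h]
  have e1 : |inner ℝ e v| ≤ ‖v‖ := by
    have := abs_real_inner_le_norm e v; rwa [he, one_mul] at this
  have e2 : |inner ℝ e' v| ≤ ‖v‖ := by
    have := abs_real_inner_le_norm e' v; rwa [he', one_mul] at this
  have e3 := abs_real_inner_le_norm (e - e') v
  calc _ ≤ ‖(A - A') • v‖ + ‖((B - B') * inner ℝ e v) • e‖ + ‖(B' * inner ℝ (e - e') v) • e‖ +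
      ‖(B' * inner ℝ e' v) • (e - e')‖ := by
        refine (norm_add_le _ _).trans ?_
        gcongr
        refine (norm_add_le _ _).trans ?_
        gcongr
        exact norm_add_le _ _
    _ = |A - A'| * ‖v‖ + |B - B'| * |inner ℝ e v| + |B'| * |inner ℝ (e - e') v| +
        |B'| * |inner ℝ e' v| * ‖e - e'‖ := by
      simp only [norm_smul, Real.norm_eq_abs, abs_mul, he, mul_one]
    _ ≤ |A - A'| * ‖v‖ + |B - B'| * ‖v‖ + |B'| * (‖e - e'‖ * ‖v‖) +
        |B'| * ‖v‖ * ‖e - e'‖ := by gcongr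
    _ = _ := by ring

lemma trQ_rankOne (A B : ℝ) {e : Euc n} (he : ‖e‖ = 1) (X : Euc n →L[ℝ] Euc n) :
    trQ X (rankOne A B e) = A ^ 2 * LinearMap.trace ℝ (Euc n) (X : Euc n →ₗ[ℝ] Euc n) +
      ((A + B) ^ 2 - A ^ 2) * inner ℝ (X e) e := by
  have h1 : LinearMap.trace ℝ (Euc n) (X : Euc n →ₗ[ℝ] Euc n) =
      ∑ i, inner ℝ (X (stdb n i)) (stdb n i) := by
    rw [LinearMap.trace_eq_sum_inner _ (stdb n)]
    exact Finset.sum_congr rfl fun i _ => real_inner_comm _ _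
  have h2 : ∑ i, inner ℝ e (stdb n i) * inner ℝ (X e) (stdb n i) = inner ℝ (X e) e := by
    rw [← (stdb n).sum_inner_mul_inner (X e) e]
    exact Finset.sum_congr rfl fun i _ => by rw [real_inner_comm (stdb n i) e]; ring
  have h3 : ∑ i, inner ℝ e (stdb n i) * inner ℝ (X (stdb n i)) e = inner ℝ (X e) e := by
    have := (stdb n).sum_inner_mul_inner e (ContinuousLinearMap.adjoint X e)
    rw [ContinuousLinearMap.adjoint_inner_right] at this
    rw [← this]
    exact Finset.sum_congr rfl fun i _ => by rw [ContinuousLinearMap.adjoint_inner_right]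
  have h4 : ∑ i, inner ℝ e (stdb n i) ^ 2 = 1 := by
    have := (stdb n).sum_inner_mul_inner e e
    rw [real_inner_self_eq_norm_sq, he, one_pow] at this
    rw [← this]
    exact Finset.sum_congr rfl fun i _ => by rw [real_inner_comm (stdb n i) e]; ring
  calc trQ X (rankOne A B e) = ∑ i, (A ^ 2 * inner ℝ (X (stdb n i)) (stdb n i) +
        A * B * (inner ℝ e (stdb n i) * inner ℝ (X e) (stdb n i)) +
        A * B * (inner ℝ e (stdb n i) * inner ℝ (X (stdb n i)) e) +
        B ^ 2 * inner ℝ (X e) e * inner ℝ e (stdb n i) ^ 2) := by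
        refine Finset.sum_congr rfl fun i _ => ?_
        rw [rankOne_apply, map_add, map_smul, map_smul]
        simp only [inner_add_left, inner_add_right, real_inner_smul_left, inner_smul_right]
        ring
    _ = _ := by
        simp only [Finset.sum_add_distrib, ← Finset.mul_sum, h2, h3, h4, h1]
        ring

lemma exists_lip_rpow (b : ℝ) : ∃ K ≥ 0, ∀ s ∈ Icc (1 / 8 : ℝ) 4, ∀ s' ∈ Icc (1 / 8 : ℝ) 4,
    |s ^ b - s' ^ b| ≤ K * |s - s'| := by
  have h : ContDiffOn ℝ 1 (fun s : ℝ => s ^ b) (Icc (1 / 8) 4) := fun s hs =>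
    (Real.contDiffAt_rpow_const_of_ne (by have := hs.1; linarith : s ≠ 0)).contDiffWithinAt
  obtain ⟨K, hK⟩ := h.exists_lipschitzOnWith one_ne_zero (convex_Icc _ _) isCompact_Icc
  exact ⟨K, K.2, fun s hs s' hs' => by simpa [Real.dist_eq] using hK.dist_le_mul s hs s' hs'⟩

lemma abs_sqrt_sub_le {c a b : ℝ} (hc : 0 < c) (ha : c ^ 2 ≤ a) (hb : c ^ 2 ≤ b) :
    |Real.sqrt a - Real.sqrt b| ≤ (2 * c)⁻¹ * |a - b| := by
  have h1 : c ≤ Real.sqrt a := Real.le_sqrt_of_sq_le ha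
  have h2 : c ≤ Real.sqrt b := Real.le_sqrt_of_sq_le hb
  have h3 : a - b = (Real.sqrt a - Real.sqrt b) * (Real.sqrt a + Real.sqrt b) := by
    have e1 := Real.sq_sqrt ((sq_nonneg c).trans ha)
    have e2 := Real.sq_sqrt ((sq_nonneg c).trans hb)
    linear_combination e2 - e1
  rw [h3, abs_mul, abs_of_pos (by linarith : 0 < Real.sqrt a + Real.sqrt b), mul_left_comm]
  refine le_mul_of_one_le_right (abs_nonneg _) ?_
  rw [le_inv_mul_iff₀ (by positivity)]
  linarith

/-- Diffusivity orthogonal to the gradient, as a function of its length. -/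
def hpq (p q a s : ℝ) : ℝ := s ^ (p - 2) + a * s ^ (q - 2)

/-- Diffusivity along the gradient, as a function of its length. -/
def gpq (p q a s : ℝ) : ℝ := (p - 1) * s ^ (p - 2) + a * (q - 1) * s ^ (q - 2)

/-- Square root of the diffusion matrix. -/
def sigpq (p q a : ℝ) (ξ : Euc n) : Euc n →L[ℝ] Euc n :=
  rankOne (Real.sqrt (hpq p q a ‖ξ‖)) (Real.sqrt (gpq p q a ‖ξ‖) - Real.sqrt (hpq p q a ‖ξ‖))
    (unitDir ξ)

variable {p q a : ℝ}

lemma hpq_pos (ha : 0 < a) {s : ℝ} (hs : 0 < s) : 0 < hpq p q a s := by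
  unfold hpq; positivity

lemma hpq_mono (hp : 2 ≤ p) (hpq' : p ≤ q) (ha : 0 < a) {s s' : ℝ} (hs : 0 ≤ s) (h : s ≤ s') :
    hpq p q a s ≤ hpq p q a s' := by
  unfold hpq
  have h1 := Real.rpow_le_rpow hs h (by linarith : 0 ≤ p - 2)
  have h2 := Real.rpow_le_rpow hs h (by linarith : 0 ≤ q - 2)
  gcongr

lemma hpq_le_gpq (hp : 2 ≤ p) (hpq' : p ≤ q) (ha : 0 < a) {s : ℝ} (hs : 0 ≤ s) :
    hpq p q a s ≤ gpq p q a s := by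
  unfold hpq gpq
  have h1 : 0 ≤ s ^ (p - 2) := Real.rpow_nonneg hs _
  have h2 : 0 ≤ a * s ^ (q - 2) := mul_nonneg ha.le (Real.rpow_nonneg hs _)
  nlinarith

lemma gpq_le (hpq' : p ≤ q) {s : ℝ} (hs : 0 ≤ s) :
    gpq p q a s ≤ (q - 1) * hpq p q a s := by
  unfold hpq gpq
  have h1 : 0 ≤ s ^ (p - 2) := Real.rpow_nonneg hs _
  nlinarith

lemma hpq_scale (hpq' : p ≤ q) (ha : 0 < a) {k : ℕ} (hk : q - 2 ≤ k) {κ s : ℝ}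
    (hκ : 0 < κ) (hκ1 : κ ≤ 1) (hs : 0 < s) : κ ^ k * hpq p q a s ≤ hpq p q a (κ * s) := by
  unfold hpq
  rw [Real.mul_rpow hκ.le hs.le, Real.mul_rpow hκ.le hs.le, ← Real.rpow_natCast]
  have h1 := Real.rpow_le_rpow_of_exponent_ge hκ hκ1 hk
  have h2 := Real.rpow_le_rpow_of_exponent_ge hκ hκ1 (by linarith : p - 2 ≤ k)
  have h3 : 0 ≤ s ^ (p - 2) := Real.rpow_nonneg hs.le _
  have h4 : 0 ≤ a * s ^ (q - 2) := mul_nonneg ha.le (Real.rpow_nonneg hs.le _)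
  have := mul_le_mul_of_nonneg_right h1 h4
  have := mul_le_mul_of_nonneg_right h2 h3
  linarith

lemma trQ_sigpq (hp : 2 ≤ p) (hpq' : p ≤ q) (ha : 0 < a) {ξ : Euc n} (hξ : ξ ≠ 0)
    (X : Euc n →L[ℝ] Euc n) :
    trQ X (sigpq p q a ξ) = hpq p q a ‖ξ‖ * LinearMap.trace ℝ (Euc n) (X : Euc n →ₗ[ℝ] Euc n) +
      (gpq p q a ‖ξ‖ - hpq p q a ‖ξ‖) * inner ℝ (X (unitDir ξ)) (unitDir ξ) := by
  have h0 := hpq_pos (p := p) (q := q) ha (norm_pos_iff.2 hξ)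
  have h1 := hpq_le_gpq hp hpq' ha (norm_nonneg ξ)
  rw [sigpq, trQ_rankOne _ _ (norm_unitDir hξ), Real.sq_sqrt h0.le, add_sub_cancel,
    Real.sq_sqrt (h0.le.trans h1)]

lemma isDeg_sigpq (n : ℕ) (hp : 2 ≤ p) (hpq' : p ≤ q) (ha : 0 < a) :
    ∃ (k : ℕ) (c C L : ℝ), 0 < c ∧ 0 ≤ L ∧
      IsDeg (sigpq p q a : Euc n → Euc n →L[ℝ] Euc n) (hpq p q a) k c C L := by
  obtain ⟨k, hk⟩ := exists_nat_ge (q - 2)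
  obtain ⟨K₁, hK₁, H₁⟩ := exists_lip_rpow (p - 2)
  obtain ⟨K₂, hK₂, H₂⟩ := exists_lip_rpow (q - 2)
  obtain ⟨c, hcd⟩ : ∃ c : ℝ, c = Real.sqrt ((1 / 8) ^ k) := ⟨_, rfl⟩
  have hc : 0 < c := by rw [hcd]; positivity
  have hc2 : c ^ 2 = (1 / 8) ^ k := by rw [hcd, Real.sq_sqrt (by positivity)]
  obtain ⟨C, hCd⟩ : ∃ C : ℝ, C = Real.sqrt ((q - 1) * 4 ^ k) := ⟨_, rfl⟩
  have hC2 : C ^ 2 = (q - 1) * 4 ^ k := by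
    rw [hCd, Real.sq_sqrt (mul_nonneg (by linarith) (by positivity))]
  have hC : 0 ≤ C := by rw [hCd]; positivity
  have hq1 : 1 ≤ q - 1 := by linarith
  obtain ⟨D, hD⟩ : ∃ D : ℝ, D = (2 * c)⁻¹ * ((q - 1) * (K₁ + K₂)) := ⟨_, rfl⟩
  have hD0 : 0 ≤ D := by rw [hD]; positivity
  refine ⟨k, c, C, 3 * D + C * 32, hc, by positivity, fun s hs => hpq_pos ha hs,
    fun s s' hs h => hpq_mono hp hpq' ha hs.le h,
    fun κ s hκ hκ1 hs => hpq_scale hpq' ha hk hκ hκ1 hs, fun l hl => ?_⟩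
  obtain ⟨H, hH⟩ : ∃ H : ℝ → ℝ, H = fun s => hpq p q a (l * s) / hpq p q a l := ⟨_, rfl⟩
  obtain ⟨G, hG⟩ : ∃ G : ℝ → ℝ, G = fun s => gpq p q a (l * s) / hpq p q a l := ⟨_, rfl⟩
  have hl0 := hpq_pos (p := p) (q := q) ha hl
  have hHG : ∀ s, 0 < s → H s ≤ G s := fun s hs => by
    rw [hH, hG]
    exact div_le_div_of_nonneg_right (hpq_le_gpq hp hpq' ha (by positivity)) hl0.le
  have hHc : ∀ s, 1 / 8 < s → c ^ 2 ≤ H s := fun s hs => by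
    rw [hc2, hH]
    simp only
    rw [le_div_iff₀ hl0]
    refine (hpq_scale hpq' ha hk (by norm_num) (by norm_num) hl).trans
      (hpq_mono hp hpq' ha (by positivity) ?_)
    have := mul_le_mul_of_nonneg_left hs.le hl.le
    linarith
  have hGC : ∀ s, 0 < s → s < 4 → G s ≤ C ^ 2 := fun s hs0 hs => by
    rw [hC2, hG]
    simp only
    rw [div_le_iff₀ hl0]
    refine (gpq_le hpq' (by positivity)).trans ?_
    have h1 := hpq_scale hpq' ha hk (κ := 1 / 4) (s := 4 * l) (by norm_num) (by norm_num)
      (by positivity)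
    rw [show (1 / 4 : ℝ) * (4 * l) = l by ring, one_div, inv_pow,
      inv_mul_le_iff₀ (by positivity)] at h1
    have h2 : hpq p q a (l * s) ≤ hpq p q a (4 * l) := hpq_mono hp hpq' ha (by positivity) (by
      have := mul_le_mul_of_nonneg_left hs.le hl.le
      linarith)
    rw [mul_assoc]
    exact mul_le_mul_of_nonneg_left (h2.trans h1) (by linarith)
  have hθ1 : l ^ (p - 2) / hpq p q a l ≤ 1 := by
    rw [div_le_one hl0, hpq]
    have : 0 ≤ a * l ^ (q - 2) := by positivity
    linarith
  have hθ2 : a * l ^ (q - 2) / hpq p q a l ≤ 1 := by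
    rw [div_le_one hl0, hpq]
    have : 0 ≤ l ^ (p - 2) := by positivity
    linarith
  have hlip : ∀ b₁ b₂ : ℝ, 0 ≤ b₁ → b₁ ≤ q - 1 → 0 ≤ b₂ → b₂ ≤ q - 1 →
      ∀ s ∈ Icc (1 / 8 : ℝ) 4, ∀ s' ∈ Icc (1 / 8 : ℝ) 4,
      |(b₁ * (l * s) ^ (p - 2) + a * b₂ * (l * s) ^ (q - 2)) / hpq p q a l -
        (b₁ * (l * s') ^ (p - 2) + a * b₂ * (l * s') ^ (q - 2)) / hpq p q a l| ≤
      (q - 1) * (K₁ + K₂) * |s - s'| := by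
    intro b₁ b₂ hb₁ hb₁' hb₂ hb₂' s hs s' hs'
    have hs0 : 0 ≤ s := by have := hs.1; linarith
    have hs0' : 0 ≤ s' := by have := hs'.1; linarith
    rw [Real.mul_rpow hl.le hs0, Real.mul_rpow hl.le hs0, Real.mul_rpow hl.le hs0',
      Real.mul_rpow hl.le hs0']
    have e : (b₁ * (l ^ (p - 2) * s ^ (p - 2)) + a * b₂ * (l ^ (q - 2) * s ^ (q - 2))) / hpq p q a l -
        (b₁ * (l ^ (p - 2) * s' ^ (p - 2)) + a * b₂ * (l ^ (q - 2) * s' ^ (q - 2))) / hpq p q a l =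
        b₁ * (l ^ (p - 2) / hpq p q a l) * (s ^ (p - 2) - s' ^ (p - 2)) +
        b₂ * (a * l ^ (q - 2) / hpq p q a l) * (s ^ (q - 2) - s' ^ (q - 2)) := by ring
    rw [e]
    refine (abs_add_le _ _).trans ?_
    have p1 : 0 ≤ l ^ (p - 2) / hpq p q a l := by positivity
    have p2 : 0 ≤ a * l ^ (q - 2) / hpq p q a l := by positivity
    rw [abs_mul _ (s ^ (p - 2) - s' ^ (p - 2)), abs_mul _ (s ^ (q - 2) - s' ^ (q - 2)),
      abs_of_nonneg (mul_nonneg hb₁ p1), abs_of_nonneg (mul_nonneg hb₂ p2)]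
    have m1 : b₁ * (l ^ (p - 2) / hpq p q a l) ≤ q - 1 :=
      (mul_le_of_le_one_right hb₁ hθ1).trans hb₁'
    have m2 : b₂ * (a * l ^ (q - 2) / hpq p q a l) ≤ q - 1 :=
      (mul_le_of_le_one_right hb₂ hθ2).trans hb₂'
    calc _ ≤ (q - 1) * (K₁ * |s - s'|) + (q - 1) * (K₂ * |s - s'|) :=
        add_le_add (mul_le_mul m1 (H₁ s hs s' hs') (abs_nonneg _) (by linarith))
          (mul_le_mul m2 (H₂ s hs s' hs') (abs_nonneg _) (by linarith))
      _ = _ := by ring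
  have hHl : ∀ s ∈ Icc (1 / 8 : ℝ) 4, ∀ s' ∈ Icc (1 / 8 : ℝ) 4,
      |H s - H s'| ≤ (q - 1) * (K₁ + K₂) * |s - s'| := fun s hs s' hs' => by
    have := hlip 1 1 (by norm_num) hq1 (by norm_num) hq1 s hs s' hs'
    simpa only [one_mul, mul_one, hH, hpq] using this
  have hGl : ∀ s ∈ Icc (1 / 8 : ℝ) 4, ∀ s' ∈ Icc (1 / 8 : ℝ) 4,
      |G s - G s'| ≤ (q - 1) * (K₁ + K₂) * |s - s'| := fun s hs s' hs' => by
    have := hlip (p - 1) (q - 1) (by linarith) (by linarith) (by linarith) le_rfl s hs s' hs'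
    simpa only [hG, gpq] using this
  have hform : ∀ ζ : Euc n, (1 / Real.sqrt (hpq p q a l)) • sigpq p q a (l • ζ) =
      rankOne (Real.sqrt (H ‖ζ‖)) (Real.sqrt (G ‖ζ‖) - Real.sqrt (H ‖ζ‖)) (unitDir ζ) := fun ζ => by
    rw [sigpq, unitDir_smul hl, norm_smul, Real.norm_of_nonneg hl.le, hH, hG]
    simp only
    rw [Real.sqrt_div' _ hl0.le, Real.sqrt_div' _ hl0.le, rankOne, rankOne]
    module
  have hsub : ∀ ζ : Euc n, 1 / 8 < ‖ζ‖ → ζ ≠ 0 := fun ζ h h0 => by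
    rw [h0, norm_zero] at h; linarith
  refine ⟨?_, ?_, ?_⟩
  · rintro ζ ⟨h1, h2⟩ v
    simp only [hform]
    have hz := hHc _ h1
    have hz' := hHG ‖ζ‖ (by linarith)
    have hn := norm_rankOne_sq (Real.sqrt (H ‖ζ‖)) (Real.sqrt (G ‖ζ‖) - Real.sqrt (H ‖ζ‖))
      (norm_unitDir (hsub ζ h1)) v
    have hp0 : 0 ≤ H ‖ζ‖ := (sq_nonneg c).trans hz
    rw [add_sub_cancel, Real.sq_sqrt hp0, Real.sq_sqrt (hp0.trans hz')] at hn
    refine le_of_sq_le_sq ?_ (norm_nonneg _)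
    rw [hn, mul_pow]
    have e1 := mul_le_mul_of_nonneg_right hz (sq_nonneg ‖v‖)
    have e2 := mul_le_mul_of_nonneg_right hz' (sq_nonneg (inner ℝ (unitDir ζ) v))
    linarith
  · rintro ζ ⟨h1, h2⟩ v
    simp only [hform]
    have hz := hHc _ h1
    have hz' := hHG ‖ζ‖ (by linarith)
    have hz'' := hGC ‖ζ‖ (by linarith) h2
    have hn := norm_rankOne_sq (Real.sqrt (H ‖ζ‖)) (Real.sqrt (G ‖ζ‖) - Real.sqrt (H ‖ζ‖))
      (norm_unitDir (hsub ζ h1)) v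
    have hp0 : 0 ≤ H ‖ζ‖ := (sq_nonneg c).trans hz
    rw [add_sub_cancel, Real.sq_sqrt hp0, Real.sq_sqrt (hp0.trans hz')] at hn
    refine le_of_sq_le_sq ?_ (by positivity)
    rw [hn, mul_pow]
    have e3 : inner ℝ (unitDir ζ) v ^ 2 ≤ ‖v‖ ^ 2 := by
      have := abs_real_inner_le_norm (unitDir ζ) v
      rw [norm_unitDir (hsub ζ h1), one_mul] at this
      exact sq_le_sq.2 (by rwa [abs_norm])
    have e1 := mul_le_mul_of_nonneg_right (hz'.trans hz'') (sub_nonneg.2 e3)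
    have e2 := mul_le_mul_of_nonneg_right hz'' (sq_nonneg (inner ℝ (unitDir ζ) v))
    linarith
  · rintro ζ ⟨h1, h2⟩ ζ' ⟨h1', h2'⟩
    simp only [hform]
    refine (norm_rankOne_sub_le _ _ _ _ (norm_unitDir (hsub ζ h1))
      (norm_unitDir (hsub ζ' h1'))).trans ?_
    have hnn : |‖ζ‖ - ‖ζ'‖| ≤ ‖ζ - ζ'‖ := abs_norm_sub_norm_le _ _
    have hc0 : 0 < (2 * c)⁻¹ := by positivity
    have d1 : |Real.sqrt (H ‖ζ‖) - Real.sqrt (H ‖ζ'‖)| ≤ D * ‖ζ - ζ'‖ := by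
      refine (abs_sqrt_sub_le hc (hHc _ h1) (hHc _ h1')).trans ?_
      rw [hD, mul_assoc]
      refine mul_le_mul_of_nonneg_left ?_ hc0.le
      refine (hHl _ ⟨h1.le, h2.le⟩ _ ⟨h1'.le, h2'.le⟩).trans ?_
      gcongr
    have d2 : |Real.sqrt (G ‖ζ‖) - Real.sqrt (G ‖ζ'‖)| ≤ D * ‖ζ - ζ'‖ := by
      refine (abs_sqrt_sub_le hc ((hHc _ h1).trans (hHG _ (by linarith)))
        ((hHc _ h1').trans (hHG _ (by linarith)))).trans ?_
      rw [hD, mul_assoc]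
      refine mul_le_mul_of_nonneg_left ?_ hc0.le
      refine (hGl _ ⟨h1.le, h2.le⟩ _ ⟨h1'.le, h2'.le⟩).trans ?_
      gcongr
    have d3 : |Real.sqrt (G ‖ζ‖) - Real.sqrt (H ‖ζ‖) -
        (Real.sqrt (G ‖ζ'‖) - Real.sqrt (H ‖ζ'‖))| ≤ 2 * D * ‖ζ - ζ'‖ := by
      rw [abs_le] at d1 d2 ⊢
      constructor <;> linarith [d1.1, d1.2, d2.1, d2.2]
    have d4 : |Real.sqrt (G ‖ζ'‖) - Real.sqrt (H ‖ζ'‖)| ≤ C := by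
      have e1 := Real.sqrt_le_sqrt (hHG ‖ζ'‖ (by linarith))
      have e2 := Real.sqrt_le_sqrt (hGC ‖ζ'‖ (by linarith) h2')
      rw [Real.sqrt_sq hC] at e2
      rw [abs_of_nonneg (by linarith)]
      have := Real.sqrt_nonneg (H ‖ζ'‖)
      linarith
    have d5 : 2 * ‖unitDir ζ - unitDir ζ'‖ ≤ 32 * ‖ζ - ζ'‖ := by
      have e1 := norm_unitDir_sub (hsub ζ h1) (hsub ζ' h1')
      have e2 : ‖ζ‖⁻¹ ≤ 8 := by
        rw [inv_le_comm₀ (by linarith) (by norm_num)]; linarith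
      have e3 := mul_le_mul_of_nonneg_right e2 (norm_nonneg (ζ - ζ'))
      linarith
    have d6 := mul_le_mul d4 d5 (by positivity) hC
    linarith

end PQCoefficient

section Translation

variable {n : ℕ}

/-- Symmetric part of an operator. -/
def symPart (X : Euc n →L[ℝ] Euc n) : Euc n →L[ℝ] Euc n :=
  (1 / 2 : ℝ) • (X + ContinuousLinearMap.adjoint X)

lemma inner_symPart (X : Euc n →L[ℝ] Euc n) (v : Euc n) :
    inner ℝ (symPart X v) v = inner ℝ (X v) v := by
  simp only [symPart, smul_apply, add_apply, real_inner_smul_left, inner_add_left,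
    ContinuousLinearMap.adjoint_inner_left, real_inner_comm v (X v)]
  ring

/-- Quadratic polynomial centred at `x`. -/
def quadPoly (b : ℝ) (ξ : Euc n) (X : Euc n →L[ℝ] Euc n) (x y : Euc n) : ℝ :=
  b + inner ℝ ξ (y - x) + 1 / 2 * inner ℝ (X (y - x)) (y - x)

lemma hasGradientAt_quadPoly (b : ℝ) (ξ : Euc n) (X : Euc n →L[ℝ] Euc n) (x y : Euc n) :
    HasGradientAt (quadPoly b ξ X x) (ξ + symPart X (y - x)) y := by
  rw [hasGradientAt_iff_hasFDerivAt]
  have h0 : HasFDerivAt (fun y : Euc n => y - x) (ContinuousLinearMap.id ℝ (Euc n)) y :=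
    (hasFDerivAt_id y).sub_const x
  have h1 : HasFDerivAt (fun y : Euc n => X (y - x)) X y := by
    exact (X.hasFDerivAt.comp y h0).congr_fderiv (by ext1 v; simp)
  have h2 := (((hasFDerivAt_const ξ y).inner ℝ h0).const_add b).add ((h1.inner ℝ h0).const_mul (1 / 2))
  refine (h2.congr_fderiv ?_)
  ext v
  simp [symPart, ContinuousLinearMap.adjoint_inner_left, fderivInnerCLM_apply,
    real_inner_comm, inner_sub_left, inner_sub_right]
  ring

lemma gradient_quadPoly (b : ℝ) (ξ : Euc n) (X : Euc n →L[ℝ] Euc n) (x y : Euc n) :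
    gradient (quadPoly b ξ X x) y = ξ + symPart X (y - x) :=
  (hasGradientAt_quadPoly b ξ X x y).gradient

lemma hessOp_quadPoly (b : ℝ) (ξ : Euc n) (X : Euc n →L[ℝ] Euc n) (x y : Euc n) :
    hessOp (quadPoly b ξ X x) y = symPart X := by
  have h0 : HasFDerivAt (fun y : Euc n => y - x) (ContinuousLinearMap.id ℝ (Euc n)) y :=
    (hasFDerivAt_id y).sub_const x
  have h1 : HasFDerivAt (fun y : Euc n => ξ + symPart X (y - x)) (symPart X) y := by
    exact (((symPart X).hasFDerivAt.comp y h0).const_add ξ).congr_fderiv (by ext1 v; simp)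
  rw [hessOp, funext (gradient_quadPoly b ξ X x)]
  exact h1.fderiv

/-- The spatial operator of the `(p,q)`-growth equation. -/
def pqOp (p q a : ℝ) : Euc n × ℝ → (Euc n → ℝ) → ℝ := fun z ψ =>
  (‖gradient ψ z.1‖ ^ (p - 2) + a * ‖gradient ψ z.1‖ ^ (q - 2)) * pLapN p ψ z.1 +
    a * (q - p) * ‖gradient ψ z.1‖ ^ (q - 2) * infLapN ψ z.1

variable {p q a M : ℝ}

lemma pqOp_quadPoly (hp : 2 ≤ p) (hpq' : p ≤ q) (ha : 0 < a) {ξ : Euc n} (hξ : ξ ≠ 0) (b : ℝ)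
    (X : Euc n →L[ℝ] Euc n) (x : Euc n) (t : ℝ) :
    pqOp p q a (x, t) (quadPoly b ξ X x) = trQ X (sigpq p q a ξ) := by
  have h1 : trQ X (sigpq p q a ξ) = trQ (symPart X) (sigpq p q a ξ) :=
    Finset.sum_congr rfl fun i _ => (inner_symPart _ _).symm
  rw [h1, trQ_sigpq hp hpq' ha hξ, pqOp, pLapN, infLapN]
  simp only [gradient_quadPoly, hessOp_quadPoly, sub_self, map_zero, add_zero]
  rw [unitDir, hpq, gpq]
  ring

lemma pqOp_neg (z : Euc n × ℝ) (ψ : Euc n → ℝ) :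
    pqOp p q a z (fun y => -ψ y) = -pqOp p q a z ψ := by
  have hg : ∀ y, gradient (fun y => -ψ y) y = -gradient ψ y := fun y => by
    rw [gradient, gradient, fderiv_fun_neg, map_neg]
  have hh : hessOp (fun y => -ψ y) z.1 = -hessOp ψ z.1 := by
    rw [hessOp, funext hg, fderiv_fun_neg, hessOp]
  have hi : infLapN (fun y => -ψ y) z.1 = -infLapN ψ z.1 := by
    rw [infLapN, infLapN, hh, hg]
    simp
  rw [pqOp, pqOp, pLapN, pLapN, hi, hg, hh, norm_neg, ContinuousLinearMap.toLinearMap_neg, map_neg]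
  ring

lemma sigpq_neg (ξ : Euc n) : sigpq p q a (-ξ) = sigpq p q a ξ := by
  have h : unitDir (-ξ) = -unitDir ξ := by simp [unitDir]
  ext1 v
  rw [sigpq, sigpq, rankOne_apply, rankOne_apply, h, norm_neg]
  simp

lemma ViscSupersolOp.neg {G : Euc n × ℝ → (Euc n → ℝ) → ℝ} {f u : Euc n × ℝ → ℝ}
    {Q : Set (Euc n × ℝ)} (h : ViscSupersolOp G f Q u)
    (hG : ∀ z ψ, G z (fun y => -ψ y) = -G z ψ) :
    ViscSubsolOp G (fun z => -f z) Q (fun z => -u z) := by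
  intro x t hz
  obtain ⟨h1, h2⟩ := h x t hz
  constructor
  · intro φ hφ hmax hg
    have hmin : IsLocalMinOn (fun z => u z - -φ z) Q (x, t) := by
      filter_upwards [hmax] with z hz
      linarith
    have := h1 (fun z => -φ z) ⟨fun t => (hφ.1 t).neg, fun x => (hφ.2 x).neg⟩ hmin (by
      rw [gradient, fderiv_fun_neg, map_neg]
      exact neg_ne_zero.2 hg)
    simp only [hG, deriv.fun_neg] at this
    linarith
  · intro δ hδ φ hφ h0 hle ⟨ε, hε, hs⟩
    have key : ∀ y, sInf ((fun s => u (y, s) - -φ s) '' Ioo (t - δ) (t + δ)) =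
        -sSup ((fun s => -u (y, s) - φ s) '' Ioo (t - δ) (t + δ)) := fun y => by
      rw [Real.sInf_def]
      congr 2
      ext r
      simp only [Set.mem_neg, mem_image]
      constructor <;> rintro ⟨s, hs, h⟩ <;> exact ⟨s, hs, by linarith⟩
    have := h2 δ hδ (fun s => -φ s) hφ.neg (by simp [h0]) (fun s hs => by have := hle s hs; linarith)
      ⟨ε, hε, fun y hy => by rw [key, key, hs y hy]⟩
    simp only [deriv.fun_neg] at this
    linarith

lemma visSub_of_pqOp (hp : 2 ≤ p) (hpq' : p ≤ q) (ha : 0 < a) {f u : Euc n × ℝ → ℝ}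
    {Q Ω : Set (Euc n × ℝ)} (h : ViscSubsolOp (pqOp p q a) f Q u) (hΩQ : Ω ⊆ Q)
    (hf : ∀ z ∈ Ω, f z ≤ M) : VisSub (sigpq p q a) {0}ᶜ M Ω fun x t => u (x, t) := by
  intro x t hz ξ hξ τ C X hev
  have hξ0 : ξ ≠ 0 := hξ
  have hquad : ∀ b, ContDiff ℝ 2 (quadPoly b ξ X x) := fun b => by
    unfold quadPoly
    have h0 : ContDiff ℝ 2 fun y : Euc n => y - x := by fun_prop
    exact (contDiff_const.add (contDiff_const.inner ℝ h0)).add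
      (contDiff_const.mul ((X.contDiff.comp h0).inner ℝ h0))
  obtain ⟨φ, hφ⟩ : ∃ φ : Euc n × ℝ → ℝ, φ = fun z =>
    quadPoly (τ * (z.2 - t) + C * (z.2 - t) ^ 2) ξ X x z.1 := ⟨_, rfl⟩
  have htest : IsTestC21 φ := by
    refine ⟨fun s => by simp only [hφ]; exact hquad _, fun y => ?_⟩
    simp only [hφ, quadPoly]
    fun_prop
  have hslice : (fun y => φ (y, t)) = quadPoly 0 ξ X x := by
    funext y
    simp [hφ]
  have hmax : IsLocalMaxOn (fun z => u z - φ z) Q (x, t) := by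
    refine IsLocalMax.on ?_ _
    have hc : ContinuousAt (fun z : Euc n × ℝ => z - (x, t)) (x, t) := by fun_prop
    have ht : Tendsto (fun z : Euc n × ℝ => z - (x, t)) (nhds (x, t)) (nhds 0) := by
      simpa [ContinuousAt] using hc
    filter_upwards [ht.eventually hev] with z hz
    simp only [Prod.fst_sub, Prod.snd_sub, add_sub_cancel] at hz
    simp only [hφ, quadPoly, sub_self, map_zero, inner_zero_right]
    linarith
  have h1 := (h x t (hΩQ hz)).1 φ htest hmax (by
    rw [hslice, gradient_quadPoly]; simpa using hξ0)
  rw [hslice, pqOp_quadPoly hp hpq' ha hξ0] at h1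
  have hd : deriv (fun s => φ (x, s)) t = τ := by
    have h2 : HasDerivAt (fun s : ℝ => τ * (s - t) + C * (s - t) ^ 2)
        (τ * 1 + C * (2 * (t - t) ^ 1 * 1)) t := by
      have h0 := (hasDerivAt_id t).sub_const t
      exact (h0.const_mul τ).add ((h0.pow 2).const_mul C)
    have h3 : (fun s => φ (x, s)) = fun s : ℝ => τ * (s - t) + C * (s - t) ^ 2 := by
      funext s; simp [hφ, quadPoly]
    rw [h3, h2.deriv]
    ring
  rw [hd] at h1
  have := hf _ hz
  linarith

end Translation

section Paraboloid

variable {n : ℕ}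

/-- Maximum points of `v` minus a shifted paraboloid stay close to the contact point. -/
lemma exists_shifted_max {v : Euc n → ℝ → ℝ} {x : Euc n} {t R τ C B ε : ℝ} (hB : 0 ≤ B)
    (hε : 0 < ε) (hR : 0 < R)
    (hcont : ContinuousOn (fun z : Euc n × ℝ => v z.1 z.2) (closedBall x R ×ˢ Icc (t - R) (t + R)))
    (hle : ∀ w r, ‖w‖ ≤ R → |r| ≤ R → v (x + w) (t + r) ≤ v x t + τ * r + C * r ^ 2 + B * ‖w‖ ^ 2) :
    ∃ A > 0, ∀ e : Euc n, ∃ y ∈ closedBall x R, ∃ s ∈ Icc (t - R) (t + R),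
      ‖y - x - e‖ ≤ A * ‖e‖ ∧ |s - t| ≤ A * ‖e‖ ∧
      ∀ y' ∈ closedBall x R, ∀ s' ∈ Icc (t - R) (t + R),
        v y' s' - (τ * (s' - t) + (C + 1) * (s' - t) ^ 2) - (B + ε) * ‖y' - x - e‖ ^ 2 ≤
          v y s - (τ * (s - t) + (C + 1) * (s - t) ^ 2) - (B + ε) * ‖y - x - e‖ ^ 2 := by
  obtain ⟨k, hk⟩ : ∃ k, k = 2 * (B + ε) / ε := ⟨_, rfl⟩
  have hk0 : 0 < k := by rw [hk]; positivity
  obtain ⟨A₀, hA₀⟩ : ∃ A₀, A₀ = (B + ε) + B * (1 + k) := ⟨_, rfl⟩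
  have hA₀1 : 0 < A₀ := by rw [hA₀]; positivity
  refine ⟨Real.sqrt (A₀ * (1 + 2 / ε)), by positivity, fun e => ?_⟩
  have hxR : x ∈ closedBall x R := mem_closedBall_self hR.le
  have htR : t ∈ Icc (t - R) (t + R) := ⟨by linarith, by linarith⟩
  obtain ⟨⟨y, s⟩, ⟨hy, hs⟩, hmax⟩ := ((isCompact_closedBall x R).prod isCompact_Icc).exists_isMaxOn
    ⟨(x, t), hxR, htR⟩ (f := fun z : Euc n × ℝ => v z.1 z.2 -
      (τ * (z.2 - t) + (C + 1) * (z.2 - t) ^ 2) - (B + ε) * ‖z.1 - x - e‖ ^ 2)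
    (by
      refine (hcont.sub (Continuous.continuousOn (by fun_prop))).sub
        (Continuous.continuousOn (by fun_prop)))
  simp only at hy hs
  have hmax' : ∀ y' ∈ closedBall x R, ∀ s' ∈ Icc (t - R) (t + R),
        v y' s' - (τ * (s' - t) + (C + 1) * (s' - t) ^ 2) - (B + ε) * ‖y' - x - e‖ ^ 2 ≤
          v y s - (τ * (s - t) + (C + 1) * (s - t) ^ 2) - (B + ε) * ‖y - x - e‖ ^ 2 :=
    fun y' hy' s' hs' => hmax (show (y', s') ∈ _ from ⟨hy', hs'⟩)
  have h0 := hmax' x hxR t htR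
  have h1 := hle (y - x) (s - t) (by rwa [mem_closedBall, dist_eq_norm] at hy)
    (abs_le.2 ⟨by linarith [hs.1], by linarith [hs.2]⟩)
  simp only [add_sub_cancel, sub_self, zero_sub, norm_neg] at h0 h1
  have h2 : ‖y - x‖ ≤ ‖y - x - e‖ + ‖e‖ := by
    simpa using norm_add_le (y - x - e) e
  have h3 : B * ‖y - x‖ ^ 2 ≤ (B + ε / 2) * ‖y - x - e‖ ^ 2 + B * (1 + k) * ‖e‖ ^ 2 := by
    have e1 : ‖y - x‖ ^ 2 ≤ (‖y - x - e‖ + ‖e‖) ^ 2 := pow_le_pow_left₀ (norm_nonneg _) h2 2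
    have e2 := mul_le_mul_of_nonneg_left e1 hB
    have e4 : 2 * (‖y - x - e‖ * ‖e‖) ≤ 1 / k * ‖y - x - e‖ ^ 2 + k * ‖e‖ ^ 2 := by
      have e3 := sq_nonneg (‖y - x - e‖ - k * ‖e‖)
      have : 1 / k * ‖y - x - e‖ ^ 2 + k * ‖e‖ ^ 2 - 2 * (‖y - x - e‖ * ‖e‖) =
        1 / k * (‖y - x - e‖ - k * ‖e‖) ^ 2 := by field_simp; ring
      have : 0 ≤ 1 / k * (‖y - x - e‖ - k * ‖e‖) ^ 2 := by positivity
      linarith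
    have e5 := mul_le_mul_of_nonneg_left e4 hB
    have e6 : B * (1 / k) ≤ ε / 2 := by
      have : 1 / k = ε / (2 * (B + ε)) := by rw [hk]; field_simp
      rw [this, mul_div_assoc', div_le_div_iff₀ (by positivity) two_pos]
      linarith [sq_nonneg ε]
    have e7 := mul_le_mul_of_nonneg_right e6 (sq_nonneg ‖y - x - e‖)
    linarith
  have h4 : (s - t) ^ 2 + ε / 2 * ‖y - x - e‖ ^ 2 ≤ A₀ * ‖e‖ ^ 2 := by
    rw [hA₀]
    linarith
  have h5 : (Real.sqrt (A₀ * (1 + 2 / ε)) * ‖e‖) ^ 2 =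
      A₀ * ‖e‖ ^ 2 + A₀ * ‖e‖ ^ 2 * (2 / ε) := by
    rw [mul_pow, Real.sq_sqrt (by positivity)]; ring
  have h6 : 0 ≤ Real.sqrt (A₀ * (1 + 2 / ε)) * ‖e‖ := by positivity
  have h7 : 0 ≤ A₀ * ‖e‖ ^ 2 := by positivity
  refine ⟨y, hy, s, hs, ?_, ?_, hmax'⟩
  · refine le_of_sq_le_sq ?_ h6
    rw [h5]
    have e1 : ε / 2 * ‖y - x - e‖ ^ 2 ≤ A₀ * ‖e‖ ^ 2 := by linarith [sq_nonneg (s - t)]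
    have e2 := mul_le_mul_of_nonneg_right e1 (show 0 ≤ 2 / ε by positivity)
    have e3 : ε / 2 * ‖y - x - e‖ ^ 2 * (2 / ε) = ‖y - x - e‖ ^ 2 := by field_simp
    linarith
  · refine le_of_sq_le_sq ?_ h6
    rw [h5, sq_abs]
    have e1 : 0 ≤ ε / 2 * ‖y - x - e‖ ^ 2 := by positivity
    have e2 : 0 ≤ A₀ * ‖e‖ ^ 2 * (2 / ε) := by positivity
    linarith

/-- A function with quadratically small increments is constant. -/
lemma eq_of_sub_le_sq {m : Euc n → ℝ} {B ε : ℝ}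
    (h : ∀ e ∈ ball (0 : Euc n) ε, ∀ e' ∈ ball (0 : Euc n) ε, m e' - m e ≤ B * ‖e - e'‖ ^ 2) :
    ∀ e ∈ ball (0 : Euc n) ε, m e = m 0 := by
  intro e he
  have hε : 0 < ε := (norm_nonneg e).trans_lt (by simpa using he)
  have hd : ∀ y ∈ ball (0 : Euc n) ε, HasFDerivAt m (0 : Euc n →L[ℝ] ℝ) y := fun y hy => by
    have h0 : (fun z => m z - m y) =O[nhds y] fun z => ‖z - y‖ ^ 2 := by
      refine Asymptotics.IsBigO.of_bound B ?_
      filter_upwards [isOpen_ball.mem_nhds hy] with z hz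
      rw [norm_pow, norm_norm, Real.norm_eq_abs, abs_le]
      have h1 := h z hz y hy
      have h2 := h y hy z hz
      rw [norm_sub_rev] at h2
      constructor <;> linarith
    have h1 : HasFDerivAt (fun z => m z - m y) (0 : Euc n →L[ℝ] ℝ) y :=
      h0.hasFDerivAt (by norm_num)
    have h1 := h1.add_const (m y)
    simpa using h1
  exact isOpen_ball.is_const_of_fderiv_eq_zero (𝕜 := ℝ) (convex_ball (0 : Euc n) ε).isPreconnected
    (fun y hy => (hd y hy).differentiableAt.differentiableWithinAt)
    (fun y hy => (hd y hy).fderiv) he (mem_ball_self hε)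

variable {p q a M : ℝ}

lemma trQ_id_sigpq_le (hp : 2 ≤ p) (hpq' : p ≤ q) (ha : 0 < a) {ξ : Euc n} (hξ : ξ ≠ 0) {s : ℝ}
    (hs : ‖ξ‖ ≤ s) {B : ℝ} (hB : 0 ≤ B) :
    trQ ((2 * B) • ContinuousLinearMap.id ℝ (Euc n)) (sigpq p q a ξ) ≤
      2 * (n + q) * hpq p q a s * B := by
  have h1 : LinearMap.trace ℝ (Euc n) (((2 * B) • ContinuousLinearMap.id ℝ (Euc n) :
      Euc n →L[ℝ] Euc n) : Euc n →ₗ[ℝ] Euc n) = 2 * B * n := by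
    rw [ContinuousLinearMap.toLinearMap_smul, map_smul, ContinuousLinearMap.coe_id,
      LinearMap.trace_id]
    simp
  rw [trQ_sigpq hp hpq' ha hξ, h1]
  simp only [smul_apply, ContinuousLinearMap.id_apply, real_inner_smul_left,
    real_inner_self_eq_norm_sq, norm_unitDir hξ]
  have h2 := gpq_le (a := a) hpq' (norm_nonneg ξ)
  have h3 := hpq_mono hp hpq' ha (norm_nonneg ξ) hs
  have h4 := hpq_pos (p := p) (q := q) ha (norm_pos_iff.2 hξ)
  have h5 : (gpq p q a ‖ξ‖ - hpq p q a ‖ξ‖) * (2 * B) ≤ (q - 2) * hpq p q a ‖ξ‖ * (2 * B) :=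
    mul_le_mul_of_nonneg_right (by linarith) (by linarith)
  have h6 : hpq p q a ‖ξ‖ * (2 * (n + q) * B) ≤ hpq p q a s * (2 * (n + q) * B) := by
    refine mul_le_mul_of_nonneg_right h3 (mul_nonneg ?_ hB)
    have : (0 : ℝ) ≤ n := Nat.cast_nonneg n
    linarith
  have h7 : 0 ≤ hpq p q a ‖ξ‖ * B := mul_nonneg h4.le hB
  linarith

/-- Subsolutions satisfy the paraboloid test, also at points where the gradient vanishes. -/
lemma visPara_of_pqOp (hp : 2 ≤ p) (hpq' : p ≤ q) (ha : 0 < a) {f u : Euc n × ℝ → ℝ}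
    {Q Ω : Set (Euc n × ℝ)} (h : ViscSubsolOp (pqOp p q a) f Q u) (hΩ : IsOpen Ω) (hΩQ : Ω ⊆ Q)
    (hu : ContinuousOn u Ω) (hf : ∀ z ∈ Ω, f z ≤ M) {g : ℝ} (hg : 0 < g) :
    VisPara (2 * (n + q) * hpq p q a g) g M Ω fun x t => u (x, t) := by
  have hsub := visSub_of_pqOp hp hpq' ha h hΩQ hf
  have hne : ∀ x t, (x, t) ∈ Ω → ∀ ξ, ξ ≠ 0 → ‖ξ‖ ≤ g → ∀ τ C B, 0 ≤ B →
      (∀ᶠ w in nhds (0 : Euc n × ℝ), u (x + w.1, t + w.2) ≤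
        u (x, t) + τ * w.2 + C * w.2 ^ 2 + inner ℝ ξ w.1 + B * ‖w.1‖ ^ 2) →
      τ ≤ 2 * (n + q) * hpq p q a g * B + M := by
    intro x t hz ξ hξ hξg τ C B hB hev
    refine (hsub x t hz ξ hξ τ C ((2 * B) • ContinuousLinearMap.id ℝ (Euc n)) ?_).trans
      (by linarith [trQ_id_sigpq_le hp hpq' ha hξ hξg hB])
    filter_upwards [hev] with w hw
    refine hw.trans_eq ?_
    simp only [smul_apply, ContinuousLinearMap.id_apply, real_inner_smul_left,
      real_inner_self_eq_norm_sq]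
    ring
  intro x t hz ξ hξg τ C B hB hev
  by_cases hξ : ξ ≠ 0
  · exact hne x t hz ξ hξ hξg τ C B hB hev
  rw [not_not] at hξ
  simp only [hξ, inner_zero_left, add_zero] at hev
  obtain ⟨R, hR, hRle, hRΩ⟩ : ∃ R > 0, (∀ w r, ‖w‖ ≤ R → |r| ≤ R → u (x + w, t + r) ≤
      u (x, t) + τ * r + C * r ^ 2 + B * ‖w‖ ^ 2) ∧ closedBall x R ×ˢ Icc (t - R) (t + R) ⊆ Ω := by
    obtain ⟨R₁, hR₁, h1⟩ := Metric.eventually_nhds_iff.1 hev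
    obtain ⟨R₂, hR₂, h2⟩ := Metric.isOpen_iff.1 hΩ _ hz
    refine ⟨min R₁ R₂ / 2, by positivity, fun w r hw hr => ?_, fun z hz => ?_⟩
    · refine h1 (y := (w, r)) ?_
      rw [Prod.dist_eq, max_lt_iff]
      have := min_le_left R₁ R₂
      have := lt_min hR₁ hR₂
      simp only [Prod.fst_zero, Prod.snd_zero, dist_zero_right, Real.norm_eq_abs]
      constructor <;> linarith
    · refine h2 ?_
      rw [mem_ball, Prod.dist_eq, max_lt_iff]
      have := min_le_right R₁ R₂
      have := lt_min hR₁ hR₂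
      have e1 := hz.1
      have e2 := hz.2
      rw [mem_closedBall] at e1
      simp only [Real.dist_eq, abs_lt]
      exact ⟨by linarith, by linarith [e2.1], by linarith [e2.2]⟩
  obtain ⟨N, hN⟩ : ∃ N, N = 2 * (n + q) * hpq p q a g := ⟨_, rfl⟩
  have hN0 : 0 ≤ N := by
    rw [hN]
    have := hpq_pos (p := p) (q := q) ha hg
    have h0 : (0 : ℝ) ≤ n := Nat.cast_nonneg n
    have : 0 ≤ 2 * (n + q) := by linarith
    positivity
  rw [← hN] at hne ⊢
  suffices hε : ∀ ε > 0, τ ≤ N * (B + ε) + M + ε by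
    by_contra! hcon
    have h1 := hε ((τ - (N * B + M)) / (2 * (N + 1))) (div_pos (by linarith) (by positivity))
    have h2 : N * ((τ - (N * B + M)) / (2 * (N + 1))) + (τ - (N * B + M)) / (2 * (N + 1)) =
        (τ - (N * B + M)) / 2 := by field_simp
    linarith
  intro ε hε
  obtain ⟨A, hA, hmax⟩ := exists_shifted_max (v := fun x t => u (x, t)) hB hε hR
    (hu.mono hRΩ) hRle
  choose Y hY T hT hYe hTe hmax using hmax
  obtain ⟨δ, hδ, hδR, hδg, hδC⟩ : ∃ δ > 0, (A + 1) * δ < R ∧ 2 * (B + ε) * (A * δ) ≤ g ∧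
      2 * |C + 1| * (A * δ) ≤ ε := by
    have h1 : ∀ᶠ δ in nhdsWithin (0 : ℝ) (Ioi 0), (A + 1) * δ < R :=
      (((by fun_prop : Continuous fun δ : ℝ => (A + 1) * δ).tendsto 0).eventually_lt_const
        (u := R) (by simpa using hR)).filter_mono nhdsWithin_le_nhds
    have h2 : ∀ᶠ δ in nhdsWithin (0 : ℝ) (Ioi 0), 2 * (B + ε) * (A * δ) < g :=
      (((by fun_prop : Continuous fun δ : ℝ => 2 * (B + ε) * (A * δ)).tendsto 0).eventually_lt_const
        (u := g) (by simpa using hg)).filter_mono nhdsWithin_le_nhds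
    have h3 : ∀ᶠ δ in nhdsWithin (0 : ℝ) (Ioi 0), 2 * |C + 1| * (A * δ) < ε :=
      (((by fun_prop : Continuous fun δ : ℝ => 2 * |C + 1| * (A * δ)).tendsto 0).eventually_lt_const
        (u := ε) (by simpa using hε)).filter_mono nhdsWithin_le_nhds
    obtain ⟨δ, ⟨⟨h1, h2⟩, h3⟩, h4⟩ := (((h1.and h2).and h3).and self_mem_nhdsWithin).exists
    exact ⟨δ, h4, h1, h2.le, h3.le⟩
  have hnear : ∀ e : Euc n, ‖e‖ < δ → ‖Y e - x‖ < R ∧ |T e - t| < R ∧ ‖Y e - x - e‖ ≤ A * δ ∧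
      |T e - t| ≤ A * δ := by
    intro e he
    have h1 := mul_le_mul_of_nonneg_left he.le hA.le
    have h2 : ‖Y e - x‖ ≤ ‖Y e - x - e‖ + ‖e‖ := by
      simpa using norm_add_le (Y e - x - e) e
    have h3 := hYe e
    have h4 := hTe e
    refine ⟨?_, ?_, ?_, ?_⟩ <;> linarith
  by_cases hcase : ∃ e, ‖e‖ < δ ∧ Y e - x - e ≠ 0
  · obtain ⟨e, he, hne'⟩ := hcase
    obtain ⟨hYR, hTR, hYA, hTA⟩ := hnear e he
    have hBε : 0 < B + ε := by linarith
    have key := hne (Y e) (T e) (hRΩ ⟨hY e, hT e⟩) ((2 * (B + ε)) • (Y e - x - e))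
      (smul_ne_zero (by positivity) hne')
      (by
        rw [norm_smul, Real.norm_of_nonneg (by positivity)]
        exact (mul_le_mul_of_nonneg_left hYA (by positivity)).trans hδg)
      (τ + 2 * (C + 1) * (T e - t)) (C + 1) (B + ε) hBε.le
      (by
        have hev1 : ∀ᶠ w : Euc n × ℝ in nhds 0, ‖Y e + w.1 - x‖ < R :=
          ((by fun_prop : Continuous fun w : Euc n × ℝ => ‖Y e + w.1 - x‖).tendsto
            0).eventually_lt_const (u := R) (by simpa using hYR)
        have hev2 : ∀ᶠ w : Euc n × ℝ in nhds 0, |T e + w.2 - t| < R :=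
          ((by fun_prop : Continuous fun w : Euc n × ℝ => |T e + w.2 - t|).tendsto
            0).eventually_lt_const (u := R) (by simpa using hTR)
        filter_upwards [hev1, hev2] with w hw1 hw2
        rw [abs_lt] at hw2
        have h1 := hmax e (Y e + w.1) (by rw [mem_closedBall, dist_eq_norm]; exact hw1.le)
          (T e + w.2) ⟨by linarith [hw2.1], by linarith [hw2.2]⟩
        have h2 : ‖Y e + w.1 - x - e‖ ^ 2 =
            ‖Y e - x - e‖ ^ 2 + 2 * inner ℝ (Y e - x - e) w.1 + ‖w.1‖ ^ 2 := by
          rw [← norm_add_sq_real]; congr 2; abel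
        simp only [h2] at h1
        rw [real_inner_smul_left]
        linarith)
    have h1 : |2 * (C + 1) * (T e - t)| ≤ ε := by
      rw [abs_mul, abs_mul, abs_two]
      exact (mul_le_mul_of_nonneg_left hTA (by positivity)).trans hδC
    linarith [(abs_le.1 h1).1]
  · push Not at hcase
    have hYeq : ∀ e : Euc n, ‖e‖ < δ → Y e = x + e := fun e he => by
      have := hcase e he
      rw [sub_sub, sub_eq_zero] at this
      exact this
    obtain ⟨b, hb⟩ : ∃ b : ℝ → ℝ, b = fun s => τ * (s - t) + (C + 1) * (s - t) ^ 2 := ⟨_, rfl⟩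
    have hδR' : δ < R := by
      have := mul_pos hA hδ
      linarith
    have hin : ∀ e : Euc n, ‖e‖ < δ → x + e ∈ closedBall x R := fun e he => by
      rw [mem_closedBall, dist_eq_norm, add_sub_cancel_left]; linarith
    have hmb : ∀ e : Euc n, ‖e‖ < δ → ∀ y' ∈ closedBall x R, ∀ s' ∈ Icc (t - R) (t + R),
        u (y', s') - b s' - (B + ε) * ‖y' - x - e‖ ^ 2 ≤ u (x + e, T e) - b (T e) := by
      intro e he y' hy' s' hs'
      have h1 := hmax e y' hy' s' hs'
      simp only [hYeq e he, add_sub_cancel_left, sub_self, norm_zero] at h1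
      rw [hb]
      linarith
    have hconst : ∀ e ∈ ball (0 : Euc n) δ, u (x + e, T e) - b (T e) =
        u (x + 0, T 0) - b (T 0) := by
      refine eq_of_sub_le_sq (m := fun e => u (x + e, T e) - b (T e)) (B := B + ε) ?_
      intro e he e' he'
      rw [mem_ball_zero_iff] at he he'
      have h1 := hmb e he (x + e') (hin e' he') (T e') (hT e')
      rw [add_sub_cancel_left, norm_sub_rev] at h1
      linarith
    have hgreat : ∀ e : Euc n, ‖e‖ < δ →
        sSup ((fun s => u (x + e, s) - b s) '' Ioo (t - R) (t + R)) =
          u (x + e, T e) - b (T e) := by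
      intro e he
      obtain ⟨-, hTR, -, -⟩ := hnear e he
      rw [abs_lt] at hTR
      refine IsGreatest.csSup_eq ⟨⟨T e, ⟨by linarith [hTR.1], by linarith [hTR.2]⟩, rfl⟩, ?_⟩
      rintro _ ⟨s, hs, rfl⟩
      have h1 := hmb e he (x + e) (hin e he) s (Ioo_subset_Icc_self hs)
      simp only [add_sub_cancel_left, sub_self, norm_zero] at h1
      linarith
    have hbt : HasDerivAt b τ t := by
      rw [hb]
      have h1 := (((hasDerivAt_id t).sub_const t).const_mul τ).add
        ((((hasDerivAt_id t).sub_const t).pow 2).const_mul (C + 1))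
      refine h1.congr_deriv ?_
      simp
    have key := (h x t (hΩQ hz)).2 R hR b (by rw [hb]; fun_prop) (by rw [hb]; simp)
      (fun s hs => by
        have h1 := hRle 0 (s - t) (by simpa using hR.le)
          (abs_le.2 ⟨by linarith [hs.1], by linarith [hs.2]⟩)
        simp only [add_zero, add_sub_cancel, norm_zero] at h1
        rw [hb]
        linarith [sq_nonneg (s - t)])
      ⟨δ, hδ, fun y hy => by
        have h1 : ‖y - x‖ < δ := by rwa [mem_ball, dist_eq_norm] at hy
        have h2 := hgreat (y - x) h1
        have h3 := hgreat 0 (by simpa using hδ)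
        have h4 := hconst (y - x) (by simpa using h1)
        rw [add_sub_cancel] at h2 h4
        rw [add_zero] at h3 h4
        rw [h2, h3, h4]⟩
    rw [hbt.deriv] at key
    have h1 := hf _ hz
    have h2 : 0 ≤ N * (B + ε) := by positivity
    linarith

end Paraboloid

section LocalLipschitz

variable {n : ℕ} {σ : Euc n → Euc n →L[ℝ] Euc n} {h : ℝ → ℝ} {k : ℕ} {c C L M : ℝ}

lemma IsDeg.ellOn (hd : IsDeg σ h k c C L) {l : ℝ} (hl : 0 < l) :
    EllOn σ {ξ | l / 8 < ‖ξ‖ ∧ ‖ξ‖ < 4 * l} (c * Real.sqrt (h l)) (C * Real.sqrt (h l))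
      (L * Real.sqrt (h l) / l) := by
  obtain ⟨S, hS⟩ : ∃ S, S = Real.sqrt (h l) := ⟨_, rfl⟩
  have hS0 : 0 < S := by rw [hS]; exact Real.sqrt_pos.2 (hd.pos l hl)
  have he := hd.ell l hl
  rw [← hS] at he ⊢
  have hmem : ∀ ξ ∈ {ξ : Euc n | l / 8 < ‖ξ‖ ∧ ‖ξ‖ < 4 * l},
      l⁻¹ • ξ ∈ {ζ : Euc n | 1 / 8 < ‖ζ‖ ∧ ‖ζ‖ < 4} := fun ξ hξ => by
    refine ⟨?_, ?_⟩ <;> rw [norm_smul, norm_inv, Real.norm_of_nonneg hl.le, inv_mul_eq_div]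
    · rw [lt_div_iff₀ hl]; linarith [hξ.1]
    · rw [div_lt_iff₀ hl]; linarith [hξ.2]
  have hsm : ∀ ξ : Euc n, l • l⁻¹ • ξ = ξ := fun ξ => smul_inv_smul₀ hl.ne' ξ
  have hnorm : ∀ w : Euc n, ‖(1 / S) • w‖ = ‖w‖ / S := fun w => by
    rw [norm_smul, Real.norm_of_nonneg (by positivity), one_div, inv_mul_eq_div]
  refine ⟨fun ξ hξ v => ?_, fun ξ hξ v => ?_, fun ξ hξ ξ' hξ' => ?_⟩
  · have h1 := he.lower _ (hmem ξ hξ) v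
    simp only [hsm, smul_apply, hnorm] at h1
    rw [le_div_iff₀ hS0] at h1
    linarith
  · have h1 := he.upper _ (hmem ξ hξ) v
    simp only [hsm, smul_apply, hnorm] at h1
    rw [div_le_iff₀ hS0] at h1
    linarith
  · have h1 := he.lip _ (hmem ξ hξ) _ (hmem ξ' hξ')
    simp only [hsm] at h1
    have h2 : ‖(1 / S) • σ ξ - (1 / S) • σ ξ'‖ = 1 / S * ‖σ ξ - σ ξ'‖ := by
      have : (1 / S) • σ ξ - (1 / S) • σ ξ' = (1 / S) • (σ ξ - σ ξ') := (smul_sub _ _ _).symm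
      rw [this, norm_smul, Real.norm_of_nonneg (by positivity)]
    rw [h2, ← smul_sub, norm_smul, norm_inv, Real.norm_of_nonneg hl.le, one_div,
      inv_mul_le_iff₀ hS0] at h1
    refine h1.trans_eq ?_
    field_simp

lemma modulus_deg (hd : IsDeg σ h k c C L) (hc : 0 < c) (hL : 0 ≤ L) {u : Euc n → ℝ → ℝ}
    {Ω : Set (Euc n × ℝ)} (hu : VisSol σ {0}ᶜ M Ω u) (hM : 0 ≤ M) (hΩ : IsOpen Ω) {x₀ : Euc n}
    {t₀ d η W₀ : ℝ} (hd0 : 0 < d) (hη : 0 < η) (hW₀ : 0 ≤ W₀)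
    (hin : ∀ x t, ‖x - x₀‖ ≤ 2 * d → t ∈ Icc (t₀ - d) (t₀ + η) → (x, t) ∈ Ω)
    {φ m κ W : ℝ → ℝ} (hφc : ContinuousOn φ (Icc 0 d)) (hφ0 : 0 ≤ φ 0)
    (hm : ∀ s ∈ Ioo 0 d, 1 ≤ m s) (hκ : ∀ s ∈ Ioo 0 d, κ s ≤ 0)
    (hφ : ∀ s ∈ Ioo 0 d, ∀ᶠ s' in nhds s,
      φ s' ≤ φ s + m s * (s' - s) + κ s / 2 * (s' - s) ^ 2)
    (hm1 : ∀ s ∈ Ioo 0 d, 4 * W₀ ≤ d * m s) (hm2 : ∀ s ∈ Ioo 0 d, 2 * L * W₀ ≤ c * d * m s)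
    (hWW : ∀ s ∈ Ioo 0 d, W s ≤ W₀)
    (hW : ∀ x y t, ‖x - x₀‖ ≤ d → ‖x - y‖ < d → t ∈ Icc (t₀ - d) (t₀ + η) →
      u x t - u y t - φ ‖x - y‖ ≤ W ‖x - y‖)
    (hρ : ∀ x y t, ‖x - x₀‖ ≤ d → ‖x - y‖ = d → t ∈ Icc (t₀ - d) (t₀ + η) →
      u x t - u y t ≤ φ d)
    (hmain : ∀ s ∈ Ioo 0 d, (2 * W₀ / d + 2 * M) / h 1 + 2 * (W₀ / d ^ 2) * n * C ^ 2 +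
      4 * n * L ^ 2 * (W₀ / d ^ 2) * (W s / (s * m s)) < c ^ 2 * (-κ s))
    {y₀ : Euc n} (hy₀ : ‖x₀ - y₀‖ ≤ d) : u x₀ t₀ - u y₀ t₀ ≤ φ ‖x₀ - y₀‖ := by
  have hKd : 2 * (W₀ / d ^ 2) * d = 2 * W₀ / d := by field_simp
  have hmpos : ∀ s ∈ Ioo 0 d, 0 < m s := fun s hs => one_pos.trans_le (hm s hs)
  have hS : ∀ s ∈ Ioo 0 d, 0 < Real.sqrt (h (m s)) := fun s hs =>
    Real.sqrt_pos.2 (hd.pos _ (hmpos s hs))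
  refine improve_modulus hu hΩ isOpen_compl_singleton (r₀ := d) (τ₀ := d) (ρ := d) (h := η)
    (K := W₀ / d ^ 2) (Kt := W₀ / d ^ 2) (W := W) (m := m) (κ := κ)
    (c₀ := fun s => c * Real.sqrt (h (m s))) (C₀ := fun s => C * Real.sqrt (h (m s)))
    (Lσ := fun s => L * Real.sqrt (h (m s)) / m s)
    hd0.le hd0.le hη (by positivity) (by positivity) ?_ hφc hφ0 (fun s hs => (hmpos s hs).le) hκ hφ
    (fun s hs => mul_pos hc (hS s hs))
    (fun s hs => div_nonneg (mul_nonneg hL (hS s hs).le) (hmpos s hs).le) ?_ ?_ hW hρ ?_ ?_ ?_ hy₀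
  · intro x y t hx hy ht
    refine ⟨hin x t (by linarith) ht, hin y t ?_ ht⟩
    have := norm_sub_le_norm_sub_add_norm_sub y x x₀
    rw [norm_sub_rev y x] at this
    linarith
  · intro s hs ξ₁ ξ₂ h2 h12
    have hl := hmpos s hs
    rw [hKd] at h12
    have h3 : 2 * W₀ / d ≤ m s / 2 := by
      rw [div_le_div_iff₀ hd0 two_pos]; linarith [hm1 s hs]
    have h4 := norm_sub_norm_le ξ₁ ξ₂
    have h5 := norm_sub_norm_le ξ₂ ξ₁
    rw [norm_sub_rev] at h5
    have he := hd.ellOn hl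
    have hopen : IsOpen {ξ : Euc n | m s / 8 < ‖ξ‖ ∧ ‖ξ‖ < 4 * m s} :=
      (isOpen_lt continuous_const continuous_norm).inter
        (isOpen_lt continuous_norm continuous_const)
    have hm1 : ξ₁ ∈ {ξ : Euc n | m s / 8 < ‖ξ‖ ∧ ‖ξ‖ < 4 * m s} :=
      ⟨by linarith, by linarith⟩
    have hm2 : ξ₂ ∈ {ξ : Euc n | m s / 8 < ‖ξ‖ ∧ ‖ξ‖ < 4 * m s} :=
      ⟨by linarith, by linarith⟩
    refine ⟨?_, ?_, he.continuousAt hopen hm1, he.continuousAt hopen hm2, he.lower _ hm2,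
      he.upper _ hm1, he.lip _ hm1 _ hm2⟩
    · exact norm_pos_iff.1 (by linarith)
    · exact norm_pos_iff.1 (by linarith)
  · intro s hs
    have hl := hmpos s hs
    rw [hKd, div_mul_div_comm, div_le_iff₀ (by positivity)]
    have := mul_le_mul_of_nonneg_right (hm2 s hs) (hS s hs).le
    linarith
  · intro s hs
    refine (hWW s hs).trans_eq ?_
    field_simp
  · intro s hs
    refine (hWW s hs).trans_eq ?_
    field_simp
  · intro s hs
    have hl := hmpos s hs
    have hH := hd.pos _ hl
    have h1 : h 1 ≤ h (m s) := hd.mono 1 (m s) one_pos (hm s hs)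
    have h10 := hd.pos 1 one_pos
    have h2 := mul_lt_mul_of_pos_left (hmain s hs) hH
    have h3 : 2 * W₀ / d + 2 * M ≤ h (m s) * ((2 * W₀ / d + 2 * M) / h 1) := by
      rw [mul_div_assoc', le_div_iff₀ h10, mul_comm]
      exact mul_le_mul_of_nonneg_right h1 (by positivity)
    simp only [mul_pow, div_pow, Real.sq_sqrt hH.le]
    rw [hKd]
    have h4 : n * (m s / s) * (L ^ 2 * h (m s) / m s ^ 2 * (4 * (W₀ / d ^ 2) * W s)) =
        h (m s) * (4 * n * L ^ 2 * (W₀ / d ^ 2) * (W s / (s * m s))) := by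
      have := hs.1
      field_simp
    rw [h4]
    linarith

lemma sqrt_le_parabola {s s' : ℝ} (hs : 0 < s) (hs0 : 0 ≤ s') (hs' : s' ≤ 4 * s) :
    Real.sqrt s' ≤ Real.sqrt s + 1 / (2 * Real.sqrt s) * (s' - s) -
      1 / (18 * (s * Real.sqrt s)) * (s' - s) ^ 2 := by
  obtain ⟨r, hr⟩ : ∃ r, r = Real.sqrt s := ⟨_, rfl⟩
  obtain ⟨r', hr'⟩ : ∃ r', r' = Real.sqrt s' := ⟨_, rfl⟩
  have hr0 : 0 < r := by rw [hr]; positivity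
  have hr'0 : 0 ≤ r' := by rw [hr']; positivity
  have e1 : s = r ^ 2 := by rw [hr, Real.sq_sqrt hs.le]
  have e2 : s' = r' ^ 2 := by rw [hr', Real.sq_sqrt hs0]
  rw [← hr, ← hr']
  rw [e1, e2] at hs' ⊢
  have h1 : r' ≤ 2 * r := by
    refine le_of_sq_le_sq ?_ (by positivity)
    linarith
  have h2 : r + 1 / (2 * r) * (r' ^ 2 - r ^ 2) - 1 / (18 * (r ^ 2 * r)) * (r' ^ 2 - r ^ 2) ^ 2 - r' =
      (r' - r) ^ 2 * ((2 * r - r') * (r' + 4 * r)) / (18 * r ^ 3) := by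
    field_simp; ring
  have h3 : 0 ≤ (r' - r) ^ 2 * ((2 * r - r') * (r' + 4 * r)) / (18 * r ^ 3) := by
    have : 0 ≤ 2 * r - r' := by linarith
    positivity
  linarith

lemma neg_mul_sqrt_le_parabola {s s' : ℝ} (hs : 0 < s) (hs0 : 0 ≤ s') (hs' : s' ≤ 4 * s) :
    -(s' * Real.sqrt s') ≤ -(s * Real.sqrt s) - 3 / 2 * Real.sqrt s * (s' - s) -
      1 / (18 * Real.sqrt s) * (s' - s) ^ 2 := by
  obtain ⟨r, hr⟩ : ∃ r, r = Real.sqrt s := ⟨_, rfl⟩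
  obtain ⟨r', hr'⟩ : ∃ r', r' = Real.sqrt s' := ⟨_, rfl⟩
  have hr0 : 0 < r := by rw [hr]; positivity
  have hr'0 : 0 ≤ r' := by rw [hr']; positivity
  have e1 : s = r ^ 2 := by rw [hr, Real.sq_sqrt hs.le]
  have e2 : s' = r' ^ 2 := by rw [hr', Real.sq_sqrt hs0]
  rw [← hr, ← hr']
  rw [e1, e2] at hs' ⊢
  have h1 : r' ≤ 2 * r := by
    refine le_of_sq_le_sq ?_ (by positivity)
    linarith
  have h2 : -(r ^ 2 * r) - 3 / 2 * r * (r' ^ 2 - r ^ 2) - 1 / (18 * r) * (r' ^ 2 - r ^ 2) ^ 2 -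
      -(r' ^ 2 * r') = (r' - r) ^ 2 * ((r' + r) * (2 * r - r') + 15 * r * r' + 6 * r ^ 2) / (18 * r) := by
    field_simp; ring
  have h3 : 0 ≤ (r' - r) ^ 2 * ((r' + r) * (2 * r - r') + 15 * r * r' + 6 * r ^ 2) / (18 * r) := by
    have : 0 ≤ 2 * r - r' := by linarith
    positivity
  linarith

/-- Interior Hölder-1/2 bound in space. -/
lemma exists_sqrt_modulus (hd : IsDeg σ h k c C L) (hc : 0 < c) (hL : 0 ≤ L) {u : Euc n → ℝ → ℝ}
    {Ω : Set (Euc n × ℝ)} (hu : VisSol σ {0}ᶜ M Ω u) (hM : 0 ≤ M) (hΩ : IsOpen Ω) {d M₀ : ℝ}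
    (hd0 : 0 < d) (hd1 : d ≤ 1) (hM₀ : 0 ≤ M₀) (hb : ∀ z ∈ Ω, |u z.1 z.2| ≤ M₀) :
    ∃ L₁ > 0, ∀ x₀ t₀, (∃ η > 0, ∀ x t, ‖x - x₀‖ ≤ 2 * d → t ∈ Icc (t₀ - d) (t₀ + η) →
      (x, t) ∈ Ω) → ∀ y₀, ‖x₀ - y₀‖ ≤ d → u x₀ t₀ - u y₀ t₀ ≤ L₁ * Real.sqrt ‖x₀ - y₀‖ := by
  obtain ⟨W₀, hW₀⟩ : ∃ W₀, W₀ = 2 * M₀ := ⟨_, rfl⟩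
  have hW0 : 0 ≤ W₀ := by rw [hW₀]; positivity
  obtain ⟨N₁, hN₁⟩ : ∃ N₁, N₁ = (2 * W₀ / d + 2 * M) / h 1 + 2 * (W₀ / d ^ 2) * n * C ^ 2 :=
    ⟨_, rfl⟩
  obtain ⟨N₂, hN₂⟩ : ∃ N₂, N₂ = 4 * n * L ^ 2 * (W₀ / d ^ 2) := ⟨_, rfl⟩
  have h10 := hd.pos 1 one_pos
  have hN1 : 0 ≤ N₁ := by rw [hN₁]; positivity
  have hN2 : 0 ≤ N₂ := by rw [hN₂]; positivity
  obtain ⟨L₁, hL₁⟩ : ∃ L₁, L₁ = 2 + 8 * W₀ / d + 4 * L * W₀ / (c * d) + W₀ / Real.sqrt d +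
    9 * (N₁ + N₂ * (2 * W₀) + 1) / c ^ 2 := ⟨_, rfl⟩
  have q1 : 0 ≤ 8 * W₀ / d := by positivity
  have q2 : 0 ≤ 4 * L * W₀ / (c * d) := by positivity
  have q3 : 0 ≤ W₀ / Real.sqrt d := by positivity
  have q4 : 0 ≤ 9 * (N₁ + N₂ * (2 * W₀) + 1) / c ^ 2 := by positivity
  have hL2 : 2 ≤ L₁ := by linarith
  have hL0 : 0 < L₁ := by linarith
  refine ⟨L₁, hL0, ?_⟩
  rintro x₀ t₀ ⟨η, hη, hin⟩ y₀ hy₀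
  have hsq : ∀ s ∈ Ioo 0 d, 0 < Real.sqrt s ∧ Real.sqrt s ≤ 1 := fun s hs =>
    ⟨Real.sqrt_pos.2 hs.1, Real.sqrt_le_one.2 (hs.2.le.trans hd1)⟩
  have hmL : ∀ s ∈ Ioo 0 d, L₁ / 2 ≤ L₁ / (2 * Real.sqrt s) := fun s hs => by
    obtain ⟨a1, a2⟩ := hsq s hs
    exact div_le_div_of_nonneg_left hL0.le (by positivity) (by linarith)
  have hosc : ∀ x y t, ‖x - x₀‖ ≤ d → ‖x - y‖ ≤ d → t ∈ Icc (t₀ - d) (t₀ + η) →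
      u x t - u y t ≤ W₀ := fun x y t hx hy ht => by
    have h1 := (abs_le.1 (hb (x, t) (hin x t (by linarith) ht))).2
    have h2 := (abs_le.1 (hb (y, t) (hin y t (by
      have := norm_sub_le_norm_sub_add_norm_sub y x x₀
      rw [norm_sub_rev y x] at this
      linarith) ht))).1
    simp only at h1 h2
    rw [hW₀]; linarith
  refine modulus_deg hd hc hL hu hM hΩ hd0 hη hW0 hin (φ := fun s => L₁ * Real.sqrt s)
    (m := fun s => L₁ / (2 * Real.sqrt s)) (κ := fun s => -(L₁ / (9 * (s * Real.sqrt s))))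
    (W := fun _ => W₀) (by fun_prop) (by simp) (fun s hs => ?_) (fun s hs => ?_) (fun s hs => ?_)
    (fun s hs => ?_) (fun s hs => ?_) (fun _ _ => le_rfl) ?_ ?_ (fun s hs => ?_) hy₀
  · linarith [hmL s hs]
  · have := hs.1
    obtain ⟨a1, a2⟩ := hsq s hs
    rw [neg_nonpos]; positivity
  · have h1 := hs.1
    filter_upwards [eventually_gt_nhds h1, eventually_lt_nhds (show s < 4 * s by linarith)]
      with s' e1 e2
    have h2 := mul_le_mul_of_nonneg_left (sqrt_le_parabola h1 e1.le e2.le) hL0.le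
    refine h2.trans_eq ?_
    obtain ⟨a1, a2⟩ := hsq s hs
    field_simp
    ring
  · have h1 := mul_le_mul_of_nonneg_left (hmL s hs) hd0.le
    have h2 : d * (8 * W₀ / d) ≤ d * L₁ := mul_le_mul_of_nonneg_left (by linarith) hd0.le
    rw [mul_div_cancel₀ _ hd0.ne'] at h2
    linarith
  · have h1 := mul_le_mul_of_nonneg_left (hmL s hs) (mul_pos hc hd0).le
    have h2 : c * d * (4 * L * W₀ / (c * d)) ≤ c * d * L₁ :=
      mul_le_mul_of_nonneg_left (by linarith) (by positivity)
    rw [mul_div_cancel₀ _ (by positivity)] at h2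
    linarith
  · intro x y t hx hy ht
    have h1 := hosc x y t hx hy.le ht
    have : 0 ≤ L₁ * Real.sqrt ‖x - y‖ := by positivity
    linarith
  · intro x y t hx hy ht
    refine (hosc x y t hx hy.le ht).trans ?_
    have h2 : W₀ / Real.sqrt d ≤ L₁ := by linarith
    rwa [div_le_iff₀ (Real.sqrt_pos.2 hd0)] at h2
  · have hs0 := hs.1
    obtain ⟨a1, a2⟩ := hsq s hs
    rw [← hN₁, ← hN₂, neg_neg]
    have h1 : W₀ / (s * (L₁ / (2 * Real.sqrt s))) * (s * Real.sqrt s) ≤ 2 * W₀ := by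
      have : W₀ / (s * (L₁ / (2 * Real.sqrt s))) * (s * Real.sqrt s) =
          2 * W₀ * (Real.sqrt s ^ 2 / L₁) := by field_simp
      rw [this]
      refine mul_le_of_le_one_right (by positivity) ((div_le_one hL0).2 ?_)
      have := pow_le_one₀ (n := 2) a1.le a2
      linarith
    have h2 : s * Real.sqrt s ≤ 1 := mul_le_one₀ (hs.2.le.trans hd1) a1.le a2
    have h3 : c ^ 2 * (L₁ / (9 * (s * Real.sqrt s))) * (s * Real.sqrt s) = c ^ 2 * L₁ / 9 := by
      field_simp
    refine lt_of_mul_lt_mul_right (a := s * Real.sqrt s) ?_ (by positivity)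
    rw [h3]
    have h4 : c ^ 2 * (9 * (N₁ + N₂ * (2 * W₀) + 1) / c ^ 2) ≤ c ^ 2 * L₁ :=
      mul_le_mul_of_nonneg_left (by linarith) (by positivity)
    rw [mul_div_cancel₀ _ (by positivity)] at h4
    have h5 := mul_le_mul_of_nonneg_left h1 hN2
    have h6 := mul_le_mul_of_nonneg_left h2 hN1
    linarith

/-- Interior Lipschitz bound in space. -/
lemma exists_lip_modulus (hd : IsDeg σ h k c C L) (hc : 0 < c) (hL : 0 ≤ L) {u : Euc n → ℝ → ℝ}
    {Ω : Set (Euc n × ℝ)} (hu : VisSol σ {0}ᶜ M Ω u) (hM : 0 ≤ M) (hΩ : IsOpen Ω) {d L₁ : ℝ}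
    (hd0 : 0 < d) (hd1 : d ≤ 1 / 9) (hL₁ : 0 ≤ L₁) :
    ∃ L₂ > 0, ∀ x₀ t₀, (∃ η > 0, ∀ x t, ‖x - x₀‖ ≤ 2 * d → t ∈ Icc (t₀ - d) (t₀ + η) →
      (x, t) ∈ Ω ∧ ∀ y, ‖x - y‖ ≤ d → u x t - u y t ≤ L₁ * Real.sqrt ‖x - y‖) →
      ∀ y₀, ‖x₀ - y₀‖ ≤ d → u x₀ t₀ - u y₀ t₀ ≤ L₂ * ‖x₀ - y₀‖ := by
  obtain ⟨N₁, hN₁⟩ : ∃ N₁, N₁ = (2 * L₁ / d + 2 * M) / h 1 + 2 * (L₁ / d ^ 2) * n * C ^ 2 :=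
    ⟨_, rfl⟩
  obtain ⟨N₂, hN₂⟩ : ∃ N₂, N₂ = 4 * n * L ^ 2 * (L₁ / d ^ 2) := ⟨_, rfl⟩
  have h10 := hd.pos 1 one_pos
  have hN1 : 0 ≤ N₁ := by rw [hN₁]; positivity
  have hN2 : 0 ≤ N₂ := by rw [hN₂]; positivity
  obtain ⟨A, hA⟩ : ∃ A, A = 2 + 8 * L₁ / d + 4 * L * L₁ / (c * d) + 2 * L₁ / d +
    9 * (N₁ + N₂ * (2 * L₁) + 1) / c ^ 2 := ⟨_, rfl⟩
  have q1 : 0 ≤ 8 * L₁ / d := by positivity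
  have q2 : 0 ≤ 4 * L * L₁ / (c * d) := by positivity
  have q3 : 0 ≤ 2 * L₁ / d := by positivity
  have q4 : 0 ≤ 9 * (N₁ + N₂ * (2 * L₁) + 1) / c ^ 2 := by positivity
  have hA2 : 2 ≤ A := by linarith
  have hA0 : 0 < A := by linarith
  refine ⟨A, hA0, ?_⟩
  rintro x₀ t₀ ⟨η, hη, hin⟩ y₀ hy₀
  have hthird : ∀ s, s ≤ d → Real.sqrt s ≤ 1 / 3 := fun s hs => by
    rw [Real.sqrt_le_left (by norm_num)]; linarith
  have hsq : ∀ s ∈ Ioo 0 d, 0 < Real.sqrt s ∧ Real.sqrt s ≤ 1 / 3 := fun s hs =>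
    ⟨Real.sqrt_pos.2 hs.1, hthird s hs.2.le⟩
  have hmL : ∀ s ∈ Ioo 0 d, A / 2 ≤ A * (1 - 3 / 2 * Real.sqrt s) := fun s hs => by
    obtain ⟨a1, a2⟩ := hsq s hs
    have := mul_le_mul_of_nonneg_left (show 1 / 2 ≤ 1 - 3 / 2 * Real.sqrt s by linarith) hA0.le
    linarith
  have hφnn : ∀ s, 0 ≤ s → s ≤ d → s / 2 * A ≤ A * (s - s * Real.sqrt s) := fun s hs hsd => by
    have h1 := mul_le_mul_of_nonneg_left (hthird s hsd) hs
    have h2 := mul_le_mul_of_nonneg_left (show s / 2 ≤ s - s * Real.sqrt s by linarith) hA0.le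
    linarith
  have key : u x₀ t₀ - u y₀ t₀ ≤
      A * (‖x₀ - y₀‖ - ‖x₀ - y₀‖ * Real.sqrt ‖x₀ - y₀‖) := by
    refine modulus_deg hd hc hL hu hM hΩ hd0 hη hL₁ (fun x t hx ht => (hin x t hx ht).1)
      (φ := fun s => A * (s - s * Real.sqrt s))
      (m := fun s => A * (1 - 3 / 2 * Real.sqrt s)) (κ := fun s => -(A / (9 * Real.sqrt s)))
      (W := fun s => L₁ * Real.sqrt s) (by fun_prop) (by simp) (fun s hs => ?_) (fun s hs => ?_)
      (fun s hs => ?_) (fun s hs => ?_) (fun s hs => ?_) (fun s hs => ?_) ?_ ?_ (fun s hs => ?_) hy₀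
    · linarith [hmL s hs]
    · obtain ⟨a1, a2⟩ := hsq s hs
      rw [neg_nonpos]; positivity
    · have h1 := hs.1
      filter_upwards [eventually_gt_nhds h1, eventually_lt_nhds (show s < 4 * s by linarith)]
        with s' e1 e2
      have h2 := mul_le_mul_of_nonneg_left (neg_mul_sqrt_le_parabola h1 e1.le e2.le) hA0.le
      have h3 : -(A / (9 * Real.sqrt s)) / 2 * (s' - s) ^ 2 =
          -(A * (1 / (18 * Real.sqrt s) * (s' - s) ^ 2)) := by
        obtain ⟨a1, a2⟩ := hsq s hs
        field_simp
        ring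
      rw [h3]
      linarith
    · have h1 := mul_le_mul_of_nonneg_left (hmL s hs) hd0.le
      have h2 : d * (8 * L₁ / d) ≤ d * A := mul_le_mul_of_nonneg_left (by linarith) hd0.le
      rw [mul_div_cancel₀ _ hd0.ne'] at h2
      linarith
    · have h1 := mul_le_mul_of_nonneg_left (hmL s hs) (mul_pos hc hd0).le
      have h2 : c * d * (4 * L * L₁ / (c * d)) ≤ c * d * A :=
        mul_le_mul_of_nonneg_left (by linarith) (by positivity)
      rw [mul_div_cancel₀ _ (by positivity)] at h2
      linarith
    · obtain ⟨a1, a2⟩ := hsq s hs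
      exact mul_le_of_le_one_right hL₁ (by linarith)
    · intro x y t hx hy ht
      have h1 := (hin x t (by linarith) ht).2 y hy.le
      have h2 := hφnn ‖x - y‖ (norm_nonneg _) hy.le
      have : 0 ≤ ‖x - y‖ / 2 * A := by positivity
      linarith
    · intro x y t hx hy ht
      have h1 := (hin x t (by linarith) ht).2 y hy.le
      have h2 := hφnn d hd0.le le_rfl
      rw [hy] at h1
      have h3 := mul_le_mul_of_nonneg_left (hthird d le_rfl) hL₁
      have h4 : d / 2 * (2 * L₁ / d) ≤ d / 2 * A :=
        mul_le_mul_of_nonneg_left (by linarith) (by positivity)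
      have h5 : d / 2 * (2 * L₁ / d) = L₁ := by field_simp
      linarith
    · have hs0 := hs.1
      obtain ⟨a1, a2⟩ := hsq s hs
      rw [← hN₁, ← hN₂, neg_neg]
      have hm0 : 1 ≤ A * (1 - 3 / 2 * Real.sqrt s) := by linarith [hmL s hs]
      have h1 : L₁ * Real.sqrt s / (s * (A * (1 - 3 / 2 * Real.sqrt s))) * Real.sqrt s ≤ 2 * L₁ := by
        have : L₁ * Real.sqrt s / (s * (A * (1 - 3 / 2 * Real.sqrt s))) * Real.sqrt s =
            L₁ / (A * (1 - 3 / 2 * Real.sqrt s)) := by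
          rw [div_mul_eq_mul_div, mul_assoc, Real.mul_self_sqrt hs0.le, mul_comm L₁ s,
            mul_div_mul_left _ _ hs0.ne']
        rw [this]
        exact (div_le_self hL₁ hm0).trans (by linarith)
      have h3 : c ^ 2 * (A / (9 * Real.sqrt s)) * Real.sqrt s = c ^ 2 * A / 9 := by
        field_simp
      refine lt_of_mul_lt_mul_right (a := Real.sqrt s) ?_ a1.le
      rw [h3]
      have h4 : c ^ 2 * (9 * (N₁ + N₂ * (2 * L₁) + 1) / c ^ 2) ≤ c ^ 2 * A :=
        mul_le_mul_of_nonneg_left (by linarith) (by positivity)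
      rw [mul_div_cancel₀ _ (by positivity)] at h4
      have h5 := mul_le_mul_of_nonneg_left h1 hN2
      have h6 := mul_le_mul_of_nonneg_left (show Real.sqrt s ≤ 1 by linarith) hN1
      linarith
  refine key.trans (mul_le_mul_of_nonneg_left ?_ hA0.le)
  have : 0 ≤ ‖x₀ - y₀‖ * Real.sqrt ‖x₀ - y₀‖ := by positivity
  linarith

end LocalLipschitz

section AffineApproximation

variable {n : ℕ}

lemma le_of_left_limit {g : ℝ → ℝ} {a b c : ℝ} (hab : a < b) (hg : ContinuousOn g (Ioc a b))
    (h : ∀ t ∈ Ioo a b, g t ≤ c) : g b ≤ c := by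
  have h1 : ContinuousWithinAt g (Ioo a b) b :=
    (hg b ⟨hab, le_rfl⟩).mono Ioo_subset_Ioc_self
  have : (nhdsWithin b (Ioo a b)).NeBot := by
    rw [nhdsWithin_Ioo_eq_nhdsLT hab]; infer_instance
  exact le_of_tendsto h1 (by filter_upwards [self_mem_nhdsWithin] with t ht using h t ht)

/-- Upward propagation in time of an affine upper bound. -/
lemma affine_barrier {Λ g M N b m R : ℝ} {Ω : Set (Euc n × ℝ)} {u : Euc n → ℝ → ℝ}
    {x₀ ℓ : Euc n} {t₁ t' T' c₀ : ℝ} (hN : Λ * b + M < N) (hv : VisPara Λ g M Ω u)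
    (hcont : ContinuousOn (fun z : Euc n × ℝ => u z.1 z.2) Ω) (hb : 0 < b) (hR : 0 < R)
    (hm : m < b * R) (hg : ‖ℓ‖ + 2 * b * R ≤ g) (h1' : t₁ ≤ t') (h2' : t' < T')
    (hΩ : ∀ x, ‖x - x₀‖ ≤ R → ∀ t ∈ Icc t₁ T', (x, t) ∈ Ω)
    (hlip : ∀ x, ‖x - x₀‖ ≤ R → ∀ t ∈ Icc t₁ T',
      u x t - u x₀ t - inner ℝ ℓ (x - x₀) ≤ m * ‖x - x₀‖)
    (hinit : ∀ x, ‖x - x₀‖ ≤ R → u x t₁ ≤ c₀ + inner ℝ ℓ (x - x₀) + b * ‖x - x₀‖ ^ 2) :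
    u x₀ t' ≤ c₀ + N * (t' - t₁) := by
  by_contra! hcon
  let F : Euc n → ℝ → ℝ := fun x t =>
    u x t - c₀ - inner ℝ ℓ (x - x₀) - b * ‖x - x₀‖ ^ 2 - N * (t - t₁)
  have hF : ContinuousOn (fun z : Euc n × ℝ => F z.1 z.2) (closedBall x₀ R ×ˢ Icc t₁ T') := by
    have c1 : ContinuousOn (fun z : Euc n × ℝ => u z.1 z.2) (closedBall x₀ R ×ˢ Icc t₁ T') :=
      hcont.mono fun z hz => hΩ z.1 (by simpa [dist_eq_norm] using hz.1) z.2 hz.2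
    exact (((c1.sub continuousOn_const).sub (Continuous.continuousOn (by fun_prop))).sub
      (Continuous.continuousOn (by fun_prop))).sub (Continuous.continuousOn (by fun_prop))
  obtain ⟨P, hP, x, hx, t, ht, hpos, hmax⟩ := exists_parabolic_max (isCompact_closedBall x₀ R)
    h1' h2' hF (p₀ := x₀) (mem_closedBall_self hR.le) (by
      simp only [F, sub_self, inner_zero_right, norm_zero]; linarith)
  rw [mem_closedBall, dist_eq_norm] at hx
  have htI : t ∈ Icc t₁ T' := ⟨ht.1, ht.2.le⟩
  have ht1 : t₁ < t := by
    refine lt_of_le_of_ne ht.1 fun h0 => ?_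
    have := hinit x hx
    simp only [F, ← h0] at hpos
    linarith
  have hxR : ‖x - x₀‖ < R := by
    refine lt_of_le_of_ne hx fun h0 => ?_
    have h1 := hmax x₀ (mem_closedBall_self hR.le) t htI
    simp only [F, inner_zero_right, norm_zero, sub_self] at h1
    have h2 := hlip x hx t htI
    rw [h0] at h1 h2
    have h3 := mul_lt_mul_of_pos_right hm hR
    linarith
  have hnb : ∀ᶠ w in nhds (0 : Euc n × ℝ), ‖x + w.1 - x₀‖ < R ∧ t + w.2 ∈ Ioo t₁ T' := by
    have c2 : Continuous fun w : Euc n × ℝ => ‖x + w.1 - x₀‖ := by fun_prop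
    have c3 : Continuous fun w : Euc n × ℝ => t + w.2 := by fun_prop
    refine ((c2.tendsto 0).eventually_lt_const (u := R) (by simpa using hxR)).and
      ((c3.tendsto 0).eventually_mem (Ioo_mem_nhds (by simpa using ht1) (by simpa using ht.2)))
  have := hv x t (hΩ x hx t htI) (ℓ + (2 * b) • (x - x₀)) (by
    refine (norm_add_le _ _).trans ?_
    rw [norm_smul, Real.norm_of_nonneg (by positivity)]
    have := mul_le_mul_of_nonneg_left hx (show 0 ≤ 2 * b by positivity)
    linarith) (N + 2 * P * max (t - t') 0) P b hb.le (by
    filter_upwards [hnb] with w hw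
    have h1 := hmax (x + w.1) (by rw [mem_closedBall, dist_eq_norm]; exact hw.1.le) (t + w.2)
      ⟨hw.2.1.le, hw.2.2.le⟩
    have h2 : x + w.1 - x₀ = (x - x₀) + w.1 := by abel
    simp only [F, h2, norm_add_sq_real, inner_add_right] at h1
    rw [inner_add_left, inner_smul_left, RCLike.conj_to_real]
    linarith)
  have h2 : 0 ≤ 2 * P * max (t - t') 0 := by positivity
  linarith

/-- `u` is approximated by an affine function with slope `ℓ` at `(x₀, t₀)` to order `1 + α`. -/
def AffApprox (K α r H : ℝ) (u : Euc n → ℝ → ℝ) (x₀ : Euc n) (t₀ : ℝ) (ℓ : Euc n) : Prop :=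
  ∀ s, 0 < s → s ≤ r → LipX (K * s ^ α) (pCyl x₀ t₀ s (s ^ 2 / H)) fun x t => u x t - inner ℝ ℓ x

variable {K α r H : ℝ} {u : Euc n → ℝ → ℝ} {x₀ ℓ : Euc n} {t₀ : ℝ}

lemma AffApprox.taylor (h : AffApprox K α r H u x₀ t₀ ℓ) (hH : 0 < H)
    (hc : ∀ y, ‖y - x₀‖ < r → ContinuousOn (u y) (Ioc (t₀ - r ^ 2 / H) t₀)) {y : Euc n}
    (hy : 2 * ‖y - x₀‖ ≤ r) :
    |u y t₀ - u x₀ t₀ - inner ℝ ℓ (y - x₀)| ≤ K * (2 * ‖y - x₀‖) ^ α * ‖y - x₀‖ := by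
  by_cases h0 : y - x₀ = 0
  · rw [sub_eq_zero.1 h0]; simp
  have hn : 0 < ‖y - x₀‖ := norm_pos_iff.2 h0
  obtain ⟨s, hs⟩ : ∃ s, s = 2 * ‖y - x₀‖ := ⟨_, rfl⟩
  have hs0 : 0 < s := by rw [hs]; positivity
  rw [← hs] at hy ⊢
  have hL := h s hs0 hy
  have hθ : 0 < s ^ 2 / H := by positivity
  have hθr : s ^ 2 / H ≤ r ^ 2 / H := by gcongr
  have hlt : t₀ - s ^ 2 / H < t₀ := by linarith
  have hsub : Ioc (t₀ - s ^ 2 / H) t₀ ⊆ Ioc (t₀ - r ^ 2 / H) t₀ :=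
    Ioc_subset_Ioc_left (by linarith)
  have c1 := (hc y (by linarith)).mono hsub
  have c2 := (hc x₀ (by simpa using hs0.trans_le hy)).mono hsub
  have hm1 : ∀ t ∈ Ioo (t₀ - s ^ 2 / H) t₀, (y, t) ∈ pCyl x₀ t₀ s (s ^ 2 / H) :=
    fun t ht => ⟨by simp only; linarith, ht.1, ht.2⟩
  have hm2 : ∀ t ∈ Ioo (t₀ - s ^ 2 / H) t₀, (x₀, t) ∈ pCyl x₀ t₀ s (s ^ 2 / H) :=
    fun t ht => ⟨by simpa using hs0, ht.1, ht.2⟩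
  have e1 := le_of_left_limit hlt (c1.sub c2) (c := K * s ^ α * ‖y - x₀‖ + inner ℝ ℓ (y - x₀))
    (fun t ht => by
      have := hL y x₀ t (hm1 t ht) (hm2 t ht)
      rw [inner_sub_right]
      simp only [Pi.sub_apply]
      linarith)
  have e2 := le_of_left_limit hlt (c2.sub c1) (c := K * s ^ α * ‖y - x₀‖ - inner ℝ ℓ (y - x₀))
    (fun t ht => by
      have := hL x₀ y t (hm2 t ht) (hm1 t ht)
      rw [norm_sub_rev] at this
      rw [inner_sub_right]
      simp only [Pi.sub_apply]
      linarith)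
  simp only [Pi.sub_apply] at e1 e2
  rw [abs_le]
  constructor <;> linarith

lemma AffApprox.hasGradientAt (h : AffApprox K α r H u x₀ t₀ ℓ) (hα : 0 < α) (hr : 0 < r)
    (hH : 0 < H) (hc : ∀ y, ‖y - x₀‖ < r → ContinuousOn (u y) (Ioc (t₀ - r ^ 2 / H) t₀)) :
    HasGradientAt (fun y => u y t₀) ℓ x₀ := by
  rw [hasGradientAt_iff_isLittleO, Asymptotics.isLittleO_iff]
  intro ε hε
  have c1 : Continuous fun y : Euc n => K * (2 * ‖y - x₀‖) ^ α :=
    continuous_const.mul (Continuous.rpow_const (by fun_prop) fun _ => Or.inr hα.le)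
  have c2 : Continuous fun y : Euc n => 2 * ‖y - x₀‖ := by fun_prop
  filter_upwards [(c1.tendsto x₀).eventually_lt_const (u := ε)
    (by simpa [Real.zero_rpow hα.ne'] using hε), (c2.tendsto x₀).eventually_lt_const (u := r)
    (by simpa using hr)] with y h1 h2
  rw [Real.norm_eq_abs]
  exact (h.taylor hH hc h2.le).trans (mul_le_mul_of_nonneg_right h1.le (norm_nonneg _))

lemma AffApprox.norm_slope_le {l : ℝ} (h : AffApprox K α r H u x₀ t₀ ℓ) (hr : 0 < r)
    (hH : 0 < H) (hK : 0 ≤ K) (hl : 0 ≤ l) (hL : LipX l (pCyl x₀ t₀ r (r ^ 2 / H)) u) :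
    ‖ℓ‖ ≤ l + K * r ^ α := by
  have h1 : LipX l (pCyl x₀ t₀ r (r ^ 2 / H)) fun x t => u x t - inner ℝ (0 : Euc n) x := by
    simpa using hL
  have := LipX.norm_sub_le hr (by positivity) (by positivity) hl (h r hr le_rfl) h1
  rw [sub_zero] at this
  linarith

lemma norm_slope_sub_le {x₁ x₂ ℓ₁ ℓ₂ : Euc n} {t₁ t₂ G : ℝ}
    (h1 : AffApprox K α r H u x₁ t₁ ℓ₁) (h2 : AffApprox K α r H u x₂ t₂ ℓ₂) (hα : 0 < α)
    (hα1 : α ≤ 1) (hr : 0 < r) (hH : 0 < H) (hK : 0 ≤ K) (hG1 : ‖ℓ₁‖ ≤ G) (hG2 : ‖ℓ₂‖ ≤ G)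
    (hst : ∀ x t, ℓ₁ = ℓ₂ ∨ (x₁, t₁) ≠ (x, t) ∨ (x₂, t₂) ≠ (x, t)) :
    ‖ℓ₁ - ℓ₂‖ ≤ (3 * K + 4 * G / r ^ α) * (1 + H ^ (α / 2)) *
      (‖x₁ - x₂‖ ^ α + |t₁ - t₂| ^ (α / 2)) := by
  wlog ht : t₂ ≤ t₁ generalizing x₁ x₂ ℓ₁ ℓ₂ t₁ t₂
  · have := this h2 h1 hG2 hG1 (fun x t => by
      rcases hst x t with h | h | h
      exacts [Or.inl h.symm, Or.inr (Or.inr h), Or.inr (Or.inl h)]) (le_of_not_ge ht)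
    rwa [norm_sub_rev, norm_sub_rev x₁, abs_sub_comm]
  have hG : 0 ≤ G := (norm_nonneg _).trans hG1
  obtain ⟨τ, hτ⟩ : ∃ τ, τ = t₁ - t₂ := ⟨_, rfl⟩
  have hτ0 : 0 ≤ τ := by linarith
  obtain ⟨ρ, hρ⟩ : ∃ ρ, ρ = ‖x₁ - x₂‖ + Real.sqrt (H * τ) := ⟨_, rfl⟩
  have hρ0 : 0 ≤ ρ := by rw [hρ]; positivity
  have hrα : 0 < r ^ α := by positivity
  have hρα : ρ ^ α ≤ (1 + H ^ (α / 2)) * (‖x₁ - x₂‖ ^ α + |t₁ - t₂| ^ (α / 2)) := by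
    have e1 : ρ ^ α ≤ ‖x₁ - x₂‖ ^ α + Real.sqrt (H * τ) ^ α := by
      rw [hρ]
      exact Real.rpow_add_le_add_rpow (norm_nonneg _) (Real.sqrt_nonneg _) hα.le hα1
    have e2 : Real.sqrt (H * τ) ^ α = H ^ (α / 2) * |t₁ - t₂| ^ (α / 2) := by
      rw [← hτ, abs_of_nonneg hτ0, Real.sqrt_eq_rpow, ← Real.rpow_mul (by positivity),
        ← Real.mul_rpow hH.le hτ0]
      congr 1; ring
    have e3 : 0 ≤ ‖x₁ - x₂‖ ^ α := by positivity
    have e4 : 0 ≤ |t₁ - t₂| ^ (α / 2) := by positivity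
    have e5 : 0 ≤ H ^ (α / 2) := by positivity
    have e6 := mul_nonneg e5 e3
    linarith
  have hgoal : ‖ℓ₁ - ℓ₂‖ ≤ (3 * K + 4 * G / r ^ α) * ρ ^ α := by
    have hρα0 : 0 ≤ ρ ^ α := by positivity
    have f1 : 0 ≤ 3 * K * ρ ^ α := by positivity
    have f2 : 0 ≤ 4 * G / r ^ α * ρ ^ α := by positivity
    have hpow : (2 * ρ) ^ α ≤ 2 * ρ ^ α := by
      rw [Real.mul_rpow two_pos.le hρ0]
      refine mul_le_mul_of_nonneg_right ?_ hρα0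
      calc (2 : ℝ) ^ α ≤ 2 ^ (1 : ℝ) := Real.rpow_le_rpow_of_exponent_le one_le_two hα1
        _ = 2 := Real.rpow_one 2
    rcases hρ0.eq_or_lt with hz | hpos
    · have e1 : ‖x₁ - x₂‖ = 0 := by
        have := Real.sqrt_nonneg (H * τ)
        linarith [norm_nonneg (x₁ - x₂)]
      have e2 : Real.sqrt (H * τ) = 0 := by linarith
      have e3 : τ = 0 := by
        rw [Real.sqrt_eq_zero (by positivity)] at e2
        exact (mul_eq_zero.1 e2).resolve_left hH.ne'
      have e4 : x₁ = x₂ := sub_eq_zero.1 (norm_eq_zero.1 e1)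
      have e5 : t₁ = t₂ := by linarith
      rcases hst x₁ t₁ with h | h | h
      · rw [h, sub_self, norm_zero]; linarith
      · exact absurd rfl h
      · exact absurd (by rw [e4, e5]) h
    · by_cases hle : 2 * ρ ≤ r
      · have hτρ : H * τ ≤ ρ ^ 2 := by
          have e1 : Real.sqrt (H * τ) ≤ ρ := by rw [hρ]; linarith [norm_nonneg (x₁ - x₂)]
          have e2 := pow_le_pow_left₀ (Real.sqrt_nonneg _) e1 2
          rwa [Real.sq_sqrt (by positivity)] at e2
        have hτ' : τ ≤ ρ ^ 2 / H := by rw [le_div_iff₀ hH]; linarith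
        have hsub : pCyl x₂ t₂ ρ (ρ ^ 2 / H) ⊆ pCyl x₁ t₁ (2 * ρ) ((2 * ρ) ^ 2 / H) := by
          rintro ⟨x, t⟩ ⟨hx, ht1, ht2⟩
          simp only at hx ht1 ht2
          have e1 : ‖x - x₁‖ ≤ ‖x - x₂‖ + ‖x₂ - x₁‖ := norm_sub_le_norm_sub_add_norm_sub x x₂ x₁
          rw [norm_sub_rev x₂] at e1
          have e2 : (2 * ρ) ^ 2 / H = 4 * (ρ ^ 2 / H) := by ring
          have e3 : 0 ≤ ρ ^ 2 / H := by positivity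
          have e4 := Real.sqrt_nonneg (H * τ)
          refine ⟨?_, ?_, ?_⟩ <;> simp only
          · linarith
          · rw [e2]; linarith
          · linarith
        have k1 := LipX.mono (h1 (2 * ρ) (by linarith) hle) le_rfl hsub
        have k2 := h2 ρ hpos (by linarith)
        have := LipX.norm_sub_le hpos (by positivity) (by positivity) (by positivity) k1 k2
        have k3 := mul_le_mul_of_nonneg_left hpow hK
        linarith
      · have e1 : r ^ α ≤ 2 * ρ ^ α :=
          (Real.rpow_le_rpow hr.le (by linarith) hα.le).trans hpow
        have e2 : 2 * G ≤ 4 * G / r ^ α * ρ ^ α := by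
          rw [div_mul_eq_mul_div, le_div_iff₀ hrα]
          have := mul_le_mul_of_nonneg_left e1 (show 0 ≤ 2 * G by positivity)
          linarith
        have := norm_sub_le ℓ₁ ℓ₂
        linarith
  have h3 : 0 ≤ 3 * K + 4 * G / r ^ α := by positivity
  rw [mul_assoc]
  exact hgoal.trans (mul_le_mul_of_nonneg_left hρα h3)

lemma AffApprox.time_le {Λ g M G : ℝ} {Ω : Set (Euc n × ℝ)} {t₁ t₂ : ℝ}
    (h : AffApprox K α r H u x₀ t₁ ℓ) (hα : 0 < α) (hα1 : α ≤ 1) (hH : 0 < H)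
    (hK : 0 < K) (hΛ : 0 ≤ Λ) (hM : 0 ≤ M) (hG : ‖ℓ‖ ≤ G) (hg : G + 3 * (K * r ^ α) ≤ g)
    (hv : VisPara Λ g M Ω u) (hcont : ContinuousOn (fun z : Euc n × ℝ => u z.1 z.2) Ω)
    (hΩ : pCyl x₀ t₁ r (r ^ 2 / H) ⊆ Ω)
    (hc : ContinuousOn (u x₀) (Ioc (t₁ - r ^ 2 / H) t₁)) (ht : t₂ < t₁)
    (htr : Real.sqrt (2 * H * (t₁ - t₂)) ≤ r) :
    u x₀ t₁ - u x₀ t₂ ≤ (K * (1 / 12 + 3 * Λ / (2 * H)) + (M + 1) * r ^ (1 - α) / (2 * H)) *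
      Real.sqrt (2 * H * (t₁ - t₂)) ^ (1 + α) := by
  obtain ⟨τ, hτ⟩ : ∃ τ, τ = t₁ - t₂ := ⟨_, rfl⟩
  have hτ0 : 0 < τ := by linarith
  rw [← hτ] at htr ⊢
  obtain ⟨ρ, hρ⟩ : ∃ ρ, ρ = Real.sqrt (2 * H * τ) := ⟨_, rfl⟩
  have hρ0 : 0 < ρ := by rw [hρ]; positivity
  have hρ2 : ρ ^ 2 = 2 * H * τ := by rw [hρ, Real.sq_sqrt (by positivity)]
  rw [← hρ] at htr ⊢
  obtain ⟨m, hm⟩ : ∃ m, m = K * ρ ^ α := ⟨_, rfl⟩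
  have hm0 : 0 < m := by rw [hm]; positivity
  have hmr : m ≤ K * r ^ α := by
    rw [hm]; exact mul_le_mul_of_nonneg_left (Real.rpow_le_rpow hρ0.le htr hα.le) hK.le
  have hρH : ρ ^ 2 / H = 2 * τ := by rw [hρ2]; field_simp
  have hsub : pCyl x₀ t₁ ρ (ρ ^ 2 / H) ⊆ pCyl x₀ t₁ r (r ^ 2 / H) :=
    pCyl_subset htr (by gcongr)
  have hmem : ∀ x, ‖x - x₀‖ ≤ ρ / 2 → ∀ t, t₂ ≤ t → t < t₁ → (x, t) ∈ pCyl x₀ t₁ ρ (ρ ^ 2 / H) :=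
    fun x hx t e1 e2 => ⟨by simp only; linarith, by rw [hρH]; simp only; linarith, e2⟩
  have hL := h ρ hρ0 htr
  rw [← hm] at hL
  have hlip : ∀ x, ‖x - x₀‖ ≤ ρ / 2 → ∀ t, t₂ ≤ t → t < t₁ →
      u x t - u x₀ t - inner ℝ ℓ (x - x₀) ≤ m * ‖x - x₀‖ := fun x hx t e1 e2 => by
    have := hL x x₀ t (hmem x hx t e1 e2) (hmem x₀ (by simp; positivity) t e1 e2)
    rw [inner_sub_right]; linarith
  have key : ∀ t' ∈ Ioo t₂ t₁,
      u x₀ t' ≤ u x₀ t₂ + m * ρ / 12 + (Λ * (3 * m / ρ) + M + 1) * τ := by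
    intro t' ht'
    have := affine_barrier (Λ := Λ) (g := g) (M := M) (N := Λ * (3 * m / ρ) + M + 1)
      (b := 3 * m / ρ) (m := m) (R := ρ / 2) (Ω := Ω) (u := u) (x₀ := x₀) (ℓ := ℓ) (t₁ := t₂)
      (t' := t') (T' := (t' + t₁) / 2) (c₀ := u x₀ t₂ + m * ρ / 12) (by linarith) hv hcont
      (by positivity) (by positivity)
      (by
        have : 3 * m / ρ * (ρ / 2) = 3 / 2 * m := by field_simp
        rw [this]; linarith)
      (by
        have : 2 * (3 * m / ρ) * (ρ / 2) = 3 * m := by field_simp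
        rw [this]; linarith)
      ht'.1.le (by linarith [ht'.2])
      (fun x hx t htt => hΩ (hsub (hmem x hx t htt.1 (by linarith [htt.2, ht'.2]))))
      (fun x hx t htt => hlip x hx t htt.1 (by linarith [htt.2, ht'.2]))
      (fun x hx => by
        have e1 := hlip x hx t₂ le_rfl ht
        have e2 : m * ‖x - x₀‖ ≤ m * ρ / 12 + 3 * m / ρ * ‖x - x₀‖ ^ 2 := by
          have : m * ρ / 12 + 3 * m / ρ * ‖x - x₀‖ ^ 2 - m * ‖x - x₀‖ =
            3 * m / ρ * (‖x - x₀‖ - ρ / 6) ^ 2 := by field_simp; ring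
          have : 0 ≤ 3 * m / ρ * (‖x - x₀‖ - ρ / 6) ^ 2 := by positivity
          linarith
        linarith)
    refine this.trans ?_
    have e1 : (Λ * (3 * m / ρ) + M + 1) * (t' - t₂) ≤ (Λ * (3 * m / ρ) + M + 1) * τ :=
      mul_le_mul_of_nonneg_left (by linarith [ht'.2]) (by positivity)
    linarith
  have hlim := le_of_left_limit ht (hc.mono (Ioc_subset_Ioc_left (by
    have : ρ ^ 2 / H ≤ r ^ 2 / H := by gcongr
    linarith))) key
  have e1 : m * ρ = K * ρ ^ (1 + α) := by
    rw [hm, Real.rpow_add hρ0, Real.rpow_one]; ring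
  have e2 : τ = ρ ^ 2 / (2 * H) := by rw [hρ2]; field_simp
  have e3 : Λ * (3 * m / ρ) * τ = 3 * Λ / (2 * H) * (m * ρ) := by
    rw [e2]; field_simp
  have e4 : ρ ^ 2 ≤ r ^ (1 - α) * ρ ^ (1 + α) := by
    have : ρ ^ 2 = ρ ^ (1 - α) * ρ ^ (1 + α) := by
      rw [← Real.rpow_add hρ0, ← Real.rpow_natCast]; congr 1; push_cast; ring
    rw [this]
    exact mul_le_mul_of_nonneg_right (Real.rpow_le_rpow hρ0.le htr (by linarith)) (by positivity)
  have e5 : (M + 1) * τ ≤ (M + 1) * r ^ (1 - α) / (2 * H) * ρ ^ (1 + α) := by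
    rw [e2]
    have := mul_le_mul_of_nonneg_left e4 (show 0 ≤ (M + 1) / (2 * H) by positivity)
    refine (le_of_eq ?_).trans (this.trans_eq ?_) <;> ring
  have e6 : (Λ * (3 * m / ρ) + M + 1) * τ = Λ * (3 * m / ρ) * τ + (M + 1) * τ := by ring
  rw [e6, e3, e1] at hlim
  linarith

end AffineApproximation

section LocalEstimates

variable {n : ℕ} {p q a M : ℝ}

/-- Interior differential inequalities for the `(p,q)`-growth equation in the unit cylinder. -/
structure PQSol (n : ℕ) (p q a M : ℝ) (u : Euc n → ℝ → ℝ) : Prop where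
  sol : VisSol (sigpq p q a) {0}ᶜ M (oCyl n 1) u
  para : ∀ s, 0 < s → VisPara (2 * (n + q) * hpq p q a s) s M (oCyl n 1) u
  para_neg : ∀ s, 0 < s → VisPara (2 * (n + q) * hpq p q a s) s M (oCyl n 1) fun x t => -u x t
  slice : ∀ y : Euc n, ‖y‖ < 1 → ContinuousOn (u y) (Ioc (-1) 0)

lemma oCyl_subset_Qcyl : oCyl n 1 ⊆ Qcyl n 1 := fun _ h => ⟨h.1, h.2.1, h.2.2.le⟩

lemma PQSol.of_viscSolOp (hp : 2 ≤ p) (hpq' : p ≤ q) (ha : 0 < a) {f u : Euc n × ℝ → ℝ}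
    (h : ViscSolOp (pqOp p q a) f (Qcyl n 1) u) (hf : ∀ z ∈ Qcyl n 1, |f z| ≤ M) :
    PQSol n p q a M fun x t => u (x, t) := by
  have hneg := h.2.2.neg pqOp_neg
  have hc := h.1.mono oCyl_subset_Qcyl
  have hf1 : ∀ z ∈ oCyl n 1, f z ≤ M := fun z hz =>
    (abs_le.1 (hf z (oCyl_subset_Qcyl hz))).2
  have hf2 : ∀ z ∈ oCyl n 1, -f z ≤ M := fun z hz => by
    have := (abs_le.1 (hf z (oCyl_subset_Qcyl hz))).1
    linarith
  refine ⟨⟨visSub_of_pqOp hp hpq' ha h.2.1 oCyl_subset_Qcyl hf1, ?_, hc⟩, fun s hs =>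
    visPara_of_pqOp hp hpq' ha h.2.1 (isOpen_oCyl 1) oCyl_subset_Qcyl hc hf1 hs, fun s hs =>
    visPara_of_pqOp hp hpq' ha hneg (isOpen_oCyl 1) oCyl_subset_Qcyl hc.neg hf2 hs,
    fun y hy => h.1.comp (by fun_prop) fun t ht => ⟨hy, by simpa using ht.1, ht.2⟩⟩
  have e1 : {ξ : Euc n | -ξ ∈ ({0}ᶜ : Set (Euc n))} = {0}ᶜ := by ext ξ; simp
  simp only [sigpq_neg, e1]
  exact visSub_of_pqOp hp hpq' ha hneg oCyl_subset_Qcyl hf2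

lemma PQSol.lip {u : Euc n → ℝ → ℝ} (hp : 2 ≤ p) (hpq' : p ≤ q) (ha : 0 < a)
    (h : PQSol n p q a M u) (hM : 0 ≤ M) {M₀ : ℝ} (hM₀ : 0 ≤ M₀)
    (hb : ∀ z ∈ oCyl n 1, |u z.1 z.2| ≤ M₀) {δ : ℝ} (hδ : 0 < δ) (hδ1 : δ < 1) :
    ∃ L > 0, ∀ x t, ‖x‖ < 1 - δ / 2 → -1 + δ / 2 < t → t < 0 → ∀ y, ‖x - y‖ ≤ δ / 20 →
      u x t - u y t ≤ L * ‖x - y‖ := by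
  obtain ⟨k, c, C, L, hc, hL, hd⟩ := isDeg_sigpq n hp hpq' ha
  obtain ⟨L₁, hL₁, h1⟩ := exists_sqrt_modulus hd hc hL h.sol hM (isOpen_oCyl 1) (d := δ / 20)
    (by positivity) (by linarith) hM₀ hb
  obtain ⟨L₂, hL₂, h2⟩ := exists_lip_modulus hd hc hL h.sol hM (isOpen_oCyl 1) (d := δ / 20)
    (by positivity) (by linarith) hL₁.le
  have key : ∀ (x₀ : Euc n) t₀ ε, ‖x₀‖ < 1 - ε → δ / 8 ≤ ε → -1 + ε < t₀ → t₀ < 0 →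
      ∀ x t, ‖x - x₀‖ ≤ 2 * (δ / 20) → t ∈ Icc (t₀ - δ / 20) (t₀ + -t₀ / 2) →
      ‖x‖ < 1 - ε + δ / 10 ∧ -1 + ε - δ / 20 < t ∧ t < 0 := by
    intro x₀ t₀ ε h1 h2 h3 h4 x t hx ht
    have := norm_sub_norm_le x x₀
    exact ⟨by linarith, by linarith [ht.1], by linarith [ht.2]⟩
  refine ⟨L₂, hL₂, fun x₀ t₀ hx ht ht0 => h2 x₀ t₀ ⟨-t₀ / 2, by linarith, fun x t hx' ht' => ?_⟩⟩
  obtain ⟨k1, k2, k3⟩ := key x₀ t₀ (δ / 2) hx (by linarith) ht ht0 x t hx' ht'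
  refine ⟨⟨by dsimp only; linarith, by dsimp only; linarith, k3⟩, h1 x t ⟨-t / 2, by linarith,
    fun x' t' hx'' ht'' => ?_⟩⟩
  obtain ⟨j1, j2, j3⟩ := key x t (δ / 4) (by linarith) (by linarith) (by linarith) k3 x' t' hx'' ht''
  exact ⟨by dsimp only; linarith, by dsimp only; linarith, j3⟩

lemma PQSol.approx {u : Euc n → ℝ → ℝ} (hp : 2 ≤ p) (hpq' : p ≤ q) (ha : 0 < a)
    (hM : 0 ≤ M) (h : PQSol n p q a M u) {M₀ : ℝ} (hM₀ : 0 ≤ M₀)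
    (hb : ∀ z ∈ oCyl n 1, |u z.1 z.2| ≤ M₀) {α K η : ℝ} (hα : 0 < α) (hK : 0 < K) (hη : 0 < η)
    (hcam : ∀ (x₀ : Euc n) (t₀ r l : ℝ), 0 < r → 0 < l →
      8 * (M * r) ≤ η * (hpq p q a l * l) →
      pCyl x₀ t₀ r (r ^ 2 / hpq p q a l) ⊆ oCyl n 1 →
      LipX l (pCyl x₀ t₀ r (r ^ 2 / hpq p q a l)) u →
      ∃ ℓ : Euc n, ∀ s, 0 < s → s ≤ r →
        LipX (K * l * (s / r) ^ α) (pCyl x₀ t₀ s (s ^ 2 / hpq p q a l))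
          fun x t => u x t - inner ℝ ℓ x)
    {δ : ℝ} (hδ : 0 < δ) (hδ1 : δ < 1) :
    ∃ r > 0, ∃ H > 0, ∃ K' > 0, ∃ G > 0, ∀ x₀ t₀, ‖x₀‖ ≤ 1 - δ → -1 + δ ≤ t₀ → t₀ ≤ 0 →
      pCyl x₀ t₀ r (r ^ 2 / H) ⊆ oCyl n 1 ∧ ∃ ℓ, AffApprox K' α r H u x₀ t₀ ℓ ∧
        HasGradientAt (fun y => u y t₀) ℓ x₀ ∧ ‖ℓ‖ ≤ G ∧ r ^ 2 / H ≤ δ / 2 := by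
  obtain ⟨L, hL, hlip⟩ := h.lip hp hpq' ha hM hM₀ hb hδ hδ1
  obtain ⟨H, hH⟩ : ∃ H, H = hpq p q a L := ⟨_, rfl⟩
  have hH0 : 0 < H := hH ▸ hpq_pos ha hL
  obtain ⟨r, hr⟩ : ∃ r, r = min (δ / 40) (min (η * (H * L) / (8 * (M + 1))) (δ / 2 * H)) := ⟨_, rfl⟩
  have hr0 : 0 < r := by
    rw [hr]; exact lt_min (by positivity) (lt_min (by positivity) (by positivity))
  have hr1 : r ≤ δ / 40 := hr ▸ min_le_left _ _
  have hr2 : r ≤ η * (H * L) / (8 * (M + 1)) := hr ▸ (min_le_right _ _).trans (min_le_left _ _)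
  have hr3 : r ≤ δ / 2 * H := hr ▸ (min_le_right _ _).trans (min_le_right _ _)
  rw [le_div_iff₀ (by positivity)] at hr2
  have hrH : r ^ 2 / H ≤ δ / 2 := by
    rw [div_le_iff₀ hH0]
    nlinarith
  have hK' : 0 < K * L / r ^ α := by positivity
  refine ⟨r, hr0, H, hH0, K * L / r ^ α, hK', L + K * L / r ^ α * r ^ α, by positivity,
    fun x₀ t₀ hx ht ht0 => ?_⟩
  have hin : ∀ z ∈ pCyl x₀ t₀ r (r ^ 2 / H), ‖z.1‖ < 1 - δ / 2 ∧ -1 + δ / 2 < z.2 ∧ z.2 < 0 := by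
    intro z hz
    have h1 := norm_sub_norm_le z.1 x₀
    exact ⟨by linarith [hz.1], by linarith [hz.2.1], hz.2.2.trans_le ht0⟩
  have hsub : pCyl x₀ t₀ r (r ^ 2 / H) ⊆ oCyl n 1 := fun z hz => by
    obtain ⟨h1, h2, h3⟩ := hin z hz
    exact ⟨by linarith, by linarith, h3⟩
  have hLip : LipX L (pCyl x₀ t₀ r (r ^ 2 / H)) u := fun x y t hx' hy' => by
    obtain ⟨h1, h2, h3⟩ := hin _ hx'
    refine hlip x t h1 h2 h3 y ?_
    have h4 := norm_sub_le (x - x₀) (y - x₀)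
    have h5 : ‖x - x₀‖ < r := hx'.1
    have h6 : ‖y - x₀‖ < r := hy'.1
    rw [sub_sub_sub_cancel_right] at h4
    linarith
  obtain ⟨ℓ, hℓ⟩ := hcam x₀ t₀ r L hr0 hL (by rw [← hH]; linarith) (hH ▸ hsub) (hH ▸ hLip)
  have hA : AffApprox (K * L / r ^ α) α r H u x₀ t₀ ℓ := fun s hs hsr => by
    have := hℓ s hs hsr
    rwa [Real.div_rpow hs.le hr0.le, ← hH, ← mul_div_assoc, mul_div_right_comm] at this
  refine ⟨hsub, ℓ, hA, hA.hasGradientAt hα hr0 hH0 fun y hy => (h.slice y ?_).mono ?_,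
    hA.norm_slope_le hr0 hH0 hK'.le hL.le hLip, hrH⟩
  · have h1 := norm_sub_norm_le y x₀
    linarith
  · exact Ioc_subset_Ioc (by linarith) ht0

lemma AffApprox.neg {K α r H : ℝ} {u : Euc n → ℝ → ℝ} {x₀ ℓ : Euc n} {t₀ : ℝ}
    (h : AffApprox K α r H u x₀ t₀ ℓ) :
    AffApprox K α r H (fun x t => -u x t) x₀ t₀ (-ℓ) := fun s hs hsr x y t hx hy => by
  have := h s hs hsr y x t hy hx
  rw [norm_sub_rev] at this
  simp only [inner_neg_left]
  linarith

/-- Hölder estimates for the gradient and for the time slices on a smaller cylinder. -/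
lemma PQSol.holder {u : Euc n → ℝ → ℝ} (hp : 2 ≤ p) (hpq' : p ≤ q) (ha : 0 < a)
    (hM : 0 ≤ M) (h : PQSol n p q a M u) {M₀ : ℝ} (hM₀ : 0 ≤ M₀)
    (hb : ∀ z ∈ Qcyl n 1, |u z.1 z.2| ≤ M₀) {α δ r H K G : ℝ} (hα : 0 < α) (hα1 : α ≤ 1)
    (hδ : 0 < δ) (hr : 0 < r) (hH : 0 < H) (hK : 0 < K) (hG : 0 < G)
    (happ : ∀ x₀ t₀, ‖x₀‖ ≤ 1 - δ → -1 + δ ≤ t₀ → t₀ ≤ 0 →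
      pCyl x₀ t₀ r (r ^ 2 / H) ⊆ oCyl n 1 ∧ ∃ ℓ, AffApprox K α r H u x₀ t₀ ℓ ∧
        HasGradientAt (fun y => u y t₀) ℓ x₀ ∧ ‖ℓ‖ ≤ G ∧ r ^ 2 / H ≤ δ / 2) :
    ∃ N > 0, ∀ x₁ t₁, ‖x₁‖ ≤ 1 - δ → -1 + δ ≤ t₁ → t₁ ≤ 0 →
      DifferentiableAt ℝ (fun y => u y t₁) x₁ ∧
      ∀ x₂ t₂, ‖x₂‖ ≤ 1 - δ → -1 + δ ≤ t₂ → t₂ ≤ 0 →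
      ‖gradient (fun y => u y t₁) x₁ - gradient (fun y => u y t₂) x₂‖ ≤
        N * (‖x₁ - x₂‖ ^ α + |t₁ - t₂| ^ (α / 2)) ∧
      |u x₁ t₁ - u x₁ t₂| ≤ N * |t₁ - t₂| ^ ((1 + α) / 2) := by
  obtain ⟨g, hg⟩ : ∃ g, g = G + 3 * (K * r ^ α) := ⟨_, rfl⟩
  have hg0 : 0 < g := by rw [hg]; positivity
  obtain ⟨Λ, hΛ⟩ : ∃ Λ, Λ = 2 * (n + q) * hpq p q a g := ⟨_, rfl⟩
  have hΛ0 : 0 ≤ Λ := by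
    have := hpq_pos (p := p) (q := q) ha hg0
    have : 0 ≤ q := by linarith
    rw [hΛ]; positivity
  obtain ⟨N₁, hN₁⟩ : ∃ N₁, N₁ = (3 * K + 4 * G / r ^ α) * (1 + H ^ (α / 2)) := ⟨_, rfl⟩
  obtain ⟨N₂, hN₂⟩ : ∃ N₂, N₂ = K * (1 / 12 + 3 * Λ / (2 * H)) +
    (M + 1) * r ^ (1 - α) / (2 * H) + 2 * M₀ / r ^ (1 + α) := ⟨_, rfl⟩
  have hN10 : 0 < N₁ := by rw [hN₁]; positivity
  have hN20 : 0 < N₂ := by rw [hN₂]; positivity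
  have hsq : ∀ τ, 0 ≤ τ → Real.sqrt (2 * H * τ) ^ (1 + α) =
      (2 * H) ^ ((1 + α) / 2) * τ ^ ((1 + α) / 2) := fun τ hτ => by
    rw [Real.sqrt_eq_rpow, ← Real.rpow_mul (by positivity), Real.mul_rpow (by positivity) hτ]
    ring_nf
  have htime : ∀ x₁ t₁ t₂, ‖x₁‖ ≤ 1 - δ → -1 + δ ≤ t₁ → t₁ ≤ 0 → -1 + δ ≤ t₂ → t₂ < t₁ →
      |u x₁ t₁ - u x₁ t₂| ≤ N₂ * (2 * H) ^ ((1 + α) / 2) * |t₁ - t₂| ^ ((1 + α) / 2) := by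
    intro x₁ t₁ t₂ hx ht1 ht1' ht2 hlt
    obtain ⟨hsub, ℓ, hA, -, hℓ, hrH⟩ := happ x₁ t₁ hx ht1 ht1'
    rw [abs_of_pos (sub_pos.2 hlt), mul_assoc, ← hsq _ (sub_pos.2 hlt).le]
    have hρ0 : 0 < Real.sqrt (2 * H * (t₁ - t₂)) := by
      have := sub_pos.2 hlt
      positivity
    rcases le_or_gt (Real.sqrt (2 * H * (t₁ - t₂))) r with hs | hs
    · have hc : ContinuousOn (u x₁) (Ioc (t₁ - r ^ 2 / H) t₁) :=
        (h.slice x₁ (by linarith)).mono (Ioc_subset_Ioc (by linarith) ht1')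
      have k1 := hA.time_le hα hα1 hH hK hΛ0 hM hℓ hg.ge (hΛ ▸ h.para g hg0) h.sol.cont hsub
        hc hlt hs
      have k2 := hA.neg.time_le hα hα1 hH hK hΛ0 hM (by rwa [norm_neg]) hg.ge
        (hΛ ▸ h.para_neg g hg0) h.sol.cont.neg hsub hc.neg hlt hs
      have k3 : (K * (1 / 12 + 3 * Λ / (2 * H)) + (M + 1) * r ^ (1 - α) / (2 * H)) *
          Real.sqrt (2 * H * (t₁ - t₂)) ^ (1 + α) ≤
          N₂ * Real.sqrt (2 * H * (t₁ - t₂)) ^ (1 + α) := by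
        gcongr
        rw [hN₂]
        have : 0 ≤ 2 * M₀ / r ^ (1 + α) := by positivity
        linarith
      rw [abs_le]
      constructor <;> linarith
    · have k1 := hb (x₁, t₁) ⟨by dsimp only; linarith, by dsimp only; linarith, ht1'⟩
      have k2 := hb (x₁, t₂) ⟨by dsimp only; linarith, by dsimp only; linarith,
        by dsimp only; linarith⟩
      have k3 : r ^ (1 + α) ≤ Real.sqrt (2 * H * (t₁ - t₂)) ^ (1 + α) :=
        Real.rpow_le_rpow hr.le hs.le (by linarith)
      have k4 : 2 * M₀ ≤ 2 * M₀ / r ^ (1 + α) * Real.sqrt (2 * H * (t₁ - t₂)) ^ (1 + α) := by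
        have : 0 < r ^ (1 + α) := by positivity
        rw [div_mul_eq_mul_div, le_div_iff₀ this]
        gcongr
      have k5 : 2 * M₀ / r ^ (1 + α) * Real.sqrt (2 * H * (t₁ - t₂)) ^ (1 + α) ≤
          N₂ * Real.sqrt (2 * H * (t₁ - t₂)) ^ (1 + α) := by
        gcongr
        rw [hN₂]
        have : 0 ≤ K * (1 / 12 + 3 * Λ / (2 * H)) + (M + 1) * r ^ (1 - α) / (2 * H) := by
          positivity
        linarith
      have := abs_sub (u x₁ t₁) (u x₁ t₂)
      dsimp only at k1 k2
      linarith
  have hN : N₁ ≤ N₁ + N₂ * (2 * H) ^ ((1 + α) / 2) := le_add_of_nonneg_right (by positivity)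
  have hN' : N₂ * (2 * H) ^ ((1 + α) / 2) ≤ N₁ + N₂ * (2 * H) ^ ((1 + α) / 2) :=
    le_add_of_nonneg_left hN10.le
  refine ⟨N₁ + N₂ * (2 * H) ^ ((1 + α) / 2), by positivity, fun x₁ t₁ hx1 ht1 ht1' => ?_⟩
  obtain ⟨-, ℓ₁, hA1, hd1, hG1, -⟩ := happ x₁ t₁ hx1 ht1 ht1'
  refine ⟨hd1.differentiableAt, fun x₂ t₂ hx2 ht2 ht2' => ⟨?_, ?_⟩⟩
  · obtain ⟨-, ℓ₂, hA2, hd2, hG2, -⟩ := happ x₂ t₂ hx2 ht2 ht2'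
    rw [hd1.gradient, hd2.gradient]
    refine (norm_slope_sub_le hA1 hA2 hα hα1 hr hH hK.le hG1 hG2 fun x t => ?_).trans ?_
    · by_cases h1 : (x₁, t₁) = (x, t)
      · by_cases h2 : (x₂, t₂) = (x, t)
        · left
          simp only [Prod.mk.injEq] at h1 h2
          obtain ⟨rfl, rfl⟩ := h1
          obtain ⟨rfl, rfl⟩ := h2
          rw [← hd1.gradient, ← hd2.gradient]
        · exact Or.inr (Or.inr h2)
      · exact Or.inr (Or.inl h1)
    · rw [← hN₁]
      gcongr
  · have main : |u x₁ t₁ - u x₁ t₂| ≤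
        N₂ * (2 * H) ^ ((1 + α) / 2) * |t₁ - t₂| ^ ((1 + α) / 2) := by
      rcases lt_trichotomy t₁ t₂ with hlt | rfl | hlt
      · rw [abs_sub_comm, abs_sub_comm t₁]
        exact htime x₁ t₂ t₁ hx1 ht2 ht2' ht1 hlt
      · rw [sub_self, abs_zero]; positivity
      · exact htime x₁ t₁ t₂ hx1 ht1 ht1' ht2 hlt
    exact main.trans (by gcongr)

end LocalEstimates

section Conclusion

variable {n : ℕ}

lemma supAbs_nonneg {X : Type*} (g : X → ℝ) (Q : Set X) : 0 ≤ supAbs g Q :=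
  Real.sSup_nonneg (by rintro _ ⟨z, -, rfl⟩; exact abs_nonneg _)

lemma exists_margin {z : Euc n × ℝ} (hz : z ∈ Qcyl n 1) :
    ∃ δ > 0, δ < 1 ∧ ∃ ε > 0, ∀ w ∈ Qcyl n 1 ∩ ball z ε,
      ‖w.1‖ ≤ 1 - δ ∧ -1 + δ ≤ w.2 ∧ w.2 ≤ 0 := by
  obtain ⟨h1, h2, h3⟩ := hz
  obtain ⟨m, hm⟩ : ∃ m, m = min (1 - ‖z.1‖) (1 + z.2) := ⟨_, rfl⟩
  have hm0 : 0 < m := by rw [hm]; exact lt_min (by linarith) (by linarith)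
  have hm1 : m ≤ 1 - ‖z.1‖ := hm ▸ min_le_left _ _
  have hm2 : m ≤ 1 + z.2 := hm ▸ min_le_right _ _
  refine ⟨m / 2, by positivity, by linarith [norm_nonneg z.1], m / 2, by positivity,
    fun w hw => ?_⟩
  obtain ⟨hwQ, hwb⟩ := hw
  rw [mem_ball, Prod.dist_eq, max_lt_iff, dist_eq_norm, Real.dist_eq, abs_lt] at hwb
  have := norm_sub_norm_le w.1 z.1
  exact ⟨by linarith [hwb.1], by linarith [hwb.2.1], hwQ.2.2⟩

lemma exists_local_estimates {p q a : ℝ} (hp : 2 ≤ p) (hpq' : p ≤ q) (ha : 0 < a)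
    {f u : Euc n × ℝ → ℝ} (hb : BddOn u (Qcyl n 1))
    (hsol : ViscSolOp (pqOp p q a) f (Qcyl n 1) u) (hf : BddOn f (Qcyl n 1)) :
    ∃ α > 0, α < 1 / (p - 1) ∧ ∀ δ : ℝ, 0 < δ → δ < 1 → ∃ N > 0,
      ∀ (x₁ : Euc n) (t₁ : ℝ), ‖x₁‖ ≤ 1 - δ → -1 + δ ≤ t₁ → t₁ ≤ 0 →
      DifferentiableAt ℝ (fun y => u (y, t₁)) x₁ ∧
      ∀ x₂ t₂, ‖x₂‖ ≤ 1 - δ → -1 + δ ≤ t₂ → t₂ ≤ 0 →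
      ‖sgrad u x₁ t₁ - sgrad u x₂ t₂‖ ≤ N * (‖x₁ - x₂‖ ^ α + |t₁ - t₂| ^ (α / 2)) ∧
      |u (x₁, t₁) - u (x₁, t₂)| ≤ N * |t₁ - t₂| ^ ((1 + α) / 2) := by
  obtain ⟨M₀, hM₀⟩ := hb
  obtain ⟨M, hM⟩ := hf
  have h00 : ((0 : Euc n), (0 : ℝ)) ∈ Qcyl n 1 := ⟨by simp, by simp, le_rfl⟩
  have hM0 : 0 ≤ M := (abs_nonneg _).trans (hM _ h00)
  have hM₀0 : 0 ≤ M₀ := (abs_nonneg _).trans (hM₀ _ h00)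
  have hP := PQSol.of_viscSolOp hp hpq' ha hsol hM
  obtain ⟨k, c, C, L, hc, hL, hd⟩ := isDeg_sigpq n hp hpq' ha
  obtain ⟨α, hα, hα1, K, hK, η, hη, hcam⟩ := campanato n (k := k) (c := c) (C := C) (L := L)
    (Λ := 2 * (n + q)) (α₀ := 1 / (p - 1)) hc hL
    (by have : 0 ≤ q := by linarith
        positivity) (one_div_pos.2 (by linarith))
  have hα1' : α ≤ 1 := hα1.le.trans (by rw [div_le_one (by linarith)]; linarith)
  refine ⟨α, hα, hα1, fun δ hδ hδ1 => ?_⟩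
  obtain ⟨r, hr, H, hH, K', hK', G, hG, happ⟩ := hP.approx hp hpq' ha hM0 hM₀0
    (fun z hz => hM₀ z (oCyl_subset_Qcyl hz)) hα hK hη
    (hcam _ _ hd _ _ M hP.sol hM0 hP.para hP.para_neg) hδ hδ1
  exact hP.holder hp hpq' ha hM0 hM₀0 hM₀ hα hα1' hδ hr hH hK' hG happ

end Conclusion

/-- Corollary 1.4: application to parabolic equations with
`(p,q)`-growth, written in non-divergence form. -/
theorem pq_growth_regularity
    (n : ℕ) (hn : 1 ≤ n) (p q a₀ : ℝ) (hp2 : 2 ≤ p) (hpq : p ≤ q) (ha₀ : 0 < a₀)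
    (f u : Euc n × ℝ → ℝ) (hb : BddOn u (Qcyl n 1))
    (hsol : ViscSolOp
      (fun z ψ =>
        (‖gradient ψ z.1‖ ^ (p - 2) + a₀ * ‖gradient ψ z.1‖ ^ (q - 2)) * pLapN p ψ z.1 +
          a₀ * (q - p) * ‖gradient ψ z.1‖ ^ (q - 2) * infLapN ψ z.1)
      f (Qcyl n 1) u)
    (hcase :
      (BddOn (fun z => ‖sgrad u z.1 z.2‖ ^ (q - 2) * infLapN (fun y => u (y, z.2)) z.1)
          (Qcyl n 1) ∧ BddOn f (Qcyl n 1)) ∨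
      (BddOn (fun z => infLapN (fun y => u (y, z.2)) z.1) (Qcyl n 1) ∧
        BddOn f (Qcyl n 1) ∧
        (∃ L : ℝ, ∀ x y : Euc n, ∀ t : ℝ, (x, t) ∈ Qcyl n 1 → (y, t) ∈ Qcyl n 1 →
          |u (x, t) - u (y, t)| ≤ L * ‖x - y‖) ∧ 2 ≤ q)) :
    ∃ α C : ℝ, 0 < α ∧ α < 1 / (p - 1) ∧ 0 < C ∧
      (∀ z ∈ Qcyl n 1, ∃ ε > (0 : ℝ), ∃ K : ℝ,
        (∀ w ∈ Qcyl n 1 ∩ ball z ε, DifferentiableAt ℝ (fun y => u (y, w.2)) w.1) ∧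
        ∀ w₁ ∈ Qcyl n 1 ∩ ball z ε, ∀ w₂ ∈ Qcyl n 1 ∩ ball z ε,
          ‖sgrad u w₁.1 w₁.2 - sgrad u w₂.1 w₂.2‖ ≤
            K * (‖w₁.1 - w₂.1‖ ^ α + |w₁.2 - w₂.2| ^ (α / 2)) ∧
          |u (w₁.1, w₁.2) - u (w₁.1, w₂.2)| ≤ K * |w₁.2 - w₂.2| ^ ((1 + α) / 2)) ∧
      (∀ x y : Euc n, ∀ t s : ℝ,
        (x, t) ∈ Qcyl n (1 / 2) → (y, s) ∈ Qcyl n (1 / 2) →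
        ‖sgrad u x t - sgrad u y s‖ ≤
          C * (supAbs u (Qcyl n 1) +
            (supAbs f (Qcyl n 1) +
              supAbs (fun z => ‖sgrad u z.1 z.2‖ ^ (q - 2) *
                infLapN (fun y => u (y, z.2)) z.1) (Qcyl n 1)) ^ (1 / (1 + (p - 2)))) *
            (‖x - y‖ ^ α + |t - s| ^ (α / 2))) ∧
      ∀ x : Euc n, ∀ t s : ℝ,
        (x, t) ∈ Qcyl n (1 / 2) → (x, s) ∈ Qcyl n (1 / 2) →
        |u (x, t) - u (x, s)| ≤
          C * (supAbs u (Qcyl n 1) +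
            (supAbs f (Qcyl n 1) +
              supAbs (fun z => ‖sgrad u z.1 z.2‖ ^ (q - 2) *
                infLapN (fun y => u (y, z.2)) z.1) (Qcyl n 1)) ^ (1 / (1 + (p - 2)))) *
            |t - s| ^ ((1 + α) / 2) := by
  have hfb : BddOn f (Qcyl n 1) := by
    rcases hcase with h | h
    exacts [h.2, h.2.1]
  obtain ⟨α, hα, hα1, hloc⟩ := exists_local_estimates hp2 hpq ha₀ hb hsol hfb
  obtain ⟨N, hN, hest⟩ := hloc (1 / 2) (by norm_num) (by norm_num)
  obtain ⟨M₀, hM₀⟩ := hb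
  have hu : BddAbove ((fun z => |u z|) '' Qcyl n 1) := ⟨M₀, by rintro _ ⟨z, hz, rfl⟩; exact hM₀ z hz⟩
  have hule : ∀ z ∈ Qcyl n 1, |u z| ≤ supAbs u (Qcyl n 1) := fun z hz =>
    le_csSup hu (mem_image_of_mem _ hz)
  have hB : ∀ b : ℝ, 0 ≤ b → supAbs u (Qcyl n 1) ≤ supAbs u (Qcyl n 1) +
      (supAbs f (Qcyl n 1) + b) ^ (1 / (1 + (p - 2))) := fun b hb =>
    le_add_of_nonneg_right (Real.rpow_nonneg (add_nonneg (supAbs_nonneg _ _) hb) _)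
  have hC : ∃ C > 0, ∀ b : ℝ, 0 ≤ b → (∀ x y t s, (x, t) ∈ Qcyl n (1 / 2) →
      (y, s) ∈ Qcyl n (1 / 2) → ‖sgrad u x t - sgrad u y s‖ ≤ C * (supAbs u (Qcyl n 1) +
      (supAbs f (Qcyl n 1) + b) ^ (1 / (1 + (p - 2)))) * (‖x - y‖ ^ α + |t - s| ^ (α / 2))) ∧
      ∀ x t s, (x, t) ∈ Qcyl n (1 / 2) → (x, s) ∈ Qcyl n (1 / 2) → |u (x, t) - u (x, s)| ≤
      C * (supAbs u (Qcyl n 1) + (supAbs f (Qcyl n 1) + b) ^ (1 / (1 + (p - 2)))) *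
      |t - s| ^ ((1 + α) / 2) := by
    have hhalf : ∀ x t, (x, t) ∈ Qcyl n (1 / 2) → ‖x‖ ≤ 1 - 1 / 2 ∧ (-1 : ℝ) + 1 / 2 ≤ t ∧ t ≤ 0 := by
      intro x t h
      obtain ⟨h1, h2, h3⟩ := h
      norm_num at h1 h2 h3
      exact ⟨by linarith, by linarith, h3⟩
    rcases (supAbs_nonneg u (Qcyl n 1)).eq_or_lt with h0 | h0
    · refine ⟨1, one_pos, fun b hb => ?_⟩
      have hB' := hB b hb
      rw [← h0] at hB' hule
      have hz : ∀ z ∈ Qcyl n 1, u z = 0 := fun z hz =>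
        abs_eq_zero.1 (le_antisymm (hule z hz) (abs_nonneg _))
      have hz' : ∀ x t, (x, t) ∈ Qcyl n (1 / 2) → (x, t) ∈ Qcyl n 1 := fun x t h => by
        obtain ⟨h1, h2, h3⟩ := hhalf x t h
        exact ⟨by dsimp only; linarith, by dsimp only; linarith, h3⟩
      have hg : ∀ x t, (x, t) ∈ Qcyl n (1 / 2) → sgrad u x t = 0 := fun x t h => by
        have h1 := hz' x t h
        have h2 : (fun y => u (y, t)) =ᶠ[nhds x] fun _ => 0 := by
          filter_upwards [isOpen_ball.mem_nhds (mem_ball_zero_iff.2 h1.1)] with y hy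
          exact hz (y, t) ⟨mem_ball_zero_iff.1 hy, h1.2⟩
        rw [sgrad, gradient, h2.fderiv_eq]
        simp
      rw [← h0]
      refine ⟨fun x y t s h1 h2 => ?_, fun x t s h1 h2 => ?_⟩
      · rw [hg x t h1, hg y s h2, sub_zero, norm_zero]
        positivity
      · rw [hz _ (hz' x t h1), hz _ (hz' x s h2), sub_zero, abs_zero]
        positivity
    · refine ⟨N / supAbs u (Qcyl n 1), by positivity, fun b hb => ?_⟩
      have hN' : N ≤ N / supAbs u (Qcyl n 1) * (supAbs u (Qcyl n 1) +
          (supAbs f (Qcyl n 1) + b) ^ (1 / (1 + (p - 2)))) := by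
        rw [div_mul_eq_mul_div, le_div_iff₀ h0]
        exact mul_le_mul_of_nonneg_left (hB b hb) hN.le
      refine ⟨fun x y t s h1 h2 => ?_, fun x t s h1 h2 => ?_⟩
      · obtain ⟨a1, a2, a3⟩ := hhalf x t h1
        obtain ⟨b1, b2, b3⟩ := hhalf y s h2
        exact (((hest x t a1 a2 a3).2 y s b1 b2 b3).1).trans
          (mul_le_mul_of_nonneg_right hN' (by positivity))
      · obtain ⟨a1, a2, a3⟩ := hhalf x t h1
        obtain ⟨b1, b2, b3⟩ := hhalf x s h2
        exact (((hest x t a1 a2 a3).2 x s b1 b2 b3).2).trans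
          (mul_le_mul_of_nonneg_right hN' (by positivity))
  obtain ⟨C, hC0, hC⟩ := hC
  obtain ⟨hC1, hC2⟩ := hC _ (supAbs_nonneg (fun z : Euc n × ℝ => ‖sgrad u z.1 z.2‖ ^ (q - 2) *
    infLapN (fun y => u (y, z.2)) z.1) (Qcyl n 1))
  refine ⟨α, C, hα, hα1, hC0, fun z hz => ?_, hC1, hC2⟩
  obtain ⟨δ, hδ, hδ1, ε, hε, hsub⟩ := exists_margin hz
  obtain ⟨K, -, hK⟩ := hloc δ hδ hδ1
  refine ⟨ε, hε, K, fun w hw => ?_, fun w₁ hw₁ w₂ hw₂ => ?_⟩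
  · obtain ⟨h1, h2, h3⟩ := hsub w hw
    exact (hK w.1 w.2 h1 h2 h3).1
  · obtain ⟨h1, h2, h3⟩ := hsub w₁ hw₁
    obtain ⟨k1, k2, k3⟩ := hsub w₂ hw₂
    exact ⟨((hK w₁.1 w₁.2 h1 h2 h3).2 w₂.1 w₂.2 k1 k2 k3).1,
      ((hK w₁.1 w₁.2 h1 h2 h3).2 w₂.1 w₂.2 k1 k2 k3).2⟩

end
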